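/- Let n ≥ 2 and let C₁,…,C_{p+1} ⊂ GL(n,ℂ) be conjugacy classes of diagonalizable matrices with generic eigenvalues, such that every eigenvalue of the class C₁ has multiplicity at most 2. Then there exists an irreducible (p+1)-tuple of matrices M_j ∈ C_j with M₁M₂⋯M_{p+1} = I if and only if (α_n): d(C₁) + … + d(C_{p+1}) ≥ 2n² − 2 and (β_n): for every j, Σ_{i≠j} r(C_i) ≥ n. -/

import Mathlib

open Matrix BigOperators

open scoped Classical

/-- `B` lies in the conjugacy class of `A` (conjugation by an invertible matrix). -/
def MatConj {n : ℕ} (A B : Matrix (Fin n) (Fin n) ℂ) : Prop :=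
  ∃ S : (Matrix (Fin n) (Fin n) ℂ)ˣ, B = S.val * A * (S⁻¹).val

/-- A tuple of `n × n` matrices is irreducible if no subspace of `ℂⁿ` other than `⊥` and `⊤`
is invariant under all of them. -/
def IrreducibleTuple {q n : ℕ} (M : Fin q → Matrix (Fin n) (Fin n) ℂ) : Prop :=
  ∀ V : Submodule ℂ (Fin n → ℂ),
    (∀ j, V.map (Matrix.mulVecLin (M j)) ≤ V) → V = ⊥ ∨ V = ⊤

/-- The dimension of the conjugacy class of `A` : `n² - dim (centralizer of A)`. -/
noncomputable def classDim {n : ℕ} (A : Matrix (Fin n) (Fin n) ℂ) : ℕ :=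
  n ^ 2 - Module.finrank ℂ
    (LinearMap.ker (LinearMap.mulLeft ℂ A - LinearMap.mulRight ℂ A))

/-- `r(A) = min over λ of rank (A - λ·I)`; a conjugation invariant. -/
noncomputable def minRank {n : ℕ} (A : Matrix (Fin n) (Fin n) ℂ) : ℕ :=
  sInf (Set.range fun lam : ℂ => (A - lam • (1 : Matrix (Fin n) (Fin n) ℂ)).rank)

/-- Genericity of the eigenvalues (= roots of the characteristic polynomials, with
multiplicity): no products of sub-multisets of equal cardinality `κ`, `1 ≤ κ ≤ n-1`, equal `1`. -/
def GenericMulRoots {q n : ℕ} (M : Fin q → Matrix (Fin n) (Fin n) ℂ) : Prop :=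
  ∀ κ : ℕ, 1 ≤ κ → κ ≤ n - 1 →
    ∀ Φ : Fin q → Multiset ℂ,
      (∀ j, Φ j ≤ (M j).charpoly.roots ∧ Multiset.card (Φ j) = κ) →
      (∏ j, (Φ j).prod) ≠ 1

set_option linter.unusedSectionVars false
set_option linter.unusedSimpArgs false
set_option linter.unusedVariables false

namespace DSP

/-- similarity of square matrices, possibly with different index types -/
def Sim {ι ι' : Type*} [Fintype ι] [DecidableEq ι] [Fintype ι'] [DecidableEq ι']
    (M : Matrix ι ι ℂ) (M' : Matrix ι' ι' ℂ) : Prop :=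
  ∃ (G : Matrix ι ι' ℂ) (H : Matrix ι' ι ℂ), G * H = 1 ∧ H * G = 1 ∧ M = G * M' * H

section Sim
variable {ι ι' ι'' : Type*} [Fintype ι] [DecidableEq ι] [Fintype ι'] [DecidableEq ι']
  [Fintype ι''] [DecidableEq ι'']

theorem Sim.refl (M : Matrix ι ι ℂ) : Sim M M := ⟨1, 1, by simp, by simp, by simp⟩

theorem Sim.symm {M : Matrix ι ι ℂ} {M' : Matrix ι' ι' ℂ} (h : Sim M M') : Sim M' M := by
  obtain ⟨G, H, h1, h2, rfl⟩ := h
  refine ⟨H, G, h2, h1, ?_⟩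
  rw [← Matrix.mul_assoc, ← Matrix.mul_assoc, h2, Matrix.one_mul, Matrix.mul_assoc, h2, Matrix.mul_one]

theorem Sim.trans {M : Matrix ι ι ℂ} {M' : Matrix ι' ι' ℂ} {M'' : Matrix ι'' ι'' ℂ}
    (h : Sim M M') (h' : Sim M' M'') : Sim M M'' := by
  obtain ⟨G, H, h1, h2, rfl⟩ := h
  obtain ⟨G', H', h1', h2', rfl⟩ := h'
  refine ⟨G * G', H' * H, ?_, ?_, ?_⟩
  · rw [Matrix.mul_assoc, ← Matrix.mul_assoc G', h1', Matrix.one_mul, h1]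
  · rw [Matrix.mul_assoc, ← Matrix.mul_assoc H, h2, Matrix.one_mul, h2']
  · simp only [Matrix.mul_assoc]

theorem Sim.card {M : Matrix ι ι ℂ} {M' : Matrix ι' ι' ℂ} (h : Sim M M') :
    Fintype.card ι = Fintype.card ι' := by
  obtain ⟨G, H, h1, h2, rfl⟩ := h
  have := congrArg Matrix.trace h1
  rw [Matrix.trace_mul_comm, h2] at this
  simpa [Matrix.trace_one] using this.symm

theorem Sim.trace {M : Matrix ι ι ℂ} {M' : Matrix ι' ι' ℂ} (h : Sim M M') :
    M.trace = M'.trace := by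
  obtain ⟨G, H, h1, h2, rfl⟩ := h
  rw [Matrix.trace_mul_comm, ← Matrix.mul_assoc, h2, Matrix.one_mul]

theorem Sim.exists_unit {M M' : Matrix ι ι ℂ} (h : Sim M M') :
    ∃ g : (Matrix ι ι ℂ)ˣ, M = g.val * M' * (g⁻¹).val := by
  obtain ⟨G, H, h1, h2, rfl⟩ := h
  exact ⟨⟨G, H, h1, h2⟩, rfl⟩

theorem sim_of_unit (g : (Matrix ι ι ℂ)ˣ) (M : Matrix ι ι ℂ) :
    Sim (g.val * M * (g⁻¹).val) M := ⟨g.val, (g⁻¹).val, by simp, by simp, rfl⟩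

theorem sim_submatrix (e : ι ≃ ι') (M : Matrix ι' ι' ℂ) : Sim (M.submatrix e e) M := by
  refine ⟨(1 : Matrix ι' ι' ℂ).submatrix e id, (1 : Matrix ι' ι' ℂ).submatrix id e, ?_, ?_, ?_⟩
  · have := Matrix.submatrix_mul_equiv (M := (1 : Matrix ι' ι' ℂ)) (N := (1 : Matrix ι' ι' ℂ)) e
      (Equiv.refl _) e
    simp only [Equiv.coe_refl] at this
    rw [this]; simp
  · have := Matrix.submatrix_mul_equiv (M := (1 : Matrix ι' ι' ℂ)) (N := (1 : Matrix ι' ι' ℂ)) id e id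
    rw [this]; simp
  · have h1 := Matrix.submatrix_mul_equiv (M := (1 : Matrix ι' ι' ℂ)) (N := M) e (Equiv.refl _) id
    simp only [Equiv.coe_refl, Matrix.submatrix_id_id, Matrix.one_mul] at h1
    rw [h1]
    have h2 := Matrix.submatrix_mul_equiv (M := M) (N := (1 : Matrix ι' ι' ℂ)) e (Equiv.refl _) e
    simp only [Equiv.coe_refl, Matrix.mul_one] at h2
    rw [h2]

theorem Sim.charpoly {M : Matrix ι ι ℂ} {M' : Matrix ι' ι' ℂ} (h : Sim M M') :
    M.charpoly = M'.charpoly := by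
  have hc := h.card
  let e : ι ≃ ι' := Fintype.equivOfCardEq hc
  have h2 : Sim M (M'.submatrix e e) := h.trans (sim_submatrix e M').symm
  obtain ⟨g, hg⟩ := h2.exists_unit
  rw [hg, Matrix.coe_units_inv, Matrix.charpoly_units_conj]
  exact Matrix.charpoly_reindex e.symm M'

theorem sim_diagonal_of_equiv {d : ι → ℂ} {d' : ι' → ℂ} (e : ι ≃ ι') (h : ∀ i, d i = d' (e i)) :
    Sim (diagonal d) (diagonal d') := by
  have : diagonal d = (diagonal d').submatrix e e := by
    ext i j
    simp [Matrix.diagonal_apply, h]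
  rw [this]; exact sim_submatrix e _

/-- functions with the same fibre cardinalities agree up to an equivalence -/
theorem exists_equiv_of_card_fiber {Λ : Type*} [DecidableEq Λ] (d : ι → Λ) (d' : ι' → Λ)
    (h : ∀ k, (Finset.univ.filter fun i => d i = k).card
      = (Finset.univ.filter fun i => d' i = k).card) :
    ∃ e : ι ≃ ι', ∀ i, d i = d' (e i) := by
  have e : ∀ k, {i // d i = k} ≃ {i // d' i = k} := fun k =>
    Fintype.equivOfCardEq (by rw [Fintype.card_subtype, Fintype.card_subtype, h k])
  refine ⟨((Equiv.sigmaFiberEquiv d).symm.trans (Equiv.sigmaCongrRight e)).trans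
    (Equiv.sigmaFiberEquiv d'), fun i => ?_⟩
  simp only [Equiv.trans_apply, Equiv.sigmaFiberEquiv, Equiv.coe_fn_mk, Equiv.coe_fn_symm_mk,
    Equiv.sigmaCongrRight_apply, Sigma.map]
  exact (e (d i) ⟨i, rfl⟩).2.symm

theorem charpoly_diagonal_roots (d : ι → ℂ) :
    (diagonal d).charpoly.roots = Finset.univ.val.map d := by
  rw [Matrix.charpoly_diagonal]
  have : (∏ i, (Polynomial.X - Polynomial.C (d i)))
      = ((Finset.univ.val.map d).map fun a => Polynomial.X - Polynomial.C a).prod := by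
    rw [Multiset.map_map]; rfl
  rw [this, Polynomial.roots_multiset_prod_X_sub_C]

theorem exists_subset_of_le_map {Λ : Type*} (d : ι → Λ) (s : Multiset Λ)
    (h : s ≤ Finset.univ.val.map d) : ∃ S : Finset ι, S.val.map d = s := by
  have key : ∀ (t : Multiset ι), s ≤ t.map d → ∃ u ≤ t, u.map d = s := by
    intro t
    induction t using Quotient.inductionOn with
    | _ l =>
    induction s using Quotient.inductionOn with
    | _ l1 =>
    intro h
    have h' : l1.Subperm (l.map d) := by simpa using h
    obtain ⟨l2, hl2, hs⟩ := h'
    obtain ⟨l3, hl3, rfl⟩ := List.sublist_map_iff.1 hs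
    refine ⟨(l3 : Multiset ι), ?_, ?_⟩
    · exact Multiset.coe_le.2 hl3.subperm
    · simpa using hl2
  obtain ⟨u, hu, hu2⟩ := key _ h
  exact ⟨⟨u, Multiset.nodup_of_le hu Finset.univ.nodup⟩, hu2⟩

section Irr
variable {J : Type*}

/-- irreducible tuple of matrices -/
def Irr (A : J → Matrix ι ι ℂ) : Prop :=
  ∀ V : Submodule ℂ (ι → ℂ), (∀ j, ∀ v ∈ V, A j *ᵥ v ∈ V) → V = ⊥ ∨ V = ⊤

theorem Irr.schur [Nonempty ι] {A : J → Matrix ι ι ℂ} (hA : Irr A) (X : Matrix ι ι ℂ)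
    (hX : ∀ j, X * A j = A j * X) : ∃ c : ℂ, X = c • (1 : Matrix ι ι ℂ) := by
  obtain ⟨c, hc⟩ := Module.End.exists_eigenvalue (Matrix.mulVecLin X)
  have hV := hA (Module.End.eigenspace (Matrix.mulVecLin X) c) (by
    intro j v hv
    rw [Module.End.mem_eigenspace_iff] at hv ⊢
    simp only [Matrix.mulVecLin_apply] at hv ⊢
    rw [Matrix.mulVec_mulVec, hX j, ← Matrix.mulVec_mulVec, hv, Matrix.mulVec_smul])
  refine ⟨c, ?_⟩
  rcases hV with h | h
  · exact absurd h hc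
  · apply Matrix.toLin'.injective
    ext1 i
    have : ∀ v, v ∈ Module.End.eigenspace (Matrix.mulVecLin X) c := by simp [h]
    have := fun v => Module.End.mem_eigenspace_iff.1 (this v)
    ext v
    simp only [Matrix.mulVecLin_apply] at this
    simp [this]

theorem Irr.schur_zero {A : J → Matrix ι ι ℂ} {B : J → Matrix ι' ι' ℂ} (hA : Irr A) (hB : Irr B)
    (X : Matrix ι' ι ℂ) (hX : ∀ j, X * A j = B j * X) :
    X = 0 ∨ Function.Bijective X.mulVec := by
  by_cases h0 : X = 0
  · exact Or.inl h0
  right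
  have hk := hA (LinearMap.ker X.mulVecLin) (by
    intro j v hv
    simp only [LinearMap.mem_ker, Matrix.mulVecLin_apply] at hv ⊢
    rw [Matrix.mulVec_mulVec, hX j, ← Matrix.mulVec_mulVec, hv, Matrix.mulVec_zero])
  have hr := hB (LinearMap.range X.mulVecLin) (by
    rintro j _ ⟨v, rfl⟩
    refine ⟨A j *ᵥ v, ?_⟩
    simp only [Matrix.mulVecLin_apply]
    rw [Matrix.mulVec_mulVec, hX j, ← Matrix.mulVec_mulVec])
  have hne : X.mulVecLin ≠ 0 := by
    intro h
    apply h0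
    have : Matrix.toLin' X = 0 := h
    simpa using this
  constructor
  · rcases hk with h | h
    · exact LinearMap.ker_eq_bot.1 h
    · exact absurd (LinearMap.ker_eq_top.1 h) hne
  · rcases hr with h | h
    · exact absurd (LinearMap.range_eq_bot.1 h) hne
    · exact LinearMap.range_eq_top.1 h

/-- block triangular form with respect to an invariant subspace -/
theorem exists_block_form (V : Submodule ℂ (ι → ℂ)) :
    ∃ (r s : ℕ) (G : Matrix ι (Fin r ⊕ Fin s) ℂ) (H : Matrix (Fin r ⊕ Fin s) ι ℂ),
      G * H = 1 ∧ H * G = 1 ∧ r = Module.finrank ℂ V ∧ r + s = Fintype.card ι ∧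
      ∀ M : Matrix ι ι ℂ, (∀ v ∈ V, M *ᵥ v ∈ V) → ∃ B X C,
        H * M * G = Matrix.fromBlocks B X 0 C := by
  obtain ⟨W, hW⟩ := Submodule.exists_isCompl V
  let bV := Module.finBasis ℂ V
  let bW := Module.finBasis ℂ W
  let b : Module.Basis (Fin (Module.finrank ℂ V) ⊕ Fin (Module.finrank ℂ W)) ℂ (ι → ℂ) :=
    (bV.prod bW).map (Submodule.prodEquivOfIsCompl V W hW)
  let b0 := Pi.basisFun ℂ ι
  refine ⟨_, _, b0.toMatrix b, b.toMatrix b0, ?_, ?_, rfl, ?_, ?_⟩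
  · exact Module.Basis.toMatrix_mul_toMatrix_flip _ _
  · exact Module.Basis.toMatrix_mul_toMatrix_flip _ _
  · rw [Submodule.finrank_add_eq_of_isCompl hW]; simp
  · intro M hM
    have h1 : b.toMatrix b0 * M * b0.toMatrix b = LinearMap.toMatrix b b (Matrix.toLin' M) := by
      rw [← basis_toMatrix_mul_linearMap_toMatrix_mul_basis_toMatrix b b0 b b0]
      congr 2
      rw [LinearMap.toMatrix_eq_toMatrix', LinearMap.toMatrix'_toLin']
    rw [h1]
    refine ⟨(LinearMap.toMatrix b b (Matrix.toLin' M)).toBlocks₁₁,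
      (LinearMap.toMatrix b b (Matrix.toLin' M)).toBlocks₁₂,
      (LinearMap.toMatrix b b (Matrix.toLin' M)).toBlocks₂₂, ?_⟩
    · conv_lhs => rw [← Matrix.fromBlocks_toBlocks (LinearMap.toMatrix b b (Matrix.toLin' M))]
      congr 1
      ext i j
      simp only [Matrix.toBlocks₂₁, Matrix.of_apply, Matrix.zero_apply, LinearMap.toMatrix_apply]
      have hb : b (Sum.inl j) = bV j := by simp [b]
      rw [hb]
      have hmem := hM (bV j) (bV j).2
      have : Matrix.toLin' M (bV j) = Submodule.prodEquivOfIsCompl V W hW (⟨_, hmem⟩, 0) := by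
        simp [Submodule.coe_prodEquivOfIsCompl']
      rw [this]
      simp only [b, Module.Basis.map_repr, LinearEquiv.trans_apply, LinearEquiv.symm_apply_apply,
        Module.Basis.prod_repr_inr, map_zero, Finsupp.coe_zero, Pi.zero_apply]

end Irr

/-- a matrix killed by a split squarefree polynomial is diagonalizable -/
theorem exists_diag_of_annihilated (M : Matrix ι ι ℂ) (s : Finset ℂ)
    (h : Polynomial.aeval M (∏ k ∈ s, (Polynomial.X - Polynomial.C k)) = 0) :
    ∃ (d : ι → ℂ) (g : (Matrix ι ι ℂ)ˣ), (∀ i, d i ∈ s) ∧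
      M = g.val * diagonal d * (g⁻¹).val := by
  set f := Matrix.toLin' M with hf
  have hf0 : Polynomial.aeval f (∏ k ∈ s, (Polynomial.X - Polynomial.C k)) = 0 := by
    have := congrArg (Matrix.toLinAlgEquiv' (R := ℂ) (n := ι)) h
    rw [map_zero] at this
    rw [← this]
    exact (Polynomial.aeval_algHom_apply (Matrix.toLinAlgEquiv' (R := ℂ) (n := ι)).toAlgHom M _)
  have hsq : Squarefree (∏ k ∈ s, (Polynomial.X - Polynomial.C k)) :=
    (Polynomial.separable_prod_X_sub_C_iff'.2 (fun x _ y _ hxy => hxy)).squarefree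
  have hss := Module.End.isSemisimple_of_squarefree_aeval_eq_zero hsq hf0
  have htop : ⨆ μ : ℂ, Module.End.eigenspace f μ = ⊤ := hss.iSup_eigenspace_eq_top
  have hnint : DirectSum.IsInternal (fun μ : ℂ => Module.End.eigenspace f μ) :=
    DirectSum.isInternal_submodule_of_iSupIndep_of_iSup_eq_top
      (Module.End.eigenspaces_iSupIndep f) htop
  let b := hnint.collectedBasis (fun μ => Module.finBasis ℂ (Module.End.eigenspace f μ))
  let e := b.indexEquiv (Pi.basisFun ℂ ι)
  let b' := b.reindex e
  let d : ι → ℂ := fun i => (e.symm i).1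
  have hb' : ∀ i, f (b' i) = d i • b' i := by
    intro i
    have := hnint.collectedBasis_mem (fun μ => Module.finBasis ℂ (Module.End.eigenspace f μ)) (e.symm i)
    rw [Module.End.mem_eigenspace_iff] at this
    simpa [b', b, d] using this
  let b0 := Pi.basisFun ℂ ι
  refine ⟨d, ⟨b0.toMatrix b', b'.toMatrix b0, Module.Basis.toMatrix_mul_toMatrix_flip _ _,
    Module.Basis.toMatrix_mul_toMatrix_flip _ _⟩, ?_, ?_⟩
  · intro i
    have hne : b' i ≠ 0 := b'.ne_zero i
    have h2 : Polynomial.aeval f (∏ k ∈ s, (Polynomial.X - Polynomial.C k)) (b' i) = 0 := by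
      rw [hf0]; rfl
    rw [Module.End.aeval_apply_of_hasEigenvector (μ := d i)
      ⟨Module.End.mem_eigenspace_iff.2 (hb' i), hne⟩] at h2
    have h3 := (smul_eq_zero.1 h2).resolve_right hne
    rw [Polynomial.eval_prod, Finset.prod_eq_zero_iff] at h3
    obtain ⟨k, hk, h4⟩ := h3
    simp only [Polynomial.eval_sub, Polynomial.eval_X, Polynomial.eval_C] at h4
    rw [sub_eq_zero.1 h4]; exact hk
  · have h1 : diagonal d = LinearMap.toMatrix b' b' f := by
      ext i j
      rw [LinearMap.toMatrix_apply, hb']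
      simp only [map_smul, Module.Basis.repr_self, Finsupp.smul_single, smul_eq_mul, mul_one,
        Matrix.diagonal_apply, Finsupp.single_apply]
      by_cases hij : i = j
      · subst hij; simp
      · simp [hij, Ne.symm hij]
    have h2 : LinearMap.toMatrix b0 b0 f = M := by
      rw [LinearMap.toMatrix_eq_toMatrix', LinearMap.toMatrix'_toLin']
    rw [h1]
    change M = b0.toMatrix b' * LinearMap.toMatrix b' b' f * b'.toMatrix b0
    rw [basis_toMatrix_mul_linearMap_toMatrix_mul_basis_toMatrix, h2]

end Sim
end DSP

namespace DSP
section
variable {ι : Type*} [Fintype ι] [DecidableEq ι]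

/-- no proper sub-tuple of eigenvalues sums to zero -/
def AddGen {J : Type*} [Fintype J] (d : J → ι → ℂ) : Prop :=
  ∀ (S : J → Finset ι) (r : ℕ), (∀ j, (S j).card = r) → 0 < r → r < Fintype.card ι →
    ∑ j, ∑ i ∈ S j, d j i ≠ 0

theorem exists_blocks_of_not_irr {J : Type*} {M : J → Matrix ι ι ℂ} (h : ¬ Irr M) :
    ∃ (r s : ℕ) (G : Matrix ι (Fin r ⊕ Fin s) ℂ) (H : Matrix (Fin r ⊕ Fin s) ι ℂ)
      (B : J → Matrix (Fin r) (Fin r) ℂ) (X : J → Matrix (Fin r) (Fin s) ℂ)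
      (C : J → Matrix (Fin s) (Fin s) ℂ),
      0 < r ∧ 0 < s ∧ r + s = Fintype.card ι ∧ G * H = 1 ∧ H * G = 1 ∧
      ∀ j, H * M j * G = Matrix.fromBlocks (B j) (X j) 0 (C j) := by
  simp only [Irr, not_forall, not_or] at h
  obtain ⟨V, hV, hb, ht⟩ := h
  obtain ⟨r, s, G, H, h1, h2, h3, h4, h5⟩ := exists_block_form V
  choose B X C hBXC using fun j => h5 (M j) (hV j)
  refine ⟨r, s, G, H, B, X, C, ?_, ?_, h4, h1, h2, hBXC⟩
  · rw [h3]
    exact Nat.pos_of_ne_zero fun h0 => hb (Submodule.finrank_eq_zero.1 h0)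
  · have : Module.finrank ℂ V < Module.finrank ℂ (ι → ℂ) :=
      Submodule.finrank_lt ht
    rw [Module.finrank_fintype_fun_eq_card] at this
    omega

theorem charpoly_block {r s : Type*} [Fintype r] [DecidableEq r] [Fintype s] [DecidableEq s]
    {M : Matrix ι ι ℂ} {G : Matrix ι (r ⊕ s) ℂ} {H : Matrix (r ⊕ s) ι ℂ}
    {B : Matrix r r ℂ} {X : Matrix r s ℂ} {C : Matrix s s ℂ}
    (h1 : G * H = 1) (h2 : H * G = 1) (h : H * M * G = Matrix.fromBlocks B X 0 C) :
    M.charpoly = B.charpoly * C.charpoly := by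
  rw [← Matrix.charpoly_fromBlocks_zero₂₁ (M₁₂ := X), ← h]
  exact Sim.charpoly (Sim.symm ⟨H, G, h2, h1, rfl⟩)

theorem roots_le_of_block {r s : Type*} [Fintype r] [DecidableEq r] [Fintype s] [DecidableEq s]
    {M : Matrix ι ι ℂ} {G : Matrix ι (r ⊕ s) ℂ} {H : Matrix (r ⊕ s) ι ℂ}
    {B : Matrix r r ℂ} {X : Matrix r s ℂ} {C : Matrix s s ℂ}
    (h1 : G * H = 1) (h2 : H * G = 1) (h : H * M * G = Matrix.fromBlocks B X 0 C) :
    M.charpoly.roots = B.charpoly.roots + C.charpoly.roots := by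
  rw [charpoly_block h1 h2 h, Polynomial.roots_mul]
  exact mul_ne_zero (Matrix.charpoly_monic _).ne_zero (Matrix.charpoly_monic _).ne_zero

theorem card_roots_charpoly (M : Matrix ι ι ℂ) :
    Multiset.card M.charpoly.roots = Fintype.card ι := by
  rw [← (IsAlgClosed.splits M.charpoly).natDegree_eq_card_roots,
    Matrix.charpoly_natDegree_eq_dim]

theorem irr_of_addGen {J : Type*} [Fintype J] {A : J → Matrix ι ι ℂ} {d : J → ι → ℂ}
    (hc : ∀ j, (A j).charpoly = (diagonal (d j)).charpoly) (hs : ∑ j, A j = 0)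
    (hg : AddGen d) : Irr A := by
  by_contra hI
  obtain ⟨r, s, G, H, B, X, C, hr, hs', hrs, h1, h2, h⟩ := exists_blocks_of_not_irr hI
  have hle : ∀ j, (B j).charpoly.roots ≤ Finset.univ.val.map (d j) := by
    intro j
    rw [← charpoly_diagonal_roots, ← hc, roots_le_of_block h1 h2 (h j)]
    exact Multiset.le_add_right _ _
  choose S hS using fun j => exists_subset_of_le_map (d j) _ (hle j)
  refine hg S r (fun j => ?_) hr (by omega) ?_
  · have := congrArg Multiset.card (hS j)
    rw [Multiset.card_map, card_roots_charpoly, Fintype.card_fin] at this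
    exact this
  · have h3 : ∀ j, ∑ i ∈ S j, d j i = (B j).trace := by
      intro j
      rw [Matrix.trace_eq_sum_roots_charpoly, ← hS j]; rfl
    simp_rw [h3]
    rw [← Matrix.trace_sum]
    have h4 : Matrix.fromBlocks (∑ j, B j) (∑ j, X j) 0 (∑ j, C j) = 0 := by
      have : ∑ j, H * A j * G = 0 := by
        rw [← Matrix.sum_mul, ← Matrix.mul_sum, hs]; simp
      rw [← this]
      simp_rw [h]
      ext i j
      rcases i with i | i <;> rcases j with j | j <;> simp [Matrix.sum_apply]
    have h5 := congrArg Matrix.toBlocks₁₁ h4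
    simp only [Matrix.toBlocks_fromBlocks₁₁] at h5
    rw [h5]
    simp [Matrix.toBlocks₁₁, Matrix.trace]

end

section upper
variable {ι : Type*} [Fintype ι] [DecidableEq ι] {Λ : Type*} [LinearOrder Λ]

/-- strictly upper triangular with respect to a labelling -/
def SU (κ : ι → Λ) (U : Matrix ι ι ℂ) : Prop := ∀ i i', ¬ κ i < κ i' → U i i' = 0

theorem SU.bt {κ : ι → Λ} {U : Matrix ι ι ℂ} (h : SU κ U) : U.BlockTriangular κ :=
  fun i j hij => h i j (not_lt.2 hij.le)

theorem bt_diagonal (κ : ι → Λ) (d : ι → ℂ) : (diagonal d).BlockTriangular κ :=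
  Matrix.blockTriangular_diagonal d

theorem charpoly_diag_add_su {κ : ι → Λ} {U : Matrix ι ι ℂ} (h : SU κ U) (d : ι → ℂ) :
    (diagonal d + U).charpoly = (diagonal d).charpoly := by
  have h1 : ∀ V : Matrix ι ι ℂ, SU κ V →
      (Matrix.charmatrix (diagonal d + V)).BlockTriangular κ := by
    intro V hV i j hij
    have hne : i ≠ j := by rintro rfl; exact lt_irrefl _ hij
    rw [Matrix.charmatrix_apply_ne _ _ _ hne]
    simp [Matrix.diagonal_apply_ne _ hne, hV.bt hij]
  have h0 : SU κ (0 : Matrix ι ι ℂ) := fun _ _ _ => rfl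
  have h2 := h1 0 h0
  rw [add_zero] at h2
  rw [Matrix.charpoly, Matrix.charpoly, (h1 U h).det, h2.det]
  refine Finset.prod_congr rfl fun a _ => ?_
  congr 1
  ext ⟨i, hi⟩ ⟨j, hj⟩ : 1
  simp only [Matrix.toSquareBlock_def, Matrix.of_apply, Matrix.charmatrix_apply, Matrix.add_apply]
  rw [h i j (by rw [hi, hj]; exact lt_irrefl _), add_zero]

theorem aeval_prod_su {κ : ι → Λ} {U : Matrix ι ι ℂ} (h : SU κ U) (μ : Λ → ℂ)
    (s : Finset Λ) :
    (∀ i i', κ i' ∈ s → κ i < κ i' → κ i ∈ s) →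
    ∀ v : ι → ℂ, (∀ i, κ i ∉ s → v i = 0) →
      (Polynomial.aeval (diagonal (μ ∘ κ) + U) (∏ k ∈ s, (Polynomial.X - Polynomial.C (μ k)))) *ᵥ v
        = 0 := by
  induction s using Finset.induction_on_max with
  | empty =>
    intro _ v hv
    have : v = 0 := by ext i; exact hv i (by simp)
    simp [this]
  | insert a s ha ih =>
    intro hs v hv
    have has : a ∉ s := fun h => lt_irrefl _ (ha a h)
    rw [Finset.prod_insert has, mul_comm, map_mul, ← Matrix.mulVec_mulVec]
    apply ih
    · intro i i' hi' hlt
      have := hs i i' (Finset.mem_insert_of_mem hi') hlt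
      rcases Finset.mem_insert.1 this with h1 | h1
      · exact absurd (ha _ hi') (not_lt.2 (h1 ▸ hlt.le))
      · exact h1
    · intro i hi
      have e1 : (Polynomial.aeval (diagonal (μ ∘ κ) + U)) (Polynomial.X - Polynomial.C (μ a))
          = diagonal (fun i => μ (κ i) - μ a) + U := by
        rw [map_sub, Polynomial.aeval_X, Polynomial.aeval_C]
        ext x y
        by_cases hxy : x = y
        · subst hxy; simp [Matrix.algebraMap_matrix_apply]; ring
        · simp [Matrix.algebraMap_matrix_apply, hxy]
      rw [e1, Matrix.add_mulVec, Pi.add_apply, Matrix.mulVec_diagonal]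
      have z1 : (μ (κ i) - μ a) * v i = 0 := by
        by_cases hia : κ i = a
        · simp [hia]
        · rw [hv i (by simp [hia, hi]), mul_zero]
      have z2 : (U *ᵥ v) i = 0 := by
        apply Finset.sum_eq_zero
        intro i' _
        by_cases hlt : κ i < κ i'
        · by_cases hi' : κ i' ∈ insert a s
          · have := hs i i' hi' hlt
            rcases Finset.mem_insert.1 this with h1 | h1
            · exfalso
              rcases Finset.mem_insert.1 hi' with h2 | h2
              · rw [h1, h2] at hlt; exact lt_irrefl _ hlt
              · rw [h1] at hlt; exact lt_asymm hlt (ha _ h2)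
            · exact absurd h1 hi
          · simp [hv i' hi']
        · simp [h i i' hlt]
      rw [z1, z2, add_zero]

theorem card_fiber_of_map_eq {ι' : Type*} [Fintype ι'] {d : ι → ℂ} {d' : ι' → ℂ}
    (h : Finset.univ.val.map d = Finset.univ.val.map d') (k : ℂ) :
    (Finset.univ.filter fun i => d i = k).card = (Finset.univ.filter fun i => d' i = k).card := by
  have := congrArg (Multiset.count k) h
  rw [Multiset.count_map, Multiset.count_map] at this
  simpa [eq_comm, Finset.card, Finset.filter] using this

/-- diagonalizable matrices with the same charpoly are similar -/
theorem sim_diagonal_of_charpoly {ι' : Type*} [Fintype ι'] [DecidableEq ι'] {d : ι → ℂ}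
    {d' : ι' → ℂ} (h : (diagonal d).charpoly = (diagonal d').charpoly) :
    Sim (diagonal d) (diagonal d') := by
  have h1 := congrArg Polynomial.roots h
  rw [charpoly_diagonal_roots, charpoly_diagonal_roots] at h1
  obtain ⟨e, he⟩ := exists_equiv_of_card_fiber d d' (card_fiber_of_map_eq h1)
  exact sim_diagonal_of_equiv e he

theorem sim_diag_add_su {κ : ι → Λ} {U : Matrix ι ι ℂ} (h : SU κ U) (μ : Λ → ℂ)
    (hμ : ∀ i i', μ (κ i) = μ (κ i') → κ i = κ i') :
    Sim (diagonal (μ ∘ κ) + U) (diagonal (μ ∘ κ)) := by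
  have h1 : Polynomial.aeval (diagonal (μ ∘ κ) + U)
      (∏ k ∈ (Finset.univ.image κ).image μ, (Polynomial.X - Polynomial.C k)) = 0 := by
    rw [Finset.prod_image]
    · apply Matrix.toLin'.injective
      apply LinearMap.ext
      intro v
      rw [Matrix.toLin'_apply, map_zero, LinearMap.zero_apply]
      refine aeval_prod_su h μ _ ?_ v ?_
      · intro i i' _ _; simp
      · intro i hi; simp at hi
    · intro a ha b hb hab
      simp only [Finset.coe_image, Finset.coe_univ, Set.image_univ, Set.mem_range] at ha hb
      obtain ⟨i, rfl⟩ := ha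
      obtain ⟨i', rfl⟩ := hb
      exact hμ i i' hab
  obtain ⟨d, g, -, hg⟩ := exists_diag_of_annihilated _ _ h1
  have h2 : Sim (diagonal (μ ∘ κ) + U) (diagonal d) := hg ▸ sim_of_unit g _
  refine h2.trans (sim_diagonal_of_charpoly ?_)
  rw [← h2.charpoly, charpoly_diag_add_su h]

end upper
end DSP

namespace DSP

theorem exists_trace_repr {ι ι' : Type*} [Fintype ι] [DecidableEq ι] [Fintype ι'] [DecidableEq ι']
    (φ : Matrix ι ι' ℂ →ₗ[ℂ] ℂ) : ∃ θ : Matrix ι' ι ℂ, ∀ w, φ w = (θ * w).trace := by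
  refine ⟨fun i' i => φ (Matrix.single i i' 1), fun w => ?_⟩
  conv_lhs => rw [Matrix.matrix_eq_sum_single w]
  simp only [map_sum, Matrix.trace, Matrix.diag_apply, Matrix.mul_apply]
  rw [Finset.sum_comm]
  refine Finset.sum_congr rfl fun i' _ => Finset.sum_congr rfl fun i _ => ?_
  have : Matrix.single i i' (w i i') = (w i i') • Matrix.single i i' (1 : ℂ) := by
    rw [Matrix.smul_single]; simp
  rw [this, map_smul, smul_eq_mul, mul_comm]

theorem eq_zero_of_trace {ι ι' : Type*} [Fintype ι] [DecidableEq ι] [Fintype ι'] [DecidableEq ι']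
    (θ : Matrix ι' ι ℂ) (h : ∀ w : Matrix ι ι' ℂ, (θ * w).trace = 0) : θ = 0 := by
  ext i' i
  have := h (Matrix.single i i' 1)
  rw [Matrix.trace_mul_single] at this
  simpa using this

theorem scott {V : Type*} [AddCommGroup V] [Module ℂ V] [FiniteDimensional ℂ V] {N : ℕ}
    (T : Fin N → Module.End ℂ V) (hT : (List.ofFn T).prod = 1) :
    Module.finrank ℂ V + Module.finrank ℂ (⨆ j, LinearMap.range (T j - 1) : Submodule ℂ V)
      ≤ ∑ j, Module.finrank ℂ (LinearMap.range (T j - 1))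
        + Module.finrank ℂ (⨅ j, LinearMap.ker (T j - 1) : Submodule ℂ V) := by
  let Q : ℕ → Module.End ℂ V := fun j => ((List.ofFn T).drop j).prod
  have hQ0 : Q 0 = 1 := by simp [Q, hT]
  have hQN : Q N = 1 := by
    simp only [Q]
    rw [List.drop_of_length_le (by simp)]; rfl
  have hQs : ∀ j : Fin N, Q j = T j * Q (j + 1) := by
    intro j
    simp only [Q]
    rw [List.drop_eq_getElem_cons (by simp)]
    simp
  let p : V →ₗ[ℂ] (∀ j, LinearMap.range (T j - 1)) :=
    LinearMap.pi fun j => (T j - 1).rangeRestrict ∘ₗ Q (j + 1)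
  let s : (∀ j, LinearMap.range (T j - 1)) →ₗ[ℂ] V :=
    ∑ j, (Submodule.subtype _) ∘ₗ LinearMap.proj j
  have hp : ∀ w j, ((p w j : _) : V) = Q j w - Q (j + 1) w := by
    intro w j
    simp [p, hQs j, Module.End.mul_apply]
  have hsp : ∀ w, s (p w) = 0 := by
    intro w
    have : s (p w) = ∑ j : Fin N, (Q j w - Q (j + 1) w) := by
      simp only [s, LinearMap.sum_apply, LinearMap.comp_apply, LinearMap.proj_apply,
        Submodule.subtype_apply, hp]
    rw [this, Fin.sum_univ_eq_sum_range (fun j => Q j w - Q (j + 1) w),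
      Finset.sum_range_sub' (fun j => Q j w), hQ0, hQN, sub_self]
  have hker : LinearMap.ker p ≤ ⨅ j, LinearMap.ker (T j - 1) := by
    intro w hw
    have h1 : ∀ j : Fin N, Q j w = Q (j + 1) w := by
      intro j
      have := hp w j
      rw [LinearMap.mem_ker.1 hw] at this
      simpa [sub_eq_zero] using this.symm
    have h2 : ∀ j : ℕ, j ≤ N → Q j w = w := by
      intro j
      induction j with
      | zero => intro _; rw [hQ0]; rfl
      | succ j ih => intro hj; rw [← h1 ⟨j, hj⟩]; exact ih (by omega)
    rw [Submodule.mem_iInf]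
    intro j
    have h3 := h2 j j.2.le
    rw [hQs j, Module.End.mul_apply, h2 (j + 1) j.2] at h3
    simp [h3]
  have hrange : (⨆ j, LinearMap.range (T j - 1) : Submodule ℂ V) ≤ LinearMap.range s := by
    refine iSup_le fun j => ?_
    rintro x hx
    refine ⟨Pi.single j ⟨x, hx⟩, ?_⟩
    simp only [s, LinearMap.sum_apply, LinearMap.comp_apply, LinearMap.proj_apply,
        Submodule.subtype_apply]
    rw [Finset.sum_eq_single j]
    · simp
    · intro b _ hb; rw [Pi.single_eq_of_ne hb]; rfl
    · simp
  have e1 := LinearMap.finrank_range_add_finrank_ker p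
  have e2 := LinearMap.finrank_range_add_finrank_ker s
  have e3 : Module.finrank ℂ (LinearMap.range p) ≤ Module.finrank ℂ (LinearMap.ker s) := by
    apply Submodule.finrank_mono
    rintro _ ⟨w, rfl⟩
    exact hsp w
  have e4 := Submodule.finrank_mono hker
  have e5 := Submodule.finrank_mono hrange
  rw [Module.finrank_pi_fintype] at e2
  omega

section
variable {n : ℕ}

theorem classDim_eq (A : Matrix (Fin n) (Fin n) ℂ) :
    classDim A = Module.finrank ℂ
      (LinearMap.range (LinearMap.mulLeft ℂ A - LinearMap.mulRight ℂ A)) := by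
  have := LinearMap.finrank_range_add_finrank_ker (LinearMap.mulLeft ℂ A - LinearMap.mulRight ℂ A)
  rw [Module.finrank_matrix, Module.finrank_self, Fintype.card_fin] at this
  rw [classDim]
  have h2 : n * n * 1 = n ^ 2 := by ring
  omega

theorem classDim_conj {A B : Matrix (Fin n) (Fin n) ℂ} (h : MatConj A B) :
    classDim B = classDim A := by
  obtain ⟨S, rfl⟩ := h
  have e : LinearMap.ker (LinearMap.mulLeft ℂ A - LinearMap.mulRight ℂ A) ≃ₗ[ℂ]
      LinearMap.ker (LinearMap.mulLeft ℂ (S.val * A * (S⁻¹).val)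
        - LinearMap.mulRight ℂ (S.val * A * (S⁻¹).val)) := by
    refine LinearEquiv.ofLinearMap
      (LinearMap.restrict ((LinearMap.mulLeft ℂ S.val) ∘ₗ (LinearMap.mulRight ℂ (S⁻¹).val)) ?_)
      (LinearMap.restrict ((LinearMap.mulLeft ℂ (S⁻¹).val) ∘ₗ (LinearMap.mulRight ℂ S.val)) ?_) ?_ ?_
    · intro x hx
      simp only [LinearMap.mem_ker, LinearMap.sub_apply, LinearMap.mulLeft_apply,
        LinearMap.mulRight_apply, sub_eq_zero, LinearMap.comp_apply] at hx ⊢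
      simp only [mul_assoc, Units.inv_mul_cancel_left]
      rw [← mul_assoc A, hx, mul_assoc]
    · intro x hx
      simp only [LinearMap.mem_ker, LinearMap.sub_apply, LinearMap.mulLeft_apply,
        LinearMap.mulRight_apply, sub_eq_zero, LinearMap.comp_apply] at hx ⊢
      have := congrArg (fun y => (S⁻¹).val * y * S.val) hx
      simpa [mul_assoc] using this
    · ext x : 2
      simp [mul_assoc]
    · ext x : 2
      simp [mul_assoc]
  rw [classDim, classDim, e.finrank_eq]

theorem rank_conj (A : Matrix (Fin n) (Fin n) ℂ) (S : (Matrix (Fin n) (Fin n) ℂ)ˣ) :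
    (S.val * A * (S⁻¹).val).rank = A.rank := by
  rw [Matrix.rank_mul_eq_left_of_isUnit_det, Matrix.rank_mul_eq_right_of_isUnit_det]
  · exact (Matrix.isUnit_iff_isUnit_det _).1 S.isUnit
  · exact (Matrix.isUnit_iff_isUnit_det _).1 (S⁻¹).isUnit

theorem minRank_conj {A B : Matrix (Fin n) (Fin n) ℂ} (h : MatConj A B) :
    minRank B = minRank A := by
  obtain ⟨S, rfl⟩ := h
  rw [minRank, minRank]
  congr 2
  ext lam
  rw [← rank_conj (A - lam • 1) S]
  congr 1
  rw [mul_sub, sub_mul]; simp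

theorem IrreducibleTuple.irr {q : ℕ} {M : Fin q → Matrix (Fin n) (Fin n) ℂ} :
    IrreducibleTuple M ↔ Irr M := by
  refine forall_congr' fun V => ?_
  have : (∀ j, V.map (Matrix.mulVecLin (M j)) ≤ V) ↔ (∀ j, ∀ v ∈ V, M j *ᵥ v ∈ V) := by
    refine forall_congr' fun j => ?_
    rw [Submodule.map_le_iff_le_comap]; rfl
  rw [this]

/-- adjoint action -/
noncomputable def Ad : (Matrix (Fin n) (Fin n) ℂ)ˣ →* Module.End ℂ (Matrix (Fin n) (Fin n) ℂ) where
  toFun g := (LinearMap.mulLeft ℂ g.val) ∘ₗ (LinearMap.mulRight ℂ (g⁻¹).val)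
  map_one' := by ext; simp
  map_mul' g h := by
    apply LinearMap.ext
    intro x; simp [mul_assoc]

theorem alpha_necessary (hn : 2 ≤ n) {q : ℕ} (M : Fin q → Matrix (Fin n) (Fin n) ℂ)
    (hu : ∀ j, IsUnit (M j)) (hI : Irr M) (hp : (List.ofFn M).prod = 1) :
    2 * n ^ 2 - 2 ≤ ∑ j, classDim (M j) := by
  choose u hu using hu
  have hN : Nonempty (Fin n) := ⟨⟨0, by omega⟩⟩
  have hup : (List.ofFn u).prod = 1 := by
    apply Units.ext
    have h1 : (List.ofFn M).prod = (List.ofFn u).prod := by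
      rw [← Units.coeHom_apply, map_list_prod, List.map_ofFn]
      congr 2
      ext1 j; simp [hu]
    rw [← h1, hp]; rfl
  have hs := scott (fun j => Ad (u j)) (by
    have : (List.ofFn fun j => Ad (u j)) = (List.ofFn u).map Ad := by
      rw [List.map_ofFn]; rfl
    rw [this, ← map_list_prod, hup, map_one])
  have hr : ∀ j, Module.finrank ℂ (LinearMap.range (Ad (u j) - 1)) = classDim (M j) := by
    intro j
    rw [classDim_eq]
    have hk : LinearMap.ker (Ad (u j) - 1)
        = LinearMap.ker (LinearMap.mulLeft ℂ (M j) - LinearMap.mulRight ℂ (M j)) := by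
      ext x
      simp only [LinearMap.mem_ker, LinearMap.sub_apply, Ad, MonoidHom.coe_mk, OneHom.coe_mk,
        LinearMap.comp_apply, LinearMap.mulLeft_apply, LinearMap.mulRight_apply,
        Module.End.one_apply, sub_eq_zero, ← hu]
      rw [← mul_assoc, Units.mul_inv_eq_iff_eq_mul]
    have e1 := LinearMap.finrank_range_add_finrank_ker (Ad (u j) - 1)
    have e2 := LinearMap.finrank_range_add_finrank_ker
      (LinearMap.mulLeft ℂ (M j) - LinearMap.mulRight ℂ (M j))
    rw [hk] at e1
    omega
  have hfix : Module.finrank ℂ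
      (⨅ j, LinearMap.ker (Ad (u j) - 1) : Submodule ℂ (Matrix (Fin n) (Fin n) ℂ)) ≤ 1 := by
    refine (Submodule.finrank_mono (t := Submodule.span ℂ {(1 : Matrix (Fin n) (Fin n) ℂ)})
      ?_).trans ((finrank_span_le_card _).trans (by simp))
    intro x hx
    rw [Submodule.mem_iInf] at hx
    obtain ⟨c, hc⟩ := hI.schur x (by
      intro j
      have := hx j
      simp only [LinearMap.mem_ker, LinearMap.sub_apply, Ad, MonoidHom.coe_mk, OneHom.coe_mk,
        LinearMap.comp_apply, LinearMap.mulLeft_apply, LinearMap.mulRight_apply,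
        Module.End.one_apply, sub_eq_zero] at this
      rw [← mul_assoc, Units.mul_inv_eq_iff_eq_mul] at this
      rw [← hu, this])
    exact Submodule.mem_span_singleton.2 ⟨c, hc.symm⟩
  have hcofix : n ^ 2 ≤ Module.finrank ℂ
      (⨆ j, LinearMap.range (Ad (u j) - 1) : Submodule ℂ (Matrix (Fin n) (Fin n) ℂ)) + 1 := by
    set R := (⨆ j, LinearMap.range (Ad (u j) - 1) : Submodule ℂ (Matrix (Fin n) (Fin n) ℂ))
    have h1 := Subspace.finrank_add_finrank_dualAnnihilator_eq R
    have h2 : Module.finrank ℂ R.dualAnnihilator ≤ 1 := by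
      refine (Submodule.finrank_mono (t := Submodule.span ℂ
        {Matrix.traceLinearMap (Fin n) ℂ ℂ}) ?_).trans ((finrank_span_le_card _).trans (by simp))
      intro φ hφ
      rw [Submodule.mem_dualAnnihilator] at hφ
      obtain ⟨θ, hθ⟩ := exists_trace_repr φ
      obtain ⟨c, hc⟩ := hI.schur θ (by
        intro j
        rw [← sub_eq_zero]
        apply eq_zero_of_trace
        intro w
        have h3 := hφ ((Ad (u j) - 1) (w * M j)) (Submodule.mem_iSup_of_mem j ⟨_, rfl⟩)
        rw [hθ] at h3
        simp only [LinearMap.sub_apply, Ad, MonoidHom.coe_mk, OneHom.coe_mk,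
          LinearMap.comp_apply, LinearMap.mulLeft_apply, LinearMap.mulRight_apply,
          Module.End.one_apply, mul_sub, Matrix.trace_sub, ← hu, Units.mul_inv_cancel_right] at h3
        rw [sub_mul, Matrix.trace_sub, ← hu, mul_assoc, mul_assoc,
          Matrix.trace_mul_comm (u j).val, mul_assoc, h3])
      refine Submodule.mem_span_singleton.2 ⟨c, ?_⟩
      apply LinearMap.ext
      intro w
      rw [hθ, hc]
      simp
    rw [Module.finrank_matrix, Module.finrank_self, Fintype.card_fin] at h1
    have h2 : n * n * 1 = n ^ 2 := by ring
    omega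
  simp_rw [hr] at hs
  rw [Module.finrank_matrix, Module.finrank_self, Fintype.card_fin] at hs
  have h2 : n * n * 1 = n ^ 2 := by ring
  omega

theorem finrank_iInf_ge {V : Type*} [AddCommGroup V] [Module ℂ V] [FiniteDimensional ℂ V]
    {J : Type*} (s : Finset J) (f : J → Module.End ℂ V) :
    Module.finrank ℂ V ≤ Module.finrank ℂ (s.inf fun j => LinearMap.ker (f j) : Submodule ℂ V)
      + ∑ j ∈ s, Module.finrank ℂ (LinearMap.range (f j)) := by
  induction s using Finset.induction_on with
  | empty => rw [Finset.inf_empty, finrank_top]; simp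
  | insert a s ha ih =>
    rw [Finset.inf_insert, Finset.sum_insert ha]
    have h1 := Submodule.finrank_sup_add_finrank_inf_eq (LinearMap.ker (f a))
      (s.inf fun j => LinearMap.ker (f j))
    have h2 := LinearMap.finrank_range_add_finrank_ker (f a)
    have h3 := Submodule.finrank_le (LinearMap.ker (f a) ⊔ s.inf fun j => LinearMap.ker (f j))
    omega

theorem beta_necessary (hn : 2 ≤ n) {q : ℕ} (M : Fin q → Matrix (Fin n) (Fin n) ℂ)
    (hu : ∀ j, IsUnit (M j)) (hI : Irr M) (hp : (List.ofFn M).prod = 1) (j : Fin q) :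
    n ≤ ∑ i ∈ Finset.univ.erase j, minRank (M i) := by
  by_contra hlt
  push Not at hlt
  have hmin : ∀ i, ∃ lam : ℂ, (M i - lam • (1 : Matrix (Fin n) (Fin n) ℂ)).rank = minRank (M i) := by
    intro i
    exact Nat.sInf_mem (Set.range_nonempty fun lam : ℂ =>
      (M i - lam • (1 : Matrix (Fin n) (Fin n) ℂ)).rank)
  choose lam hlam using hmin
  have h1 := finrank_iInf_ge (Finset.univ.erase j) (fun i => Matrix.mulVecLin (M i - lam i • 1))
  have h2 : ∑ i ∈ Finset.univ.erase j,
      Module.finrank ℂ (LinearMap.range (Matrix.mulVecLin (M i - lam i • 1)))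
      = ∑ i ∈ Finset.univ.erase j, minRank (M i) :=
    Finset.sum_congr rfl fun i _ => hlam i
  rw [h2, Module.finrank_fintype_fun_eq_card, Fintype.card_fin] at h1
  have h3 : ((Finset.univ.erase j).inf fun i =>
      LinearMap.ker (Matrix.mulVecLin (M i - lam i • 1)) : Submodule ℂ (Fin n → ℂ)) ≠ ⊥ := by
    intro h
    rw [h, finrank_bot] at h1
    omega
  obtain ⟨v, hv, hv0⟩ := Submodule.exists_mem_ne_zero_of_ne_bot h3
  have hve : ∀ i, i ≠ j → M i *ᵥ v = lam i • v := by
    intro i hi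
    have := (Finset.inf_le (f := fun i => LinearMap.ker (Matrix.mulVecLin (M i - lam i • 1)))
      (Finset.mem_erase.2 ⟨hi, Finset.mem_univ i⟩)) hv
    simpa [Matrix.sub_mulVec, Matrix.smul_mulVec, sub_eq_zero] using this
  choose u hu using hu
  have hup : (List.ofFn u).prod = 1 := by
    apply Units.ext
    have h1 : (List.ofFn M).prod = (List.ofFn u).prod := by
      rw [← Units.coeHom_apply, map_list_prod, List.map_ofFn]
      congr 2
      ext1 j; simp [hu]
    rw [← h1, hp]; rfl
  let S : Subgroup (Matrix (Fin n) (Fin n) ℂ)ˣ :=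
    { carrier := {g | ∃ c : ℂ, g.val *ᵥ v = c • v}
      one_mem' := ⟨1, by simp⟩
      mul_mem' := by
        rintro a b ⟨c, hc⟩ ⟨d, hd⟩
        refine ⟨d * c, ?_⟩
        rw [Units.val_mul, ← Matrix.mulVec_mulVec, hd, Matrix.mulVec_smul, hc, smul_smul]
      inv_mem' := by
        rintro a ⟨c, hc⟩
        have hc0 : c ≠ 0 := by
          rintro rfl
          apply hv0
          have := congrArg (fun w => (a⁻¹).val *ᵥ w) hc
          simpa [Matrix.mulVec_mulVec] using this
        refine ⟨c⁻¹, ?_⟩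
        have := congrArg (fun w => c⁻¹ • ((a⁻¹).val *ᵥ w)) hc
        simp only [Matrix.mulVec_mulVec, Units.inv_mul, Matrix.one_mulVec, Matrix.mulVec_smul,
          smul_smul, inv_mul_cancel₀ hc0, one_smul] at this
        exact this.symm }
  have hS : ∀ i, i ≠ j → u i ∈ S := fun i hi => ⟨lam i, by rw [hu]; exact hve i hi⟩
  have hSj : u j ∈ S := by
    have e1 := List.prod_take_mul_prod_drop (List.ofFn u) j
    rw [hup, List.drop_eq_getElem_cons (by simp), List.prod_cons, List.getElem_ofFn] at e1
    have t1 : ((List.ofFn u).take j).prod ∈ S := by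
      apply Subgroup.list_prod_mem
      intro x hx
      obtain ⟨k, hk, rfl⟩ := List.mem_iff_getElem.1 hx
      rw [List.getElem_take, List.getElem_ofFn]
      apply hS
      simp only [List.length_take, List.length_ofFn] at hk
      intro h
      have := congrArg Fin.val h
      simp only at this
      omega
    have t2 : ((List.ofFn u).drop (j + 1)).prod ∈ S := by
      apply Subgroup.list_prod_mem
      intro x hx
      obtain ⟨k, hk, rfl⟩ := List.mem_iff_getElem.1 hx
      rw [List.getElem_drop, List.getElem_ofFn]
      apply hS
      intro h
      have := congrArg Fin.val h
      simp only at this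
      omega
    have e2 : u j = ((List.ofFn u).take j).prod⁻¹ * ((List.ofFn u).drop (j + 1)).prod⁻¹ := by
      rw [eq_mul_inv_iff_mul_eq]
      exact (inv_eq_of_mul_eq_one_right e1).symm
    rw [e2]
    exact S.mul_mem (S.inv_mem t1) (S.inv_mem t2)
  have hall : ∀ i, ∃ c : ℂ, M i *ᵥ v = c • v := by
    intro i
    by_cases hi : i = j
    · subst hi; obtain ⟨c, hc⟩ := hSj; exact ⟨c, by rw [← hu]; exact hc⟩
    · exact ⟨_, hve i hi⟩
  rcases hI (Submodule.span ℂ {v}) (by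
    intro i w hw
    obtain ⟨c, rfl⟩ := Submodule.mem_span_singleton.1 hw
    obtain ⟨d, hd⟩ := hall i
    rw [Matrix.mulVec_smul, hd, smul_smul]
    exact Submodule.mem_span_singleton.2 ⟨_, rfl⟩) with h | h
  · exact hv0 (Submodule.span_singleton_eq_bot.1 h)
  · have := finrank_span_singleton (K := ℂ) hv0
    rw [h, finrank_top, Module.finrank_fintype_fun_eq_card, Fintype.card_fin] at this
    omega

end
end DSP

namespace DSP

theorem genericMulRoots_conj {q n : ℕ} {Y M : Fin q → Matrix (Fin n) (Fin n) ℂ}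
    (h : ∀ j, MatConj (Y j) (M j)) (hg : GenericMulRoots Y) : GenericMulRoots M := by
  have : ∀ j, (M j).charpoly = (Y j).charpoly := by
    intro j
    obtain ⟨S, hS⟩ := h j
    rw [hS]
    exact (sim_of_unit S _).charpoly
  intro κ h1 h2 Φ hΦ
  exact hg κ h1 h2 Φ (fun j => by rw [← this]; exact hΦ j)

theorem irr_of_genericMul {q n : ℕ} {M : Fin q → Matrix (Fin n) (Fin n) ℂ}
    (hg : GenericMulRoots M) (hp : (List.ofFn M).prod = 1) : Irr M := by
  by_contra hI
  obtain ⟨r, s, G, H, B, X, C, hr, hs', hrs, h1, h2, h⟩ := exists_blocks_of_not_irr hI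
  rw [Fintype.card_fin] at hrs
  refine hg r hr (by omega) (fun j => (B j).charpoly.roots) (fun j => ⟨?_, ?_⟩) ?_
  · rw [roots_le_of_block h1 h2 (h j)]
    exact Multiset.le_add_right _ _
  · rw [card_roots_charpoly, Fintype.card_fin]
  · have key : ∀ l : List (Fin q), ∃ Z, H * (l.map M).prod * G
        = Matrix.fromBlocks (l.map B).prod Z 0 (l.map C).prod := by
      intro l
      induction l with
      | nil => exact ⟨0, by simp [h2]⟩
      | cons a l ih =>
        obtain ⟨Z, hZ⟩ := ih
        simp only [List.map_cons, List.prod_cons]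
        have : H * (M a * (l.map M).prod) * G = (H * M a * G) * (H * (l.map M).prod * G) := by
          simp only [Matrix.mul_assoc]
          rw [← Matrix.mul_assoc G H, h1, Matrix.one_mul]
        rw [this, h, hZ, Matrix.fromBlocks_multiply]
        exact ⟨_, by simp; rfl⟩
    obtain ⟨Z, hZ⟩ := key (List.finRange q)
    rw [← List.ofFn_eq_map, hp, Matrix.mul_one, h2] at hZ
    have h5 := congrArg Matrix.toBlocks₁₁ hZ
    rw [Matrix.toBlocks_fromBlocks₁₁, ← List.ofFn_eq_map] at h5
    have h6 : (1 : Matrix (Fin r ⊕ Fin s) (Fin r ⊕ Fin s) ℂ).toBlocks₁₁ = 1 := by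
      rw [← Matrix.fromBlocks_one, Matrix.toBlocks_fromBlocks₁₁]
    rw [h6] at h5
    have h7 := congrArg Matrix.det h5
    rw [Matrix.det_one] at h7
    have h8 : (List.ofFn B).prod.det = ∏ j, (B j).det := by
      rw [← Matrix.coe_detMonoidHom, map_list_prod, List.map_ofFn, List.prod_ofFn]; rfl
    rw [h8] at h7
    rw [h7]
    exact Finset.prod_congr rfl fun j _ => (Matrix.det_eq_prod_roots_charpoly _).symm

end DSP

namespace DSP
section blocks
variable {ι : Type*} [Fintype ι] [DecidableEq ι] {Λ : Type*} [LinearOrder Λ]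

theorem toSquareBlock_mul {κ : ι → Λ} {y z : Matrix ι ι ℂ} (hy : y.BlockTriangular κ)
    (hz : z.BlockTriangular κ) (k : Λ) :
    (y * z).toSquareBlock κ k = y.toSquareBlock κ k * z.toSquareBlock κ k := by
  ext ⟨i, hi⟩ ⟨j, hj⟩
  simp only [Matrix.toSquareBlock_def, Matrix.of_apply, Matrix.mul_apply]
  rw [← Finset.sum_subtype (Finset.univ.filter fun l => κ l = k) (by simp)
    (fun l => y i l * z l j), Finset.sum_filter]
  refine Finset.sum_congr rfl fun l _ => ?_
  split_ifs with h
  · rfl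
  · rcases lt_or_gt_of_ne h with h | h
    · rw [hy (by rw [hi]; exact h), zero_mul]
    · rw [hz (by rw [hj]; exact h), mul_zero]

theorem sum_label_eq {κ : ι → Λ} (y : Matrix ι ι ℂ) (μ : Λ → ℂ) :
    ∑ i, μ (κ i) * y i i = ∑ k ∈ Finset.univ.image κ, μ k * (y.toSquareBlock κ k).trace := by
  rw [← Finset.sum_fiberwise_of_maps_to (g := κ) (t := Finset.univ.image κ) (by simp)]
  refine Finset.sum_congr rfl fun k _ => ?_
  simp only [Matrix.trace, Matrix.diag_apply, Matrix.toSquareBlock_def, Matrix.of_apply]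
  rw [← Finset.sum_subtype (Finset.univ.filter fun l => κ l = k) (by simp) (fun l => y l l),
    Finset.mul_sum]
  refine Finset.sum_congr rfl fun i hi => ?_
  rw [(Finset.mem_filter.1 hi).2]

theorem sum_label_nilpotent {κ : ι → Λ} {y : Matrix ι ι ℂ} (hy : y.BlockTriangular κ)
    (hn : IsNilpotent y) (μ : Λ → ℂ) : ∑ i, μ (κ i) * y i i = 0 := by
  rw [sum_label_eq]
  refine Finset.sum_eq_zero fun k _ => ?_
  obtain ⟨m, hm⟩ := hn
  have hb : ∀ m : ℕ, (y ^ m).BlockTriangular κ ∧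
      (y ^ m).toSquareBlock κ k = (y.toSquareBlock κ k) ^ m := by
    intro m
    induction m with
    | zero =>
      refine ⟨by rw [pow_zero]; exact Matrix.blockTriangular_one, ?_⟩
      ext ⟨i, hi⟩ ⟨j, hj⟩
      simp [Matrix.toSquareBlock_def, Matrix.one_apply]
    | succ m ih =>
      rw [pow_succ, pow_succ]
      exact ⟨ih.1.mul hy, by rw [toSquareBlock_mul ih.1 hy, ih.2]⟩
  have h1 : IsNilpotent (y.toSquareBlock κ k) := ⟨m, by
    rw [← (hb m).2, hm]; rfl⟩
  have h2 := Matrix.isNilpotent_trace_of_isNilpotent h1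
  rw [h2.eq_zero, mul_zero]

theorem exists_nat_trace_idem {ι : Type*} [Fintype ι] [DecidableEq ι] {e : Matrix ι ι ℂ}
    (he : e * e = e) :
    ∃ t : ℕ, t ≤ Fintype.card ι ∧ e.trace = t ∧ (t = 0 → e = 0) := by
  have h1 : IsIdempotentElem (Matrix.toLin' e) := by
    rw [IsIdempotentElem, Module.End.mul_eq_comp, ← Matrix.toLin'_mul, he]
  refine ⟨Module.finrank ℂ (LinearMap.range (Matrix.toLin' e)), ?_, ?_, ?_⟩
  · refine (Submodule.finrank_le _).trans ?_
    simp
  · rw [← (LinearMap.IsIdempotentElem.isProj_range _ h1).trace, Matrix.trace_toLin'_eq]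
  · intro h
    rw [Submodule.finrank_eq_zero, LinearMap.range_eq_bot] at h
    simpa using h

theorem sum_label_idem {κ : ι → Λ} {y : Matrix ι ι ℂ} (hy : y.BlockTriangular κ)
    (hn : y * y = y) : ∃ S : Finset ι, ∀ μ : Λ → ℂ, ∑ i, μ (κ i) * y i i = ∑ i ∈ S, μ (κ i) := by
  have h1 : ∀ k, ∃ T : Finset ι, T ⊆ Finset.univ.filter (fun i => κ i = k) ∧
      (y.toSquareBlock κ k).trace = T.card := by
    intro k
    obtain ⟨t, ht, ht2, -⟩ := exists_nat_trace_idem (e := y.toSquareBlock κ k)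
      (by rw [← toSquareBlock_mul hy hy, hn])
    rw [Fintype.card_subtype] at ht
    obtain ⟨T, hT, hT2⟩ := Finset.exists_subset_card_eq ht
    exact ⟨T, hT, by rw [ht2, hT2]⟩
  choose T hT hT2 using h1
  refine ⟨Finset.univ.filter fun i => i ∈ T (κ i), fun μ => ?_⟩
  rw [sum_label_eq, ← Finset.sum_fiberwise_of_maps_to (g := κ) (t := Finset.univ.image κ)
    (s := Finset.univ.filter fun i => i ∈ T (κ i)) (by simp)]
  refine Finset.sum_congr rfl fun k _ => ?_
  have h3 : ((Finset.univ.filter fun i => i ∈ T (κ i)).filter fun i => κ i = k) = T k := by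
    ext i
    simp only [Finset.mem_filter, Finset.mem_univ, true_and]
    constructor
    · rintro ⟨h, rfl⟩; exact h
    · intro h
      have := (Finset.mem_filter.1 (hT k h)).2
      exact ⟨by rw [this]; exact h, this⟩
  rw [h3, hT2, Finset.sum_congr rfl (fun i hi => by rw [(Finset.mem_filter.1 (hT k hi)).2])]
  simp [mul_comm]

end blocks

section transfer
variable {ι : Type*} [Fintype ι] [DecidableEq ι] {Λ : Type*} [LinearOrder Λ]
  {J : Type*} [Fintype J]

/-- the matrices `g (D + U) g⁻¹` -/
noncomputable def AA (κ : J → ι → Λ) (g : J → (Matrix ι ι ℂ)ˣ) (μ : J → Λ → ℂ)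
    (U : J → Matrix ι ι ℂ) (j : J) : Matrix ι ι ℂ :=
  (g j).val * (diagonal (μ j ∘ κ j) + U j) * ((g j)⁻¹).val

/-- solutions of the (extended) additive problem -/
def Sol (κ : J → ι → Λ) (g : J → (Matrix ι ι ℂ)ˣ) (b : J → ℂ) (E : Matrix ι ι ℂ)
    (μ : J → Λ → ℂ) (U : J → Matrix ι ι ℂ) : Prop :=
  (∀ j, SU (κ j) (U j)) ∧ ∑ j, AA κ g μ U j = 0 ∧
    ∑ j, b j * (E * AA κ g μ U j).trace = 0

/-- compatibility of the extra matrix `E` with the host flag -/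
structure ECompat (κ : J → ι → Λ) (g : J → (Matrix ι ι ℂ)ˣ) (b : J → ℂ) (E : Matrix ι ι ℂ)
    (h : J) : Prop where
  bh : b h = 0
  sq : E * E = 0
  tr : E.trace = 0
  left : ∀ θ, (((g h)⁻¹).val * θ * (g h).val).BlockTriangular (κ h) → ∃ t : ℂ, θ * E = t • E
  right : ∀ θ, (((g h)⁻¹).val * θ * (g h).val).BlockTriangular (κ h) → ∃ t : ℂ, E * θ = t • E

/-- the algebra of the transfer lemma -/
def tAlg (κ : J → ι → Λ) (g : J → (Matrix ι ι ℂ)ˣ) (b : J → ℂ) (E : Matrix ι ι ℂ)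
    (h : J) (hE : ECompat κ g b E h) : Subalgebra ℂ (J → Matrix ι ι ℂ) where
  carrier := {x | (∃ θ : Matrix ι ι ℂ, ∃ c : ℂ, ∀ j, x j = θ + (c * b j) • E) ∧
    ∀ j, (((g j)⁻¹).val * x j * (g j).val).BlockTriangular (κ j)}
  mul_mem' := by
    rintro x y ⟨⟨θ, c, hx⟩, hx2⟩ ⟨⟨θ', c', hy⟩, hy2⟩
    have hxh : x h = θ := by rw [hx, hE.bh]; simp
    have hyh : y h = θ' := by rw [hy, hE.bh]; simp
    obtain ⟨t, ht⟩ := hE.left θ (by rw [← hxh]; exact hx2 h)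
    obtain ⟨t', ht'⟩ := hE.right θ' (by rw [← hyh]; exact hy2 h)
    refine ⟨⟨θ * θ', c * t' + c' * t, fun j => ?_⟩, fun j => ?_⟩
    · rw [Pi.mul_apply, hx, hy, add_mul, mul_add, mul_add]
      simp only [Matrix.smul_mul, Matrix.mul_smul, ht, ht', hE.sq, smul_zero, add_zero]
      module
    · have : ((g j)⁻¹).val * (x * y) j * (g j).val
          = (((g j)⁻¹).val * x j * (g j).val) * (((g j)⁻¹).val * y j * (g j).val) := by
        simp [mul_assoc]
      rw [this]
      exact (hx2 j).mul (hy2 j)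
  add_mem' := by
    rintro x y ⟨⟨θ, c, hx⟩, hx2⟩ ⟨⟨θ', c', hy⟩, hy2⟩
    refine ⟨⟨θ + θ', c + c', fun j => ?_⟩, fun j => ?_⟩
    · rw [Pi.add_apply, hx, hy]; module
    · rw [Pi.add_apply, mul_add, add_mul]
      exact (hx2 j).add (hy2 j)
  algebraMap_mem' := by
    intro r
    refine ⟨⟨algebraMap ℂ _ r, 0, fun j => by simp⟩, fun j => ?_⟩
    rw [Pi.algebraMap_apply, Algebra.algebraMap_eq_smul_one]
    simp only [Matrix.mul_smul, Matrix.smul_mul, mul_one, Units.inv_mul]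
    rw [← Algebra.algebraMap_eq_smul_one]
    exact Matrix.blockTriangular_algebraMap r

theorem trace_bt_su {κ : ι → Λ} {y U : Matrix ι ι ℂ} (hy : y.BlockTriangular κ) (hU : SU κ U)
    (d : ι → ℂ) : (y * (diagonal d + U)).trace = ∑ i, d i * y i i := by
  rw [mul_add, Matrix.trace_add]
  have : (y * U).trace = 0 := by
    refine Finset.sum_eq_zero fun i _ => ?_
    rw [Matrix.diag_apply, Matrix.mul_apply]
    refine Finset.sum_eq_zero fun l _ => ?_
    by_cases h : κ l < κ i
    · rw [hy h, zero_mul]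
    · rw [hU l i h, mul_zero]
  rw [this, add_zero]
  simp [Matrix.trace, mul_comm]

theorem trace_AA {κ : J → ι → Λ} {g : J → (Matrix ι ι ℂ)ˣ} {μ : J → Λ → ℂ}
    {U : J → Matrix ι ι ℂ} (x : Matrix ι ι ℂ) (j : J) (hU : SU (κ j) (U j))
    (hx : (((g j)⁻¹).val * x * (g j).val).BlockTriangular (κ j)) :
    (x * AA κ g μ U j).trace
      = ∑ i, μ j (κ j i) * (((g j)⁻¹).val * x * (g j).val) i i := by
  have := trace_bt_su hx hU (μ j ∘ κ j)
  simp only [Function.comp_apply] at this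
  rw [← this, AA, ← mul_assoc, ← mul_assoc, Matrix.trace_mul_comm]
  simp only [mul_assoc]

theorem unique_eigenvalue {R : Type*} [Ring R] [Algebra ℂ R] [Nontrivial R]
    [FiniteDimensional ℂ R] (x : R)
    (hidem : ∀ p : Polynomial ℂ, IsIdempotentElem (Polynomial.aeval x p) →
      Polynomial.aeval x p = 0 ∨ Polynomial.aeval x p = 1) :
    ∃ ν : ℂ, IsNilpotent (x - algebraMap ℂ R ν) := by
  have hnint : IsIntegral ℂ x := Algebra.IsIntegral.isIntegral x
  set P := minpoly ℂ x with hP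
  have hP0 : P ≠ 0 := minpoly.ne_zero hnint
  have hdeg : P.degree ≠ 0 := (minpoly.degree_pos hnint).ne'
  obtain ⟨ν, hν⟩ := IsAlgClosed.exists_root P hdeg
  obtain ⟨q, hq, hndvd⟩ := Polynomial.exists_eq_pow_rootMultiplicity_mul_and_not_dvd P hP0 ν
  set k := P.rootMultiplicity ν
  have hk : 0 < k := (Polynomial.rootMultiplicity_pos hP0).2 hν
  have hcop : IsCoprime ((Polynomial.X - Polynomial.C ν) ^ k) q := by
    apply IsCoprime.pow_left
    exact (Polynomial.irreducible_X_sub_C ν).coprime_iff_not_dvd.2 hndvd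
  obtain ⟨a, b, hab⟩ := hcop
  have hx0 : Polynomial.aeval x ((Polynomial.X - Polynomial.C ν) ^ k * q) = 0 := by
    rw [← hq]; exact minpoly.aeval ℂ x
  have hab' := congrArg (Polynomial.aeval x) hab
  rw [map_add, map_one] at hab'
  have hid : IsIdempotentElem (Polynomial.aeval x (b * q)) := by
    have h0 : Polynomial.aeval x (b * q) * Polynomial.aeval x (a * (Polynomial.X - Polynomial.C ν) ^ k)
        = 0 := by
      rw [← map_mul]
      have : b * q * (a * (Polynomial.X - Polynomial.C ν) ^ k)
        = (b * a) * ((Polynomial.X - Polynomial.C ν) ^ k * q) := by ring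
      rw [this, map_mul, hx0, mul_zero]
    rw [IsIdempotentElem]
    conv_rhs => rw [← mul_one (Polynomial.aeval x (b * q)), ← hab']
    rw [mul_add, h0, zero_add]
  rcases hidem _ hid with h | h
  · exfalso
    have h1 : Polynomial.aeval x q = 0 := by
      rw [h, add_zero] at hab'
      have : Polynomial.aeval x q = Polynomial.aeval x q
          * Polynomial.aeval x (a * (Polynomial.X - Polynomial.C ν) ^ k) := by rw [hab', mul_one]
      rw [this, ← map_mul]
      have : q * (a * (Polynomial.X - Polynomial.C ν) ^ k)
        = a * ((Polynomial.X - Polynomial.C ν) ^ k * q) := by ring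
      rw [this, map_mul, hx0, mul_zero]
    have h2 : P ∣ q := minpoly.dvd ℂ x h1
    exact hndvd ((Dvd.intro _ ((pow_succ' _ _).symm.trans (by rw [Nat.sub_add_cancel hk]))).trans
      ((Dvd.intro _ hq.symm).trans h2))
  · refine ⟨ν, k, ?_⟩
    have : (x - algebraMap ℂ R ν) ^ k = Polynomial.aeval x ((Polynomial.X - Polynomial.C ν) ^ k) := by
      simp
    rw [this, ← mul_one (Polynomial.aeval x ((Polynomial.X - Polynomial.C ν) ^ k)), ← h, ← map_mul]
    have : (Polynomial.X - Polynomial.C ν) ^ k * (b * q)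
        = b * ((Polynomial.X - Polynomial.C ν) ^ k * q) := by ring
    rw [this, map_mul, hx0, mul_zero]

theorem label_sum_zero [Nonempty ι] {κ : J → ι → Λ} {g : J → (Matrix ι ι ℂ)ˣ} {b : J → ℂ}
    {E : Matrix ι ι ℂ} {h : J} (hE : ECompat κ g b E h) {μ : J → Λ → ℂ} {U : J → Matrix ι ι ℂ}
    (hS : Sol κ g b E μ U) (hgen : AddGen fun j => μ j ∘ κ j) (x : J → Matrix ι ι ℂ)
    (hx : x ∈ tAlg κ g b E h hE) (μ' : J → Λ → ℂ) (hμ' : ∑ j, ∑ i, μ' j (κ j i) = 0) :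
    ∑ j, ∑ i, μ' j (κ j i) * (((g j)⁻¹).val * x j * (g j).val) i i = 0 := by
  have hJ : Nonempty J := ⟨h⟩
  have hτ : ∀ z ∈ tAlg κ g b E h hE,
      ∑ j, ∑ i, μ j (κ j i) * (((g j)⁻¹).val * z j * (g j).val) i i = 0 := by
    rintro z ⟨⟨θ, c, hz⟩, hz2⟩
    have : ∀ j, ∑ i, μ j (κ j i) * (((g j)⁻¹).val * z j * (g j).val) i i
        = (θ * AA κ g μ U j).trace + c * (b j * (E * AA κ g μ U j).trace) := by
      intro j
      rw [← trace_AA (U := U) (z j) j (hS.1 j) (hz2 j), hz, add_mul, Matrix.trace_add,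
        Matrix.smul_mul, Matrix.trace_smul, smul_eq_mul, mul_assoc]
    simp_rw [this]
    rw [Finset.sum_add_distrib, ← Finset.mul_sum, hS.2.2, mul_zero, add_zero, ← Matrix.trace_sum,
      ← Finset.mul_sum, hS.2.1, mul_zero, Matrix.trace_zero]
  have hidem : ∀ z ∈ tAlg κ g b E h hE, IsIdempotentElem z → z = 0 ∨ z = 1 := by
    intro z hz hzi
    have hz' := hz
    obtain ⟨⟨θ, c, hzθ⟩, hz2⟩ := hz'
    have hy : ∀ j, (((g j)⁻¹).val * z j * (g j).val) * (((g j)⁻¹).val * z j * (g j).val)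
        = ((g j)⁻¹).val * z j * (g j).val := by
      intro j
      have := congrFun hzi j
      rw [Pi.mul_apply] at this
      simp only [mul_assoc, Units.mul_inv_cancel_left]
      rw [← mul_assoc (z j), this]
    have htr : ∀ j, (((g j)⁻¹).val * z j * (g j).val).trace = θ.trace := by
      intro j
      rw [Matrix.trace_mul_comm, ← mul_assoc, Units.mul_inv, one_mul, hzθ, Matrix.trace_add,
        Matrix.trace_smul, hE.tr, smul_zero, add_zero]
    choose S hSS using fun j => sum_label_idem (hz2 j) (hy j)
    have hcard : ∀ j, ((S j).card : ℂ) = θ.trace := by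
      intro j
      have := hSS j (fun _ => 1)
      simp only [one_mul, Finset.sum_const, nsmul_eq_mul, mul_one] at this
      rw [← this, ← htr j]; rfl
    have hcard' : ∀ j, (S j).card = (S h).card := by
      intro j
      exact_mod_cast (hcard j).trans (hcard h).symm
    have hz_of : ∀ j, (((g j)⁻¹).val * z j * (g j).val) = 0 → z j = 0 := by
      intro j hj
      have := congrArg (fun w => (g j).val * w * ((g j)⁻¹).val) hj
      simpa [mul_assoc] using this
    rcases Nat.eq_zero_or_pos (S h).card with h0 | hpos
    · left
      ext1 j
      apply hz_of
      obtain ⟨t, -, ht, ht0⟩ := exists_nat_trace_idem (hy j)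
      apply ht0
      rw [htr, ← hcard j, hcard' j, h0] at ht
      exact_mod_cast ht.symm
    · by_cases hlt : (S h).card < Fintype.card ι
      · exfalso
        refine hgen S _ hcard' hpos hlt ?_
        rw [← hτ z hz]
        exact Finset.sum_congr rfl fun j _ => (hSS j (μ j)).symm
      · right
        have hEq : (S h).card = Fintype.card ι :=
          le_antisymm (Finset.card_le_univ _) (not_lt.1 hlt)
        ext1 j
        rw [Pi.one_apply, ← sub_eq_zero, ← neg_eq_zero, neg_sub]
        have h1 : (1 - z j) * (1 - z j) = 1 - z j := by
          have := congrFun hzi j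
          rw [Pi.mul_apply] at this
          rw [sub_mul, mul_sub, mul_sub, this]; simp
        obtain ⟨t, -, ht, ht0⟩ := exists_nat_trace_idem h1
        apply ht0
        have h2 := htr j
        rw [Matrix.trace_mul_comm, ← mul_assoc, Units.mul_inv, one_mul, ← hcard j, hcard' j,
          hEq] at h2
        rw [Matrix.trace_sub, Matrix.trace_one, h2, sub_self] at ht
        exact_mod_cast ht.symm
  obtain ⟨ν, hν⟩ := unique_eigenvalue x (by
    intro p hp
    exact hidem _ (Algebra.adjoin_le (Set.singleton_subset_iff.2 hx) (Polynomial.aeval_mem_adjoin_singleton ℂ x)) hp)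
  obtain ⟨k, hk⟩ := hν
  have hfin : ∀ j, ∑ i, μ' j (κ j i) * (((g j)⁻¹).val * x j * (g j).val) i i
      = ν * ∑ i, μ' j (κ j i) := by
    intro j
    have hbt : (((g j)⁻¹).val * (x j - algebraMap ℂ _ ν) * (g j).val).BlockTriangular (κ j) :=
      (((tAlg κ g b E h hE).sub_mem hx ((tAlg κ g b E h hE).algebraMap_mem ν)).2 j)
    have hnil : IsNilpotent (((g j)⁻¹).val * (x j - algebraMap ℂ _ ν) * (g j).val) := by
      refine ⟨k, ?_⟩
      have h1 : (x j - algebraMap ℂ _ ν) ^ k = 0 := congrFun hk j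
      have h2 := Units.conj_pow' (g j) (x j - algebraMap ℂ _ ν) k
      rw [h2, h1]; simp
    have h3 := sum_label_nilpotent hbt hnil (μ' j)
    have h4 : ((g j)⁻¹).val * (x j - algebraMap ℂ _ ν) * (g j).val
        = ((g j)⁻¹).val * x j * (g j).val - ν • (1 : Matrix ι ι ℂ) := by
      rw [Algebra.algebraMap_eq_smul_one, mul_sub, sub_mul]; simp
    rw [h4] at h3
    simp only [Matrix.sub_apply, Matrix.smul_apply, Matrix.one_apply_eq, mul_sub, smul_eq_mul,
      mul_one, Finset.sum_sub_distrib] at h3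
    rw [sub_eq_zero.1 h3, Finset.mul_sum]
    exact Finset.sum_congr rfl fun i _ => mul_comm _ _
  simp_rw [hfin]
  rw [← Finset.mul_sum, hμ', mul_zero]

/-- masking to the strictly upper triangular part -/
def mask (κ : ι → Λ) : Matrix ι ι ℂ →ₗ[ℂ] Matrix ι ι ℂ where
  toFun U := Matrix.of fun i i' => if κ i < κ i' then U i i' else 0
  map_add' U V := by ext i i'; simp only [Matrix.of_apply, Matrix.add_apply]; split_ifs <;> simp
  map_smul' c U := by
    ext i i'; simp only [Matrix.of_apply, Matrix.smul_apply, RingHom.id_apply]; split_ifs <;> simp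

theorem su_mask (κ : ι → Λ) (U : Matrix ι ι ℂ) : SU κ (mask κ U) := by
  intro i i' h
  simp [mask, h]

theorem mask_eq {κ : ι → Λ} {U : Matrix ι ι ℂ} (h : SU κ U) : mask κ U = U := by
  ext i i'
  simp only [mask, LinearMap.coe_mk, AddHom.coe_mk, Matrix.of_apply]
  split_ifs with h1
  · rfl
  · exact (h i i' h1).symm

theorem bt_of_trace {κ : ι → Λ} {y : Matrix ι ι ℂ} (h : ∀ U, SU κ U → (y * U).trace = 0) :
    y.BlockTriangular κ := by
  intro i i' hlt
  have := h (Matrix.single i' i 1) (by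
    intro a c hac
    rw [Matrix.single_apply]
    split_ifs with h1
    · exfalso; rw [← h1.1, ← h1.2] at hac; exact hac hlt
    · rfl)
  rw [Matrix.trace_mul_single] at this
  simpa using this

/-- **Transfer lemma** -/
theorem transfer [Nonempty ι] {κ : J → ι → Λ} {g : J → (Matrix ι ι ℂ)ˣ} {b : J → ℂ}
    {E : Matrix ι ι ℂ} {h : J} (hE : ECompat κ g b E h) {μ : J → Λ → ℂ} {U : J → Matrix ι ι ℂ}
    (hS : Sol κ g b E μ U) (hgen : AddGen fun j => μ j ∘ κ j)
    (μ' : J → Λ → ℂ) (hμ' : ∑ j, ∑ i, μ' j (κ j i) = 0) : ∃ U', Sol κ g b E μ' U' := by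
  let L1 : (J → Matrix ι ι ℂ) →ₗ[ℂ] Matrix ι ι ℂ :=
    ∑ j, (LinearMap.mulLeft ℂ (g j).val) ∘ₗ (LinearMap.mulRight ℂ ((g j)⁻¹).val) ∘ₗ
      (mask (κ j)) ∘ₗ LinearMap.proj j
  let L2 : (J → Matrix ι ι ℂ) →ₗ[ℂ] ℂ :=
    ∑ j, (b j) • ((Matrix.traceLinearMap ι ℂ ℂ) ∘ₗ (LinearMap.mulLeft ℂ E) ∘ₗ
      (LinearMap.mulLeft ℂ (g j).val) ∘ₗ (LinearMap.mulRight ℂ ((g j)⁻¹).val) ∘ₗ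
      (mask (κ j)) ∘ₗ LinearMap.proj j)
  have hL1 : ∀ V, L1 V = ∑ j, (g j).val * mask (κ j) (V j) * ((g j)⁻¹).val := by
    intro V; simp [L1, mul_assoc]
  have hL2 : ∀ V, L2 V = ∑ j, b j * (E * ((g j).val * mask (κ j) (V j) * ((g j)⁻¹).val)).trace := by
    intro V; simp [L2, mul_assoc]
  let D : J → Matrix ι ι ℂ := fun j => (g j).val * diagonal (μ' j ∘ κ j) * ((g j)⁻¹).val
  let T : Matrix ι ι ℂ × ℂ := (- ∑ j, D j, - ∑ j, b j * (E * D j).trace)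
  by_cases hT : T ∈ LinearMap.range (L1.prod L2)
  · obtain ⟨V, hV⟩ := hT
    have e1 : L1 V = - ∑ j, D j := congrArg Prod.fst hV
    have e2 : L2 V = - ∑ j, b j * (E * D j).trace := congrArg Prod.snd hV
    have hA : ∀ j, AA κ g μ' (fun j => mask (κ j) (V j)) j
        = D j + (g j).val * mask (κ j) (V j) * ((g j)⁻¹).val := by
      intro j; simp [AA, D, mul_add, add_mul]
    refine ⟨fun j => mask (κ j) (V j), fun j => su_mask _ _, ?_, ?_⟩
    · simp_rw [hA]
      rw [Finset.sum_add_distrib, ← hL1, e1, add_neg_cancel]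
    · simp_rw [hA]
      simp only [mul_add, Matrix.trace_add]
      rw [Finset.sum_add_distrib, ← hL2, e2, add_neg_cancel]
  · exfalso
    obtain ⟨φ, hφT, hφ⟩ := Submodule.exists_le_ker_of_notMem hT
    obtain ⟨θ, hθ⟩ := exists_trace_repr (φ ∘ₗ LinearMap.inl ℂ (Matrix ι ι ℂ) ℂ)
    set c := φ (0, 1) with hc
    have hφe : ∀ M z, φ (M, z) = (θ * M).trace + c * z := by
      intro M z
      have h1 : (M, z) = LinearMap.inl ℂ (Matrix ι ι ℂ) ℂ M + z • ((0 : Matrix ι ι ℂ), (1 : ℂ)) := by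
        simp
      rw [h1, map_add, map_smul, ← hθ, ← hc, smul_eq_mul, mul_comm]; rfl
    let x : J → Matrix ι ι ℂ := fun j => θ + (c * b j) • E
    have hxtr : ∀ (j : J) (W : Matrix ι ι ℂ),
        (x j * W).trace = (θ * W).trace + c * (b j * (E * W).trace) := by
      intro j W
      simp [x, add_mul, Matrix.trace_add, mul_assoc]
    have hx : x ∈ tAlg κ g b E h hE := by
      refine ⟨⟨θ, c, fun j => rfl⟩, fun j => bt_of_trace fun V hV => ?_⟩
      have h1 : φ ((L1.prod L2) (Pi.single j V)) = 0 := hφ ⟨_, rfl⟩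
      have h2 : L1 (Pi.single j V) = (g j).val * V * ((g j)⁻¹).val := by
        rw [hL1, Finset.sum_eq_single j]
        · rw [Pi.single_eq_same, mask_eq hV]
        · intro i _ hi; rw [Pi.single_eq_of_ne hi]; simp
        · simp
      have h3 : L2 (Pi.single j V) = b j * (E * ((g j).val * V * ((g j)⁻¹).val)).trace := by
        rw [hL2, Finset.sum_eq_single j]
        · rw [Pi.single_eq_same, mask_eq hV]
        · intro i _ hi; rw [Pi.single_eq_of_ne hi]; simp
        · simp
      rw [show (L1.prod L2) (Pi.single j V) = (L1 (Pi.single j V), L2 (Pi.single j V)) from rfl, hφe, h2, h3, ← hxtr] at h1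
      rw [← h1, ← mul_assoc, Matrix.trace_mul_comm (x j * _)]
      simp only [mul_assoc]
    apply hφT
    have h4 := label_sum_zero hE hS hgen x hx μ' hμ'
    have h0 : ∀ j, SU (κ j) ((0 : J → Matrix ι ι ℂ) j) := fun j _ _ _ => rfl
    have h5 : ∀ j, ∑ i, μ' j (κ j i) * (((g j)⁻¹).val * x j * (g j).val) i i
        = (θ * D j).trace + c * (b j * (E * D j).trace) := by
      intro j
      rw [← hxtr, ← trace_AA (U := 0) (x j) j (h0 j) (hx.2 j)]
      simp [AA, D]
    simp_rw [h5] at h4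
    rw [Finset.sum_add_distrib, ← Finset.mul_sum, ← Matrix.trace_sum, ← Finset.mul_sum] at h4
    rw [hφe, mul_neg, mul_neg, Matrix.trace_neg, ← neg_add, h4, neg_zero]

end transfer
end DSP

namespace DSP

theorem quad_open {V W : Type*} [NormedAddCommGroup V] [NormedSpace ℂ V] [FiniteDimensional ℂ V]
    [NormedAddCommGroup W] [NormedSpace ℂ W] [FiniteDimensional ℂ W]
    (L : V →ₗ[ℂ] W) (B : V →ₗ[ℂ] V →ₗ[ℂ] W) (hL : Function.Surjective L)
    (P : V → Prop) (hP : ∀ᶠ x in nhds (0 : V), P x) :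
    ∀ᶠ y in nhds (0 : W), ∃ x, P x ∧ L x + B x x = y := by
  have : CompleteSpace V := FiniteDimensional.complete ℂ V
  have : CompleteSpace W := FiniteDimensional.complete ℂ W
  let L' : V →L[ℂ] W := LinearMap.toContinuousLinearMap L
  let B' : V →L[ℂ] V →L[ℂ] W := LinearMap.toContinuousLinearMap
    ((LinearMap.toContinuousLinearMap : (V →ₗ[ℂ] W) ≃ₗ[ℂ] (V →L[ℂ] W)).toLinearMap ∘ₗ B)
  have h1 : HasStrictFDerivAt (fun x : V => L' x) L' 0 := L'.hasStrictFDerivAt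
  have h2 : HasStrictFDerivAt (fun x : V => B' x x) (0 : V →L[ℂ] W) 0 := by
    have h3 : HasStrictFDerivAt (fun x : V => (B' x)) B' 0 := B'.hasStrictFDerivAt
    have h4 := h3.clm_apply (hasStrictFDerivAt_id (𝕜 := ℂ) (0 : V))
    have e : (B' 0).comp (ContinuousLinearMap.id ℂ V) + B'.flip (id 0) = 0 := by
      ext v; simp
    rw [e] at h4
    exact h4
  have h3 : HasStrictFDerivAt (fun x : V => L' x + B' x x) L' 0 := by
    have := h1.add h2
    rw [add_zero] at this
    exact this
  have h4 := h3.map_nhds_eq_of_surj (LinearMap.range_eq_top.2 hL)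
  have h5 : (L' 0 + B' 0 0 : W) = 0 := by simp
  rw [h5] at h4
  rw [← h4, Filter.eventually_map]
  filter_upwards [hP] with x hx
  exact ⟨x, hx, rfl⟩

section deform
variable {ι : Type*} [Fintype ι] [DecidableEq ι] {Λ : Type*} [LinearOrder Λ]
  {J : Type*} [Fintype J]

attribute [local instance] Matrix.normedAddCommGroup Matrix.normedSpace

/-- the c-brick property -/
def CBrick (κ : J → ι → Λ) (g : J → (Matrix ι ι ℂ)ˣ) (b : J → ℂ) (E : Matrix ι ι ℂ)
    (h : J) (A : J → Matrix ι ι ℂ) : Prop :=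
  ∀ (θ : Matrix ι ι ℂ) (c : ℂ), (((g h)⁻¹).val * θ * (g h).val).BlockTriangular (κ h) →
    (∀ j, j ≠ h → (θ + (c * b j) • E) * A j = A j * (θ + (c * b j) • E)) →
    (∃ s : ℂ, θ = s • 1) ∧ c • E = 0


/-- domain of the deformation problem -/
abbrev DDom (J ι : Type*) := (J → Matrix ι ι ℂ) × (J → Matrix ι ι ℂ) × (J → Matrix ι ι ℂ) × ℂ × ℂ × ℂ
/-- codomain of the deformation problem -/
abbrev DCod (J ι : Type*) := (J → Matrix ι ι ℂ) × Matrix ι ι ℂ × ℂ × ℂ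

/-- first coordinates -/
def dAl (j : J) : DDom J ι →ₗ[ℂ] Matrix ι ι ℂ where
  toFun x := x.1 j
  map_add' _ _ := rfl
  map_smul' _ _ := rfl
/-- conjugation coordinates -/
noncomputable def dX (h j : J) : DDom J ι →ₗ[ℂ] Matrix ι ι ℂ where
  toFun x := if j = h then 0 else x.2.1 j
  map_add' x y := by split_ifs <;> simp
  map_smul' x y := by split_ifs <;> simp
/-- variations -/
def dW (κ : J → ι → Λ) (g : J → (Matrix ι ι ℂ)ˣ) (η : J → Λ → ℂ) (j : J) :
    DDom J ι →ₗ[ℂ] Matrix ι ι ℂ where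
  toFun x := (g j).val * (x.2.2.2.2.2 • diagonal (η j ∘ κ j) + mask (κ j) (x.2.2.1 j))
        * ((g j)⁻¹).val
  map_add' := by
    intro x y
    simp only [Prod.snd_add, Prod.fst_add, Pi.add_apply, map_add, add_smul]
    noncomm_ring
  map_smul' := by
    intro r x
    simp only [Prod.smul_snd, Prod.smul_fst, Pi.smul_apply, map_smul, smul_assoc, RingHom.id_apply,
      ← smul_add, Matrix.mul_smul, Matrix.smul_mul]

/-- linear part -/
noncomputable def dL (κ : J → ι → Λ) (g : J → (Matrix ι ι ℂ)ˣ) (η : J → Λ → ℂ) (h : J)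
    (A : J → Matrix ι ι ℂ) (b : J → ℂ) (E : Matrix ι ι ℂ) (ep : ℂ) : DDom J ι →ₗ[ℂ] DCod J ι where
  toFun x := (fun j => dAl j x + A j * dX h j x - dX h j x * A j - dW κ g η j x,
    ∑ j, dAl j x - x.2.2.2.1 • 1, ∑ j, b j * (E * dAl j x).trace - ep * x.2.2.2.2.1, x.2.2.2.2.2)
  map_add' x y := by
    simp only [map_add, Prod.mk_add_mk, Prod.mk.injEq, Prod.snd_add, Prod.fst_add, mul_add, add_mul,
      Finset.sum_add_distrib, Matrix.trace_add, add_smul]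
    refine ⟨?_, by abel, by abel, trivial⟩
    ext1 j
    simp only [Pi.add_apply]
    abel
  map_smul' r x := by
    simp only [map_smul, Prod.smul_mk, Prod.mk.injEq, Prod.smul_snd, Prod.smul_fst, RingHom.id_apply,
      Matrix.mul_smul, Matrix.smul_mul, ← Finset.smul_sum, Matrix.trace_smul, smul_sub, smul_assoc]
    refine ⟨?_, trivial, ?_, trivial⟩
    · ext1 j
      simp only [Pi.smul_apply, smul_sub, smul_add]
    · simp only [smul_eq_mul, Finset.mul_sum]
      congr 1
      · exact Finset.sum_congr rfl fun j _ => by ring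
      · ring

/-- quadratic part -/
noncomputable def dB (κ : J → ι → Λ) (g : J → (Matrix ι ι ℂ)ˣ) (η : J → Λ → ℂ) (h : J) :
    DDom J ι →ₗ[ℂ] DDom J ι →ₗ[ℂ] DCod J ι := LinearMap.mk₂ ℂ
    (fun x y => ((fun j => dAl j x * dX h j y - dX h j x * dW κ g η j y), 0, 0, 0))
    (by
      intro x x' y
      simp only [map_add, Prod.mk_add_mk, Prod.mk.injEq, add_zero, and_true, add_mul]
      ext1 j; simp only [Pi.add_apply]; abel)
    (by
      intro c x y
      simp only [map_smul, Prod.smul_mk, Prod.mk.injEq, smul_zero, and_true, Matrix.smul_mul]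
      ext1 j; simp only [Pi.smul_apply, smul_sub])
    (by
      intro x x' y
      simp only [map_add, Prod.mk_add_mk, Prod.mk.injEq, add_zero, and_true, mul_add]
      ext1 j; simp only [Pi.add_apply]; abel)
    (by
      intro c x y
      simp only [map_smul, Prod.smul_mk, Prod.mk.injEq, smul_zero, and_true, Matrix.mul_smul]
      ext1 j; simp only [Pi.smul_apply, smul_sub])

theorem dL_surj [Nonempty ι] {κ : J → ι → Λ} {g : J → (Matrix ι ι ℂ)ˣ} {b : J → ℂ}
    {E : Matrix ι ι ℂ} {h : J} {A : J → Matrix ι ι ℂ} (bh : b h = 0) {ep : ℂ}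
    (hep : E = 0 → ep ≠ 0)
    (hbr : CBrick κ g b E h A) (η : J → Λ → ℂ) :
    Function.Surjective (dL κ g η h A b E ep) := by
  rw [← LinearMap.range_eq_top]
  by_contra hne
  obtain ⟨T, hT⟩ : ∃ T, T ∉ LinearMap.range (dL κ g η h A b E ep) := by
    by_contra hcon
    push Not at hcon
    exact hne (eq_top_iff.2 fun x _ => hcon x)
  obtain ⟨φ, hφT, hφ⟩ := Submodule.exists_le_ker_of_notMem hT
  have hφ0 : ∀ x, φ (dL κ g η h A b E ep x) = 0 := fun x => hφ ⟨x, rfl⟩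
  have hψ : ∀ j, ∃ ψ : Matrix ι ι ℂ, ∀ M, φ (Pi.single j M, 0, 0, 0) = (ψ * M).trace := fun j =>
    exists_trace_repr (φ ∘ₗ LinearMap.inl ℂ _ _ ∘ₗ LinearMap.single ℂ (fun _ => Matrix ι ι ℂ) j)
  choose ψ hψ using hψ
  obtain ⟨θ, hθ⟩ := exists_trace_repr (φ ∘ₗ LinearMap.inr ℂ (J → Matrix ι ι ℂ) _ ∘ₗ
    LinearMap.inl ℂ (Matrix ι ι ℂ) (ℂ × ℂ))
  set c := φ (0, 0, 1, 0) with hc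
  set τ := φ (0, 0, 0, 1) with hτ
  have hφe : ∀ (f : J → Matrix ι ι ℂ) M z w, φ (f, M, z, w)
      = ∑ j, (ψ j * f j).trace + (θ * M).trace + c * z + τ * w := by
    intro f M z w
    have e : ((f, M, z, w) : DCod J ι) = LinearMap.inl ℂ _ _ (∑ j, (Pi.single j (f j) : J → Matrix ι ι ℂ))
        + (0, M, 0, 0) + z • (0, 0, 1, 0) + w • (0, 0, 0, 1) := by
      rw [Finset.univ_sum_single]
      simp
    rw [e, map_add, map_add, map_add, map_sum, map_sum, map_smul, map_smul, ← hc, ← hτ]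
    simp only [smul_eq_mul, mul_comm c, mul_comm τ]
    congr 3
    · exact Finset.sum_congr rfl fun j _ => hψ j (f j)
    · exact hθ M
  have hall : ∀ x : DDom J ι, ∑ j, (ψ j * (dAl j x + A j * dX h j x - dX h j x * A j - dW κ g η j x)).trace
      + (θ * (∑ j, dAl j x - x.2.2.2.1 • 1)).trace
      + c * (∑ j, b j * (E * dAl j x).trace - ep * x.2.2.2.2.1) + τ * x.2.2.2.2.2 = 0 := by
    intro x
    rw [← hφe]
    exact hφ0 x
  have h1 : ∀ j, ψ j = - (θ + (c * b j) • E) := by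
    intro j
    rw [eq_neg_iff_add_eq_zero]
    refine eq_zero_of_trace _ fun M => ?_
    have := hall (Pi.single j M, 0, 0, 0, 0, 0)
    simp only [dAl, dX, dW, LinearMap.coe_mk, AddHom.coe_mk, Pi.zero_apply, map_zero, zero_smul,
      add_zero, mul_zero, zero_mul, sub_zero, ite_self] at this
    rw [Finset.sum_eq_single j, Finset.sum_eq_single j, Finset.sum_eq_single j] at this
    · simp only [Pi.single_eq_same] at this
      rw [← this]
      simp [add_mul, Matrix.trace_add]
      ring
    all_goals first | (intro i _ hi; simp [Pi.single_eq_of_ne hi]) | simp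
  have h2 : ∀ j, j ≠ h → ψ j * A j = A j * ψ j := by
    intro j hj
    rw [← sub_eq_zero]
    refine eq_zero_of_trace _ fun M => ?_
    have := hall (0, Pi.single j M, 0, 0, 0, 0)
    simp only [dAl, dX, dW, LinearMap.coe_mk, AddHom.coe_mk, Pi.zero_apply, map_zero, zero_smul,
      add_zero, mul_zero, zero_mul, sub_zero, zero_add, Finset.sum_const_zero, Matrix.trace_zero] at this
    rw [Finset.sum_eq_single j] at this
    · rw [if_neg hj, Pi.single_eq_same] at this
      rw [← this, mul_sub, sub_mul, Matrix.trace_sub, Matrix.trace_sub, mul_assoc, mul_assoc,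
        ← mul_assoc (ψ j) M, Matrix.trace_mul_comm (ψ j * M)]
    · intro i _ hi; simp [Pi.single_eq_of_ne hi]
    · simp
  have h3 : (((g h)⁻¹).val * θ * (g h).val).BlockTriangular (κ h) := by
    refine bt_of_trace fun U hU => ?_
    have := hall (0, 0, Pi.single h U, 0, 0, 0)
    simp only [dAl, dX, dW, LinearMap.coe_mk, AddHom.coe_mk, Pi.zero_apply, map_zero, zero_smul,
      add_zero, mul_zero, zero_mul, sub_zero, zero_add, Finset.sum_const_zero, Matrix.trace_zero,
      ite_self, zero_sub] at this
    rw [Finset.sum_eq_single h] at this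
    · rw [Pi.single_eq_same, mask_eq hU, h1, bh, mul_zero, zero_smul, add_zero] at this
      rw [← this, neg_mul_neg, ← mul_assoc, Matrix.trace_mul_comm _ (((g h)⁻¹).val)]
      simp only [mul_assoc]
    · intro i _ hi; simp [Pi.single_eq_of_ne hi]
    · simp
  have h4 : θ.trace = 0 := by
    have := hall (0, 0, 0, 1, 0, 0)
    simp only [dAl, dX, dW, LinearMap.coe_mk, AddHom.coe_mk, Pi.zero_apply, map_zero, zero_smul,
      add_zero, mul_zero, zero_mul, sub_zero, zero_add, Finset.sum_const_zero, Matrix.trace_zero,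
      ite_self, zero_sub] at this
    simpa using this
  have h5 : c * ep = 0 := by
    have := hall (0, 0, 0, 0, 1, 0)
    simp only [dAl, dX, dW, LinearMap.coe_mk, AddHom.coe_mk, Pi.zero_apply, map_zero, zero_smul,
      add_zero, mul_zero, zero_mul, sub_zero, zero_add, Finset.sum_const_zero, Matrix.trace_zero,
      ite_self, zero_sub] at this
    simpa using this
  obtain ⟨⟨s, hs⟩, hcE⟩ := hbr θ c h3 (by
    intro j hj
    have := h2 j hj
    rw [h1, neg_mul, mul_neg, neg_inj] at this
    exact this)
  have hθ0 : θ = 0 := by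
    rw [hs, Matrix.trace_smul, Matrix.trace_one, smul_eq_mul] at h4
    rcases mul_eq_zero.1 h4 with h4 | h4
    · rw [hs, h4, zero_smul]
    · simp at h4
  have hc0 : c = 0 := by
    by_cases hE0 : E = 0
    · exact (mul_eq_zero.1 h5).resolve_right (hep hE0)
    · exact (smul_eq_zero.1 hcE).resolve_right hE0
  have hψ0 : ∀ j, ψ j = 0 := by
    intro j; rw [h1, hθ0, hc0]; simp
  have hτ0 : τ = 0 := by
    have := hall (0, 0, 0, 0, 0, 1)
    simpa [hψ0, hθ0, hc0] using this
  apply hφT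
  obtain ⟨f, M, z, w⟩ := T
  rw [hφe]
  simp [hψ0, hθ0, hc0, hτ0]

theorem isUnit_one_add_eventually :
    ∀ᶠ X in nhds (0 : Matrix ι ι ℂ), IsUnit (1 + X) := by
  have h1 : Continuous fun X : Matrix ι ι ℂ => (1 + X).det :=
    Continuous.matrix_det (continuous_const.add continuous_id)
  have h2 : ∀ᶠ X in nhds (0 : Matrix ι ι ℂ), (1 + X).det ≠ 0 :=
    h1.continuousAt.eventually_ne (by simp)
  filter_upwards [h2] with X hX
  exact (Matrix.isUnit_iff_isUnit_det _).2 (isUnit_iff_ne_zero.2 hX)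

theorem deform [Nonempty ι] {κ : J → ι → Λ} {g : J → (Matrix ι ι ℂ)ˣ} {b : J → ℂ}
    {E : Matrix ι ι ℂ} {h : J} {μ : J → Λ → ℂ} (bh : b h = 0)
    (hS : Sol κ g b E μ 0) (hbr : CBrick κ g b E h (AA κ g μ 0)) (η : J → Λ → ℂ)
    (hη : ∑ j, ∑ i, η j (κ j i) = 0) :
    ∀ᶠ t in nhds (0 : ℂ), ∃ g' U, g' h = g h ∧ Sol κ g' b E (fun j k => μ j k + t * η j k) U := by
  let A := AA κ g μ 0
  let ep : ℂ := if E = 0 then 1 else 0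
  have hsurj := dL_surj (ep := ep) bh (by intro h0; simp [ep, h0]) hbr η
  have hP : ∀ᶠ x in nhds (0 : DDom J ι), ∀ j, IsUnit (1 + dX h j x) := by
    rw [Filter.eventually_all]
    intro j
    have hc : Continuous (dX (ι := ι) h j) := LinearMap.continuous_of_finiteDimensional _
    have := hc.tendsto 0
    rw [map_zero] at this
    exact this.eventually isUnit_one_add_eventually
  have hQ := quad_open _ (dB κ g η h) hsurj _ hP
  have hlim : Filter.Tendsto (fun t : ℂ => ((0, 0, 0, t) : DCod J ι)) (nhds 0) (nhds 0) := by
    have : Continuous (fun t : ℂ => ((0, 0, 0, t) : DCod J ι)) := by fun_prop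
    exact this.tendsto 0
  filter_upwards [hlim.eventually hQ] with t ht
  obtain ⟨x, hx, hxe⟩ := ht
  have e1 := fun j => congrFun (congrArg Prod.fst hxe) j
  have e2 := congrArg (fun z => z.2.1) hxe
  have e3 := congrArg (fun z => z.2.2.1) hxe
  have e4 := congrArg (fun z => z.2.2.2) hxe
  simp only [dL, dB, LinearMap.mk₂_apply, LinearMap.coe_mk, AddHom.coe_mk, Prod.fst_add, Prod.snd_add,
    Pi.add_apply, add_zero, Pi.zero_apply] at e1 e2 e3 e4
  choose G hG using hx
  let g' : J → (Matrix ι ι ℂ)ˣ := fun j => G j * g j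
  let U : J → Matrix ι ι ℂ := fun j => mask (κ j) (x.2.2.1 j)
  have key : ∀ j, AA κ g' (fun j k => μ j k + t * η j k) U j = A j + dAl j x := by
    intro j
    have hW : (g j).val * (diagonal ((fun k => μ j k + t * η j k) ∘ κ j) + U j) * ((g j)⁻¹).val
        = A j + dW κ g η j x := by
      have : diagonal ((fun k => μ j k + t * η j k) ∘ κ j)
          = diagonal (μ j ∘ κ j) + t • diagonal (η j ∘ κ j) := by
        rw [← Matrix.diagonal_smul, Matrix.diagonal_add]; rfl
      simp only [A, AA, dW, LinearMap.coe_mk, AddHom.coe_mk, this, U, e4, Pi.zero_apply]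
      noncomm_ring
    have : AA κ g' (fun j k => μ j k + t * η j k) U j
        = (G j).val * (A j + dW κ g η j x) * ((G j)⁻¹).val := by
      rw [← hW]
      simp only [AA, g', Units.val_mul, _root_.mul_inv_rev, mul_assoc]
    rw [this, Units.mul_inv_eq_iff_eq_mul, hG]
    have h0 := e1 j
    rw [← sub_eq_zero, ← neg_eq_zero, ← h0]
    noncomm_ring
  have htr : ∑ j, (AA κ g' (fun j k => μ j k + t * η j k) U j).trace = 0 := by
    have h0 : ∀ j, (AA κ g' (fun j k => μ j k + t * η j k) U j).trace
      = ∑ i, μ j (κ j i) + t * ∑ i, η j (κ j i) := by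
      intro j
      have := trace_AA (κ := κ) (g := g') (μ := fun j k => μ j k + t * η j k) (U := U) 1 j
        (su_mask _ _) (by simp only [mul_one, Units.inv_mul]; exact Matrix.blockTriangular_one)
      rw [one_mul] at this
      rw [this]
      simp [Finset.sum_add_distrib, Finset.mul_sum]
    have h00 : ∀ j, (AA κ g μ 0 j).trace = ∑ i, μ j (κ j i) := by
      intro j
      have := trace_AA (κ := κ) (g := g) (μ := μ) (U := 0) 1 j
        (fun _ _ _ => rfl) (by simp only [mul_one, Units.inv_mul]; exact Matrix.blockTriangular_one)
      rw [one_mul] at this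
      rw [this]
      simp
    simp_rw [h0]
    rw [Finset.sum_add_distrib, ← Finset.mul_sum, hη, mul_zero, add_zero]
    simp_rw [← h00]
    rw [← Matrix.trace_sum, hS.2.1, Matrix.trace_zero]
  have hsum : ∑ j, AA κ g' (fun j k => μ j k + t * η j k) U j = x.2.2.2.1 • 1 := by
    simp_rw [key]
    rw [Finset.sum_add_distrib]
    have : ∑ j, A j = 0 := hS.2.1
    rw [this, zero_add]
    exact sub_eq_zero.1 e2
  have hs1 : x.2.2.2.1 = 0 := by
    have := congrArg Matrix.trace hsum
    rw [Matrix.trace_sum, htr, Matrix.trace_smul, Matrix.trace_one, smul_eq_mul] at this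
    rcases mul_eq_zero.1 this.symm with h4 | h4
    · exact h4
    · simp at h4
  refine ⟨g', U, ?_, fun j => su_mask _ _, by rw [hsum, hs1, zero_smul], ?_⟩
  · have : (G h).val = 1 := by rw [hG]; simp [dX]
    simp only [g']
    rw [Units.val_eq_one.1 this, one_mul]
  · simp_rw [key, mul_add, Matrix.trace_add, mul_add]
    rw [Finset.sum_add_distrib]
    have h3 := hS.2.2
    have h3' : ∑ j, b j * (E * A j).trace = 0 := h3
    rw [h3', zero_add]
    by_cases hE0 : E = 0
    · simp [hE0]
    · simpa [ep, hE0] using e3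
end deform
end DSP

namespace DSP

section avoid
variable {Λ : Type*} [Fintype Λ] {J : Type*} [Fintype J]

/-- pairing -/
def pr (μ w : J → Λ → ℂ) : ℂ := ∑ j, ∑ k, μ j k * w j k

/-- cast of a type vector -/
def cv (m : J → Λ → ℕ) : J → Λ → ℂ := fun j k => (m j k : ℂ)

/-- pairing as a functional of the first variable -/
def prL (w : J → Λ → ℂ) : (J → Λ → ℂ) →ₗ[ℂ] ℂ where
  toFun μ := pr μ w
  map_add' x y := by simp [pr, add_mul, Finset.sum_add_distrib]
  map_smul' c x := by simp [pr, mul_assoc, Finset.mul_sum]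

theorem pr_comm (μ w : J → Λ → ℂ) : pr μ w = pr w μ := by
  simp [pr, mul_comm]

theorem pr_add (μ w w' : J → Λ → ℂ) : pr μ (w + w') = pr μ w + pr μ w' := by
  simp [pr, mul_add, Finset.sum_add_distrib]

theorem pr_sub (μ w w' : J → Λ → ℂ) : pr μ (w - w') = pr μ w - pr μ w' := by
  simp [pr, mul_sub, Finset.sum_sub_distrib]

theorem pr_smul (μ w : J → Λ → ℂ) (c : ℂ) : pr μ (c • w) = c * pr μ w := by
  simp only [pr, Finset.mul_sum, Pi.smul_apply, smul_eq_mul]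
  exact Finset.sum_congr rfl fun j _ => Finset.sum_congr rfl fun k _ => by ring

theorem pr_single (μ : J → Λ → ℂ) (j : J) (k : Λ) : pr μ (Pi.single j (Pi.single k 1)) = μ j k := by
  unfold pr
  rw [Finset.sum_eq_single j]
  · simp [Pi.single_apply]
  · intro i _ hi; simp [Pi.single_eq_of_ne hi]
  · simp

theorem exists_pr_repr (f : (J → Λ → ℂ) →ₗ[ℂ] ℂ) : ∃ x, ∀ w, f w = pr x w := by
  refine ⟨fun j k => f (Pi.single j (Pi.single k 1)), fun w => ?_⟩
  have : w = ∑ j, ∑ k, w j k • (Pi.single j (Pi.single k 1) : J → Λ → ℂ) := by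
    ext j k
    simp [Finset.sum_apply, Pi.single_apply, Finset.sum_ite_eq, apply_ite, ite_apply]
  conv_lhs => rw [this]
  simp [pr, mul_comm]

theorem avoid {I : Type*} [Finite I] (C : Submodule ℂ (J → Λ → ℂ)) (v : I → J → Λ → ℂ)
    (hv : ∀ i, v i ∉ C) (μ0 : J → Λ → ℂ) (S : Set ℂ) (hS : S.Countable) :
    ∃ μ, (∀ c ∈ C, pr μ c = pr μ0 c) ∧ ∀ i, pr μ (v i) ∉ S := by
  let K : Submodule ℂ (J → Λ → ℂ) := ⨅ c ∈ C, LinearMap.ker (prL c)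
  have hK : ∀ x, x ∈ K ↔ ∀ c ∈ C, pr x c = 0 := by
    intro x; simp only [K, Submodule.mem_iInf, LinearMap.mem_ker]; exact Iff.rfl
  obtain ⟨ν, hνK, hν⟩ := Module.Dual.exists_forall_mem_ne_zero_of_forall_exists K
    (fun i => prL (v i)) (by
      intro i
      obtain ⟨f, hf, hfC⟩ := Submodule.exists_le_ker_of_notMem (hv i)
      obtain ⟨x, hx⟩ := exists_pr_repr f
      refine ⟨x, (hK x).2 fun c hc => ?_, ?_⟩
      · rw [← hx]; exact hfC hc
      · change pr x (v i) ≠ 0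
        rw [← hx]; exact hf)
  have hcount : (⋃ i, (fun t : ℂ => pr μ0 (v i) + t * pr ν (v i)) ⁻¹' S).Countable := by
    refine Set.countable_iUnion fun i => hS.preimage_of_injOn ?_
    intro t _ t' _ h
    have hne : pr ν (v i) ≠ 0 := hν i
    simpa [hne] using h
  obtain ⟨t, ht⟩ : ∃ t, t ∉ ⋃ i, (fun t : ℂ => pr μ0 (v i) + t * pr ν (v i)) ⁻¹' S := by
    by_contra hcon
    push Not at hcon
    exact not_countable_complex ((Set.eq_univ_of_forall hcon) ▸ hcount)
  have e : ∀ w, pr (μ0 + t • ν) w = pr μ0 w + t * pr ν w := by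
    intro w; rw [pr_comm, pr_add, pr_smul, pr_comm, pr_comm w]
  refine ⟨μ0 + t • ν, fun c hc => ?_, fun i => ?_⟩
  · rw [e, (hK ν).1 hνK c hc, mul_zero, add_zero]
  · rw [e]
    intro h
    exact ht (Set.mem_iUnion.2 ⟨i, h⟩)

end avoid

section robust
variable {ι : Type*} [Fintype ι] [DecidableEq ι] {Λ : Type*} [LinearOrder Λ] [Fintype Λ]
  {J : Type*} [Fintype J]

/-- label counts of a family of subsets -/
def cnt (κ : J → ι → Λ) (S : J → Finset ι) : J → Λ → ℕ :=
  fun j k => ((S j).filter fun i => κ j i = k).card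

theorem pr_cnt (κ : J → ι → Λ) (S : J → Finset ι) (μ : J → Λ → ℂ) :
    ∑ j, ∑ i ∈ S j, μ j (κ j i) = pr μ (cv (cnt κ S)) := by
  unfold pr
  refine Finset.sum_congr rfl fun j _ => ?_
  rw [← Finset.sum_fiberwise_of_maps_to (g := κ j) (t := Finset.univ) (by simp)]
  refine Finset.sum_congr rfl fun k _ => ?_
  rw [Finset.sum_congr rfl (g := fun _ => μ j k)
    (fun i hi => by rw [(Finset.mem_filter.1 hi).2])]
  simp [cv, cnt, mul_comm]

theorem sum_cnt (κ : J → ι → Λ) (S : J → Finset ι) (j : J) : ∑ k, cnt κ S j k = (S j).card := by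
  simp only [cnt]
  rw [← Finset.card_eq_sum_card_fiberwise (by simp)]

theorem cnt_le (κ : J → ι → Λ) (S : J → Finset ι) (j : J) (k : Λ) :
    cnt κ S j k ≤ cnt κ (fun _ => Finset.univ) j k :=
  Finset.card_le_card (Finset.filter_subset_filter _ (Finset.subset_univ _))

/-- no proper sub-vector is proportional to the type -/
theorem not_prop {m v : J → Λ → ℕ} {n r : ℕ} (hm : ∀ j, ∑ k, m j k = n) (hv : ∀ j, ∑ k, v j k = r)
    (hr : 0 < r) (hrn : r < n) (j0 : J) (h2 : ∀ k, m j0 k ≤ 2) (hodd : ∃ j k, Odd (m j k)) (s : ℂ) :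
    cv v ≠ s • cv m := by
  intro h
  have he : ∀ j k, (v j k : ℂ) = s * m j k := fun j k => congrFun (congrFun h j) k
  have hs : (r : ℂ) = s * n := by
    rw [← hv j0, ← hm j0]; push_cast; rw [Finset.mul_sum]
    exact Finset.sum_congr rfl fun k _ => he j0 k
  have hn0 : (n : ℂ) ≠ 0 := by norm_cast; omega
  have hcross : ∀ j k, n * v j k = r * m j k := by
    intro j k
    have : (n : ℂ) * v j k = r * m j k := by rw [he, hs]; ring
    exact_mod_cast this
  obtain ⟨k, hk⟩ : ∃ k, m j0 k ≠ 0 := by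
    by_contra hcon
    push Not at hcon
    have := hm j0
    simp [hcon] at this
    omega
  have hk2 := h2 k
  have hc := hcross j0 k
  have hk' : m j0 k = 1 ∨ m j0 k = 2 := by omega
  rcases hk' with hk' | hk'
  · rw [hk', mul_one] at hc
    have : v j0 k = 0 ∨ 1 ≤ v j0 k := by omega
    rcases this with h0 | h0
    · rw [h0] at hc; omega
    · nlinarith
  · rw [hk'] at hc
    have h1 : v j0 k = 1 := by
      have h3 : v j0 k ≠ 0 := by intro h0; rw [h0] at hc; omega
      have h4 : v j0 k < 2 := by
        by_contra hcon
        push Not at hcon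
        nlinarith
      omega
    rw [h1] at hc
    obtain ⟨j, k', ho⟩ := hodd
    have := hcross j k'
    have h5 : 2 * v j k' = m j k' := by
      have hr' : n = 2 * r := by omega
      rw [hr'] at this
      have : r * (2 * v j k') = r * m j k' := by rw [← this]; ring
      exact Nat.eq_of_mul_eq_mul_left hr this
    rw [← h5] at ho
    exact (Nat.not_odd_iff_even.2 (even_two_mul _)) ho

theorem ECompat.congr {κ : J → ι → Λ} {g g' : J → (Matrix ι ι ℂ)ˣ} {b : J → ℂ} {E : Matrix ι ι ℂ}
    {h : J} (hE : ECompat κ g b E h) (hg : g' h = g h) : ECompat κ g' b E h where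
  bh := hE.bh
  sq := hE.sq
  tr := hE.tr
  left := by rw [hg]; exact hE.left
  right := by rw [hg]; exact hE.right

theorem robust [Nonempty ι] {κ : J → ι → Λ} {g : J → (Matrix ι ι ℂ)ˣ} {b : J → ℂ}
    {E : Matrix ι ι ℂ} {h : J} {μ : J → Λ → ℂ} (hE : ECompat κ g b E h)
    (hS : Sol κ g b E μ 0) (hbr : CBrick κ g b E h (AA κ g μ 0))
    (j0 : J) (h2 : ∀ k, cnt κ (fun _ => Finset.univ) j0 k ≤ 2)
    (hodd : ∃ j k, Odd (cnt κ (fun _ => Finset.univ) j k)) :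
    ∃ g' : J → (Matrix ι ι ℂ)ˣ, g' h = g h ∧ ∀ μ' : J → Λ → ℂ, ∑ j, ∑ i, μ' j (κ j i) = 0 →
      ∃ U, Sol κ g' b E μ' U := by
  let I := {S : J → Finset ι // ∃ r, (∀ j, (S j).card = r) ∧ 0 < r ∧ r < Fintype.card ι}
  let m := cnt κ (fun _ => Finset.univ)
  obtain ⟨η, hη, hηI⟩ := avoid (I := I) (Submodule.span ℂ {cv m}) (fun S => cv (cnt κ S.1)) (by
    rintro ⟨S, r, hS, hr, hrn⟩ hmem
    obtain ⟨s, hs⟩ := Submodule.mem_span_singleton.1 hmem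
    refine not_prop (m := m) (v := cnt κ S) (n := Fintype.card ι) (r := r) ?_ ?_ hr hrn j0 h2 hodd s
      hs.symm
    · intro j; rw [sum_cnt]; rfl
    · intro j; rw [sum_cnt, hS]) 0 {0} (Set.countable_singleton 0)
  have hη0 : ∑ j, ∑ i, η j (κ j i) = 0 := by
    rw [pr_cnt κ (fun _ => Finset.univ) η, hη _ (Submodule.mem_span_singleton_self _)]
    simp [pr]
  have h1 := deform hE.bh hS hbr η hη0
  have h3 : ∀ S : I, ∀ᶠ t in nhdsWithin (0 : ℂ) {0}ᶜ,
      pr μ (cv (cnt κ S.1)) + t * pr η (cv (cnt κ S.1)) ≠ 0 := by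
    intro S
    have hne : pr η (cv (cnt κ S.1)) ≠ 0 := hηI S
    have : ∀ᶠ t in nhdsWithin (0 : ℂ) {0}ᶜ,
      t ≠ - pr μ (cv (cnt κ S.1)) / pr η (cv (cnt κ S.1)) := by
      by_cases h0 : - pr μ (cv (cnt κ S.1)) / pr η (cv (cnt κ S.1)) = 0
      · rw [h0]; exact eventually_mem_nhdsWithin
      · exact (eventually_ne_nhds (Ne.symm h0)).filter_mono nhdsWithin_le_nhds
    filter_upwards [this] with t ht hcon
    apply ht
    field_simp
    linear_combination hcon
  have h4 := (h1.filter_mono (nhdsWithin_le_nhds (s := {0}ᶜ))).and (Filter.eventually_all.2 h3)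
  obtain ⟨t, ⟨g', U, hg', hSol⟩, ht⟩ := h4.exists
  refine ⟨g', hg', fun μ' hμ' => transfer (hE.congr hg') hSol ?_ μ' hμ'⟩
  intro S r hS hr hrn
  have := ht ⟨S, r, hS, hr, hrn⟩
  have e : ∑ j, ∑ i ∈ S j, ((fun k => μ j k + t * η j k) ∘ κ j) i
      = pr μ (cv (cnt κ S)) + t * pr η (cv (cnt κ S)) := by
    rw [← pr_cnt, ← pr_cnt, Finset.mul_sum, ← Finset.sum_add_distrib]
    simp [Finset.sum_add_distrib, Finset.mul_sum]
  rw [e]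
  exact this
end robust
end DSP

namespace DSP

section count

theorem exists_indep {V : Type*} [AddCommGroup V] [Module ℂ V] [FiniteDimensional ℂ V]
    (Z N : Submodule ℂ V) (t : ℕ) (h : Module.finrank ℂ N + t ≤ Module.finrank ℂ Z) :
    ∃ z : Fin t → V, (∀ a, z a ∈ Z) ∧ ∀ w : Fin t → ℂ, ∑ a, w a • z a ∈ N → w = 0 := by
  let f : Z →ₗ[ℂ] V ⧸ N := N.mkQ ∘ₗ Z.subtype
  have h1 : Module.finrank ℂ (LinearMap.ker f) ≤ Module.finrank ℂ N := by
    let i : LinearMap.ker f →ₗ[ℂ] N :=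
      LinearMap.codRestrict N (Z.subtype ∘ₗ (LinearMap.ker f).subtype) (by
        rintro ⟨x, hx⟩
        simpa [f] using hx)
    refine LinearMap.finrank_le_finrank_of_injective (f := i) ?_
    intro x y hxy
    have : (i x : V) = i y := by rw [hxy]
    exact Subtype.ext (Subtype.ext this)
  have h2 := LinearMap.finrank_range_add_finrank_ker f
  have h3 : t ≤ Module.finrank ℂ (LinearMap.range f) := by omega
  let B := Module.finBasis ℂ (LinearMap.range f)
  have hz : ∀ a : Fin t, ∃ z : Z, f z = (B (Fin.castLE h3 a) : V ⧸ N) := fun a =>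
    (B (Fin.castLE h3 a)).2
  choose z hz using hz
  refine ⟨fun a => z a, fun a => (z a).2, fun w hw => ?_⟩
  have h4 : ∑ a, w a • B (Fin.castLE h3 a) = 0 := by
    apply Subtype.ext
    rw [Submodule.coe_sum]
    simp only [Submodule.coe_smul, ← hz, Submodule.coe_zero]
    have : N.mkQ (∑ a, w a • (z a : V)) = 0 := by
      rw [Submodule.mkQ_apply]; exact (Submodule.Quotient.mk_eq_zero N).2 hw
    rw [map_sum] at this
    simp only [map_smul] at this
    exact this
  have hli : LinearIndependent ℂ fun a : Fin t => B (Fin.castLE h3 a) :=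
    B.linearIndependent.comp _ (Fin.castLE_injective h3)
  ext a
  exact Fintype.linearIndependent_iff.1 hli w h4 a

theorem ext_count {J : Type*} [Fintype J] {V : Type*} [AddCommGroup V] [Module ℂ V]
    [FiniteDimensional ℂ V] (R : J → V →ₗ[ℂ] V) (N : Submodule ℂ (J → V)) (t : ℕ)
    (h : Module.finrank ℂ V + Module.finrank ℂ N + t
      ≤ ∑ j, Module.finrank ℂ (LinearMap.range (R j))) :
    ∃ y : Fin t → J → V, (∀ a, ∑ j, R j (y a j) = 0) ∧
      ∀ w : Fin t → ℂ, (fun j => ∑ a, w a • R j (y a j)) ∈ N → w = 0 := by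
  let T : ((j : J) → LinearMap.range (R j)) →ₗ[ℂ] V :=
    ∑ j, (LinearMap.range (R j)).subtype ∘ₗ LinearMap.proj j
  let inc : ((j : J) → LinearMap.range (R j)) →ₗ[ℂ] (J → V) :=
    LinearMap.pi fun j => (LinearMap.range (R j)).subtype ∘ₗ LinearMap.proj j
  have hinc : Function.Injective inc := by
    intro x y hxy
    ext j
    exact congrFun hxy j
  have h1 := LinearMap.finrank_range_add_finrank_ker T
  rw [Module.finrank_pi_fintype] at h1
  have h2 : Module.finrank ℂ (LinearMap.range T) ≤ Module.finrank ℂ V := Submodule.finrank_le _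
  have h3 : Module.finrank ℂ ((LinearMap.ker T).map inc) = Module.finrank ℂ (LinearMap.ker T) :=
    ((Submodule.equivMapOfInjective inc hinc (LinearMap.ker T)).finrank_eq).symm
  obtain ⟨z, hz, hzN⟩ := exists_indep ((LinearMap.ker T).map inc) N t (by omega)
  have hz' : ∀ a, ∃ x : (j : J) → LinearMap.range (R j), T x = 0 ∧ inc x = z a := hz
  choose x hx hx2 using hz'
  have hy : ∀ a j, ∃ y, R j y = (x a j : V) := fun a j => (x a j).2
  choose y hy using hy
  refine ⟨y, fun a => ?_, fun w hw => hzN w ?_⟩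
  · have := hx a
    simp only [T, LinearMap.sum_apply, LinearMap.comp_apply, LinearMap.proj_apply,
      Submodule.subtype_apply] at this
    rw [← this]
    exact Finset.sum_congr rfl fun j _ => hy a j
  · convert hw using 1
    ext1 j
    simp only [Finset.sum_apply, Pi.smul_apply]
    refine Finset.sum_congr rfl fun a _ => ?_
    rw [hy, ← hx2]; rfl

variable {ι₁ ι₂ : Type*} [Fintype ι₁] [DecidableEq ι₁] [Fintype ι₂] [DecidableEq ι₂]

/-- `Y ↦ Y Q - P Y` -/
def adR (P : Matrix ι₁ ι₁ ℂ) (Q : Matrix ι₂ ι₂ ℂ) : Matrix ι₁ ι₂ ℂ →ₗ[ℂ] Matrix ι₁ ι₂ ℂ where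
  toFun Y := Y * Q - P * Y
  map_add' x y := by rw [Matrix.add_mul, Matrix.mul_add]; abel
  map_smul' c x := by simp [smul_sub]

theorem finrank_adR (g : (Matrix ι₁ ι₁ ℂ)ˣ) (g' : (Matrix ι₂ ι₂ ℂ)ˣ) (d : ι₁ → ℂ) (d' : ι₂ → ℂ) :
    Module.finrank ℂ (LinearMap.range (adR (g.val * diagonal d * (g⁻¹).val)
      (g'.val * diagonal d' * (g'⁻¹).val)))
      = (Finset.univ.filter fun p : ι₁ × ι₂ => d p.1 ≠ d' p.2).card := by
  let c : Matrix ι₁ ι₂ ℂ ≃ₗ[ℂ] (ι₁ × ι₂ → ℂ) :=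
      { toFun := fun Y p => ((g⁻¹).val * Y * g'.val) p.1 p.2
        map_add' := by intros; ext p; rw [Matrix.mul_add, Matrix.add_mul]; rfl
        map_smul' := by intros; ext p; simp
        invFun := fun f => g.val * (Matrix.of fun i i' => f (i, i')) * (g'⁻¹).val
        left_inv := by
          intro Y
          have : (Matrix.of fun i i' => ((g⁻¹).val * Y * g'.val) i i') = (g⁻¹).val * Y * g'.val := rfl
          simp only [this]
          rw [← Matrix.mul_assoc, ← Matrix.mul_assoc, Units.mul_inv, Matrix.one_mul, Matrix.mul_assoc,
            Units.mul_inv, Matrix.mul_one]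
        right_inv := by
          intro f
          ext p
          change ((g⁻¹).val * (g.val * (Matrix.of fun i i' => f (i, i')) * (g'⁻¹).val) * g'.val) p.1 p.2 = f p
          rw [← Matrix.mul_assoc, ← Matrix.mul_assoc, Units.inv_mul, Matrix.one_mul, Matrix.mul_assoc,
            Units.inv_mul, Matrix.mul_one]
          rfl }
  let w : ι₁ × ι₂ → ℂ := fun p => d' p.2 - d p.1
  have hcomm : c.toLinearMap ∘ₗ adR (g.val * diagonal d * (g⁻¹).val) (g'.val * diagonal d' * (g'⁻¹).val)
      = (diagonal w).mulVecLin ∘ₗ c.toLinearMap := by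
    refine LinearMap.ext fun Y => ?_
    ext p
    have e : (g⁻¹).val * (Y * (g'.val * diagonal d' * (g'⁻¹).val) - g.val * diagonal d * (g⁻¹).val * Y)
        * g'.val = ((g⁻¹).val * Y * g'.val) * diagonal d' - diagonal d * ((g⁻¹).val * Y * g'.val) := by
      rw [Matrix.mul_sub, Matrix.sub_mul]
      simp only [Matrix.mul_assoc, Units.inv_mul, Matrix.mul_one]
      rw [← Matrix.mul_assoc ((g⁻¹).val) g.val, Units.inv_mul, Matrix.one_mul]
    have : (c.toLinearMap ∘ₗ adR (g.val * diagonal d * (g⁻¹).val) (g'.val * diagonal d' * (g'⁻¹).val)) Y p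
      = ((g⁻¹).val * (Y * (g'.val * diagonal d' * (g'⁻¹).val) - g.val * diagonal d * (g⁻¹).val * Y)
        * g'.val) p.1 p.2 := rfl
    rw [this, e, Matrix.sub_apply, Matrix.mul_diagonal, Matrix.diagonal_mul]
    simp only [LinearMap.comp_apply, Matrix.mulVecLin_apply, Matrix.mulVec_diagonal]
    change _ = (d' p.2 - d p.1) * ((g⁻¹).val * Y * g'.val) p.1 p.2
    ring
  have h1 : Module.finrank ℂ (LinearMap.range (c.toLinearMap ∘ₗ
      adR (g.val * diagonal d * (g⁻¹).val) (g'.val * diagonal d' * (g'⁻¹).val)))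
      = (diagonal w).rank := by
    rw [hcomm, LinearMap.range_comp, LinearEquiv.range, Submodule.map_top]; rfl
  rw [LinearMap.range_comp, LinearEquiv.finrank_map_eq, Matrix.rank_diagonal] at h1
  rw [h1, Fintype.card_subtype]
  congr 1
  ext p
  simp [w, sub_ne_zero, ne_comm]
end count

theorem extend_sum {J : Type*} [Fintype J] {α β : Type*} [Fintype α] [Fintype β] (h : J) (X : Matrix α β ℂ)
    (A : J → Matrix α α ℂ) (B : J → Matrix β β ℂ) (hA : ∑ j, A j = 0) (hB : ∑ j, B j = 0)
    (hXB : ∀ j, j ≠ h → X * B j = A j * X) (j : J) : X * B j = A j * X := by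
  by_cases hj : j = h
  · subst hj
    rw [← Finset.add_sum_erase _ _ (Finset.mem_univ j)] at hA hB
    rw [eq_neg_of_add_eq_zero_left hA, eq_neg_of_add_eq_zero_left hB, Matrix.mul_neg, Matrix.neg_mul,
      Matrix.mul_sum, Matrix.sum_mul]
    congr 1
    exact Finset.sum_congr rfl fun i hi => hXB i (Finset.ne_of_mem_erase hi)
  · exact hXB j hj

section ext
variable {ι₁ ι₂ : Type*} [Fintype ι₁] [DecidableEq ι₁] [Fintype ι₂] [DecidableEq ι₂]
  {Λ : Type*} [LinearOrder Λ] {J : Type*} [Fintype J]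

/-- block frame -/
def bg (g₁ : J → (Matrix ι₁ ι₁ ℂ)ˣ) (g₂ : J → (Matrix ι₂ ι₂ ℂ)ˣ) (Y : J → Matrix ι₁ ι₂ ℂ) (j : J) :
    (Matrix (ι₁ ⊕ ι₂) (ι₁ ⊕ ι₂) ℂ)ˣ where
  val := fromBlocks (g₁ j).val (Y j * (g₂ j).val) 0 (g₂ j).val
  inv := fromBlocks ((g₁ j)⁻¹).val (-(((g₁ j)⁻¹).val * Y j)) 0 ((g₂ j)⁻¹).val
  val_inv := by
    simp [Matrix.fromBlocks_multiply, ← Matrix.mul_assoc, Matrix.mul_assoc (Y j)]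
  inv_val := by
    simp [Matrix.fromBlocks_multiply, Matrix.mul_assoc]

theorem AA_bg (κ₁ : J → ι₁ → Λ) (κ₂ : J → ι₂ → Λ) (g₁ : J → (Matrix ι₁ ι₁ ℂ)ˣ)
    (g₂ : J → (Matrix ι₂ ι₂ ℂ)ˣ) (Y : J → Matrix ι₁ ι₂ ℂ) (μ : J → Λ → ℂ) (j : J) :
    AA (fun j => Sum.elim (κ₁ j) (κ₂ j)) (bg g₁ g₂ Y) μ 0 j
      = fromBlocks (AA κ₁ g₁ μ 0 j) (adR (AA κ₁ g₁ μ 0 j) (AA κ₂ g₂ μ 0 j) (Y j)) 0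
        (AA κ₂ g₂ μ 0 j) := by
  have : diagonal (μ j ∘ Sum.elim (κ₁ j) (κ₂ j))
      = fromBlocks (diagonal (μ j ∘ κ₁ j)) 0 0 (diagonal (μ j ∘ κ₂ j)) := by
    rw [Matrix.fromBlocks_diagonal, Sum.comp_elim]
  simp only [AA, this, Pi.zero_apply, add_zero]
  change fromBlocks (g₁ j).val (Y j * (g₂ j).val) 0 (g₂ j).val * _ *
    fromBlocks ((g₁ j)⁻¹).val (-(((g₁ j)⁻¹).val * Y j)) 0 ((g₂ j)⁻¹).val = _
  simp only [Matrix.fromBlocks_multiply, adR, LinearMap.coe_mk, AddHom.coe_mk]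
  congr 1
  · simp
  · simp only [Matrix.mul_zero, Matrix.zero_mul, add_zero, zero_add, Matrix.mul_neg, Matrix.mul_assoc]
    abel
  · simp
  · simp

theorem cbrick_bg (κ₁ : J → ι₁ → Λ) (κ₂ : J → ι₂ → Λ) (g₁ : J → (Matrix ι₁ ι₁ ℂ)ˣ)
    (g₂ : J → (Matrix ι₂ ι₂ ℂ)ˣ) (Y : J → Matrix ι₁ ι₂ ℂ) (μ : J → Λ → ℂ) (h : J) (b : J → ℂ)
    (E : Matrix ι₁ ι₂ ℂ)
    (hP : ∑ j, AA κ₁ g₁ μ 0 j = 0) (hQ : ∑ j, AA κ₂ g₂ μ 0 j = 0)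
    (H21 : ∀ X : Matrix ι₂ ι₁ ℂ, (∀ j, AA κ₂ g₂ μ 0 j * X = X * AA κ₁ g₁ μ 0 j) → X = 0)
    (H : ∀ (θ₁ : Matrix ι₁ ι₁ ℂ) (θ₂ : Matrix ι₂ ι₂ ℂ) (x : Matrix ι₁ ι₂ ℂ) (c : ℂ),
      (∀ j, θ₁ * AA κ₁ g₁ μ 0 j = AA κ₁ g₁ μ 0 j * θ₁) →
      (∀ j, θ₂ * AA κ₂ g₂ μ 0 j = AA κ₂ g₂ μ 0 j * θ₂) →
      (∀ j, j ≠ h → θ₁ * adR (AA κ₁ g₁ μ 0 j) (AA κ₂ g₂ μ 0 j) (Y j)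
        - adR (AA κ₁ g₁ μ 0 j) (AA κ₂ g₂ μ 0 j) (Y j) * θ₂
        + adR (AA κ₁ g₁ μ 0 j) (AA κ₂ g₂ μ 0 j) (x + (c * b j) • E) = 0) →
      ∃ s : ℂ, θ₁ = s • 1 ∧ θ₂ = s • 1 ∧ x = 0 ∧ c • E = 0) :
    CBrick (fun j => Sum.elim (κ₁ j) (κ₂ j)) (bg g₁ g₂ Y) b (fromBlocks 0 E 0 0) h
      (AA (fun j => Sum.elim (κ₁ j) (κ₂ j)) (bg g₁ g₂ Y) μ 0) := by
  intro θ c _ hc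
  simp only [AA_bg] at hc
  set P := AA κ₁ g₁ μ 0
  set Q := AA κ₂ g₂ μ 0
  set ξ := fun j => adR (P j) (Q j) (Y j) with hξ
  obtain ⟨θ₁, x, z, θ₂, rfl⟩ : ∃ a b c d, θ = fromBlocks a b c d :=
    ⟨_, _, _, _, (Matrix.fromBlocks_toBlocks θ).symm⟩
  simp only [Matrix.fromBlocks_smul, Matrix.fromBlocks_add, Matrix.fromBlocks_multiply,
    Matrix.fromBlocks_inj, smul_zero, add_zero, Matrix.mul_zero, Matrix.zero_mul, zero_add] at hc
  have hz : z = 0 := H21 z fun j => (extend_sum h z Q P hQ hP (fun j hj => (hc j hj).2.2.1) j).symm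
  subst hz
  simp only [Matrix.mul_zero, Matrix.zero_mul, zero_add, add_zero] at hc
  obtain ⟨s, h1, h2, h3, h4⟩ := H θ₁ θ₂ x c
    (extend_sum h θ₁ P P hP hP (fun j hj => (hc j hj).1))
    (extend_sum h θ₂ Q Q hQ hQ (fun j hj => (hc j hj).2.2.2)) (by
      intro j hj
      have := (hc j hj).2.1
      have e : adR (P j) (Q j) (x + (c * b j) • E)
        = (x + (c * b j) • E) * Q j - P j * (x + (c * b j) • E) := rfl
      rw [e, ← sub_eq_zero.2 this]
      abel)
  refine ⟨⟨s, ?_⟩, ?_⟩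
  · rw [h1, h2, h3, ← Matrix.fromBlocks_one, Matrix.fromBlocks_smul]; simp
  · rw [Matrix.fromBlocks_smul, h4]; simp

theorem sol_bg (κ₁ : J → ι₁ → Λ) (κ₂ : J → ι₂ → Λ) (g₁ : J → (Matrix ι₁ ι₁ ℂ)ˣ)
    (g₂ : J → (Matrix ι₂ ι₂ ℂ)ˣ) (Y : J → Matrix ι₁ ι₂ ℂ) (μ : J → Λ → ℂ) (b : J → ℂ)
    (E : Matrix ι₁ ι₂ ℂ)
    (hP : ∑ j, AA κ₁ g₁ μ 0 j = 0) (hQ : ∑ j, AA κ₂ g₂ μ 0 j = 0)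
    (hY : ∑ j, adR (AA κ₁ g₁ μ 0 j) (AA κ₂ g₂ μ 0 j) (Y j) = 0) :
    Sol (fun j => Sum.elim (κ₁ j) (κ₂ j)) (bg g₁ g₂ Y) b (fromBlocks 0 E 0 0) μ 0 := by
  refine ⟨fun _ _ _ _ => rfl, ?_, ?_⟩
  · simp only [AA_bg]
    have : ∀ (A : J → Matrix ι₁ ι₁ ℂ) (B : J → Matrix ι₁ ι₂ ℂ) (D : J → Matrix ι₂ ι₂ ℂ) (s : Finset J),
      ∑ j ∈ s, fromBlocks (A j) (B j) 0 (D j) = fromBlocks (∑ j ∈ s, A j) (∑ j ∈ s, B j) 0 (∑ j ∈ s, D j) := by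
      intro A B D s
      induction s using Finset.induction_on with
      | empty => simp
      | insert a s ha ih => rw [Finset.sum_insert ha, Finset.sum_insert ha, Finset.sum_insert ha,
          Finset.sum_insert ha, ih, Matrix.fromBlocks_add, add_zero]
    rw [this, hP, hQ, hY]; simp
  · refine Finset.sum_eq_zero fun j _ => ?_
    rw [AA_bg, Matrix.fromBlocks_multiply]
    simp [Matrix.trace, Fintype.sum_sum_type]

theorem ecompat_zero {ι : Type*} [Fintype ι] [DecidableEq ι] (κ : J → ι → Λ) (g : J → (Matrix ι ι ℂ)ˣ)
    (h : J) : ECompat κ g 0 0 h where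
  bh := rfl
  sq := by simp
  tr := by simp
  left := fun θ _ => ⟨0, by simp⟩
  right := fun θ _ => ⟨0, by simp⟩

theorem ecompat_single {ι : Type*} [Fintype ι] [DecidableEq ι] (κ : J → ι → Λ)
    (g : J → (Matrix ι ι ℂ)ˣ) (b : J → ℂ) (h : J) (bh : b h = 0) (i0 i1 : ι) (hne : i0 ≠ i1)
    (hmin : ∀ i, i ≠ i0 → κ h i0 < κ h i) (hmax : ∀ i, i ≠ i1 → κ h i < κ h i1) :
    ECompat κ g b ((g h).val * Matrix.single i0 i1 1 * ((g h)⁻¹).val) h where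
  bh := bh
  sq := by
    simp only [mul_assoc, Units.inv_mul_cancel_left]
    rw [← mul_assoc (Matrix.single i0 i1 1) (Matrix.single i0 i1 1)]
    rw [Matrix.single_mul_single_of_ne (h := hne.symm)]
    simp
  tr := by
    rw [Matrix.trace_mul_comm, ← mul_assoc, Units.inv_mul, one_mul]
    exact Matrix.trace_single_eq_of_ne _ _ _ hne
  left := by
    intro θ hθ
    set y := ((g h)⁻¹).val * θ * (g h).val with hy
    have e : y * Matrix.single i0 i1 (1 : ℂ) = y i0 i0 • Matrix.single i0 i1 1 := by
      ext i i'
      rw [Matrix.smul_apply, Matrix.mul_apply, Finset.sum_eq_single i0]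
      · simp only [Matrix.single_apply, true_and, smul_eq_mul]
        by_cases hi : i = i0
        · subst hi; simp
        · rw [hθ (hmin i hi)]; simp [Ne.symm hi]
      · intro l _ hl; simp [Matrix.single_apply, Ne.symm hl]
      · simp
    refine ⟨y i0 i0, ?_⟩
    have e2 : θ * ((g h).val * Matrix.single i0 i1 1 * ((g h)⁻¹).val)
      = (g h).val * (y * Matrix.single i0 i1 1) * ((g h)⁻¹).val := by
      rw [hy]; simp only [mul_assoc, Units.mul_inv_cancel_left]
    rw [e2, e, Matrix.mul_smul, Matrix.smul_mul]
  right := by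
    intro θ hθ
    set y := ((g h)⁻¹).val * θ * (g h).val with hy
    have e : Matrix.single i0 i1 (1 : ℂ) * y = y i1 i1 • Matrix.single i0 i1 1 := by
      ext i i'
      rw [Matrix.smul_apply, Matrix.mul_apply, Finset.sum_eq_single i1]
      · simp only [Matrix.single_apply, and_true, smul_eq_mul]
        by_cases hi : i' = i1
        · subst hi; simp
        · rw [hθ (hmax i' hi)]; simp [Ne.symm hi]
      · intro l _ hl; simp [Matrix.single_apply, Ne.symm hl]
      · simp
    refine ⟨y i1 i1, ?_⟩
    have e2 : ((g h).val * Matrix.single i0 i1 1 * ((g h)⁻¹).val) * θ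
      = (g h).val * (Matrix.single i0 i1 1 * y) * ((g h)⁻¹).val := by
      rw [hy]; simp only [mul_assoc, Units.mul_inv, mul_one]
    rw [e2, e, Matrix.mul_smul, Matrix.smul_mul]
end ext
end DSP

namespace DSP

section lines
variable {ι : Type*} [Fintype ι] [DecidableEq ι]
  {Λ : Type*} [LinearOrder Λ] {J : Type*} [Fintype J]

theorem AA_const {τ : Type*} [Fintype τ] [DecidableEq τ] (ε : J → Λ) (μ : J → Λ → ℂ) (j : J) :
    AA (fun j (_ : τ) => ε j) (fun _ => 1) μ 0 j = (μ j (ε j)) • (1 : Matrix τ τ ℂ) := by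
  have : (μ j ∘ fun (_ : τ) => ε j) = fun _ => μ j (ε j) := rfl
  simp [AA, this, Matrix.smul_one_eq_diagonal]

theorem left_zero {τ : Type*} [Fintype τ] (g : (Matrix ι ι ℂ)ˣ) (d : ι → ℂ) (χ : ℂ) (hχ : ∀ i, d i ≠ χ)
    (X : Matrix ι τ ℂ) (h : g.val * diagonal d * (g⁻¹).val * X = χ • X) : X = 0 := by
  have h1 : diagonal d * ((g⁻¹).val * X) = χ • ((g⁻¹).val * X) := by
    rw [← Matrix.mul_smul, ← h]
    simp only [Matrix.mul_assoc]
    rw [← Matrix.mul_assoc ((g⁻¹).val) g.val, Units.inv_mul, Matrix.one_mul]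
  have h2 : (g⁻¹).val * X = 0 := by
    ext i a
    have := congrFun (congrFun h1 i) a
    rw [Matrix.diagonal_mul, Matrix.smul_apply, smul_eq_mul] at this
    have h3 : (d i - χ) * ((g⁻¹).val * X) i a = 0 := by rw [sub_mul, this, sub_self]
    exact (mul_eq_zero.1 h3).resolve_left (sub_ne_zero.2 (hχ i))
  have : g.val * ((g⁻¹).val * X) = X := by rw [← Matrix.mul_assoc, Units.mul_inv, Matrix.one_mul]
  rw [← this, h2, Matrix.mul_zero]

theorem right_zero {τ : Type*} [Fintype τ] (g : (Matrix ι ι ℂ)ˣ) (d : ι → ℂ) (χ : ℂ) (hχ : ∀ i, d i ≠ χ)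
    (X : Matrix τ ι ℂ) (h : X * (g.val * diagonal d * (g⁻¹).val) = χ • X) : X = 0 := by
  have h1 : (X * g.val) * diagonal d = χ • (X * g.val) := by
    rw [← Matrix.smul_mul, ← h]
    simp only [Matrix.mul_assoc, Units.inv_mul, Matrix.mul_one]
  have h2 : X * g.val = 0 := by
    ext a i
    have := congrFun (congrFun h1 a) i
    rw [Matrix.mul_diagonal, Matrix.smul_apply, smul_eq_mul] at this
    have h3 : (d i - χ) * (X * g.val) a i = 0 := by rw [sub_mul, mul_comm (d i), this, sub_self]
    exact (mul_eq_zero.1 h3).resolve_left (sub_ne_zero.2 (hχ i))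
  have : X * g.val * (g⁻¹).val = X := by rw [Matrix.mul_assoc, Units.mul_inv, Matrix.mul_one]
  rw [← this, h2, Matrix.zero_mul]

theorem irr_unit (χ : J → ℂ) : Irr fun j => χ j • (1 : Matrix Unit Unit ℂ) := by
  intro V _
  have hV : Module.finrank ℂ V ≤ 1 := by
    have := Submodule.finrank_le V
    simpa using this
  rcases Nat.le_one_iff_eq_zero_or_eq_one.1 hV with h | h
  · left; exact Submodule.finrank_eq_zero.1 h
  · right; apply Submodule.eq_top_of_finrank_eq; simp [h]

theorem finrank_eq_of_bij {ι' : Type*} [Fintype ι'] (X : Matrix ι' ι ℂ) (h : Function.Bijective X.mulVec) :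
    Fintype.card ι = Fintype.card ι' := by
  have := (LinearEquiv.ofBijective X.mulVecLin h).finrank_eq
  simpa using this

theorem char_left {Q : J → Matrix ι ι ℂ} (hQ : Irr Q) (h2 : 2 ≤ Fintype.card ι) (χ : J → ℂ) {τ : Type*} [Fintype τ]
    (X : Matrix ι τ ℂ) (h : ∀ j, Q j * X = χ j • X) : X = 0 := by
  ext i a
  let x : Matrix ι Unit ℂ := Matrix.of fun i _ => X i a
  have hx : ∀ j, x * (χ j • (1 : Matrix Unit Unit ℂ)) = Q j * x := by
    intro j
    rw [Matrix.mul_smul, Matrix.mul_one]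
    ext i u
    have := congrFun (congrFun (h j) i) a
    exact this.symm
  have hU : Irr fun j => χ j • (1 : Matrix Unit Unit ℂ) := irr_unit _
  rcases Irr.schur_zero hU hQ x hx with h0 | h0
  · exact congrFun (congrFun h0 i) ()
  · have := finrank_eq_of_bij x h0
    simp at this; omega

theorem char_right {Q : J → Matrix ι ι ℂ} (hQ : Irr Q) (h2 : 2 ≤ Fintype.card ι) (χ : J → ℂ) {τ : Type*} [Fintype τ]
    (X : Matrix τ ι ℂ) (h : ∀ j, X * Q j = χ j • X) : X = 0 := by
  ext a i
  let x : Matrix Unit ι ℂ := Matrix.of fun _ i => X a i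
  have hx : ∀ j, x * Q j = (χ j • (1 : Matrix Unit Unit ℂ)) * x := by
    intro j
    rw [Matrix.smul_mul, Matrix.one_mul]
    ext u i
    have := congrFun (congrFun (h j) a) i
    exact this
  have hU : Irr fun j => χ j • (1 : Matrix Unit Unit ℂ) := irr_unit _
  rcases Irr.schur_zero hQ hU x hx with h0 | h0
  · exact congrFun (congrFun h0 ()) i
  · have := finrank_eq_of_bij x h0
    simp at this; omega

theorem lines [Nonempty ι] [Fintype Λ] (κ : J → ι → Λ) (g : J → (Matrix ι ι ℂ)ˣ) (μ : J → Λ → ℂ) (ε : J → Λ) (t : ℕ)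
    (hsum : ∑ j, AA κ g μ 0 j = 0) (hirr : Irr (AA κ g μ 0)) (hε : ∑ j, μ j (ε j) = 0) (j0 : J)
    (hj0 : (∃ j, ∀ i, μ j (κ j i) ≠ μ j (ε j)) ∨ 2 ≤ Fintype.card ι)
    (hcount : 2 * Fintype.card ι + t
      ≤ ∑ j, (Finset.univ.filter fun i => μ j (ε j) ≠ μ j (κ j i)).card)
    (j1 : J)
    (h2 : ∀ k, cnt (fun j => Sum.elim (fun _ : Fin t => ε j) (κ j)) (fun _ => Finset.univ) j1 k ≤ 2)
    (hodd : ∃ j k, Odd (cnt (fun j => Sum.elim (fun _ : Fin t => ε j) (κ j)) (fun _ => Finset.univ) j k)) :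
    ∃ g' : J → (Matrix (Fin t ⊕ ι) (Fin t ⊕ ι) ℂ)ˣ, ∀ μ' : J → Λ → ℂ,
      ∑ j, ∑ i, μ' j (Sum.elim (fun _ : Fin t => ε j) (κ j) i) = 0 →
      ∃ U, (∀ j, SU (Sum.elim (fun _ : Fin t => ε j) (κ j)) (U j)) ∧
        ∑ j, AA (fun j => Sum.elim (fun _ : Fin t => ε j) (κ j)) g' μ' U j = 0 := by
  set Q := AA κ g μ 0 with hQ
  have hQd : ∀ j, Q j = (g j).val * diagonal (μ j ∘ κ j) * ((g j)⁻¹).val := by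
    intro j; simp [hQ, AA]
  let R : J → Matrix Unit ι ℂ →ₗ[ℂ] Matrix Unit ι ℂ := fun j => adR ((μ j (ε j)) • 1) (Q j)
  have hR : ∀ j x, R j x = x * Q j - (μ j (ε j)) • x := by
    intro j x
    change x * Q j - (μ j (ε j)) • (1 : Matrix Unit Unit ℂ) * x = _
    simp
  let L : Matrix Unit ι ℂ →ₗ[ℂ] (J → Matrix Unit ι ℂ) := LinearMap.pi R
  have hV : Module.finrank ℂ (Matrix Unit ι ℂ) = Fintype.card ι := by
    rw [Module.finrank_matrix]; simp
  have hN : Module.finrank ℂ (LinearMap.range L) ≤ Fintype.card ι := by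
    rw [← hV]; exact LinearMap.finrank_range_le L
  have hRr : ∀ j, Module.finrank ℂ (LinearMap.range (R j))
      = (Finset.univ.filter fun i => μ j (ε j) ≠ μ j (κ j i)).card := by
    intro j
    have := finrank_adR (1 : (Matrix Unit Unit ℂ)ˣ) (g j) (fun _ => μ j (ε j)) (μ j ∘ κ j)
    have e1 : (1 : (Matrix Unit Unit ℂ)ˣ).val * diagonal (fun _ => μ j (ε j))
      * ((1 : (Matrix Unit Unit ℂ)ˣ)⁻¹).val = (μ j (ε j)) • 1 := by
      simp [Matrix.smul_one_eq_diagonal]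
    rw [e1, ← hQd] at this
    rw [this]
    refine Finset.card_bij (fun p _ => p.2) ?_ ?_ ?_
    · intro p hp; simpa using hp
    · intro p _ p' _ h; exact Prod.ext rfl h
    · intro i hi; exact ⟨((), i), by simpa using hi, rfl⟩
  obtain ⟨y, hy, hyN⟩ := ext_count R (LinearMap.range L) t (by
    rw [hV, Finset.sum_congr rfl fun j _ => hRr j]; omega)
  let Y : J → Matrix (Fin t) ι ℂ := fun j => Matrix.of fun a i => y a j () i
  let κ₁ : J → Fin t → Λ := fun j _ => ε j
  let g₁ : J → (Matrix (Fin t) (Fin t) ℂ)ˣ := fun _ => 1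
  have hP : ∀ j, AA κ₁ g₁ μ 0 j = (μ j (ε j)) • 1 := fun j => AA_const ε μ j
  have hPs : ∑ j, AA κ₁ g₁ μ 0 j = 0 := by
    simp only [hP, ← Finset.sum_smul, hε, zero_smul]
  have row : ∀ j (X : Matrix (Fin t) ι ℂ) a i, adR (AA κ₁ g₁ μ 0 j) (Q j) X a i
      = R j (Matrix.of fun _ i => X a i) () i := by
    intro j X a i
    rw [hR, hP]
    change (X * Q j - (μ j (ε j)) • (1 : Matrix (Fin t) (Fin t) ℂ) * X) a i = _
    simp [Matrix.mul_apply]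
  have hYs : ∑ j, adR (AA κ₁ g₁ μ 0 j) (Q j) (Y j) = 0 := by
    ext a i
    rw [Matrix.sum_apply]
    simp only [row]
    have := congrFun (congrFun (hy a) ()) i
    rw [Matrix.sum_apply] at this
    exact this
  have hsol := sol_bg κ₁ κ g₁ g Y μ 0 0 hPs hsum hYs
  rw [Matrix.fromBlocks_zero] at hsol
  have hbr := cbrick_bg κ₁ κ g₁ g Y μ j0 0 0 hPs hsum (by
      intro X hX
      have hX' : ∀ j, Q j * X = μ j (ε j) • X := by
        intro j
        have := hX j
        rw [hP, Matrix.mul_smul, Matrix.mul_one] at this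
        exact this
      rcases hj0 with ⟨j, hj⟩ | hj0
      · refine left_zero (g j) (μ j ∘ κ j) (μ j (ε j)) hj X ?_
        rw [← hQd]; exact hX' j
      · exact char_left hirr hj0 _ X hX') (by
      intro θ₁ θ₂ x c h1 h3 h4
      obtain ⟨s, hs⟩ := hirr.schur θ₂ h3
      have h5 : ∀ j, θ₁ * adR (AA κ₁ g₁ μ 0 j) (Q j) (Y j) - s • adR (AA κ₁ g₁ μ 0 j) (Q j) (Y j)
          + adR (AA κ₁ g₁ μ 0 j) (Q j) x = 0 := by
        have hne : ∀ j, j ≠ j0 → θ₁ * adR (AA κ₁ g₁ μ 0 j) (Q j) (Y j)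
            - s • adR (AA κ₁ g₁ μ 0 j) (Q j) (Y j) + adR (AA κ₁ g₁ μ 0 j) (Q j) x = 0 := by
          intro j hj
          have := h4 j hj
          rw [hs] at this
          simpa using this
        have htot : ∑ j, (θ₁ * adR (AA κ₁ g₁ μ 0 j) (Q j) (Y j)
            - s • adR (AA κ₁ g₁ μ 0 j) (Q j) (Y j) + adR (AA κ₁ g₁ μ 0 j) (Q j) x) = 0 := by
          rw [Finset.sum_add_distrib, Finset.sum_sub_distrib, ← Matrix.mul_sum, ← Finset.smul_sum, hYs]
          have : ∑ j, adR (AA κ₁ g₁ μ 0 j) (Q j) x = x * ∑ j, Q j - (∑ j, AA κ₁ g₁ μ 0 j) * x := by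
            rw [Matrix.mul_sum, Matrix.sum_mul, ← Finset.sum_sub_distrib]; rfl
          rw [this, hsum, hPs]; simp
        intro j
        by_cases hj : j = j0
        · subst hj
          rw [← Finset.add_sum_erase _ _ (Finset.mem_univ j),
            Finset.sum_eq_zero (fun i hi => hne i (Finset.ne_of_mem_erase hi)), add_zero] at htot
          exact htot
        · exact hne j hj
      have h6 : ∀ a a', θ₁ a a' = s * (1 : Matrix (Fin t) (Fin t) ℂ) a a' := by
        intro a
        have := hyN (fun a' => θ₁ a a' - s * (1 : Matrix (Fin t) (Fin t) ℂ) a a') (by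
          refine ⟨-(Matrix.of fun _ i => x a i), ?_⟩
          ext j u i
          have := congrFun (congrFun (h5 j) a) i
          rw [Matrix.add_apply, Matrix.sub_apply, Matrix.smul_apply, Matrix.mul_apply] at this
          simp only [row] at this
          change (R j (-(Matrix.of fun _ i => x a i))) u i = _
          rw [map_neg, Matrix.sum_apply, Matrix.neg_apply]
          simp only [Matrix.smul_apply, smul_eq_mul, sub_mul, Finset.sum_sub_distrib, Matrix.one_apply,
            mul_ite, mul_one, mul_zero, ite_mul, zero_mul, Finset.sum_ite_eq, Finset.mem_univ, if_true]
          have e : ∀ a', (Matrix.of fun (_ : Unit) i => Y j a' i) = y a' j := fun a' => rfl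
          simp only [e, smul_eq_mul] at this
          replace this := this.trans (show (0 : Matrix (Fin t) ι ℂ) a i = 0 from rfl)
          linear_combination -this)
        intro a'
        exact sub_eq_zero.1 (congrFun this a')
      have h7 : θ₁ = s • 1 := by ext a a'; rw [h6]; rfl
      refine ⟨s, h7, hs, ?_, by simp⟩
      have hx' : ∀ j, x * Q j = μ j (ε j) • x := by
        intro j
        have := h5 j
        rw [h7, Matrix.smul_mul, Matrix.one_mul, sub_self, zero_add, hP] at this
        have h8 : x * Q j - (μ j (ε j)) • (1 : Matrix (Fin t) (Fin t) ℂ) * x = 0 := this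
        rw [Matrix.smul_mul, Matrix.one_mul] at h8
        exact sub_eq_zero.1 h8
      rcases hj0 with ⟨j, hj⟩ | hj0
      · refine right_zero (g j) (μ j ∘ κ j) (μ j (ε j)) hj x ?_
        rw [← hQd]; exact hx' j
      · exact char_right hirr hj0 _ x hx')
  rw [Matrix.fromBlocks_zero] at hbr
  obtain ⟨g', -, hg'⟩ := robust (ecompat_zero _ _ j0) hsol hbr j1 h2 hodd
  refine ⟨g', fun μ' hμ' => ?_⟩
  obtain ⟨U, hU, hs, -⟩ := hg' μ' hμ'
  exact ⟨U, hU, hs⟩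
end lines
end DSP

namespace DSP

section numerics
variable {J : Type*} (J1 : Finset J) (n e s0 : ℤ) (M s D : J → ℤ)

theorem num_T1 (hn : 3 ≤ n) (he : 0 ≤ e) (hr : ∑ j ∈ J1, (n - M j) = n + e)
    (hM : ∀ j ∈ J1, M j ≤ n) (hM0 : ∀ j ∈ J1, 0 ≤ M j) (hs : ∀ j ∈ J1, M j ^ 2 ≤ s j)
    (hD : ∀ j ∈ J1, D j = 0 ∨ (D j = 1 ∧ 2 * M j ≤ n ∧ 2 * M j ^ 2 ≤ s j))
    (ha : 1 ≤ e ∨ (n ≤ s0 ∧ 2 * n ^ 2 - 2 ≤ (n ^ 2 - s0) + ∑ j ∈ J1, (n ^ 2 - s j))) :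
    ∑ j ∈ J1, D j ≤ e + 1 := by
  by_contra hcon
  push Not at hcon
  have h1 : ∀ j ∈ J1, n * D j ≤ 2 * (n - M j) := by
    intro j hj
    rcases hD j hj with h | ⟨h, h', _⟩ <;> rw [h]
    · linarith [hM j hj]
    · linarith
  have h2 := Finset.sum_le_sum h1
  rw [← Finset.mul_sum, ← Finset.mul_sum, hr] at h2
  have he0 : e = 0 := by nlinarith
  subst he0
  have hDs : ∑ j ∈ J1, D j = 2 := by nlinarith
  obtain ha | ⟨hs0, ha⟩ := ha
  · omega
  have h3 : ∀ j ∈ J1, n * D j = 2 * (n - M j) := by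
    refine (Finset.sum_eq_sum_iff_of_le h1).1 ?_
    rw [← Finset.mul_sum, ← Finset.mul_sum, hr, hDs]; ring
  have h4 : ∀ j ∈ J1, 2 * (n ^ 2 - s j) ≤ n ^ 2 * D j := by
    intro j hj
    have := h3 j hj
    rcases hD j hj with h | ⟨h, _, h'⟩ <;> rw [h] at this ⊢
    · have h5 : M j = n := by linarith
      have := hs j hj
      rw [h5] at this; linarith
    · have h5 : n = 2 * M j := by linarith
      rw [h5]; nlinarith
  have h5 := Finset.sum_le_sum h4
  rw [← Finset.mul_sum, ← Finset.mul_sum, hDs] at h5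
  linarith

theorem num_M2 (hn : 2 ≤ n) (hr : ∑ j ∈ J1, (n - M j) = n)
    (hM : ∀ j ∈ J1, M j ≤ n) (hM0 : ∀ j ∈ J1, 1 ≤ M j) (hs : ∀ j ∈ J1, M j ^ 2 ≤ s j)
    (hs' : ∀ j ∈ J1, n ≤ s j) (hs0 : n + 2 ≤ s0)
    (ha : 2 * n ^ 2 - 2 ≤ (n ^ 2 - s0) + ∑ j ∈ J1, (n ^ 2 - s j)) : ∀ j ∈ J1, 2 ≤ M j := by
  intro j hj
  by_contra hcon
  have hMj : M j = 1 := by have := hM0 j hj; omega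
  rw [← Finset.add_sum_erase _ _ hj] at hr ha
  have h1 : ∀ i ∈ J1.erase j, n ^ 2 - s i ≤ (2 * n - 1) * (n - M i) := by
    intro i hi
    have hi' := Finset.mem_of_mem_erase hi
    have := hs i hi'
    have h3 := hM i hi'
    have h4 := hM0 i hi'
    rcases eq_or_lt_of_le h3 with h | h
    · rw [h] at this ⊢; linarith
    · nlinarith
  have h2 := Finset.sum_le_sum h1
  rw [← Finset.mul_sum] at h2
  rw [hMj] at hr
  have h5 : ∑ i ∈ J1.erase j, (n - M i) = 1 := by linarith
  rw [h5] at h2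
  have := hs' j hj
  linarith

theorem num_T2 (hn : 4 ≤ n) (hr : ∑ j ∈ J1, (n - M j) = n)
    (hM : ∀ j ∈ J1, M j ≤ n) (hM0 : ∀ j ∈ J1, 0 ≤ M j) (hs : ∀ j ∈ J1, M j ^ 2 ≤ s j)
    (hD : ∀ j ∈ J1, D j = 0 ∨ (D j = 1 ∧ 2 * M j ≤ n + 1 ∧ M j ^ 2 + (M j - 1) ^ 2 ≤ s j)
      ∨ (D j = 2 ∧ 2 * M j ≤ n ∧ 2 * M j ^ 2 ≤ s j))
    (hs0 : n + 2 ≤ s0)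
    (ha : 2 * n ^ 2 - 2 ≤ (n ^ 2 - s0) + ∑ j ∈ J1, (n ^ 2 - s j)) :
    ∑ j ∈ J1, D j ≤ 2 := by
  by_contra hcon
  push Not at hcon
  set K := J1.filter fun j => D j ≠ 0 with hK
  have h1 : (n - 1) * K.card ≤ 2 * n := by
    have : ∑ j ∈ K, (n - 1) ≤ ∑ j ∈ J1, 2 * (n - M j) := by
      refine (Finset.sum_le_sum (g := fun j => 2 * (n - M j)) ?_).trans
        (Finset.sum_le_sum_of_subset_of_nonneg (Finset.filter_subset _ _) ?_)
      · intro j hj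
        rw [hK, Finset.mem_filter] at hj
        rcases hD j hj.1 with h | ⟨_, h, _⟩ | ⟨_, h, _⟩
        · exact absurd h hj.2
        · linarith
        · linarith
      · intro j hj _
        linarith [hM j hj]
    rw [Finset.sum_const, ← Finset.mul_sum, hr] at this
    simp only [nsmul_eq_mul] at this
    linarith
  have h2 : ∑ j ∈ K, D j = ∑ j ∈ J1, D j := Finset.sum_filter_ne_zero J1
  have h3 : ∑ j ∈ K, D j ≤ 2 * K.card := by
    have : ∑ j ∈ K, D j ≤ ∑ j ∈ K, 2 := by
      refine Finset.sum_le_sum fun j hj => ?_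
      rw [hK, Finset.mem_filter] at hj
      rcases hD j hj.1 with h | ⟨h, _⟩ | ⟨h, _⟩ <;> omega
    rw [Finset.sum_const] at this
    simpa [mul_comm] using this
  have hK2 : K.card = 2 := by
    have h4 : (2 : ℤ) ≤ K.card := by omega
    have h5 : (K.card : ℤ) < 3 := by nlinarith
    omega
  obtain ⟨x, y, hxy, hKe⟩ := Finset.card_eq_two.1 hK2
  have hx : x ∈ J1 ∧ D x ≠ 0 := by
    have : x ∈ K := by rw [hKe]; simp
    rw [hK, Finset.mem_filter] at this; exact this
  have hy : y ∈ J1 ∧ D y ≠ 0 := by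
    have : y ∈ K := by rw [hKe]; simp
    rw [hK, Finset.mem_filter] at this; exact this
  have hD2 : 3 ≤ D x + D y := by
    rw [hKe, Finset.sum_pair hxy] at h2; omega
  have hy' : y ∈ J1.erase x := Finset.mem_erase.2 ⟨hxy.symm, hy.1⟩
  rw [← Finset.add_sum_erase _ _ hx.1, ← Finset.add_sum_erase _ _ hy'] at hr ha
  have h6 : ∀ i ∈ (J1.erase x).erase y, n ^ 2 - s i ≤ (2 * n) * (n - M i) := by
    intro i hi
    have hi' := Finset.mem_of_mem_erase (Finset.mem_of_mem_erase hi)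
    nlinarith [hs i hi', hM i hi', hM0 i hi']
  have h7 := Finset.sum_le_sum h6
  rw [← Finset.mul_sum] at h7
  have h8 : 0 ≤ ∑ i ∈ (J1.erase x).erase y, (n - M i) :=
    Finset.sum_nonneg fun i hi => by
      have hi' := Finset.mem_of_mem_erase (Finset.mem_of_mem_erase hi)
      linarith [hM i hi']
  generalize ∑ i ∈ (J1.erase x).erase y, (n - M i) = R at *
  generalize ∑ i ∈ (J1.erase x).erase y, (n ^ 2 - s i) = R' at *
  have key : ∀ x y, D x = 2 → 2 * M x ≤ n → 2 * M x ^ 2 ≤ s x →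
     ((D y = 1 ∧ 2 * M y ≤ n + 1 ∧ M y ^ 2 + (M y - 1) ^ 2 ≤ s y)
      ∨ (D y = 2 ∧ 2 * M y ≤ n ∧ 2 * M y ^ 2 ≤ s y)) → n - M x + (n - M y + R) = n →
      2 * n ^ 2 - 2 ≤ n ^ 2 - s0 + (n ^ 2 - s x + (n ^ 2 - s y + R')) → False := by
    intro x y hDx hMx hsx hyy hr ha
    have hxy : M x + M y = n := by
      rcases hyy with ⟨_, h, _⟩ | ⟨_, h, _⟩ <;> omega
    have hR : R = 0 := by omega
    rw [hR, mul_zero] at h7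
    have hMy : M y = n - M x := by omega
    rw [hMy] at hyy
    have hc : n = 2 * M x ∨ n = 2 * M x + 1 := by
      rcases hyy with ⟨_, h, _⟩ | ⟨_, h, _⟩ <;> omega
    rcases hc with hc | hc <;> rw [hc] at hyy ha hs0 <;>
      rcases hyy with ⟨_, h, h'⟩ | ⟨_, h, h'⟩ <;> nlinarith
  rcases hD x hx.1 with h | ⟨h, hh⟩ | ⟨h, hh, hh'⟩
  · exact hx.2 h
  · rcases hD y hy.1 with h' | ⟨h', _⟩ | ⟨h', hh', hh''⟩
    · exact hy.2 h'
    · omega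
    · exact key y x h' hh' hh'' (Or.inl ⟨h, hh⟩) (by linarith) (by linarith)
  · refine key x y h hh hh' ?_ (by linarith) (by linarith)
    rcases hD y hy.1 with h' | h' | h'
    · exact absurd h' hy.2
    · exact Or.inl h'
    · exact Or.inr h'

end numerics
end DSP

namespace DSP

section good
variable {Λ : Type*} [LinearOrder Λ] [Fintype Λ] {J : Type*} [Fintype J]

/-- indicator of a choice of labels -/
def ev (k : J → Λ) : J → Λ → ℕ := fun j l => if l = k j then 1 else 0

/-- the additive problem with arbitrary label values is solvable -/
def Good (m : J → Λ → ℕ) : Prop :=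
  ∃ (ι : Type) (_ : Fintype ι) (_ : DecidableEq ι) (κ : J → ι → Λ) (g : J → (Matrix ι ι ℂ)ˣ),
    cnt κ (fun _ => Finset.univ) = m ∧ ∀ μ : J → Λ → ℂ, pr μ (cv m) = 0 →
      ∃ U, (∀ j, SU (κ j) (U j)) ∧ ∑ j, AA κ g μ U j = 0

theorem pr_ev (μ : J → Λ → ℂ) (k : J → Λ) : pr μ (cv (ev k)) = ∑ j, μ j (k j) := by
  unfold pr cv ev
  refine Finset.sum_congr rfl fun j _ => ?_
  simp

theorem Good.inst {m : J → Λ → ℕ} (h : Good m) (μ : J → Λ → ℂ) (hμ : ∀ j, Function.Injective (μ j))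
    (h0 : pr μ (cv m) = 0) :
    ∃ (ι : Type) (_ : Fintype ι) (_ : DecidableEq ι) (κ : J → ι → Λ) (g : J → (Matrix ι ι ℂ)ˣ),
    cnt κ (fun _ => Finset.univ) = m ∧ ∑ j, AA κ g μ 0 j = 0 := by
  obtain ⟨ι, _, _, κ, g, hc, hg⟩ := h
  obtain ⟨U, hU, hs⟩ := hg μ h0
  have : ∀ j, ∃ g' : (Matrix ι ι ℂ)ˣ, AA κ g μ U j = g'.val * diagonal (μ j ∘ κ j) * (g'⁻¹).val := by
    intro j
    exact ((sim_of_unit (g j) _).trans (sim_diag_add_su (hU j) (μ j) (fun i i' h => hμ j h))).exists_unit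
  choose g' hg' using this
  refine ⟨ι, _, _, κ, g', hc, ?_⟩
  rw [← hs]
  refine Finset.sum_congr rfl fun j _ => ?_
  rw [hg' j]; simp [AA]

theorem irr_inst {ι : Type*} [Fintype ι] [DecidableEq ι] {κ : J → ι → Λ} {g : J → (Matrix ι ι ℂ)ˣ}
    {μ : J → Λ → ℂ} {m : J → Λ → ℕ} (hc : cnt κ (fun _ => Finset.univ) = m)
    (hs : ∑ j, AA κ g μ 0 j = 0)
    (h : ∀ (v : J → Λ → ℕ) (r : ℕ), (∀ j k, v j k ≤ m j k) → (∀ j, ∑ k, v j k = r) → 0 < r →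
      r < Fintype.card ι → pr μ (cv v) ≠ 0) : Irr (AA κ g μ 0) := by
  refine irr_of_addGen (d := fun j => μ j ∘ κ j) ?_ hs ?_
  · intro j
    have : AA κ g μ 0 j = (g j).val * diagonal (μ j ∘ κ j) * ((g j)⁻¹).val := by simp [AA]
    rw [this]
    exact (sim_of_unit _ _).charpoly
  · intro S r hS hr hrn
    have := h (cnt κ S) r (fun j k => by rw [← hc]; exact cnt_le κ S j k)
      (fun j => by rw [sum_cnt, hS]) hr hrn
    rw [← pr_cnt] at this
    exact this

theorem cnt_elim {ι : Type*} [Fintype ι] [DecidableEq ι] (κ : J → ι → Λ) (ε : J → Λ) (t : ℕ) (j : J) (l : Λ) :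
    cnt (fun j => Sum.elim (fun _ : Fin t => ε j) (κ j)) (fun _ => Finset.univ) j l
      = cnt κ (fun _ => Finset.univ) j l + t * ev ε j l := by
  simp only [cnt, Finset.card_filter, Fintype.sum_sum_type, Sum.elim_inl, Sum.elim_inr, ev, eq_comm]
  rw [add_comm]
  congr 1
  by_cases h : l = ε j <;> simp [h]

theorem sum_type {ι : Type*} [Fintype ι] [DecidableEq ι] {κ : J → ι → Λ} {m : J → Λ → ℕ}
    (hc : cnt κ (fun _ => Finset.univ) = m) (j : J) : ∑ k, m j k = Fintype.card ι := by
  rw [← hc, sum_cnt]; rfl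

theorem good_of_lines {ι : Type} [Fintype ι] [DecidableEq ι] [Nonempty ι] {κ : J → ι → Λ}
    {g : J → (Matrix ι ι ℂ)ˣ} {μ : J → Λ → ℂ} {m' m : J → Λ → ℕ}
    (hc : cnt κ (fun _ => Finset.univ) = m') (hs : ∑ j, AA κ g μ 0 j = 0)
    (hirr : Irr (AA κ g μ 0)) (ε : J → Λ) (hε : pr μ (cv (ev ε)) = 0)
    (hμ : ∀ j, Function.Injective (μ j)) (t : ℕ)
    (hj : (∃ j, m' j (ε j) = 0) ∨ 2 ≤ Fintype.card ι)
    (hcount : 2 * (Fintype.card ι : ℤ) + t ≤ ∑ j, ((Fintype.card ι : ℤ) - m' j (ε j)))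
    (hm : ∀ j l, m j l = m' j l + t * ev ε j l) (j0 : J) (h2 : ∀ l, m j0 l ≤ 2)
    (hodd : ∃ j l, Odd (m j l)) : Good m := by
  have hcm : cnt (fun j => Sum.elim (fun _ : Fin t => ε j) (κ j)) (fun _ => Finset.univ) = m := by
    funext j l; rw [cnt_elim, hm, hc]
  obtain ⟨g', hg'⟩ := lines κ g μ ε t hs hirr (by rw [← pr_ev, hε]) j0 (by
    rcases hj with ⟨j, hj⟩ | hj
    · left
      refine ⟨j, fun i h => ?_⟩
      have h' := hμ j h
      rw [← hc] at hj
      simp only [cnt, Finset.card_eq_zero] at hj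
      have : i ∈ (Finset.univ.filter fun i => κ j i = ε j) := by simp [h']
      rw [hj] at this
      simp at this
    · exact Or.inr hj) (by
    zify
    refine hcount.trans (le_of_eq (Finset.sum_congr rfl fun j _ => ?_))
    have h1 : (Finset.univ.filter fun i => μ j (ε j) ≠ μ j (κ j i))
      = (Finset.univ.filter fun i => ¬ κ j i = ε j) := by
      ext i; simp only [Finset.mem_filter, Finset.mem_univ, true_and, ne_eq, (hμ j).eq_iff]
      rw [eq_comm]
    have h2 := Finset.card_filter_add_card_filter_not (s := Finset.univ) (fun i => κ j i = ε j)
    rw [h1, ← hc]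
    simp only [cnt]
    rw [Finset.card_univ] at h2
    omega) j0 (by rw [hcm]; exact h2) (by rw [hcm]; exact hodd)
  refine ⟨Fin t ⊕ ι, inferInstance, inferInstance, _, g', hcm, fun μ' hμ' => hg' μ' ?_⟩
  have := pr_cnt (fun j => Sum.elim (fun _ : Fin t => ε j) (κ j)) (fun _ => Finset.univ) μ'
  rw [hcm, hμ'] at this
  exact this

end good
end DSP

namespace DSP

section split

theorem aeval_intertwine {α β : Type*} [Fintype α] [DecidableEq α] [Fintype β] [DecidableEq β]
    {M : Matrix α α ℂ} {B : Matrix β β ℂ} {X : Matrix α β ℂ} (h : M * X = X * B) (p : Polynomial ℂ) :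
    Polynomial.aeval M p * X = X * Polynomial.aeval B p := by
  induction p using Polynomial.induction_on' with
  | add p q hp hq => rw [map_add, map_add, Matrix.add_mul, Matrix.mul_add, hp, hq]
  | monomial n a =>
    have hpow : M ^ n * X = X * B ^ n := by
      induction n with
      | zero => simp
      | succ n ih => rw [pow_succ', pow_succ', Matrix.mul_assoc, ih, ← Matrix.mul_assoc, h, Matrix.mul_assoc]
    rw [Polynomial.aeval_monomial, Polynomial.aeval_monomial, ← Algebra.smul_def, ← Algebra.smul_def,
      Matrix.smul_mul, Matrix.mul_smul, hpow]

theorem aeval_conj_diagonal {α : Type*} [Fintype α] [DecidableEq α] (g : (Matrix α α ℂ)ˣ) (d : α → ℂ)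
    (p : Polynomial ℂ) (hp : ∀ i, p.eval (d i) = 0) :
    Polynomial.aeval (g.val * diagonal d * (g⁻¹).val) p = 0 := by
  have h0 : Polynomial.aeval (diagonal d) p = 0 := by
    have := Polynomial.aeval_algHom_apply (Matrix.diagonalAlgHom ℂ (n := α) (α := ℂ)) d p
    have h2 : Polynomial.aeval d p = 0 := by
      ext i
      have := Polynomial.aeval_algHom_apply (Pi.evalAlgHom ℂ (fun _ : α => ℂ) i) d p
      simp only [Pi.evalAlgHom_apply] at this
      rw [← this, Pi.zero_apply, ← hp i]
      simp [Polynomial.aeval_def, Polynomial.eval₂_eq_eval_map]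
    rw [h2, map_zero] at this
    exact this
  have h1 := aeval_intertwine (M := g.val * diagonal d * (g⁻¹).val) (X := g.val) (B := diagonal d)
    (by rw [mul_assoc, Units.inv_mul, mul_one]) p
  rw [h0, Matrix.mul_zero] at h1
  have : Polynomial.aeval (g.val * diagonal d * (g⁻¹).val) p * g.val * (g⁻¹).val = 0 := by
    rw [h1, zero_mul]
  rwa [mul_assoc, Units.mul_inv, mul_one] at this

variable {Λ : Type*} [LinearOrder Λ] [Fintype Λ] {J : Type*} [Fintype J]

theorem AA_zero {ι : Type*} [Fintype ι] [DecidableEq ι] (κ : J → ι → Λ) (g : J → (Matrix ι ι ℂ)ˣ)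
    (μ : J → Λ → ℂ) (j : J) : AA κ g μ 0 j = (g j).val * diagonal (μ j ∘ κ j) * ((g j)⁻¹).val := by
  simp [AA]

theorem count_cnt {ι : Type*} [Fintype ι] [DecidableEq ι] (κ : J → ι → Λ) (μ : J → Λ → ℂ) (j : J)
    (hμ : Function.Injective (μ j)) (l : Λ) :
    Multiset.count (μ j l) (Finset.univ.val.map (μ j ∘ κ j)) = cnt κ (fun _ => Finset.univ) j l := by
  rw [Multiset.count_map, cnt]
  rw [← Finset.filter_val, Finset.card_val]
  congr 1
  ext i
  simp only [Finset.mem_filter, Finset.mem_univ, true_and, Function.comp, hμ.eq_iff]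
  exact eq_comm

theorem split_inst {ι : Type*} [Fintype ι] [DecidableEq ι] {κ : J → ι → Λ}
    {g : J → (Matrix ι ι ℂ)ˣ} {μ : J → Λ → ℂ} (hs : ∑ j, AA κ g μ 0 j = 0)
    (hμ : ∀ j, Function.Injective (μ j)) (hI : ¬ Irr (AA κ g μ 0)) :
    ∃ (r s : ℕ) (κ₁ : J → Fin r → Λ) (g₁ : J → (Matrix (Fin r) (Fin r) ℂ)ˣ)
      (κ₂ : J → Fin s → Λ) (g₂ : J → (Matrix (Fin s) (Fin s) ℂ)ˣ), 0 < r ∧ 0 < s ∧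
      r + s = Fintype.card ι ∧ ∑ j, AA κ₁ g₁ μ 0 j = 0 ∧ ∑ j, AA κ₂ g₂ μ 0 j = 0 ∧
      ∀ j l, cnt κ (fun _ => Finset.univ) j l
        = cnt κ₁ (fun _ => Finset.univ) j l + cnt κ₂ (fun _ => Finset.univ) j l := by
  obtain ⟨r, s, G, H, B, X, C, hr, hs', hrs, hGH, hHG, hb⟩ := exists_blocks_of_not_irr hI
  set A := AA κ g μ 0 with hA
  let p : J → Polynomial ℂ := fun j => ∏ k ∈ Finset.univ.image (μ j), (Polynomial.X - Polynomial.C k)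
  have hpA : ∀ j, Polynomial.aeval (A j) (p j) = 0 := by
    intro j
    rw [hA, AA_zero]
    refine aeval_conj_diagonal _ _ _ fun i => ?_
    simp only [p, Polynomial.eval_prod, Function.comp]
    exact Finset.prod_eq_zero (Finset.mem_image_of_mem _ (Finset.mem_univ (κ j i))) (by simp)
  have hpF : ∀ j, Polynomial.aeval (fromBlocks (B j) (X j) 0 (C j)) (p j) = 0 := by
    intro j
    have h1 := aeval_intertwine (M := fromBlocks (B j) (X j) 0 (C j)) (X := H) (B := A j)
      (by rw [← hb, Matrix.mul_assoc, hGH, Matrix.mul_one]) (p j)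
    rw [hpA, Matrix.mul_zero] at h1
    have : Polynomial.aeval (fromBlocks (B j) (X j) 0 (C j)) (p j) * H * G = 0 := by
      rw [h1, Matrix.zero_mul]
    rwa [Matrix.mul_assoc, hHG, Matrix.mul_one] at this
  have hpB : ∀ j, Polynomial.aeval (B j) (p j) = 0 := by
    intro j
    have h1 := aeval_intertwine (M := fromBlocks (B j) (X j) 0 (C j)) (X := fromRows 1 0) (B := B j)
      (by ext (i | i) i' <;> simp [Matrix.mul_apply, Fintype.sum_sum_type, Matrix.one_apply]) (p j)
    rw [hpF, Matrix.zero_mul] at h1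
    ext i i'
    have := congrFun (congrFun h1 (Sum.inl i)) i'
    simp [Matrix.mul_apply, Matrix.one_apply] at this
    exact this.symm
  have hpC : ∀ j, Polynomial.aeval (C j) (p j) = 0 := by
    intro j
    have h1 := aeval_intertwine (M := C j) (X := fromCols 0 1) (B := fromBlocks (B j) (X j) 0 (C j))
      (by ext i (i' | i') <;> simp [Matrix.mul_apply, Fintype.sum_sum_type, Matrix.one_apply]) (p j)
    rw [hpF, Matrix.mul_zero] at h1
    ext i i'
    have := congrFun (congrFun h1 i) (Sum.inr i')
    simp [Matrix.mul_apply, Matrix.one_apply] at this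
    exact this
  choose d₁ g₁ hd₁ hB using fun j => exists_diag_of_annihilated (B j) _ (hpB j)
  choose d₂ g₂ hd₂ hC using fun j => exists_diag_of_annihilated (C j) _ (hpC j)
  have h1 : ∀ j i, ∃ l, μ j l = d₁ j i := fun j i => by simpa using hd₁ j i
  have h2 : ∀ j i, ∃ l, μ j l = d₂ j i := fun j i => by simpa using hd₂ j i
  choose κ₁ hκ₁ using h1
  choose κ₂ hκ₂ using h2
  have hB' : ∀ j, AA κ₁ g₁ μ 0 j = B j := by
    intro j; rw [AA_zero, hB j]; congr 3; ext i; exact hκ₁ j i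
  have hC' : ∀ j, AA κ₂ g₂ μ 0 j = C j := by
    intro j; rw [AA_zero, hC j]; congr 3; ext i; exact hκ₂ j i
  have hsum : ∑ j, fromBlocks (B j) (X j) 0 (C j) = 0 := by
    simp only [← hb]
    rw [← Matrix.sum_mul, ← Matrix.mul_sum, hs]; simp
  refine ⟨r, s, κ₁, g₁, κ₂, g₂, hr, hs', hrs, ?_, ?_, ?_⟩
  · simp only [hB']
    ext i i'
    have := congrFun (congrFun hsum (Sum.inl i)) (Sum.inl i')
    rw [Matrix.sum_apply] at this ⊢
    exact this
  · simp only [hC']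
    ext i i'
    have := congrFun (congrFun hsum (Sum.inr i)) (Sum.inr i')
    rw [Matrix.sum_apply] at this ⊢
    exact this
  · intro j l
    have h := roots_le_of_block hGH hHG (hb j)
    have e1 : (A j).charpoly.roots = Finset.univ.val.map (μ j ∘ κ j) := by
      rw [hA, AA_zero, (sim_of_unit (g j) (diagonal (μ j ∘ κ j))).charpoly, charpoly_diagonal_roots]
    have e2 : (B j).charpoly.roots = Finset.univ.val.map (μ j ∘ κ₁ j) := by
      rw [← hB', AA_zero, (sim_of_unit (g₁ j) (diagonal (μ j ∘ κ₁ j))).charpoly, charpoly_diagonal_roots]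
    have e3 : (C j).charpoly.roots = Finset.univ.val.map (μ j ∘ κ₂ j) := by
      rw [← hC', AA_zero, (sim_of_unit (g₂ j) (diagonal (μ j ∘ κ₂ j))).charpoly, charpoly_diagonal_roots]
    rw [e1, e2, e3] at h
    have := congrArg (Multiset.count (μ j l)) h
    rwa [Multiset.count_add, count_cnt κ μ j (hμ j), count_cnt κ₁ μ j (hμ j),
      count_cnt κ₂ μ j (hμ j)] at this

theorem pr_type_zero {ι : Type*} [Fintype ι] [DecidableEq ι] {κ : J → ι → Λ}
    {g : J → (Matrix ι ι ℂ)ˣ} {μ : J → Λ → ℂ} (hs : ∑ j, AA κ g μ 0 j = 0) :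
    pr μ (cv (cnt κ (fun _ => Finset.univ))) = 0 := by
  rw [← pr_cnt]
  have := congrArg Matrix.trace hs
  rw [Matrix.trace_sum, Matrix.trace_zero] at this
  rw [← this]
  refine Finset.sum_congr rfl fun j _ => ?_
  rw [AA_zero, (sim_of_unit (g j) (diagonal (μ j ∘ κ j))).trace, Matrix.trace_diagonal]; rfl

end split
end DSP

namespace DSP

section plain
variable {Λ : Type*} [LinearOrder Λ] [Fintype Λ] {J : Type*} [Fintype J]

theorem exists_mu (m' : J → Λ → ℕ) (ε : J → Λ)
    (hns : ∃ j1 j2, j1 ≠ j2 ∧ (∃ l, l ≠ ε j1 ∧ m' j1 l ≠ 0) ∧ (∃ l, l ≠ ε j2 ∧ m' j2 l ≠ 0)) :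
    ∃ μ : J → Λ → ℂ, (∀ j, Function.Injective (μ j)) ∧ pr μ (cv m') = 0 ∧ pr μ (cv (ev ε)) = 0 ∧
      ∀ v : J → Λ → ℕ, (∀ j k, v j k ≤ m' j k) → pr μ (cv v) = 0 →
        ∃ a b : ℂ, ∀ j l, (v j l : ℂ) = a * m' j l + b * ev ε j l := by
  let C : Submodule ℂ (J → Λ → ℂ) := Submodule.span ℂ {cv m', cv (ev ε)}
  let I1 := {v : J → Λ → ℕ // v ∈ Set.Iic m' ∧ cv v ∉ C}
  let I2 := {p : J × Λ × Λ // p.2.1 ≠ p.2.2}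
  have hf : Finite I1 := by
    have : (Set.Iic m').Finite := Set.finite_Iic m'
    exact (this.subset (fun v (hv : v ∈ Set.Iic m' ∧ cv v ∉ C) => hv.1)).to_subtype
  obtain ⟨μ, hμ, hμ2⟩ := avoid (I := I1 ⊕ I2) C
    (Sum.elim (fun v => cv v.1) (fun p => Pi.single p.1.1 (Pi.single p.1.2.1 1)
      - Pi.single p.1.1 (Pi.single p.1.2.2 1))) (by
      rintro (⟨v, hv⟩ | ⟨⟨j, l, l'⟩, hp⟩) hmem
      · exact hv.2 hmem
      · simp only [Sum.elim_inr] at hmem hp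
        obtain ⟨a, b, hab⟩ := Submodule.mem_span_pair.1 hmem
        have key : ∀ i, i ≠ j → (∃ l, l ≠ ε i ∧ m' i l ≠ 0) → False := by
          rintro i hij ⟨x, hx, hmx⟩
          have h1 := congrFun (congrFun hab i) x
          have h2 := congrFun (congrFun hab i) (ε i)
          simp [cv, ev, hx, Pi.single_eq_of_ne hij, hmx] at h1 h2
          rw [h1] at h2
          simp at h2
          rw [h1, h2] at hab
          have h3 := congrFun (congrFun hab j) l
          simp [Pi.single_apply, hp] at h3
        obtain ⟨j1, j2, h12, h1, h2⟩ := hns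
        by_cases hj : j1 = j
        · exact key j2 (fun h => h12 (hj.trans h.symm)) h2
        · exact key j1 hj h1) 0 {0} (Set.countable_singleton 0)
  refine ⟨μ, ?_, ?_, ?_, ?_⟩
  · intro j l l' hl
    by_contra hne
    apply hμ2 (Sum.inr ⟨(j, l, l'), hne⟩)
    have ps : ∀ x, pr μ (Pi.single j (Pi.single x 1)) = μ j x := by
      intro x; convert pr_single μ j x
    simp only [Sum.elim_inr, pr_sub, Set.mem_singleton_iff]
    rw [ps, ps, hl, sub_self]
  · rw [hμ _ (Submodule.subset_span (by simp))]; simp [pr]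
  · rw [hμ _ (Submodule.subset_span (by simp))]; simp [pr]
  · intro v hv h0
    by_cases hvC : cv v ∈ C
    · obtain ⟨a, b, hab⟩ := Submodule.mem_span_pair.1 hvC
      exact ⟨a, b, fun j l => (congrFun (congrFun hab j) l).symm⟩
    · exact absurd (by simpa using h0) (hμ2 (Sum.inl ⟨v, hv, hvC⟩))

/-- reduced type -/
def sb (m : J → Λ → ℕ) (t : ℕ) (k : J → Λ) : J → Λ → ℕ := fun j l => m j l - t * ev k j l

/-- maximal multiplicity -/
def mx (m : J → Λ → ℕ) (j : J) : ℕ := Finset.univ.sup (m j)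

/-- sum of squares -/
def sq (m : J → Λ → ℕ) (j : J) : ℤ := ∑ l, (m j l : ℤ) ^ 2

variable {m : J → Λ → ℕ} {n : ℕ} {k : J → Λ} {t : ℕ}

theorem sb_add (ht : ∀ j, t ≤ m j (k j)) (j : J) (l : Λ) : m j l = sb m t k j l + t * ev k j l := by
  unfold sb
  have := ht j
  by_cases h : l = k j
  · subst h; simp [ev]; omega
  · simp [ev, h]

theorem sb_ne (j : J) {l : Λ} (h : l ≠ k j) : sb m t k j l = m j l := by
  simp [sb, ev, h]

theorem sb_eq (j : J) : sb m t k j (k j) = m j (k j) - t := by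
  simp [sb, ev]

theorem sum_ev (j : J) : ∑ l, ev k j l = 1 := by simp [ev]

theorem sum_sb (hm : ∀ j, ∑ l, m j l = n) (ht : ∀ j, t ≤ m j (k j)) (j : J) :
    ∑ l, sb m t k j l + t = n := by
  rw [← hm j, Finset.sum_congr rfl fun l _ => sb_add ht j l, Finset.sum_add_distrib, ← Finset.mul_sum,
    sum_ev, mul_one]

theorem sq_sb (ht : ∀ j, t ≤ m j (k j)) (j : J) :
    sq (sb m t k) j = sq m j - 2 * t * m j (k j) + t ^ 2 := by
  have h : ∀ l, ((sb m t k j l : ℕ) : ℤ) ^ 2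
      = (m j l : ℤ) ^ 2 - (if l = k j then 2 * t * (m j (k j) : ℤ) - t ^ 2 else 0) := by
    intro l
    by_cases h : l = k j
    · subst h
      rw [sb_eq, Nat.cast_sub (ht j)]; simp; ring
    · rw [sb_ne j h]; simp [h]
  unfold sq
  rw [Finset.sum_congr rfl fun l _ => h l, Finset.sum_sub_distrib]
  simp; ring

theorem sq_ge_max (j : J) (l : Λ) : (m j l : ℤ) ^ 2 ≤ sq m j :=
  Finset.single_le_sum (f := fun l => (m j l : ℤ) ^ 2) (fun l _ => sq_nonneg _) (Finset.mem_univ l)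

theorem sq_ge_two (j : J) {l l' : Λ} (h : l ≠ l') : (m j l : ℤ) ^ 2 + (m j l' : ℤ) ^ 2 ≤ sq m j := by
  rw [← Finset.sum_pair (f := fun l => (m j l : ℤ) ^ 2) h]
  exact Finset.sum_le_sum_of_subset_of_nonneg (Finset.subset_univ _) fun l _ _ => sq_nonneg _

theorem sum_ge_one (hm : ∀ j, ∑ l, m j l = n) (j : J) (l : Λ) : m j l ≤ n := by
  rw [← hm j]
  exact Finset.single_le_sum (f := m j) (fun l _ => Nat.zero_le _) (Finset.mem_univ l)

theorem sum_ge_two (hm : ∀ j, ∑ l, m j l = n) (j : J) {l l' : Λ} (h : l ≠ l') : m j l + m j l' ≤ n := by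
  rw [← hm j, ← Finset.sum_pair (f := m j) h]
  exact Finset.sum_le_sum_of_subset (Finset.subset_univ _)

theorem sq_ge (hm : ∀ j, ∑ l, m j l = n) (j : J) : (n : ℤ) ≤ sq m j := by
  rw [← hm j]; push_cast
  refine Finset.sum_le_sum fun l _ => ?_
  have : m j l ≤ m j l ^ 2 := Nat.le_self_pow (by norm_num) _
  exact_mod_cast this

theorem sq_ge_add (hm : ∀ j, ∑ l, m j l = n) (j : J) (l : Λ) (h : m j l = 2) : (n : ℤ) + 2 ≤ sq m j := by
  have h1 : ∑ x, ((m j x : ℤ) ^ 2 - m j x) = sq m j - n := by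
    rw [Finset.sum_sub_distrib, ← hm j]; push_cast; rfl
  have h2 := Finset.single_le_sum (f := fun x => (m j x : ℤ) ^ 2 - m j x) (fun x _ => by
    have : m j x ≤ m j x ^ 2 := Nat.le_self_pow (by norm_num) _
    have : (m j x : ℤ) ≤ (m j x : ℤ) ^ 2 := by exact_mod_cast this
    linarith) (Finset.mem_univ l)
  rw [h1] at h2
  simp [h] at h2
  linarith

theorem sq_le (hm : ∀ j, ∑ l, m j l = n) (j : J) (M : ℕ) (hM : ∀ l, m j l ≤ M) :
    sq m j ≤ n * M := by
  rw [← hm j]; push_cast; rw [Finset.sum_mul]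
  refine Finset.sum_le_sum fun l _ => ?_
  have : (m j l : ℤ) ≤ M := by exact_mod_cast hM l
  nlinarith [Int.natCast_nonneg (m j l)]

theorem drop_sb [Nonempty Λ] (hm : ∀ j, ∑ l, m j l = n) (ht : ∀ j, t ≤ m j (k j)) (j : J)
    (hk : ∀ l, m j l ≤ m j (k j)) (D : ℤ) (hD : D = mx (sb m t k) j - (m j (k j) - t)) :
    D = 0 ∨ (0 < D ∧ D ≤ t ∧ 2 * (m j (k j) : ℤ) - t + D ≤ n ∧
      (m j (k j) : ℤ) ^ 2 + (m j (k j) - t + D) ^ 2 ≤ sq m j) := by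
  obtain ⟨l, -, hl⟩ := Finset.exists_mem_eq_sup Finset.univ Finset.univ_nonempty (sb m t k j)
  have h0 : sb m t k j (k j) ≤ mx (sb m t k) j := Finset.le_sup (Finset.mem_univ _)
  rw [sb_eq] at h0
  have h1 := ht j
  have hl' : mx (sb m t k) j = sb m t k j l := hl
  by_cases h : l = k j
  · left
    rw [hl', h, sb_eq] at hD
    omega
  · by_cases hD0 : D = 0
    · exact Or.inl hD0
    right
    rw [sb_ne j h] at hl'
    have h2 := hk l
    have h3 := sum_ge_two hm j h
    have h4 := sq_ge_two (m := m) j h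
    have e : (m j (k j) - t + D : ℤ) = m j l := by rw [hD, hl']; ring
    rw [e]
    refine ⟨by omega, by omega, by omega, by linarith⟩

theorem two_nonscalar (hm : ∀ j, ∑ l, m j l = n) (hn : 1 ≤ n) (j0 : J)
    (hpos : ∀ j, 1 ≤ m j (k j))
    (hb : (n : ℤ) ≤ ∑ j ∈ Finset.univ.erase j0, ((n : ℤ) - m j (k j))) :
    ∃ j1 j2, j1 ≠ j2 ∧ (∃ l, l ≠ k j1 ∧ m j1 l ≠ 0) ∧ (∃ l, l ≠ k j2 ∧ m j2 l ≠ 0) := by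
  have key : ∀ j, (0 : ℤ) < n - m j (k j) → ∃ l, l ≠ k j ∧ m j l ≠ 0 := by
    intro j hj
    by_contra hcon
    push Not at hcon
    have := hm j
    rw [Finset.sum_eq_single (k j) (fun l _ hl => hcon l hl) (by simp)] at this
    omega
  obtain ⟨j1, hj1, h1⟩ : ∃ j ∈ Finset.univ.erase j0, (0 : ℤ) < n - m j (k j) := by
    by_contra hcon
    push Not at hcon
    have := Finset.sum_nonpos hcon
    omega
  rw [← Finset.add_sum_erase _ _ hj1] at hb
  obtain ⟨j2, hj2, h2⟩ : ∃ j ∈ (Finset.univ.erase j0).erase j1, (0 : ℤ) < n - m j (k j) := by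
    by_contra hcon
    push Not at hcon
    have := Finset.sum_nonpos hcon
    have := hpos j1
    omega
  exact ⟨j1, j2, (Finset.ne_of_mem_erase hj2).symm, key j1 h1, key j2 h2⟩

theorem alpha_sb (hm : ∀ j, ∑ l, m j l = n) (ht : ∀ j, t ≤ m j (k j)) (htn : t ≤ n) :
    ∑ j, (((n - t : ℕ) : ℤ) ^ 2 - sq (sb m t k) j)
      = ∑ j, ((n : ℤ) ^ 2 - sq m j) - 2 * t * ∑ j, ((n : ℤ) - m j (k j)) := by
  rw [Finset.mul_sum, ← Finset.sum_sub_distrib]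
  refine Finset.sum_congr rfl fun j _ => ?_
  rw [sq_sb ht, Nat.cast_sub htn]
  ring

end plain
end DSP

namespace DSP

section plain2
variable {Λ : Type*} [LinearOrder Λ] [Fintype Λ] {J : Type*} [Fintype J]
variable {m : J → Λ → ℕ} {n : ℕ} {k : J → Λ} {t : ℕ}

theorem count_lines (hm : ∀ j, ∑ l, m j l = n) (ht : ∀ j, t ≤ m j (k j)) (htn : t ≤ n) :
    ∑ j, (((n - t : ℕ) : ℤ) - (sb m t k j (k j) : ℕ)) = ∑ j, ((n : ℤ) - m j (k j)) := by
  refine Finset.sum_congr rfl fun j _ => ?_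
  have := ht j
  rw [sb_eq]; omega

theorem nonscalar_sb (hm : ∀ j, ∑ l, m j l = n) (hn : 1 ≤ n) (j0 : J) (hpos : ∀ j, 1 ≤ m j (k j))
    (hb : (n : ℤ) ≤ ∑ j ∈ Finset.univ.erase j0, ((n : ℤ) - m j (k j))) :
    ∃ j1 j2, j1 ≠ j2 ∧ (∃ l, l ≠ k j1 ∧ sb m t k j1 l ≠ 0) ∧ (∃ l, l ≠ k j2 ∧ sb m t k j2 l ≠ 0) := by
  obtain ⟨j1, j2, h, ⟨l1, h1, h1'⟩, ⟨l2, h2, h2'⟩⟩ := two_nonscalar hm hn j0 hpos hb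
  exact ⟨j1, j2, h, ⟨l1, h1, by rwa [sb_ne _ h1]⟩, ⟨l2, h2, by rwa [sb_ne _ h2]⟩⟩

theorem step_free (hm : ∀ j, ∑ l, m j l = n) (ht : ∀ j, t ≤ m j (k j)) (j0 : J) (h0 : m j0 (k j0) = t)
    (ht1 : 1 ≤ t) (htn : t < n)
    (hb : (n : ℤ) ≤ ∑ j ∈ Finset.univ.erase j0, ((n : ℤ) - m j (k j)))
    (h2 : ∀ l, m j0 l ≤ 2) (hodd : ∃ j l, Odd (m j l)) (hodd' : ∃ j l, Odd (sb m t k j l))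
    (hG : Good (sb m t k)) : Good m := by
  obtain ⟨μ, hinj, hμ0, hμε, hspan⟩ := exists_mu (sb m t k) k
    (nonscalar_sb hm (by omega) j0 (fun j => ht1.trans (ht j)) hb)
  obtain ⟨ι, _, _, κ, g, hc, hs⟩ := hG.inst μ hinj hμ0
  have hsum : ∀ j, ∑ l, sb m t k j l = n - t := fun j => by have := sum_sb hm ht j; omega
  have hcard : Fintype.card ι = n - t := by rw [← sum_type hc j0, hsum]
  have hz : sb m t k j0 (k j0) = 0 := by rw [sb_eq]; omega
  have : Nonempty ι := Fintype.card_pos_iff.1 (by omega)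
  have hirr : Irr (AA κ g μ 0) := by
    refine irr_inst hc hs fun v r hv hvr hr hrn hpr => ?_
    obtain ⟨a, b, hab⟩ := hspan v hv hpr
    have h1 := hab j0 (k j0)
    have h3 : v j0 (k j0) = 0 := by have := hv j0 (k j0); omega
    rw [h3, hz] at h1
    simp [ev] at h1
    refine not_prop hsum hvr hr (by omega) j0 (fun l => ?_) hodd' a ?_
    · have := sb_add ht j0 l; have := h2 l; omega
    · funext j l
      simp [cv, hab, ← h1]
  refine good_of_lines hc hs hirr k hμε hinj t (Or.inl ⟨j0, hz⟩) ?_ (fun j l => sb_add ht j l) j0 h2 hodd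
  rw [hcard, count_lines hm ht htn.le, ← Finset.add_sum_erase _ _ (Finset.mem_univ j0), h0]
  omega

theorem step_def (hm : ∀ j, ∑ l, m j l = n) (ht : ∀ j, 1 ≤ m j (k j)) (j0 : J) (h0 : m j0 (k j0) = 2)
    (hn : 2 ≤ n)
    (hb : (n : ℤ) + 1 ≤ ∑ j ∈ Finset.univ.erase j0, ((n : ℤ) - m j (k j)))
    (h2 : ∀ l, m j0 l ≤ 2) (hodd : ∃ j l, Odd (m j l))
    (hG : Good (sb m 1 k)) : Good m := by
  obtain ⟨μ, hinj, hμ0, hμε, hspan⟩ := exists_mu (sb m 1 k) k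
    (nonscalar_sb hm (by omega) j0 ht (by omega))
  obtain ⟨ι, _, _, κ, g, hc, hs⟩ := hG.inst μ hinj hμ0
  have hsum : ∀ j, ∑ l, sb m 1 k j l = n - 1 := fun j => by have := sum_sb hm ht j; omega
  have hcard : Fintype.card ι = n - 1 := by rw [← sum_type hc j0, hsum]
  have hz : sb m 1 k j0 (k j0) = 1 := by rw [sb_eq]; omega
  have : Nonempty ι := Fintype.card_pos_iff.1 (by omega)
  have hcnt : (2 * n - 1 : ℤ) ≤ ∑ j, ((n : ℤ) - m j (k j)) := by
    rw [← Finset.add_sum_erase _ _ (Finset.mem_univ j0), h0]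
    push_cast; omega
  by_cases hirr : Irr (AA κ g μ 0)
  · refine good_of_lines hc hs hirr k hμε hinj 1 ?_ ?_ (fun j l => sb_add ht j l) j0 h2 hodd
    · by_cases h3 : 2 ≤ n - 1
      · right; omega
      left
      by_contra hcon
      push Not at hcon
      obtain ⟨j, l, hjl⟩ := hodd
      have h4 := hcon j
      rw [sb_eq] at h4
      by_cases hl : l = k j
      · have := sum_ge_one hm j l
        have h5 : m j l = 2 := by rw [hl] at this ⊢; omega
        rw [h5] at hjl; exact absurd hjl (by decide)
      · have := sum_ge_two hm j hl
        have h5 : m j l = 0 := by omega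
        rw [h5] at hjl; exact absurd hjl (by decide)
    · rw [hcard, count_lines hm ht (by omega)]
      push_cast; omega
  · obtain ⟨r, s, κ₁, g₁, κ₂, g₂, hr, hs', hrs, hs1, hs2, hcc⟩ := split_inst hs hinj hirr
    have main : ∀ (r s : ℕ) (κ₁ : J → Fin r → Λ) (κ₂ : J → Fin s → Λ)
        (g₁ : J → (Matrix (Fin r) (Fin r) ℂ)ˣ) (g₂ : J → (Matrix (Fin s) (Fin s) ℂ)ˣ),
        0 < r → 0 < s → r + s = Fintype.card ι → ∑ j, AA κ₁ g₁ μ 0 j = 0 → ∑ j, AA κ₂ g₂ μ 0 j = 0 →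
        (∀ j l, cnt κ (fun _ => Finset.univ) j l =
                        cnt κ₁ (fun _ => Finset.univ) j l + cnt κ₂ (fun _ => Finset.univ) j l) →
        cnt κ₁ (fun _ => Finset.univ) j0 (k j0) = 1 → Good m := by
      clear hrs hs1 hs2 hcc hr hs' g₁ g₂ κ₁ κ₂ r s
      intro r s κ₁ κ₂ g₁ g₂ hr hs' hrs hs1 hs2 hcc h1
      obtain ⟨v, hv⟩ : ∃ v, v = cnt κ₁ (fun _ => Finset.univ) := ⟨_, rfl⟩
      obtain ⟨w, hw⟩ : ∃ w, w = cnt κ₂ (fun _ => Finset.univ) := ⟨_, rfl⟩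
      have hvw : ∀ j l, sb m 1 k j l = v j l + w j l := by
        intro j l; rw [← hc, hv, hw]; exact hcc j l
      have hvs := sum_type hv.symm
      have hws := sum_type hw.symm
      simp only [Fintype.card_fin] at hvs hws
      rw [← hv] at h1
      obtain ⟨a, b, hab⟩ := hspan v (fun j l => by rw [hvw]; omega) (by rw [hv]; exact pr_type_zero hs1)
      have hb1 := hab j0 (k j0)
      rw [h1, hz] at hb1
      simp [ev] at hb1
      obtain ⟨l, hl, hl0⟩ : ∃ l, l ≠ k j0 ∧ sb m 1 k j0 l ≠ 0 := by
        by_contra hcon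
        push Not at hcon
        have := hsum j0
        rw [Finset.sum_eq_single (k j0) (fun l _ hl => hcon l hl) (by simp), hz] at this
        omega
      have ha := hab j0 l
      have hl2 : sb m 1 k j0 l ≤ 2 := by rw [sb_ne _ hl]; exact h2 l
      simp [ev, hl] at ha
      have hvl : v j0 l ≤ sb m 1 k j0 l := by rw [hvw]; omega
      have ha' : a = 0 ∨ 2 * a = 1 ∨ a = 1 := by
        generalize v j0 l = X at *
        generalize sb m 1 k j0 l = Z at *
        interval_cases Z
        · exact absurd rfl hl0
        · interval_cases X
          · left; simpa using ha.symm
          · right; right; simpa using ha.symm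
        · interval_cases X
          · left; simpa using ha.symm
          · right; left; push_cast at ha; rw [mul_comm]; exact ha.symm
          · right; right; push_cast at ha
            have : (2 : ℂ) * (1 - a) = 0 := by rw [mul_sub, mul_comm 2 a, ← ha]; norm_num
            rcases mul_eq_zero.1 this with h | h
            · norm_num at h
            · exact (sub_eq_zero.1 h).symm
      rcases ha' with ha0 | ha1 | ha2
      · have hb2 : b = 1 := by rw [ha0] at hb1; simpa using hb1.symm
        have hvε : ∀ j l, v j l = ev k j l := by
          intro j l
          have := hab j l
          rw [ha0, hb2] at this
          simp at this; exact this
        have hmw : ∀ j l, m j l = w j l + 2 * ev k j l := by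
          intro j l
          rw [sb_add ht j l, hvw, hvε]; omega
        have hwk : w j0 (k j0) = 0 := by have := hvw j0 (k j0); omega
        have hoddw : ∃ j l, Odd (w j l) := by
          obtain ⟨j, l, hjl⟩ := hodd
          refine ⟨j, l, ?_⟩
          rw [hmw] at hjl
          rw [Nat.odd_iff] at hjl ⊢; omega
        have hr1 : r = 1 := by
          rw [← hvs j0, Finset.sum_congr rfl fun l _ => hvε j0 l, sum_ev]
        have hirr2 : Irr (AA κ₂ g₂ μ 0) := by
          refine irr_inst hw.symm hs2 fun v' r' hv' hvr' hr' hrn' hpr' => ?_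
          obtain ⟨a', b', hab'⟩ := hspan v' (fun j l => by
            have := hv' j l; have := hvw j l; omega) hpr'
          have h3 : v' j0 (k j0) = 0 := by have := hv' j0 (k j0); omega
          have h4 := hab' j0 (k j0)
          rw [h3, hz] at h4
          simp [ev] at h4
          rw [Fintype.card_fin] at hrn'
          refine not_prop hws hvr' hr' hrn' j0 (fun l => ?_) hoddw a' ?_
          · have := hmw j0 l; have := h2 l; omega
          · funext j l
            have h5 := hab' j l
            rw [hvw, hvε] at h5
            simp only [cv, Pi.smul_apply, smul_eq_mul]
            rw [h5]; push_cast
            linear_combination (-(ev k j l : ℂ)) * h4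
        have : Nonempty (Fin s) := ⟨⟨0, hs'⟩⟩
        refine good_of_lines hw.symm hs2 hirr2 k hμε hinj 2 (Or.inl ⟨j0, hwk⟩) ?_ hmw j0 h2 hodd
        have : ∑ j, ((s : ℤ) - w j (k j)) = ∑ j, ((n : ℤ) - m j (k j)) := by
          refine Finset.sum_congr rfl fun j _ => ?_
          have h6 := hmw j (k j)
          simp [ev] at h6
          omega
        rw [Fintype.card_fin, this]
        omega
      · exfalso
        obtain ⟨j, l', hjl⟩ := hodd
        have h5 := hab j l'
        have h6 : (m j l' : ℂ) = sb m 1 k j l' + ev k j l' := by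
          exact_mod_cast (by simpa using sb_add ht j l')
        have h7 : (m j l' : ℂ) = (2 * v j l' : ℕ) := by
          push_cast
          rw [h6, h5]
          linear_combination (-(sb m 1 k j l' : ℂ) + ev k j l') * ha1 + (2 * (ev k j l') : ℂ) * hb1
        have h8 : m j l' = 2 * v j l' := by exact_mod_cast h7
        rw [h8] at hjl
        exact absurd hjl (by simp)
      · exfalso
        rw [ha2] at hb1
        have hb0 : b = 0 := by linear_combination -hb1
        have : ∀ l, v j0 l = sb m 1 k j0 l := by
          intro l
          have := hab j0 l
          rw [ha2, hb0] at this
          simp at this; exact this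
        have h9 := hvs j0
        rw [Finset.sum_congr rfl fun l _ => this l, hsum] at h9
        omega
    have h1 : cnt κ₁ (fun _ => Finset.univ) j0 (k j0) + cnt κ₂ (fun _ => Finset.univ) j0 (k j0) = 1 := by
      rw [← hcc, hc, hz]
    by_cases h3 : cnt κ₁ (fun _ => Finset.univ) j0 (k j0) = 1
    · exact main r s κ₁ κ₂ g₁ g₂ hr hs' hrs hs1 hs2 hcc h3
    · exact main s r κ₂ κ₁ g₂ g₁ hs' hr (by omega) hs2 hs1 (fun j l => by rw [hcc]; omega) (by omega)

theorem good_one (hm : ∀ j, ∑ l, m j l = 1) : Good m := by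
  have : ∀ j, ∃ l, m j l ≠ 0 := by
    intro j
    by_contra hcon
    push Not at hcon
    have := hm j
    simp [hcon] at this
  choose k hk using this
  have hmk : m = ev k := by
    funext j l
    have h1 := sum_ge_one hm j (k j)
    have h2 := hk j
    by_cases h : l = k j
    · subst h; simp [ev]; omega
    · have := sum_ge_two hm j h
      simp [ev, h]; omega
  have hcc : cnt (fun j (_ : Unit) => k j) (fun _ => Finset.univ) = m := by
    rw [hmk]
    funext j l
    unfold cnt ev
    by_cases h : l = k j
    · simp [h]
    · simp [h, Ne.symm h]
  refine ⟨Unit, inferInstance, inferInstance, fun j _ => k j, fun _ => 1, hcc, ?_⟩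
  intro μ hμ
  refine ⟨0, fun j => ?_, ?_⟩
  · intro i i' h; rfl
  · rw [Finset.sum_congr rfl fun j _ => AA_const k μ j, ← Finset.sum_smul]
    rw [hmk, pr_ev] at hμ
    rw [hμ, zero_smul]

end plain2
end DSP

namespace DSP

section plain3
variable {Λ : Type*} [LinearOrder Λ] [Fintype Λ] {J : Type*} [Fintype J]

theorem beta_sb {m : J → Λ → ℕ} {n : ℕ} {k : J → Λ} {t : ℕ} (htn : t ≤ n) (j0 : J)
    (hD : ∑ j ∈ Finset.univ.erase j0, ((mx (sb m t k) j : ℤ) - (m j (k j) - t))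
      ≤ ∑ j ∈ Finset.univ.erase j0, ((n : ℤ) - m j (k j)) - n + t) :
    ((n - t : ℕ) : ℤ) ≤ ∑ j ∈ Finset.univ.erase j0, (((n - t : ℕ) : ℤ) - mx (sb m t k) j) := by
  have : ∑ j ∈ Finset.univ.erase j0, (((n - t : ℕ) : ℤ) - mx (sb m t k) j)
      = ∑ j ∈ Finset.univ.erase j0, ((n : ℤ) - m j (k j))
        - ∑ j ∈ Finset.univ.erase j0, ((mx (sb m t k) j : ℤ) - (m j (k j) - t)) := by
    rw [← Finset.sum_sub_distrib]
    refine Finset.sum_congr rfl fun j _ => ?_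
    omega
  rw [this]; omega

theorem exists_k {m : J → Λ → ℕ} {n : ℕ} (hn : 1 ≤ n) (hm : ∀ j, ∑ l, m j l = n) (j0 : J) (k0 : Λ) :
    ∃ k : J → Λ, k j0 = k0 ∧ (∀ j ∈ Finset.univ.erase j0, m j (k j) = mx m j) ∧
      (∀ j ∈ Finset.univ.erase j0, ∀ l, m j l ≤ m j (k j)) ∧
      (∀ j ∈ Finset.univ.erase j0, 1 ≤ m j (k j)) := by
  have : Nonempty Λ := ⟨k0⟩
  have : ∀ j, ∃ l, mx m j = m j l := fun j => by
    obtain ⟨l, -, hl⟩ := Finset.exists_mem_eq_sup Finset.univ Finset.univ_nonempty (m j)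
    exact ⟨l, hl⟩
  choose k hk using this
  have hle : ∀ j l, m j l ≤ m j (k j) := fun j l => by
    rw [← hk]; exact Finset.le_sup (Finset.mem_univ l)
  refine ⟨Function.update k j0 k0, by simp, ?_, ?_, ?_⟩
  · intro j hj
    rw [Function.update_of_ne (Finset.ne_of_mem_erase hj)]; exact (hk j).symm
  · intro j hj
    rw [Function.update_of_ne (Finset.ne_of_mem_erase hj)]; exact hle j
  · intro j hj
    rw [Function.update_of_ne (Finset.ne_of_mem_erase hj)]
    by_contra hcon
    have : ∑ l, m j l = 0 := Finset.sum_eq_zero fun l _ => by have := hle j l; omega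
    rw [hm] at this; omega

theorem plainGood (j0 : J) : ∀ (n : ℕ) (m : J → Λ → ℕ), 1 ≤ n → (∀ j, ∑ l, m j l = n) →
    (∀ l, m j0 l ≤ 2) → (∃ j l, Odd (m j l)) →
    (n = 1 ∨ (2 * (n : ℤ) ^ 2 - 2 ≤ ∑ j, ((n : ℤ) ^ 2 - sq m j) ∧
      (n : ℤ) ≤ ∑ j ∈ Finset.univ.erase j0, ((n : ℤ) - mx m j))) → Good m := by
  intro n
  induction n using Nat.strong_induction_on with
  | _ n ih =>
  intro m hn hm h2 hodd hab
  by_cases hn1 : n = 1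
  · subst hn1; exact good_one hm
  obtain ⟨hα, hβ⟩ := hab.resolve_left hn1
  have hn2 : 2 ≤ n := by omega
  -- common data
  have common : ∀ k : J → Λ, (∀ j ∈ Finset.univ.erase j0, m j (k j) = mx m j) →
      ∑ j ∈ Finset.univ.erase j0, ((n : ℤ) - m j (k j)) = ∑ j ∈ Finset.univ.erase j0, ((n : ℤ) - mx m j) :=
    fun k hk => Finset.sum_congr rfl fun j hj => by rw [hk j hj]
  obtain ⟨e, he⟩ : ∃ e : ℤ, e = ∑ j ∈ Finset.univ.erase j0, ((n : ℤ) - mx m j) - n := ⟨_, rfl⟩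
  have hmxs : ∀ j, sq m j ≤ n * mx m j := fun j =>
    sq_le hm j _ fun l => Finset.le_sup (Finset.mem_univ l)
  have hdlow : (n : ℤ) * (n + e) ≤ ∑ j ∈ Finset.univ.erase j0, ((n : ℤ) ^ 2 - sq m j) := by
    have : (n : ℤ) * (n + e) = ∑ j ∈ Finset.univ.erase j0, ((n : ℤ) * ((n : ℤ) - mx m j)) := by
      rw [← Finset.mul_sum, he]; ring
    rw [this]
    refine Finset.sum_le_sum fun j _ => ?_
    have := hmxs j
    nlinarith
  have hα' := hα
  rw [← Finset.add_sum_erase _ _ (Finset.mem_univ j0)] at hα'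
  by_cases hS : ∀ l, m j0 l ≤ 1
  · -- case S
    obtain ⟨k0, hk0⟩ : ∃ l, m j0 l = 1 := by
      by_contra hcon
      push Not at hcon
      have : ∑ l, m j0 l = 0 := Finset.sum_eq_zero fun l _ => by
        have := hS l; have := hcon l; omega
      rw [hm] at this; omega
    obtain ⟨k, hkj0, hkm, hkle, hk1⟩ := exists_k hn hm j0 k0
    have h0 : m j0 (k j0) = 1 := by rw [hkj0, hk0]
    have ht : ∀ j, 1 ≤ m j (k j) := fun j => by
      by_cases hj : j = j0
      · rw [hj, h0]
      · exact hk1 j (by simp [hj])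
    have hsum : ∀ j, ∑ l, sb m 1 k j l = n - 1 := fun j => by have := sum_sb hm ht j; omega
    have hodd' : ∃ j l, Odd (sb m 1 k j l) := by
      obtain ⟨l, hl, hl1⟩ : ∃ l, l ≠ k j0 ∧ m j0 l = 1 := by
        by_contra hcon
        push Not at hcon
        have := hm j0
        rw [Finset.sum_eq_single (k j0) (fun l _ hl => by
          have := hS l; have := hcon l hl; omega) (by simp)] at this
        omega
      exact ⟨j0, l, by rw [sb_ne _ hl, hl1]; decide⟩
    refine step_free hm ht j0 h0 le_rfl (by omega) (by rw [common k hkm]; exact hβ) h2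
      ⟨j0, k j0, by rw [h0]; decide⟩ hodd' ?_
    refine ih (n - 1) (by omega) _ (by omega) hsum (fun l => ?_) hodd' ?_
    · have := sb_add ht j0 l; have := h2 l; omega
    · by_cases hn3 : n = 2
      · left; omega
      right
      constructor
      · rw [alpha_sb hm ht (by omega), ← Finset.add_sum_erase _ (fun j => (n : ℤ) - m j (k j)) (Finset.mem_univ j0),
          common k hkm, h0, ← Finset.add_sum_erase _ _ (Finset.mem_univ j0), Nat.cast_sub hn]
        have hs0 : sq m j0 ≤ n * 1 := by simpa using sq_le hm j0 1 hS
        have hE : ∑ j ∈ Finset.univ.erase j0, ((n : ℤ) - mx m j) = n + e := by rw [he]; ring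
        rw [hE]
        rcases (show e = 0 ∨ 1 ≤ e by omega) with h | h
        · push_cast; nlinarith
        · push_cast; nlinarith
      · apply beta_sb (by omega)
        have hT := num_T1 (Finset.univ.erase j0) n e (sq m j0) (fun j => m j (k j)) (sq m)
          (fun j => (mx (sb m 1 k) j : ℤ) - (m j (k j) - (1 : ℕ))) (by omega) (by omega)
          (by rw [common k hkm, he]; ring) (fun j _ => by exact_mod_cast sum_ge_one hm j _)
          (fun j _ => by positivity) (fun j _ => sq_ge_max j _) (fun j hj => by
            have : Nonempty Λ := ⟨k0⟩
            rcases drop_sb hm ht j (hkle j hj) _ rfl with h | ⟨h1, h3, h4, h5⟩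
            · left; exact h
            · right
              generalize hDD : (mx (sb m 1 k) j : ℤ) - (m j (k j) - (1 : ℕ)) = D at *
              have hD1 : D = 1 := by push_cast at *; omega
              rw [hD1] at h4 h5
              refine ⟨hD1, by push_cast at *; omega, ?_⟩
              push_cast at h5
              nlinarith) (Or.inr ⟨sq_ge hm j0, hα'⟩)
        rw [common k hkm]
        push_cast at *
        linarith
  · push Not at hS
    obtain ⟨k0, hk0⟩ := hS
    have hk0 : m j0 k0 = 2 := by have := h2 k0; omega
    obtain ⟨k, hkj0, hkm, hkle, hk1⟩ := exists_k hn hm j0 k0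
    have h0 : m j0 (k j0) = 2 := by rw [hkj0, hk0]
    have ht : ∀ j, 1 ≤ m j (k j) := fun j => by
      by_cases hj : j = j0
      · rw [hj, h0]; omega
      · exact hk1 j (by simp [hj])
    have hNe : Nonempty Λ := ⟨k0⟩
    have hs2 := sq_ge_add hm j0 k0 hk0
    by_cases hee : e = 0
    · -- case R2
      have hr2 : ∑ j ∈ Finset.univ.erase j0, ((n : ℤ) - m j (k j)) = n := by
        rw [common k hkm]; linarith
      have hM2 := num_M2 (Finset.univ.erase j0) n (sq m j0) (fun j => m j (k j)) (sq m)
        (by omega) hr2 (fun j _ => by exact_mod_cast sum_ge_one hm j _)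
        (fun j _ => by exact_mod_cast ht j) (fun j _ => sq_ge_max j _) (fun j _ => sq_ge hm j) hs2 hα'
      have ht2 : ∀ j, 2 ≤ m j (k j) := fun j => by
        by_cases hj : j = j0
        · rw [hj, h0]
        · exact_mod_cast hM2 j (by simp [hj])
      have hn3 : 3 ≤ n := by
        by_contra hcon
        have : ∑ j ∈ Finset.univ.erase j0, ((n : ℤ) - m j (k j)) ≤ 0 :=
          Finset.sum_nonpos fun j _ => by have := ht2 j; omega
        omega
      have hsum : ∀ j, ∑ l, sb m 2 k j l = n - 2 := fun j => by have := sum_sb hm ht2 j; omega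
      have hodd' : ∃ j l, Odd (sb m 2 k j l) := by
        obtain ⟨j, l, hjl⟩ := hodd
        refine ⟨j, l, ?_⟩
        rw [sb_add ht2] at hjl
        rw [Nat.odd_iff] at hjl ⊢; omega
      refine step_free hm ht2 j0 h0 (by norm_num) (by omega) hr2.ge h2 hodd hodd' ?_
      refine ih (n - 2) (by omega) _ (by omega) hsum (fun l => ?_) hodd' ?_
      · have := sb_add ht2 j0 l; have := h2 l; omega
      · by_cases hn4 : n = 3
        · left; omega
        right
        constructor
        · rw [alpha_sb hm ht2 (by omega), ← Finset.add_sum_erase _ (fun j => (n : ℤ) - m j (k j)) (Finset.mem_univ j0),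
            hr2, h0, Nat.cast_sub (by omega)]
          push_cast; nlinarith
        · apply beta_sb (by omega)
          have hT := num_T2 (Finset.univ.erase j0) n (sq m j0) (fun j => m j (k j)) (sq m)
            (fun j => (mx (sb m 2 k) j : ℤ) - (m j (k j) - (2 : ℕ))) (by omega)
            hr2 (fun j _ => by exact_mod_cast sum_ge_one hm j _)
            (fun j _ => by positivity) (fun j _ => sq_ge_max j _) (fun j hj => by
              rcases drop_sb hm ht2 j (hkle j hj) _ rfl with h | ⟨h1, h3, h4, h5⟩
              · left; exact h
              · right
                generalize hDD : (mx (sb m 2 k) j : ℤ) - (m j (k j) - (2 : ℕ)) = D at *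
                rcases (show D = 1 ∨ D = 2 by push_cast at *; omega) with hD1 | hD1
                · left
                  rw [hD1] at h4 h5
                  refine ⟨hD1, by push_cast at *; omega, ?_⟩
                  push_cast at h5
                  nlinarith
                · right
                  rw [hD1] at h4 h5
                  refine ⟨hD1, by push_cast at *; omega, ?_⟩
                  push_cast at h5
                  nlinarith) hs2 hα'
          rw [hr2]
          push_cast at *
          linarith
    · -- case D
      have he1 : 1 ≤ e := by omega
      have hsum : ∀ j, ∑ l, sb m 1 k j l = n - 1 := fun j => by have := sum_sb hm ht j; omega
      refine step_def hm ht j0 h0 hn2 (by rw [common k hkm]; linarith) h2 hodd ?_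
      refine ih (n - 1) (by omega) _ (by omega) hsum (fun l => ?_)
        ⟨j0, k j0, by rw [sb_eq, h0]; decide⟩ ?_
      · have := sb_add ht j0 l; have := h2 l; omega
      · by_cases hn3 : n = 2
        · left; omega
        right
        constructor
        · rw [alpha_sb hm ht (by omega), ← Finset.add_sum_erase _ (fun j => (n : ℤ) - m j (k j)) (Finset.mem_univ j0),
            common k hkm, h0, ← Finset.add_sum_erase _ _ (Finset.mem_univ j0), Nat.cast_sub hn]
          have hs0 : sq m j0 ≤ n * 2 := by simpa using sq_le hm j0 2 h2
          have hE : ∑ j ∈ Finset.univ.erase j0, ((n : ℤ) - mx m j) = n + e := by rw [he]; ring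
          rw [hE]
          rcases (show e = 1 ∨ 2 ≤ e by omega) with h | h
          · push_cast; nlinarith
          · push_cast; nlinarith
        · apply beta_sb (by omega)
          have hT := num_T1 (Finset.univ.erase j0) n e (sq m j0) (fun j => m j (k j)) (sq m)
            (fun j => (mx (sb m 1 k) j : ℤ) - (m j (k j) - (1 : ℕ))) (by omega) (by omega)
            (by rw [common k hkm, he]; ring) (fun j _ => by exact_mod_cast sum_ge_one hm j _)
            (fun j _ => by positivity) (fun j _ => sq_ge_max j _) (fun j hj => by
              rcases drop_sb hm ht j (hkle j hj) _ rfl with h | ⟨h1, h3, h4, h5⟩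
              · left; exact h
              · right
                generalize hDD : (mx (sb m 1 k) j : ℤ) - (m j (k j) - (1 : ℕ)) = D at *
                have hD1 : D = 1 := by push_cast at *; omega
                rw [hD1] at h4 h5
                refine ⟨hD1, by push_cast at *; omega, ?_⟩
                push_cast at h5
                nlinarith) (Or.inl he1)
          rw [common k hkm]
          push_cast at *
          linarith

end plain3
end DSP

namespace DSP

section frob

theorem pseries {a : ℕ → ℂ} {R : ℝ} (h : ∀ r, 0 ≤ r → r < R → Summable fun n => ‖a n‖ * r ^ n)
    {z : ℂ} (hz : ‖z‖ < R) : ∃ d, HasSum (fun n : ℕ => ((n : ℂ) + 1) * a (n + 1) * z ^ n) d ∧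
      HasDerivAt (fun w => ∑' n, a n * w ^ n) d z := by
  obtain ⟨r, hr1, hr2⟩ := exists_between hz
  have hr0 : 0 ≤ r := (norm_nonneg z).trans hr1.le
  have hle : ∀ (n : ℕ) (w : ℂ), w ∈ Metric.ball (0 : ℂ) r → ‖a n * w ^ n‖ ≤ ‖a n‖ * r ^ n := by
    intro n w hw
    rw [norm_mul, norm_pow]
    have : ‖w‖ ≤ r := by simpa using (mem_ball_zero_iff.1 hw).le
    gcongr
  have hzm : z ∈ Metric.ball (0 : ℂ) r := by simpa using hr1
  have hd : ∀ n : ℕ, DifferentiableOn ℂ (fun w : ℂ => a n * w ^ n) (Metric.ball 0 r) := fun n => by fun_prop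
  have h1 := Complex.hasSum_deriv_of_summable_norm (h r hr0 hr2) hd Metric.isOpen_ball hle hzm
  have h2 := Complex.differentiableOn_tsum_of_summable_norm (h r hr0 hr2) hd Metric.isOpen_ball hle
  refine ⟨_, ?_, (h2.differentiableAt (Metric.isOpen_ball.mem_nhds hzm)).hasDerivAt⟩
  have h3 : (fun n : ℕ => deriv (fun w : ℂ => a n * w ^ n) z) = fun n : ℕ => a n * (n * z ^ (n - 1)) := by
    funext n; simp
  rw [h3, ← hasSum_nat_add_iff' 1] at h1
  simp at h1
  have e : (fun n : ℕ => a (n + 1) * (((n : ℂ) + 1) * z ^ n)) = fun n : ℕ => ((n : ℂ) + 1) * a (n + 1) * z ^ n := by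
    funext n; ring
  rw [e] at h1
  exact h1

variable {ι : Type*} [Fintype ι] [DecidableEq ι]

/-- coefficients of the formal local solution -/
noncomputable def fK (μ : ι → ℂ) (B : ℕ → Matrix ι ι ℂ) : ℕ → Matrix ι ι ℂ
  | 0 => 1
  | (m + 1) => Matrix.of fun i k => (∑ l : Fin (m + 1), (B (m - l) * fK μ B l)) i k / ((m : ℂ) + 1 - μ i + μ k)
  termination_by m => m
  decreasing_by exact l.isLt

theorem fK_rec (μ : ι → ℂ) (B : ℕ → Matrix ι ι ℂ)
    (hres : ∀ (m : ℕ) i k, (m : ℂ) + 1 - μ i + μ k ≠ 0 ∨ (m = 0 ∧ B 0 i k = 0)) (m : ℕ) (i k : ι) :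
    ((m : ℂ) + 1 - μ i + μ k) * fK μ B (m + 1) i k
      = ∑ l ∈ Finset.range (m + 1), (B (m - l) * fK μ B l) i k := by
  have h : fK μ B (m + 1) i k
      = (∑ l ∈ Finset.range (m + 1), (B (m - l) * fK μ B l) i k) / ((m : ℂ) + 1 - μ i + μ k) := by
    rw [fK, Matrix.of_apply, Matrix.sum_apply, Finset.sum_range]
  rw [h]
  rcases hres m i k with h1 | ⟨h1, h2⟩
  · rw [mul_div_cancel₀ _ h1]
  · subst h1
    simp [fK, h2]

set_option maxHeartbeats 1000000 in
theorem fK_summable (μ : ι → ℂ) (B : ℕ → Matrix ι ι ℂ) {C R : ℝ} (hR : 0 < R)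
    (hB : ∀ k i p, ‖B k i p‖ ≤ C / R ^ k) (i k : ι) (r : ℝ) (hr : 0 ≤ r) (hrR : r < R) :
    Summable fun n => ‖fK μ B n i k‖ * r ^ n := by
  have hC : 0 ≤ C := by
    have := (norm_nonneg _).trans (hB 0 i k); simpa using this
  obtain ⟨u, hu⟩ : ∃ u : ℕ → ℝ, u = fun n => ∑ i, ∑ k, ‖fK μ B n i k‖ := ⟨_, rfl⟩
  have hu0 : ∀ n, 0 ≤ u n := fun n => by rw [hu]; exact Finset.sum_nonneg fun _ _ => Finset.sum_nonneg fun _ _ => norm_nonneg _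
  have hcol : ∀ n k, ∑ p, ‖fK μ B n p k‖ ≤ u n := fun n k => by
    rw [hu]
    exact Finset.sum_le_sum fun p _ =>
      Finset.single_le_sum (f := fun k => ‖fK μ B n p k‖) (fun _ _ => norm_nonneg _) (Finset.mem_univ k)
  have hent : ∀ n i k, ‖fK μ B n i k‖ ≤ u n := fun n i k =>
    (Finset.single_le_sum (f := fun p => ‖fK μ B n p k‖) (fun _ _ => norm_nonneg _) (Finset.mem_univ i)).trans
      (hcol n k)
  obtain ⟨S, hS⟩ : ∃ S : ℕ → ℝ, S = fun n => ∑ l ∈ Finset.range n, u l * R ^ l := ⟨_, rfl⟩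
  have hS0 : ∀ n, 0 ≤ S n := fun n => by rw [hS]; exact Finset.sum_nonneg fun l _ => mul_nonneg (hu0 l) (by positivity)
  have hrhs : ∀ (m : ℕ) i k, R ^ m * ‖∑ l ∈ Finset.range (m + 1), (B (m - l) * fK μ B l) i k‖ ≤ C * S (m + 1) := by
    intro m i k
    rw [hS, Finset.mul_sum]
    refine (mul_le_mul_of_nonneg_left (norm_sum_le _ _) (by positivity)).trans ?_
    rw [Finset.mul_sum]
    refine Finset.sum_le_sum fun l hl => ?_
    have hlm : l ≤ m := by simp at hl; omega
    have : ‖(B (m - l) * fK μ B l) i k‖ ≤ C / R ^ (m - l) * u l := by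
      rw [Matrix.mul_apply]
      refine (norm_sum_le _ _).trans ?_
      refine le_trans ?_ (mul_le_mul_of_nonneg_left (hcol l k) (by positivity))
      rw [Finset.mul_sum]
      refine Finset.sum_le_sum fun p _ => ?_
      rw [norm_mul]
      exact mul_le_mul_of_nonneg_right (hB _ _ _) (norm_nonneg _)
    refine (mul_le_mul_of_nonneg_left this (by positivity)).trans (le_of_eq ?_)
    have : R ^ m = R ^ (m - l) * R ^ l := by rw [← pow_add]; congr 1; omega
    rw [this]; field_simp
  obtain ⟨D, hD⟩ : ∃ D : ℝ, D = ∑ i, ∑ k, ‖μ i - μ k‖ := ⟨_, rfl⟩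
  have hDik : ∀ i k, ‖μ i - μ k‖ ≤ D := fun i k => by
    rw [hD]
    exact (Finset.single_le_sum (f := fun k => ‖μ i - μ k‖) (fun _ _ => norm_nonneg _) (Finset.mem_univ k)).trans
      (Finset.single_le_sum (f := fun i => ∑ k, ‖μ i - μ k‖) (fun _ _ => Finset.sum_nonneg fun _ _ => norm_nonneg _)
        (Finset.mem_univ i))
  obtain ⟨c, hc⟩ : ∃ c : ℝ, c = (Fintype.card ι) * (Fintype.card ι) * (C * R * 2) := ⟨_, rfl⟩
  have hc0 : 0 ≤ c := by rw [hc]; positivity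
  have hstep : ∀ m : ℕ, 2 * D ≤ m + 1 → u (m + 1) * R ^ (m + 1) ≤ c / (m + 1) * S (m + 1) := by
    intro m hm
    have hk : ∀ i k, ‖fK μ B (m + 1) i k‖ * R ^ (m + 1) ≤ C * R * 2 / (m + 1) * S (m + 1) := by
      intro i k
      rw [fK, Matrix.of_apply, Matrix.sum_apply, ← Finset.sum_range (f := fun l => (B (m - l) * fK μ B l) i k), norm_div]
      have hden : ((m : ℝ) + 1) / 2 ≤ ‖(m : ℂ) + 1 - μ i + μ k‖ := by
        have e : (m : ℂ) + 1 - μ i + μ k = ((m : ℂ) + 1) - (μ i - μ k) := by ring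
        have h1 := norm_sub_norm_le ((m : ℂ) + 1) (μ i - μ k)
        have h2 : ‖(m : ℂ) + 1‖ = m + 1 := by
          have : (m : ℂ) + 1 = ((m + 1 : ℕ) : ℂ) := by push_cast; rfl
          rw [this, Complex.norm_natCast]; push_cast; rfl
        rw [e]
        have := hDik i k
        linarith
      have hpos : 0 < ((m : ℝ) + 1) / 2 := by positivity
      have h3 := hrhs m i k
      calc _ = R * (R ^ m * ‖∑ l ∈ Finset.range (m + 1), (B (m - l) * fK μ B l) i k‖) / ‖(m : ℂ) + 1 - μ i + μ k‖ := by
            rw [pow_succ]; ring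
        _ ≤ R * (C * S (m + 1)) / (((m : ℝ) + 1) / 2) := by
            have := hS0 (m + 1)
            gcongr
        _ = _ := by field_simp
    calc u (m + 1) * R ^ (m + 1) = ∑ i, ∑ k, ‖fK μ B (m + 1) i k‖ * R ^ (m + 1) := by
          rw [hu]; simp only [Finset.sum_mul]
      _ ≤ ∑ i : ι, ∑ k : ι, C * R * 2 / (m + 1) * S (m + 1) :=
          Finset.sum_le_sum fun i _ => Finset.sum_le_sum fun k _ => hk i k
      _ = _ := by
          simp only [Finset.sum_const, Finset.card_univ, nsmul_eq_mul]; rw [hc]; ring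
  obtain ⟨s, hs⟩ : ∃ s : ℝ, s = r / R := ⟨_, rfl⟩
  have hs0 : 0 ≤ s := by rw [hs]; positivity
  have hs1 : s < 1 := by rw [hs]; exact (div_lt_one hR).2 hrR
  have hlim : Filter.Tendsto (fun m : ℕ => (1 + c / ((m : ℝ) + 1)) * s) Filter.atTop (nhds ((1 + 0) * s)) := by
    refine (tendsto_const_nhds.add ?_).mul_const s
    have := tendsto_one_div_add_atTop_nhds_zero_nat (𝕜 := ℝ)
    have h4 := this.const_mul c
    simpa [div_eq_mul_inv] using h4
  obtain ⟨q, hq1, hq2⟩ := exists_between hs1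
  have hev : ∀ᶠ m : ℕ in Filter.atTop, ‖S (m + 1 + 1) * s ^ (m + 1)‖ ≤ q * ‖S (m + 1) * s ^ m‖ := by
    have e1 := hlim.eventually (gt_mem_nhds (show (1 + 0) * s < q by simpa using hq1))
    have e2 : ∀ᶠ m : ℕ in Filter.atTop, 2 * D ≤ (m : ℝ) :=
      tendsto_natCast_atTop_atTop.eventually_ge_atTop _
    filter_upwards [e1, e2] with m h1 h2
    rw [Real.norm_of_nonneg (mul_nonneg (hS0 _) (by positivity)), Real.norm_of_nonneg (mul_nonneg (hS0 _) (by positivity))]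
    have h5 := hstep m (by linarith)
    have h6 : S (m + 1 + 1) = S (m + 1) + u (m + 1) * R ^ (m + 1) := by rw [hS]; exact Finset.sum_range_succ _ _
    have h7 : S (m + 1 + 1) ≤ (1 + c / (m + 1)) * S (m + 1) := by rw [h6]; linarith
    calc S (m + 1 + 1) * s ^ (m + 1) ≤ ((1 + c / (m + 1)) * S (m + 1)) * s ^ (m + 1) :=
          mul_le_mul_of_nonneg_right h7 (pow_nonneg hs0 _)
      _ = ((1 + c / (m + 1)) * s) * (S (m + 1) * s ^ m) := by rw [pow_succ]; ring
      _ ≤ q * (S (m + 1) * s ^ m) :=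
        mul_le_mul_of_nonneg_right h1.le (mul_nonneg (hS0 (m + 1)) (pow_nonneg hs0 m))
  have hsum : Summable fun m => S (m + 1) * s ^ m :=
    summable_of_ratio_norm_eventually_le hq2 hev
  refine Summable.of_nonneg_of_le (fun n => by positivity) (fun n => ?_) hsum
  have h8 : u n * R ^ n ≤ S (n + 1) := by
    rw [hS]; exact Finset.single_le_sum (f := fun l => u l * R ^ l) (fun l _ => mul_nonneg (hu0 l) (by positivity)) (by simp)
  calc ‖fK μ B n i k‖ * r ^ n ≤ u n * r ^ n := mul_le_mul_of_nonneg_right (hent n i k) (by positivity)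
    _ = (u n * R ^ n) * s ^ n := by rw [hs, div_pow]; field_simp
    _ ≤ _ := mul_le_mul_of_nonneg_right h8 (pow_nonneg hs0 _)

theorem geom_pole {c z : ℂ} (h : ‖z‖ < ‖c‖) :
    HasSum (fun n : ℕ => -(c⁻¹) ^ (n + 1) * z ^ n) (z - c)⁻¹ ∧
    Summable (fun n : ℕ => ‖-(c⁻¹) ^ (n + 1) * z ^ n‖) := by
  have hc : c ≠ 0 := by rintro rfl; simp at h; exact absurd h (not_lt.2 (norm_nonneg _))
  have hq : ‖c⁻¹ * z‖ < 1 := by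
    rw [norm_mul, norm_inv, inv_mul_lt_iff₀ (norm_pos_iff.2 hc)]; simpa using h
  have e : (fun n : ℕ => -(c⁻¹) ^ (n + 1) * z ^ n) = fun n : ℕ => (-c⁻¹) * (c⁻¹ * z) ^ n := by
    funext n; rw [mul_pow, pow_succ]; ring
  rw [e]
  constructor
  · have h1 := (hasSum_geometric_of_norm_lt_one hq).mul_left (-c⁻¹)
    have h3 : 1 - c⁻¹ * z = -c⁻¹ * (z - c) := by
      rw [mul_sub, neg_mul, neg_mul, inv_mul_cancel₀ hc]; ring
    have h4 : (z - c)⁻¹ = -c⁻¹ * (1 - c⁻¹ * z)⁻¹ := by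
      rw [h3, _root_.mul_inv_rev, inv_neg, inv_inv, mul_comm _ (-c), ← mul_assoc, neg_mul_neg, inv_mul_cancel₀ hc, one_mul]
    rw [h4]
    exact h1
  · have h5 : (fun n : ℕ => ‖-(c⁻¹) ^ (n + 1) * z ^ n‖) = fun n : ℕ => ‖-c⁻¹‖ * ‖c⁻¹ * z‖ ^ n := by
      funext n; rw [congrFun e n, norm_mul, norm_pow]
    rw [h5]
    exact (summable_geometric_of_lt_one (norm_nonneg _) hq).mul_left _

/-- Local solutions of a Fuchsian system in the diagonal, logarithm-free case. -/
theorem frob {J : Type*} [Fintype J] (c : J → ℂ) (A : J → Matrix ι ι ℂ) (μ : ι → ℂ) {R : ℝ} (hR : 0 < R)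
    (hc : ∀ l, R ≤ ‖c l‖)
    (hres : ∀ (m : ℕ) i k, (m : ℂ) + 1 - μ i + μ k ≠ 0 ∨ (m = 0 ∧ (∑ l, (c l)⁻¹ • A l) i k = 0)) :
    ∃ H : ℂ → Matrix ι ι ℂ, H 0 = 1 ∧ ∀ z, ‖z‖ < R → ∀ i k, ∃ d, HasDerivAt (fun w => H w i k) d z ∧
      z * (d - ((∑ l, (z - c l)⁻¹ • A l) * H z) i k) = (μ i - μ k) * H z i k ∧
      (μ i = μ k → d = ((∑ l, (z - c l)⁻¹ • A l) * H z) i k) := by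
  obtain ⟨B, hB⟩ : ∃ B : ℕ → Matrix ι ι ℂ, B = fun k => ∑ l, (-((c l)⁻¹) ^ (k + 1)) • A l := ⟨_, rfl⟩
  have hBa : ∀ k i p, B k i p = ∑ l, -((c l)⁻¹) ^ (k + 1) * A l i p := by
    intro k i p; rw [hB]; simp [Matrix.sum_apply]
  have hB0 : B 0 = -∑ l, (c l)⁻¹ • A l := by rw [hB]; simp
  obtain ⟨C, hC⟩ : ∃ C : ℝ, ∀ k i p, ‖B k i p‖ ≤ C / R ^ k := by
    refine ⟨∑ l, ∑ i, ∑ p, R⁻¹ * ‖A l i p‖, fun k i p => ?_⟩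
    rw [hBa, Finset.sum_div]
    refine (norm_sum_le _ _).trans (Finset.sum_le_sum fun l _ => ?_)
    have h1 : R⁻¹ * ‖A l i p‖ ≤ ∑ i, ∑ p, R⁻¹ * ‖A l i p‖ :=
      (Finset.single_le_sum (f := fun p => R⁻¹ * ‖A l i p‖) (fun _ _ => by positivity) (Finset.mem_univ p)).trans
      (Finset.single_le_sum (f := fun i => ∑ p, R⁻¹ * ‖A l i p‖)
        (fun _ _ => Finset.sum_nonneg fun _ _ => by positivity) (Finset.mem_univ i))
    have h2 : ‖(c l)⁻¹‖ ≤ R⁻¹ := by rw [norm_inv]; exact inv_anti₀ hR (hc l)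
    rw [norm_mul, norm_neg, norm_pow]
    calc ‖(c l)⁻¹‖ ^ (k + 1) * ‖A l i p‖ ≤ R⁻¹ ^ (k + 1) * ‖A l i p‖ := by gcongr
      _ = (R⁻¹ * ‖A l i p‖) / R ^ k := by rw [pow_succ, inv_pow]; field_simp
      _ ≤ _ := by gcongr
  have hrec := fK_rec μ B (fun m i k => by
    rcases hres m i k with h | ⟨h, h'⟩
    · exact Or.inl h
    · exact Or.inr ⟨h, by rw [hB0, Matrix.neg_apply, h', neg_zero]⟩)
  have hsm := fK_summable μ B hR hC
  obtain ⟨K, hK⟩ : ∃ K, K = fK μ B := ⟨_, rfl⟩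
  have hK0 : K 0 = 1 := by rw [hK, fK]
  rw [← hK] at hrec hsm
  refine ⟨fun z => Matrix.of fun i k => ∑' n, K n i k * z ^ n, ?_, ?_⟩
  · ext i k
    show (∑' n, K n i k * (0 : ℂ) ^ n) = _
    rw [tsum_eq_single 0 (by intro n hn; simp [hn])]
    simp [hK0]
  intro z hz i k
  obtain ⟨d, hd1, hd2⟩ := pseries (hsm i k) hz
  have hKz : ∀ p k, Summable fun n => ‖K n p k * z ^ n‖ := fun p k => by
    simpa [norm_mul, norm_pow] using hsm p k ‖z‖ (norm_nonneg _) hz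
  have hg := fun l => geom_pole (lt_of_lt_of_le hz (hc l))
  have hBz : ∀ p, HasSum (fun n => B n i p * z ^ n) ((∑ l, (z - c l)⁻¹ • A l) i p) := by
    intro p
    have h1 := hasSum_sum (s := Finset.univ) fun l (_ : l ∈ Finset.univ) => (hg l).1.mul_right (A l i p)
    simp only [Matrix.sum_apply, Matrix.smul_apply, smul_eq_mul]
    have e : (fun n => B n i p * z ^ n) = fun n => ∑ l, -((c l)⁻¹) ^ (n + 1) * z ^ n * A l i p := by
      funext n
      rw [hBa, Finset.sum_mul]
      exact Finset.sum_congr rfl fun l _ => by ring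
    rw [e]
    exact h1
  have hBn : ∀ p, Summable fun n => ‖B n i p * z ^ n‖ := by
    intro p
    have h1 := summable_sum (s := Finset.univ) fun l (_ : l ∈ Finset.univ) => (hg l).2.mul_right ‖A l i p‖
    refine Summable.of_nonneg_of_le (fun n => norm_nonneg _) (fun n => ?_) h1
    rw [hBa, Finset.sum_mul]
    refine (norm_sum_le _ _).trans (le_of_eq (Finset.sum_congr rfl fun l _ => ?_))
    rw [← norm_mul]; congr 1; ring
  have hBH : HasSum (fun n => (∑ l ∈ Finset.range (n + 1), (B (n - l) * K l) i k) * z ^ n)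
      (((∑ l, (z - c l)⁻¹ • A l) * Matrix.of fun i k => ∑' n, K n i k * z ^ n) i k) := by
    rw [Matrix.mul_apply]
    have h1 := hasSum_sum (s := Finset.univ) fun p (_ : p ∈ Finset.univ) =>
      hasSum_sum_range_mul_of_summable_norm (hKz p k) (hBn p)
    have e1 : (fun n => (∑ l ∈ Finset.range (n + 1), (B (n - l) * K l) i k) * z ^ n)
        = fun n => ∑ p, ∑ l ∈ Finset.range (n + 1), K l p k * z ^ l * (B (n - l) i p * z ^ (n - l)) := by
      funext n
      rw [Finset.sum_comm, Finset.sum_mul]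
      refine Finset.sum_congr rfl fun l hl => ?_
      rw [Matrix.mul_apply, Finset.sum_mul]
      refine Finset.sum_congr rfl fun p _ => ?_
      have : z ^ n = z ^ l * z ^ (n - l) := by rw [← pow_add]; congr 1; simp at hl; omega
      rw [this]; ring
    have e2 : ∑ p, (∑ l, (z - c l)⁻¹ • A l) i p * (Matrix.of fun i k => ∑' n, K n i k * z ^ n) p k
        = ∑ p, (∑' n, K n p k * z ^ n) * ∑' n, B n i p * z ^ n := by
      refine Finset.sum_congr rfl fun p _ => ?_
      rw [(hBz p).tsum_eq, Matrix.of_apply, mul_comm]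
    rw [e1, e2]
    exact h1
  have hdiff := hd1.sub hBH
  have hcoef : ∀ n : ℕ, ((n : ℂ) + 1) * K (n + 1) i k * z ^ n
      - (∑ l ∈ Finset.range (n + 1), (B (n - l) * K l) i k) * z ^ n = (μ i - μ k) * K (n + 1) i k * z ^ n := by
    intro n; rw [← hrec]; ring
  simp only [hcoef] at hdiff
  refine ⟨d, hd2, ?_, ?_⟩
  · have h1 := hdiff.mul_left z
    have h2 := ((hKz i k).of_norm.hasSum.mul_left (μ i - μ k))
    rw [← hasSum_nat_add_iff' 1] at h2
    have h0 : (μ i - μ k) * K 0 i k = 0 := by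
      rw [hK0]; by_cases h : i = k
      · simp [h]
      · simp [Matrix.one_apply_ne h]
    simp only [Finset.range_one, Finset.sum_singleton, pow_zero, mul_one, h0, sub_zero] at h2
    refine h1.unique ?_
    have e : (fun n => z * ((μ i - μ k) * K (n + 1) i k * z ^ n)) = fun n => (μ i - μ k) * (K (n + 1) i k * z ^ (n + 1)) := by
      funext n
      rw [pow_succ]; ring
    rw [e]
    exact h2
  · intro h
    simp only [h, sub_self, zero_mul] at hdiff
    have := hdiff.unique hasSum_zero
    exact sub_eq_zero.1 this

end frob
end DSP

namespace DSP

section sol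
variable {ι : Type*} [Fintype ι] [DecidableEq ι] {κ : Type*} [Fintype κ] [DecidableEq κ]
  {κ' : Type*} [Fintype κ'] [DecidableEq κ']

/-- `Y` solves `Y' = A Y` on `U` -/
def SolOn (A : ℂ → Matrix ι ι ℂ) (Y : ℂ → Matrix ι κ ℂ) (U : Set ℂ) : Prop :=
  ∀ z ∈ U, ∀ i k, HasDerivAt (fun z => Y z i k) ((A z * Y z) i k) z

theorem SolOn.mono {A : ℂ → Matrix ι ι ℂ} {Y : ℂ → Matrix ι κ ℂ} {U V : Set ℂ} (h : SolOn A Y U)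
    (hV : V ⊆ U) : SolOn A Y V := fun z hz => h z (hV hz)

theorem SolOn.mul_const {A : ℂ → Matrix ι ι ℂ} {Y : ℂ → Matrix ι κ ℂ} {U : Set ℂ} (h : SolOn A Y U)
    (C : Matrix κ κ' ℂ) : SolOn A (fun z => Y z * C) U := by
  intro z hz i k
  have h1 : HasDerivAt (fun z => ∑ p, Y z i p * C p k) (∑ p, (A z * Y z) i p * C p k) z :=
    HasDerivAt.fun_sum fun p _ => (h z hz i p).mul_const _
  rw [← Matrix.mul_assoc]
  exact h1

theorem SolOn.sub {A : ℂ → Matrix ι ι ℂ} {Y Z : ℂ → Matrix ι κ ℂ} {U : Set ℂ} (h : SolOn A Y U)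
    (h' : SolOn A Z U) : SolOn A (fun z => Y z - Z z) U := by
  intro z hz i k
  rw [Matrix.mul_sub]
  exact (h z hz i k).sub (h' z hz i k)

/-- pull back along a holomorphic map -/
theorem SolOn.comp {A : ℂ → Matrix ι ι ℂ} {Y : ℂ → Matrix ι κ ℂ} {U V : Set ℂ} (h : SolOn A Y U)
    {f f' : ℂ → ℂ} (hf : ∀ z ∈ V, f z ∈ U ∧ HasDerivAt f (f' z) z) :
    SolOn (fun z => f' z • A (f z)) (fun z => Y (f z)) V := by
  intro z hz i k
  have h1 := (h (f z) (hf z hz).1 i k).comp z (hf z hz).2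
  rw [Matrix.smul_mul, Matrix.smul_apply, smul_eq_mul, mul_comm]
  exact h1

/-- gauge transformation on the left -/
theorem SolOn.gauge {ι' : Type*} [Fintype ι'] [DecidableEq ι']
    {A : ℂ → Matrix ι ι ℂ} {B : ℂ → Matrix ι' ι' ℂ} {Y : ℂ → Matrix ι κ ℂ} {U : Set ℂ} (h : SolOn A Y U)
    {X : ℂ → Matrix ι' ι ℂ}
    (hX : ∀ z ∈ U, ∀ i k, HasDerivAt (fun z => X z i k) ((B z * X z - X z * A z) i k) z) :
    SolOn B (fun z => X z * Y z) U := by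
  intro z hz i k
  have h1 : HasDerivAt (fun z => ∑ p, X z i p * Y z p k)
      (∑ p, ((B z * X z - X z * A z) i p * Y z p k + X z i p * (A z * Y z) p k)) z :=
    HasDerivAt.fun_sum fun p _ => (hX z hz i p).mul (h z hz p k)
  have e : (B z * (X z * Y z)) i k
      = ∑ p, ((B z * X z - X z * A z) i p * Y z p k + X z i p * (A z * Y z) p k) := by
    rw [Finset.sum_add_distrib, ← Matrix.mul_apply, ← Matrix.mul_apply, Matrix.sub_mul, Matrix.sub_apply,
      Matrix.mul_assoc, Matrix.mul_assoc]
    ring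
  rw [e]
  exact h1

theorem SolOn.uniq {A : ℂ → Matrix ι ι ℂ} {Y : ℂ → Matrix ι κ ℂ} {U : Set ℂ} (h : SolOn A Y U)
    (hU : Convex ℝ U) (hA : ∀ i k, ContinuousOn (fun z => A z i k) U) {z₀ : ℂ} (hz₀ : z₀ ∈ U)
    (h0 : Y z₀ = 0) {z : ℂ} (hz : z ∈ U) : Y z = 0 := by
  ext i k
  obtain ⟨γ, hγ⟩ : ∃ γ : ℝ → ℂ, γ = fun t : ℝ => z₀ + (t : ℂ) * (z - z₀) := ⟨_, rfl⟩
  have hγd : ∀ t, HasDerivAt γ (z - z₀) t := by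
    intro t
    rw [hγ]
    have := ((Complex.ofRealCLM.hasDerivAt (x := t)).mul_const (z - z₀)).const_add z₀
    simpa using this
  have hγU : ∀ t ∈ Set.Icc (0 : ℝ) 1, γ t ∈ U := by
    intro t ht
    have := hU.add_smul_sub_mem hz₀ hz ht
    rw [hγ]; simpa using this
  obtain ⟨f, hf⟩ : ∃ f : ℝ → ι → ℂ, f = fun t i => Y (γ t) i k := ⟨_, rfl⟩
  have hfd : ∀ t ∈ Set.Icc (0 : ℝ) 1, HasDerivAt f (fun i => (A (γ t) * Y (γ t)) i k * (z - z₀)) t := by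
    intro t ht
    rw [hasDerivAt_pi, hf]
    intro i
    exact (h (γ t) (hγU t ht) i k).comp t (hγd t)
  have hγc : Continuous γ := continuous_iff_continuousAt.2 fun t => (hγd t).continuousAt
  obtain ⟨g, hg⟩ : ∃ g : ℝ → ℝ, g = fun t => ∑ i, ∑ p, ‖A (γ t) i p‖ := ⟨_, rfl⟩
  have hgc : ContinuousOn g (Set.Icc 0 1) := by
    rw [hg]
    exact continuousOn_finsetSum _ fun i _ => continuousOn_finsetSum _ fun p _ =>
      ((hA i p).comp hγc.continuousOn hγU).norm
  obtain ⟨K, hK⟩ := isCompact_Icc.bddAbove_image hgc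
  have hK' : ∀ t ∈ Set.Icc (0 : ℝ) 1, g t ≤ K := fun t ht => hK (Set.mem_image_of_mem _ ht)
  have hmain := eq_zero_of_abs_deriv_le_mul_abs_self_of_eq_zero_right (f := f)
    (f' := fun t i => (A (γ t) * Y (γ t)) i k * (z - z₀)) (K := K * ‖z - z₀‖) (a := 0) (b := 1)
    (fun t ht => (hfd t ht).continuousAt.continuousWithinAt)
    (fun t ht => (hfd t (Set.Ico_subset_Icc_self ht)).hasDerivWithinAt)
    (by rw [hf]; funext i; simp [hγ, h0])
    (by
      intro t ht
      have ht' := hK' t (Set.Ico_subset_Icc_self ht)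
      have hKn : 0 ≤ K := le_trans (by rw [hg]; positivity) ht'
      refine (pi_norm_le_iff_of_nonneg (by positivity)).2 fun i => ?_
      rw [norm_mul, Matrix.mul_apply]
      have : ‖∑ p, A (γ t) i p * Y (γ t) p k‖ ≤ K * ‖f t‖ := by
        refine (norm_sum_le _ _).trans ?_
        calc ∑ p, ‖A (γ t) i p * Y (γ t) p k‖ ≤ ∑ p, ‖A (γ t) i p‖ * ‖f t‖ := by
              refine Finset.sum_le_sum fun p _ => ?_
              rw [norm_mul]
              have := norm_le_pi_norm (f t) p
              rw [hf] at this ⊢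
              gcongr
          _ = (∑ p, ‖A (γ t) i p‖) * ‖f t‖ := by rw [Finset.sum_mul]
          _ ≤ K * ‖f t‖ := by
              refine mul_le_mul_of_nonneg_right (le_trans ?_ ht') (norm_nonneg _)
              rw [hg]
              exact Finset.single_le_sum (f := fun i => ∑ p, ‖A (γ t) i p‖)
                (fun _ _ => Finset.sum_nonneg fun _ _ => norm_nonneg _) (Finset.mem_univ i)
      calc _ ≤ K * ‖f t‖ * ‖z - z₀‖ := mul_le_mul_of_nonneg_right this (norm_nonneg _)
        _ = _ := by ring)
    1 (by simp)
  have := congrFun hmain i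
  simpa [hf, hγ] using this

theorem SolOn.eqOn {A : ℂ → Matrix ι ι ℂ} {Y Z : ℂ → Matrix ι κ ℂ} {U : Set ℂ} (h : SolOn A Y U)
    (h' : SolOn A Z U)
    (hU : Convex ℝ U) (hA : ∀ i k, ContinuousOn (fun z => A z i k) U) {z₀ : ℂ} (hz₀ : z₀ ∈ U)
    (h0 : Y z₀ = Z z₀) {z : ℂ} (hz : z ∈ U) : Y z = Z z :=
  sub_eq_zero.1 ((h.sub h').uniq hU hA hz₀ (sub_eq_zero.2 h0) hz)

theorem SolOn.isUnit {A : ℂ → Matrix ι ι ℂ} {Y : ℂ → Matrix ι ι ℂ} {U : Set ℂ} (h : SolOn A Y U)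
    (hU : Convex ℝ U) (hA : ∀ i k, ContinuousOn (fun z => A z i k) U) {z₀ : ℂ} (hz₀ : z₀ ∈ U)
    (h0 : IsUnit (Y z₀)) {z : ℂ} (hz : z ∈ U) : IsUnit (Y z) := by
  rw [← Matrix.mulVec_injective_iff_isUnit]
  rw [← Matrix.mulVec_injective_iff_isUnit] at h0
  intro v w hvw
  rw [← sub_eq_zero] at hvw ⊢
  rw [← Matrix.mulVec_sub] at hvw
  apply h0
  rw [Matrix.mulVec_zero]
  have h1 := h.mul_const (Matrix.replicateCol Unit (v - w))
  have h2 := h1.uniq hU hA hz (by rw [← Matrix.replicateCol_mulVec, hvw]; rfl) hz₀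
  rw [← Matrix.replicateCol_mulVec] at h2
  funext i
  exact congrFun (congrFun h2 i) ()

/-- connection matrix -/
theorem SolOn.conn {A : ℂ → Matrix ι ι ℂ} {Y : ℂ → Matrix ι ι ℂ} {Z : ℂ → Matrix ι κ ℂ} {U : Set ℂ} (h : SolOn A Y U)
    (h' : SolOn A Z U) (hU : Convex ℝ U) (hA : ∀ i k, ContinuousOn (fun z => A z i k) U) {z₀ : ℂ} (hz₀ : z₀ ∈ U)
    (h0 : IsUnit (Y z₀)) : ∃ C : Matrix ι κ ℂ, ∀ z ∈ U, Z z = Y z * C := by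
  refine ⟨(Y z₀)⁻¹ * Z z₀, fun z hz => ?_⟩
  refine h'.eqOn (h.mul_const _) hU hA hz₀ ?_ hz
  rw [Matrix.mul_nonsing_inv_cancel_left _ _ ((Matrix.isUnit_iff_isUnit_det _).1 h0)]

end sol
end DSP

namespace DSP

section loc
variable {ι : Type*} [Fintype ι] [DecidableEq ι] {J : Type*} [Fintype J] [DecidableEq J]

/-- the Fuchsian coefficient matrix -/
noncomputable def fA (a : J → ℂ) (A : J → Matrix ι ι ℂ) (z : ℂ) : Matrix ι ι ℂ := ∑ l, (z - a l)⁻¹ • A l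

theorem fA_cont (a : J → ℂ) (A : J → Matrix ι ι ℂ) {U : Set ℂ} (hU : ∀ l, a l ∉ U) (i k : ι) :
    ContinuousOn (fun z => fA a A z i k) U := by
  have : (fun z => fA a A z i k) = fun z => ∑ l, (z - a l)⁻¹ * A l i k := by
    funext z; simp [fA, Matrix.sum_apply]
  rw [this]
  refine continuousOn_finsetSum _ fun l _ => ContinuousOn.mul (ContinuousOn.inv₀ (by fun_prop) ?_) continuousOn_const
  intro z hz h
  exact hU l (by rw [sub_eq_zero] at h; rwa [← h])

theorem local_sol (a : J → ℂ) (A : J → Matrix ι ι ℂ) (j : J) (g : (Matrix ι ι ℂ)ˣ) (μ : ι → ℂ)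
    (hA : A j = g.val * diagonal μ * (g⁻¹).val) {R : ℝ} (hR : 0 < R) (ha : ∀ i, i ≠ j → R ≤ ‖a i - a j‖)
    (hres : ∀ (m : ℕ) i k, (m : ℂ) + 1 - μ i + μ k ≠ 0 ∨
      (m = 0 ∧ (∑ l, (a l - a j)⁻¹ • ((g⁻¹).val * A l * g.val)) i k = 0)) :
    ∃ H : ℂ → Matrix ι ι ℂ, (∃ ε : ℝ, 0 < ε ∧ ∀ z, ‖z - a j‖ < ε → IsUnit (H z)) ∧
      ∀ (V : Set ℂ) (L : ℂ → ℂ), (∀ z ∈ V, ‖z - a j‖ < R ∧ z ≠ a j ∧ HasDerivAt L (z - a j)⁻¹ z) →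
        SolOn (fA a A) (fun z => H z * diagonal (fun k => Complex.exp (μ k * L z))) V := by
  obtain ⟨H, h0, hH⟩ := frob (J := {l // l ≠ j}) (fun l => a l - a j) (fun l => (g⁻¹).val * A l * g.val) μ hR
    (fun l => ha l l.2) (fun m i k => by
      rcases hres m i k with h | ⟨h, h'⟩
      · exact Or.inl h
      · refine Or.inr ⟨h, ?_⟩
        rw [Fintype.sum_eq_add_sum_subtype_ne _ j] at h'
        simpa using h')
  have gg : g.val * (g⁻¹).val = 1 := by rw [← Units.val_mul]; simp
  have gg' : (g⁻¹).val * g.val = 1 := by rw [← Units.val_mul]; simp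
  refine ⟨fun z => g.val * H (z - a j), ?_, ?_⟩
  · have hc : ContinuousAt (fun w => (H w).det) 0 := by
      have : ContinuousAt H 0 := by
        refine continuousAt_pi.2 fun i => continuousAt_pi.2 fun k => ?_
        obtain ⟨d, hd, -⟩ := hH 0 (by simpa using hR) i k
        exact hd.continuousAt
      exact (Continuous.matrix_det continuous_id).continuousAt.comp this
    have h1 : ∀ᶠ w in nhds (0 : ℂ), (H w).det ≠ 0 := hc.eventually_ne (by rw [h0]; simp)
    obtain ⟨ε, hε, h2⟩ := Metric.eventually_nhds_iff.1 h1
    refine ⟨ε, hε, fun z hz => ?_⟩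
    refine g.isUnit.mul ((Matrix.isUnit_iff_isUnit_det _).2 (isUnit_iff_ne_zero.2 (h2 (by simpa using hz))))
  · intro V L hV z hz
    obtain ⟨hz1, hz2, hL⟩ := hV z hz
    have hzn : z - a j ≠ 0 := sub_ne_zero.2 hz2
    obtain ⟨B, hB⟩ : ∃ B : Matrix ι ι ℂ, B = ∑ l : {l // l ≠ j}, (z - a j - (a l - a j))⁻¹ • ((g⁻¹).val * A l * g.val) :=
      ⟨_, rfl⟩
    have hsum : fA a A z * g.val = g.val * (B + (z - a j)⁻¹ • diagonal μ) := by
      rw [fA, Fintype.sum_eq_add_sum_subtype_ne _ j, hB, Matrix.mul_add, Matrix.add_mul, add_comm]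
      congr 1
      · rw [Matrix.sum_mul, Matrix.mul_sum]
        refine Finset.sum_congr rfl fun l _ => ?_
        rw [sub_sub_sub_cancel_right, Matrix.smul_mul, Matrix.mul_smul, ← Matrix.mul_assoc, ← Matrix.mul_assoc, gg,
          Matrix.one_mul]
      · rw [hA, Matrix.smul_mul, Matrix.mul_smul, Matrix.mul_assoc, gg', Matrix.mul_one]
    choose d hd1 hd2 hd3 using hH (z - a j) hz1
    have hexp : ∀ k, HasDerivAt (fun w => Complex.exp (μ k * L w)) (Complex.exp (μ k * L z) * (μ k * (z - a j)⁻¹)) z :=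
      fun k => (hL.const_mul (μ k)).cexp
    have hHd : ∀ p k, HasDerivAt (fun w => H (w - a j) p k) (d p k) z := by
      intro p k
      have := (hd1 p k).comp z ((hasDerivAt_id z).sub_const (a j))
      rw [mul_one] at this
      exact this
    intro i k
    have h1 : HasDerivAt (fun w => (∑ p, g.val i p * H (w - a j) p k) * Complex.exp (μ k * L w))
      ((∑ p, g.val i p * d p k) * Complex.exp (μ k * L z) +
        (∑ p, g.val i p * H (z - a j) p k) * (Complex.exp (μ k * L z) * (μ k * (z - a j)⁻¹))) z :=
      (HasDerivAt.fun_sum fun p _ => (hHd p k).const_mul _).mul (hexp k)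
    have e1 : (fun w => (g.val * H (w - a j) * diagonal (fun k => Complex.exp (μ k * L w))) i k)
        = fun w => (∑ p, g.val i p * H (w - a j) p k) * Complex.exp (μ k * L w) := by
      funext w; rw [Matrix.mul_diagonal, Matrix.mul_apply]
    have e2 : (fA a A z * (g.val * H (z - a j) * diagonal (fun k => Complex.exp (μ k * L z)))) i k
      = (∑ p, g.val i p * d p k) * Complex.exp (μ k * L z) +
        (∑ p, g.val i p * H (z - a j) p k) * (Complex.exp (μ k * L z) * (μ k * (z - a j)⁻¹)) := by
      rw [← Matrix.mul_assoc, ← Matrix.mul_assoc, hsum, Matrix.mul_diagonal, Matrix.mul_assoc, Matrix.mul_apply]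
      rw [show (∑ p, g.val i p * d p k) * Complex.exp (μ k * L z) +
        (∑ p, g.val i p * H (z - a j) p k) * (Complex.exp (μ k * L z) * (μ k * (z - a j)⁻¹))
        = ((∑ p, g.val i p * d p k) + (∑ p, g.val i p * H (z - a j) p k) * (μ k * (z - a j)⁻¹)) * Complex.exp (μ k * L z)
        by ring]
      congr 1
      rw [Finset.sum_mul, ← Finset.sum_add_distrib]
      refine Finset.sum_congr rfl fun p _ => ?_
      rw [mul_assoc, ← mul_add]
      congr 1
      have h2 := hd2 p k
      rw [← hB] at h2
      rw [Matrix.add_mul, Matrix.add_apply, Matrix.smul_mul, Matrix.smul_apply, Matrix.diagonal_mul, smul_eq_mul]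
      field_simp
      linear_combination -h2
    simp only [e1, e2]
    exact h1

theorem plus_sol (a : J → ℂ) (ha : ∀ j, ‖a j‖ = 1) (A : J → Matrix ι ι ℂ) :
    ∃ Y : ℂ → Matrix ι ι ℂ, SolOn (fA a A) Y (Metric.ball 0 1) ∧ ∀ z ∈ Metric.ball (0 : ℂ) 1, IsUnit (Y z) := by
  obtain ⟨H, h0, hH⟩ := frob a A (fun _ => 0) one_pos (fun l => (ha l).ge) (fun m i k => Or.inl (by
    have : ((m + 1 : ℕ) : ℂ) ≠ 0 := Nat.cast_ne_zero.2 (Nat.succ_ne_zero m)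
    simpa using this))
  have hs : SolOn (fA a A) H (Metric.ball 0 1) := by
    intro z hz i k
    obtain ⟨d, h1, -, h3⟩ := hH z (by simpa using hz) i k
    rw [h3 rfl] at h1
    exact h1
  refine ⟨H, hs, fun z hz => hs.isUnit (convex_ball 0 1) (fA_cont a A fun l => ?_) (z₀ := 0) (by simp)
    (by rw [h0]; exact isUnit_one) hz⟩
  simp [ha]

theorem minus_sol (a : J → ℂ) (ha : ∀ j, ‖a j‖ = 1) (A : J → Matrix ι ι ℂ) (hsum : ∑ j, A j = 0) :
    ∃ Y : ℂ → Matrix ι ι ℂ, SolOn (fA a A) Y {z | 1 < ‖z‖} ∧ ∀ z ∈ {z : ℂ | 1 < ‖z‖}, IsUnit (Y z) := by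
  obtain ⟨Y, h1, h2⟩ := plus_sol (fun j => (a j)⁻¹) (fun j => by rw [norm_inv, ha, inv_one]) A
  have hb : ∀ z ∈ {z : ℂ | 1 < ‖z‖}, z⁻¹ ∈ Metric.ball (0 : ℂ) 1 := by
    intro z hz
    rw [mem_ball_zero_iff, norm_inv]
    exact inv_lt_one_of_one_lt₀ hz
  refine ⟨fun z => Y z⁻¹, ?_, fun z hz => h2 _ (hb z hz)⟩
  intro z hz
  have hz0 : z ≠ 0 := by rintro rfl; simp at hz; linarith
  have h3 := h1.comp (V := {z : ℂ | 1 < ‖z‖}) (f := fun z => z⁻¹) (f' := fun z => -(z ^ 2)⁻¹) (fun z hz => ⟨hb z hz, by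
    have hz0 : z ≠ 0 := by rintro rfl; simp at hz; linarith
    exact hasDerivAt_inv hz0⟩) z hz
  have e : (-(z ^ 2)⁻¹) • fA (fun j => (a j)⁻¹) A z⁻¹ = fA a A z := by
    have e2 : fA a A z = fA a A z - z⁻¹ • ∑ l, A l := by rw [hsum]; simp
    rw [e2, fA, fA, Finset.smul_sum, Finset.smul_sum, ← Finset.sum_sub_distrib]
    refine Finset.sum_congr rfl fun l _ => ?_
    rw [smul_smul, ← sub_smul]
    congr 1
    have hal : a l ≠ 0 := by intro h; have := ha l; rw [h] at this; simp at this
    have hzl : z - a l ≠ 0 := by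
      intro h; rw [sub_eq_zero] at h; rw [h] at hz; have := ha l; simp at hz; linarith
    have hzl' : a l - z ≠ 0 := by rw [← neg_sub]; exact neg_ne_zero.2 hzl
    have e3 : z⁻¹ - (a l)⁻¹ = (a l - z) / (z * a l) := by field_simp
    have e4 : a l - z = -(z - a l) := by ring
    rw [e3, inv_div, e4]
    field_simp
    ring
  rw [← e]
  exact h3

end loc
end DSP

namespace DSP

section lm
variable {ι : Type*} [Fintype ι] [DecidableEq ι] {J : Type*} [Fintype J] [DecidableEq J]

def rReg (b : ℂ) (R : ℝ) : Set ℂ := {z | ‖z - b‖ < R ∧ -Complex.I * (z / b - 1) ∈ Complex.slitPlane}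
def lReg (b : ℂ) (R : ℝ) : Set ℂ := {z | ‖z - b‖ < R ∧ Complex.I * (z / b - 1) ∈ Complex.slitPlane}
def upReg (b : ℂ) (R : ℝ) : Set ℂ := {z | ‖z - b‖ < R ∧ ‖z‖ < 1}
def loReg (b : ℂ) (R : ℝ) : Set ℂ := {z | ‖z - b‖ < R ∧ 1 < (z / b).re}

theorem upReg_convex (b : ℂ) (R : ℝ) : Convex ℝ (upReg b R) := by
  have : upReg b R = Metric.ball b R ∩ Metric.ball 0 1 := by
    ext z; simp [upReg, dist_eq_norm]
  rw [this]; exact (convex_ball _ _).inter (convex_ball _ _)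

theorem loReg_convex (b : ℂ) (R : ℝ) : Convex ℝ (loReg b R) := by
  have : loReg b R = Metric.ball b R ∩ {z | 1 < (z / b).re} := by
    ext z; simp [loReg, dist_eq_norm]
  rw [this]; refine (convex_ball _ _).inter (convex_halfSpace_gt (f := fun z : ℂ => (z / b).re) ?_ 1)
  exact ⟨fun x y => by simp [add_div], fun c x => by simp [mul_div_assoc]⟩

theorem re_lt_of_upReg {b : ℂ} (hb : ‖b‖ = 1) {R : ℝ} {z : ℂ} (hz : z ∈ upReg b R) : (z / b).re < 1 := by
  have h1 := Complex.re_le_norm (z / b)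
  rw [norm_div, hb, div_one] at h1
  exact h1.trans_lt hz.2

theorem norm_gt_of_loReg {b : ℂ} (hb : ‖b‖ = 1) {R : ℝ} {z : ℂ} (hz : z ∈ loReg b R) : 1 < ‖z‖ := by
  have h1 := Complex.re_le_norm (z / b)
  rw [norm_div, hb, div_one] at h1
  exact hz.2.trans_le h1

theorem slit_r {w : ℂ} (h : w.re ≠ 1) : -Complex.I * (w - 1) ∈ Complex.slitPlane := by
  right; simp; intro h'; apply h; linarith

theorem slit_l {w : ℂ} (h : w.re ≠ 1) : Complex.I * (w - 1) ∈ Complex.slitPlane := by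
  right; simp; intro h'; apply h; linarith

theorem log_lt {w : ℂ} (h : w.re < 1) :
    Complex.log (Complex.I * (w - 1)) = Complex.log (-Complex.I * (w - 1)) - Real.pi * Complex.I := by
  have e : Complex.I * (w - 1) = -(-Complex.I * (w - 1)) := by ring
  rw [e, Complex.log, Complex.log, norm_neg, Complex.arg_neg_eq_arg_sub_pi_of_im_pos (by simp; linarith)]
  push_cast; ring

theorem log_gt {w : ℂ} (h : 1 < w.re) :
    Complex.log (Complex.I * (w - 1)) = Complex.log (-Complex.I * (w - 1)) + Real.pi * Complex.I := by
  have e : Complex.I * (w - 1) = -(-Complex.I * (w - 1)) := by ring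
  rw [e, Complex.log, Complex.log, norm_neg, Complex.arg_neg_eq_arg_add_pi_of_im_neg (by simp; linarith)]
  push_cast; ring

theorem log_deriv {b : ℂ} (hb : b ≠ 0) (ε : ℂ) (hε : ε ≠ 0) {z : ℂ} (h : ε * (z / b - 1) ∈ Complex.slitPlane) :
    HasDerivAt (fun z => Complex.log (ε * (z / b - 1))) (z - b)⁻¹ z := by
  have h1 : HasDerivAt (fun z => ε * (z / b - 1)) (ε * (1 / b)) z :=
    (((hasDerivAt_id z).div_const b).sub_const 1).const_mul ε
  have h2 := h1.clog h
  have hz : z - b ≠ 0 := by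
    intro h0; rw [sub_eq_zero] at h0; rw [h0, div_self hb] at h; simp at h
  have e : ε * (1 / b) / (ε * (z / b - 1)) = (z - b)⁻¹ := by
    have : z / b - 1 = (z - b) / b := by field_simp
    rw [this]; field_simp
  rwa [e] at h2

theorem isUnit_diag_exp (v : ι → ℂ) : IsUnit (diagonal (fun k => Complex.exp (v k))) := by
  rw [Matrix.isUnit_iff_isUnit_det, det_diagonal, isUnit_iff_ne_zero]
  exact Finset.prod_ne_zero_iff.2 fun k _ => Complex.exp_ne_zero _

theorem local_mono (a : J → ℂ) (ha1 : ∀ j, ‖a j‖ = 1) (A : J → Matrix ι ι ℂ) (j : J) (g : (Matrix ι ι ℂ)ˣ) (μ : ι → ℂ)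
    (hA : A j = g.val * diagonal μ * (g⁻¹).val) {R : ℝ} (hR : 0 < R) (ha : ∀ i, i ≠ j → R ≤ ‖a i - a j‖)
    (hres : ∀ (m : ℕ) i k, (m : ℂ) + 1 - μ i + μ k ≠ 0 ∨
      (m = 0 ∧ (∑ l, (a l - a j)⁻¹ • ((g⁻¹).val * A l * g.val)) i k = 0))
    {Yp Ym : ℂ → Matrix ι ι ℂ} (hYp : SolOn (fA a A) Yp (Metric.ball 0 1))
    (hYpu : ∀ z ∈ Metric.ball (0 : ℂ) 1, IsUnit (Yp z))
    (hYm : SolOn (fA a A) Ym {z | 1 < ‖z‖}) (hYmu : ∀ z ∈ {z : ℂ | 1 < ‖z‖}, IsUnit (Ym z)) :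
    ∃ (Fr Fl : ℂ → Matrix ι ι ℂ) (T T' : Matrix ι ι ℂ), IsUnit T ∧
      SolOn (fA a A) Fr (rReg (a j) R) ∧ SolOn (fA a A) Fl (lReg (a j) R) ∧
      (∀ z ∈ upReg (a j) R, Fr z = Yp z ∧ Fl z = Yp z) ∧
      (∀ z ∈ loReg (a j) R, Fr z = Ym z * T ∧ Fl z = Ym z * T') ∧
      Sim (diagonal fun k => Complex.exp (2 * Real.pi * Complex.I * μ k)) (T' * T⁻¹) := by
  obtain ⟨H, ⟨ε, hε, hHu⟩, hH⟩ := local_sol a A j g μ hA hR ha hres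
  have hb : a j ≠ 0 := by intro h; have := ha1 j; rw [h] at this; simp at this
  have hdist : ∀ i, ∀ z, ‖z - a j‖ < R → z ≠ a j → z ≠ a i := by
    rintro i z hz hzj rfl
    by_cases hij : i = j
    · rw [hij] at hzj; exact hzj rfl
    · exact absurd hz (not_lt.2 (ha i hij))
  have hne : ∀ {c : ℂ} {z : ℂ}, c * (z / a j - 1) ∈ Complex.slitPlane → z ≠ a j := by
    rintro c z h rfl; rw [div_self hb] at h; simp at h
  obtain ⟨Yr, hYr⟩ : ∃ Yr : ℂ → Matrix ι ι ℂ, Yr = fun z =>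
    H z * diagonal (fun k => Complex.exp (μ k * Complex.log (-Complex.I * (z / a j - 1)))) := ⟨_, rfl⟩
  obtain ⟨Yl, hYl⟩ : ∃ Yl : ℂ → Matrix ι ι ℂ, Yl = fun z =>
    H z * diagonal (fun k => Complex.exp (μ k * Complex.log (Complex.I * (z / a j - 1)))) := ⟨_, rfl⟩
  have sr : SolOn (fA a A) Yr (rReg (a j) R) := by
    rw [hYr]
    exact hH _ _ fun z hz => ⟨hz.1, hne hz.2, log_deriv hb _ (by simp) hz.2⟩
  have sl : SolOn (fA a A) Yl (lReg (a j) R) := by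
    rw [hYl]
    exact hH _ _ fun z hz => ⟨hz.1, hne hz.2, log_deriv hb _ (by simp) hz.2⟩
  have ur : ∀ z, ‖z - a j‖ < ε → IsUnit (Yr z) := fun z hz => by
    rw [hYr]; exact (hHu z hz).mul (isUnit_diag_exp _)
  obtain ⟨E, hE⟩ : ∃ E : Matrix ι ι ℂ, E = diagonal fun k => Complex.exp (Real.pi * Complex.I * μ k) := ⟨_, rfl⟩
  obtain ⟨E', hE'⟩ : ∃ E : Matrix ι ι ℂ, E = diagonal fun k => Complex.exp (-(Real.pi * Complex.I * μ k)) := ⟨_, rfl⟩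
  have lr1 : ∀ z, (z / a j).re < 1 → Yl z = Yr z * E' := by
    intro z hz
    rw [hYl, hYr, hE']
    simp only
    rw [log_lt hz, Matrix.mul_assoc, diagonal_mul_diagonal]
    congr 2; funext k
    rw [← Complex.exp_add]; congr 1; ring
  have lr2 : ∀ z, 1 < (z / a j).re → Yl z = Yr z * E := by
    intro z hz
    rw [hYl, hYr, hE]
    simp only
    rw [log_gt hz, Matrix.mul_assoc, diagonal_mul_diagonal]
    congr 2; funext k
    rw [← Complex.exp_add]; congr 1; ring
  have EE : E' * E = 1 := by
    rw [hE, hE', diagonal_mul_diagonal, ← diagonal_one]; congr 1; funext k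
    rw [← Complex.exp_add]; simp
  have hup : upReg (a j) R ⊆ rReg (a j) R := fun z hz =>
    ⟨hz.1, slit_r (re_lt_of_upReg (ha1 j) hz).ne⟩
  have hlo : loReg (a j) R ⊆ rReg (a j) R := fun z hz => ⟨hz.1, slit_r hz.2.ne'⟩
  have cont : ∀ U : Set ℂ, U ⊆ rReg (a j) R → ∀ i k, ContinuousOn (fun z => fA a A z i k) U := by
    intro U hU
    refine fA_cont a A fun l hl => ?_
    exact hdist l _ (hU hl).1 (hne (hU hl).2) rfl
  obtain ⟨t, ht0, ht⟩ : ∃ t : ℝ, 0 < t ∧ t < min 1 (min ε R) := by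
    have : (0 : ℝ) < min 1 (min ε R) := by simp [hε, hR]
    exact exists_between this
  simp only [lt_min_iff] at ht
  obtain ⟨ht1, ht2, ht3⟩ := ht
  obtain ⟨zu, hzu⟩ : ∃ zu : ℂ, zu = a j * ((1 - t : ℝ) : ℂ) := ⟨_, rfl⟩
  obtain ⟨zl, hzl⟩ : ∃ zl : ℂ, zl = a j * ((1 + t : ℝ) : ℂ) := ⟨_, rfl⟩
  have nu : ‖zu - a j‖ = t := by
    have : zu - a j = a j * (-t : ℝ) := by rw [hzu]; push_cast; ring
    rw [this, norm_mul, ha1, Complex.norm_real, norm_neg, Real.norm_of_nonneg ht0.le, one_mul]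
  have nl : ‖zl - a j‖ = t := by
    have : zl - a j = a j * (t : ℝ) := by rw [hzl]; push_cast; ring
    rw [this, norm_mul, ha1, Complex.norm_real, Real.norm_of_nonneg ht0.le, one_mul]
  have mu : zu ∈ upReg (a j) R := by
    refine ⟨by rw [nu]; exact ht3, ?_⟩
    rw [hzu, norm_mul, ha1, Complex.norm_real, Real.norm_of_nonneg (by linarith)]; linarith
  have ml : zl ∈ loReg (a j) R := by
    refine ⟨by rw [nl]; exact ht3, ?_⟩
    rw [hzl, mul_div_cancel_left₀ _ hb, Complex.ofReal_re]; linarith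
  have upb : upReg (a j) R ⊆ Metric.ball 0 1 := fun z hz => by simpa using hz.2
  have lob : loReg (a j) R ⊆ {z | 1 < ‖z‖} := fun z hz => norm_gt_of_loReg (ha1 j) hz
  obtain ⟨P, hP⟩ := (sr.mono hup).conn (hYp.mono upb) (upReg_convex _ _) (cont _ hup) mu (ur _ (by rw [nu]; exact ht2))
  obtain ⟨Q, hQ⟩ := (sr.mono hlo).conn (hYm.mono lob) (loReg_convex _ _) (cont _ hlo) ml (ur _ (by rw [nl]; exact ht2))
  have uP : IsUnit P := by
    have h1 := hYpu zu (upb mu)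
    rw [hP zu mu] at h1
    rw [Matrix.isUnit_iff_isUnit_det, det_mul] at h1
    exact (Matrix.isUnit_iff_isUnit_det _).2 (isUnit_of_mul_isUnit_right h1)
  have uQ : IsUnit Q := by
    have h1 := hYmu zl (lob ml)
    rw [hQ zl ml] at h1
    rw [Matrix.isUnit_iff_isUnit_det, det_mul] at h1
    exact (Matrix.isUnit_iff_isUnit_det _).2 (isUnit_of_mul_isUnit_right h1)
  have dP := (Matrix.isUnit_iff_isUnit_det _).1 uP
  have dQ := (Matrix.isUnit_iff_isUnit_det _).1 uQ
  refine ⟨fun z => Yr z * P, fun z => Yl z * (E * P), Q⁻¹ * P, Q⁻¹ * (E * E * P), ?_, sr.mul_const _, sl.mul_const _,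
    ?_, ?_, ?_⟩
  · exact (Matrix.isUnit_nonsing_inv_iff.2 uQ).mul uP
  · intro z hz
    refine ⟨(hP z hz).symm, ?_⟩
    show Yl z * (E * P) = _
    rw [hP z hz, lr1 z (re_lt_of_upReg (ha1 j) hz), Matrix.mul_assoc, ← Matrix.mul_assoc E', EE, Matrix.one_mul]
  · intro z hz
    rw [hQ z hz]
    simp only
    rw [lr2 z hz.2]
    constructor
    · rw [Matrix.mul_assoc, Matrix.mul_nonsing_inv_cancel_left _ _ dQ]
    · rw [Matrix.mul_assoc (Yr z) Q, Matrix.mul_nonsing_inv_cancel_left _ _ dQ]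
      simp only [Matrix.mul_assoc]
  · have e : diagonal (fun k => Complex.exp (2 * Real.pi * Complex.I * μ k)) = E * E := by
      rw [hE, diagonal_mul_diagonal]; congr 1; funext k; rw [← Complex.exp_add]; congr 1; ring
    rw [e]
    refine ⟨Q, Q⁻¹, Matrix.mul_nonsing_inv _ dQ, Matrix.nonsing_inv_mul _ dQ, ?_⟩
    rw [Matrix.mul_inv_rev, Matrix.nonsing_inv_nonsing_inv _ dQ]
    simp only [Matrix.mul_assoc]
    rw [Matrix.mul_nonsing_inv_cancel_left _ _ dP, Matrix.mul_nonsing_inv _ dQ, Matrix.mul_nonsing_inv_cancel_left _ _ dQ, Matrix.mul_one]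

end lm
end DSP

namespace DSP

section geo

theorem sin_ge {N k : ℕ} (hN : 2 ≤ N) (hk : 1 ≤ k) (hkN : k < N) :
    Real.sin (Real.pi / N) ≤ Real.sin (k * (Real.pi / N)) := by
  have hN0 : (0 : ℝ) < N := by positivity
  have hpi := Real.pi_pos
  have hx : 0 < Real.pi / N := by positivity
  have hk1 : (1 : ℝ) ≤ k := by exact_mod_cast hk
  have hNx : N * (Real.pi / N) = Real.pi := by field_simp
  have hkN' : (k : ℝ) + 1 ≤ N := by exact_mod_cast hkN
  rcases le_total (k * (Real.pi / N)) (Real.pi / 2) with h | h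
  · exact Real.sin_le_sin_of_le_of_le_pi_div_two (by linarith) h (by nlinarith)
  · rw [← Real.sin_pi_sub (k * (Real.pi / N))]
    exact Real.sin_le_sin_of_le_of_le_pi_div_two (by linarith) (by linarith) (by nlinarith)

theorem norm_lt_iff_sq {x y : ℂ} : ‖x‖ < ‖y‖ ↔ x.re ^ 2 + x.im ^ 2 < y.re ^ 2 + y.im ^ 2 := by
  rw [← sq_lt_sq₀ (norm_nonneg _) (norm_nonneg _), Complex.sq_norm, Complex.sq_norm, Complex.normSq_apply,
    Complex.normSq_apply, ← pow_two, ← pow_two, ← pow_two, ← pow_two]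

set_option maxHeartbeats 1000000 in
theorem geo {N : ℕ} [NeZero N] (hN : 4 ≤ N) : ∃ (a p q : Fin N → ℂ) (R : ℝ), 0 < R ∧ (∀ j, ‖a j‖ = 1) ∧
    (∀ i j, i ≠ j → R ≤ ‖a i - a j‖) ∧
    ∀ j, p j ∈ upReg (a j) R ∧ p j ∈ upReg (a (j + 1)) R ∧ q j ∈ loReg (a j) R ∧ q j ∈ loReg (a (j + 1)) R ∧
      (∀ z, ‖z - a j‖ < R → ‖z - a (j + 1)‖ < R → z ∈ rReg (a j) R ∧ z ∈ lReg (a (j + 1)) R) := by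
  have hN0 : (0 : ℝ) < N := by positivity
  have hN4 : (4 : ℝ) ≤ N := by exact_mod_cast hN
  have hpi := Real.pi_pos
  obtain ⟨φ, hφ⟩ : ∃ φ : ℝ, φ = 2 * (Real.pi / N) := ⟨_, rfl⟩
  have hφ0 : 0 < φ := by rw [hφ]; positivity
  have hφ1 : φ ≤ Real.pi / 2 := by
    have : Real.pi / N ≤ Real.pi / 4 := by gcongr
    rw [hφ]; linarith
  obtain ⟨ω, hω⟩ : ∃ ω : ℂ, ω = Complex.exp (Complex.I * φ) := ⟨_, rfl⟩
  have hωre : ω.re = Real.cos φ := by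
    rw [hω, mul_comm, Complex.exp_mul_I]; simp [Complex.cos_ofReal_re, Complex.sin_ofReal_re]
  have hωim : ω.im = Real.sin φ := by
    rw [hω, mul_comm, Complex.exp_mul_I]; simp [Complex.cos_ofReal_re, Complex.sin_ofReal_re]
  obtain ⟨c, hc⟩ : ∃ c, c = Real.cos φ := ⟨_, rfl⟩
  obtain ⟨s, hs⟩ : ∃ s, s = Real.sin φ := ⟨_, rfl⟩
  have hcs : c ^ 2 + s ^ 2 = 1 := by rw [hc, hs]; exact Real.cos_sq_add_sin_sq φ
  have hs0 : 0 < s := by rw [hs]; exact Real.sin_pos_of_pos_of_lt_pi hφ0 (by linarith)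
  have hc0 : 0 ≤ c := by rw [hc]; exact Real.cos_nonneg_of_neg_pi_div_two_le_of_le (by linarith) hφ1
  have hc1 : c < 1 := by nlinarith
  rw [← hc] at hωre
  rw [← hs] at hωim
  have hω1 : ‖ω‖ = 1 := by rw [hω, mul_comm]; exact Complex.norm_exp_ofReal_mul_I φ
  have hω0 : ω ≠ 0 := by intro h; rw [h] at hω1; simp at hω1
  have hωN : ω ^ N = 1 := by
    rw [hω, ← Complex.exp_nat_mul, Complex.exp_eq_one_iff]
    refine ⟨1, ?_⟩
    have hNc : (N : ℂ) ≠ 0 := Nat.cast_ne_zero.2 (by omega)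
    rw [hφ]; push_cast; field_simp
  have hR0 : 0 < ‖ω - 1‖ := by
    rw [norm_pos_iff, sub_ne_zero]; intro h; rw [h] at hωim; simp at hωim; linarith
  have hdist : ∀ k : ℕ, 1 ≤ k → k < N → ‖ω - 1‖ ≤ ‖ω ^ k - 1‖ := by
    intro k hk1 hk2
    have e : ω ^ k = Complex.exp (Complex.I * ((k * φ : ℝ) : ℂ)) := by
      rw [hω, ← Complex.exp_nat_mul]; congr 1; push_cast; ring
    rw [e, hω, Complex.norm_exp_I_mul_ofReal_sub_one, Complex.norm_exp_I_mul_ofReal_sub_one]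
    have h1 := sin_ge (by omega) hk1 hk2
    have e1 : φ / 2 = Real.pi / N := by rw [hφ]; ring
    have e2 : k * φ / 2 = k * (Real.pi / N) := by rw [hφ]; ring
    rw [e1, e2]
    have h0 : 0 ≤ Real.sin (Real.pi / N) := Real.sin_nonneg_of_nonneg_of_le_pi (by positivity)
      (by rw [div_le_iff₀ hN0]; nlinarith)
    rw [Real.norm_of_nonneg (by linarith), Real.norm_of_nonneg (by linarith)]
    linarith
  obtain ⟨a, ha⟩ : ∃ a : Fin N → ℂ, a = fun j : Fin N => ω ^ (j : ℕ) := ⟨_, rfl⟩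
  have ha1 : ∀ j, ‖a j‖ = 1 := fun j => by rw [ha]; simp [hω1]
  have hane : ∀ j, a j ≠ 0 := fun j => by rw [ha]; exact pow_ne_zero _ hω0
  have hasucc : ∀ j, a (j + 1) = a j * ω := by
    intro j
    rw [ha]
    simp only
    rw [← pow_succ, Fin.val_add, ← pow_eq_pow_mod _ hωN]
    congr 2
    rw [Fin.val_one', Nat.mod_eq_of_lt (by omega)]
  -- normalized points
  obtain ⟨p0, hp0⟩ : ∃ p0 : ℂ, p0 = ⟨(1 + c) / 2, s / 2⟩ := ⟨_, rfl⟩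
  obtain ⟨t, ht⟩ : ∃ t : ℝ, t = (5 - c) / 4 / (1 + c) := ⟨_, rfl⟩
  have htc : t * (1 + c) = (5 - c) / 4 := by rw [ht]; field_simp
  have ht0 : 0 < t := by rw [ht]; apply div_pos <;> linarith
  obtain ⟨q0, hq0⟩ : ∃ q0 : ℂ, q0 = ⟨t * (1 + c), t * s⟩ := ⟨_, rfl⟩
  have hts : (t * s) ^ 2 = (5 - c) / 4 * t * (1 - c) := by
    rw [mul_pow]
    have : s ^ 2 = (1 - c) * (1 + c) := by linarith
    rw [this, ← htc]; ring
  have ht54 : t ≤ 5 / 4 := by rw [ht, div_le_iff₀ (by linarith)]; linarith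
  have hu1 : t * (5 - c) ≤ 25 / 4 := by nlinarith
  have scale : ∀ (w : ℂ) (j : Fin N), ‖a j * w - a j‖ = ‖w - 1‖ := by
    intro w j
    rw [show a j * w - a j = a j * (w - 1) by ring, norm_mul, ha1, one_mul]
  have scale' : ∀ (w : ℂ) (j : Fin N), ‖a j * w - a (j + 1)‖ = ‖w - ω‖ := by
    intro w j
    rw [hasucc, show a j * w - a j * ω = a j * (w - ω) by ring, norm_mul, ha1, one_mul]
  have hωω : ∀ w : ℂ, (w / ω).re = w.re * c + w.im * s := by
    intro w
    rw [Complex.div_re, hωre, hωim, Complex.normSq_apply, hωre, hωim]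
    have : c * c + s * s = 1 := by linarith
    rw [this]; ring
  have hωω' : ∀ w : ℂ, (w / ω).im = w.im * c - w.re * s := by
    intro w
    rw [Complex.div_im, hωre, hωim, Complex.normSq_apply, hωre, hωim]
    have : c * c + s * s = 1 := by linarith
    rw [this]; ring
  have hq1 : ‖q0 - 1‖ < ‖ω - 1‖ := by
    rw [norm_lt_iff_sq, hq0]; simp only [Complex.sub_re, Complex.sub_im, hωre, hωim, Complex.one_re, Complex.one_im, sub_zero]
    rw [htc, hts]; nlinarith
  have hq2 : ‖q0 - ω‖ < ‖ω - 1‖ := by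
    rw [norm_lt_iff_sq, hq0]; simp only [Complex.sub_re, Complex.sub_im, hωre, hωim, Complex.one_re, Complex.one_im, sub_zero]
    have e : (t * (1 + c) - c) ^ 2 + (t * s - s) ^ 2 = (t * (1 + c) - 1) ^ 2 + (t * s) ^ 2 := by
      linear_combination (1 - 2 * t) * hcs
    rw [e, htc, hts]; nlinarith
  have hp1 : ‖p0 - 1‖ < ‖ω - 1‖ := by
    rw [norm_lt_iff_sq, hp0]; simp only [Complex.sub_re, Complex.sub_im, hωre, hωim, Complex.one_re, Complex.one_im, sub_zero]
    nlinarith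
  have hp2 : ‖p0 - ω‖ < ‖ω - 1‖ := by
    rw [norm_lt_iff_sq, hp0]; simp only [Complex.sub_re, Complex.sub_im, hωre, hωim, Complex.one_re, Complex.one_im, sub_zero]
    nlinarith
  have hp3 : ‖p0‖ < 1 := by
    have : ‖p0‖ < ‖(1 : ℂ)‖ := by
      rw [norm_lt_iff_sq, hp0]; simp only [Complex.one_re, Complex.one_im]
      nlinarith
    simpa using this
  refine ⟨a, fun j => a j * p0, fun j => a j * q0, ‖ω - 1‖, hR0, ha1, ?_, ?_⟩
  · have key : ∀ i j : Fin N, i < j → ‖ω - 1‖ ≤ ‖a j - a i‖ := by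
      intro i j hij
      have hij' : (i : ℕ) < j := hij
      have e : a j - a i = a i * (ω ^ ((j : ℕ) - i) - 1) := by
        rw [ha]; simp only; rw [mul_sub, ← pow_add, Nat.add_sub_cancel' hij'.le, mul_one]
      rw [e, norm_mul, ha1, one_mul]
      exact hdist _ (by omega) (by omega)
    intro i j hij
    rcases lt_or_gt_of_ne hij with h | h
    · rw [norm_sub_rev (a i)]; exact key i j h
    · exact key j i h
  · intro j
    have hpn : ‖a j * p0‖ < 1 := by rw [norm_mul, ha1, one_mul]; exact hp3
    refine ⟨⟨by rw [scale]; exact hp1, hpn⟩, ⟨by rw [scale']; exact hp2, hpn⟩, ⟨by rw [scale]; exact hq1, ?_⟩,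
      ⟨by rw [scale']; exact hq2, ?_⟩, ?_⟩
    · rw [mul_div_cancel_left₀ _ (hane j), hq0]
      show 1 < t * (1 + c)
      rw [htc]; linarith
    · rw [hasucc, mul_div_mul_left _ _ (hane j), hωω, hq0]
      show 1 < t * (1 + c) * c + t * s * s
      have : t * (1 + c) * c + t * s * s = t * (1 + c) := by linear_combination t * hcs
      rw [this, htc]; linarith
    · intro z h1 h2
      obtain ⟨w, rfl⟩ : ∃ w, z = a j * w := ⟨z / a j, by rw [mul_div_cancel₀ _ (hane j)]⟩
      refine ⟨⟨h1, ?_⟩, ⟨h2, ?_⟩⟩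
      · rw [scale'] at h2
        rw [mul_div_cancel_left₀ _ (hane j)]
        rw [norm_lt_iff_sq] at h2
        simp only [Complex.sub_re, Complex.sub_im, hωre, hωim, Complex.one_re, Complex.one_im, sub_zero] at h2
        by_cases hre : w.re = 1
        · left
          simp
          rw [hre] at h2
          by_contra hcon
          push Not at hcon
          have h3 := mul_nonneg (neg_nonneg.2 hcon) hs0.le
          have h4 := sq_nonneg w.im
          have e : (1 - c) ^ 2 + (w.im - s) ^ 2 = (c - 1) ^ 2 + s ^ 2 + w.im ^ 2 + 2 * (-w.im * s) := by ring
          rw [e] at h2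
          linarith
        · exact slit_r hre
      · rw [scale] at h1
        rw [hasucc, mul_div_mul_left _ _ (hane j)]
        obtain ⟨v, rfl⟩ : ∃ v, w = v * ω := ⟨w / ω, by rw [div_mul_cancel₀ _ hω0]⟩
        rw [mul_div_cancel_right₀ _ hω0]
        rw [norm_lt_iff_sq] at h1
        simp only [Complex.sub_re, Complex.sub_im, hωre, hωim, Complex.one_re, Complex.one_im, sub_zero,
          Complex.mul_re, Complex.mul_im] at h1
        by_cases hre : v.re = 1
        · left
          simp
          rw [hre] at h1
          by_contra hcon
          push Not at hcon
          have h3 := mul_nonneg hcon hs0.le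
          have h4 := sq_nonneg v.im
          have e : (1 * c - v.im * s - 1) ^ 2 + (1 * s + v.im * c) ^ 2 = (c - 1) ^ 2 + s ^ 2 + v.im ^ 2 + 2 * (v.im * s) := by
            linear_combination v.im ^ 2 * hcs
          rw [e] at h1
          linarith
        · exact slit_l hre

end geo
end DSP

namespace DSP

section mono
variable {N : ℕ} [NeZero N] {ι : Type*} [Fintype ι] [DecidableEq ι] {ι' : Type*} [Fintype ι'] [DecidableEq ι']

/-- the configuration of poles -/
structure Pts (N : ℕ) [NeZero N] where
  a : Fin N → ℂ
  p : Fin N → ℂ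
  q : Fin N → ℂ
  R : ℝ
  hR : 0 < R
  ha : ∀ j, ‖a j‖ = 1
  hd : ∀ i j, i ≠ j → R ≤ ‖a i - a j‖
  hp : ∀ j, p j ∈ upReg (a j) R
  hp' : ∀ j, p j ∈ upReg (a (j + 1)) R
  hq : ∀ j, q j ∈ loReg (a j) R
  hq' : ∀ j, q j ∈ loReg (a (j + 1)) R
  hl : ∀ j, ∀ z, ‖z - a j‖ < R → ‖z - a (j + 1)‖ < R → z ∈ rReg (a j) R ∧ z ∈ lReg (a (j + 1)) R

theorem exists_pts (hN : 4 ≤ N) : Nonempty (Pts N) := by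
  obtain ⟨a, p, q, R, h1, h2, h3, h4⟩ := geo (N := N) hN
  exact ⟨⟨a, p, q, R, h1, h2, h3, fun j => (h4 j).1, fun j => (h4 j).2.1, fun j => (h4 j).2.2.1,
    fun j => (h4 j).2.2.2.1, fun j => (h4 j).2.2.2.2⟩⟩

def Pts.lens (X : Pts N) (j : Fin N) : Set ℂ := {z | ‖z - X.a j‖ < X.R ∧ ‖z - X.a (j + 1)‖ < X.R}

theorem Pts.lens_convex (X : Pts N) (j : Fin N) : Convex ℝ (X.lens j) := by
  have : X.lens j = Metric.ball (X.a j) X.R ∩ Metric.ball (X.a (j + 1)) X.R := by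
    ext z; simp [Pts.lens, dist_eq_norm]
  rw [this]; exact (convex_ball _ _).inter (convex_ball _ _)

theorem Pts.ne (X : Pts N) (j : Fin N) : X.a j ≠ 0 := by
  intro h; have := X.ha j; rw [h] at this; simp at this

theorem Pts.inj (X : Pts N) : Function.Injective X.a := by
  intro i j h
  by_contra hij
  have := X.hd i j hij
  rw [h, sub_self, norm_zero] at this
  exact absurd X.hR (not_lt.2 this)

theorem Pts.not_lens (X : Pts N) (j l : Fin N) : X.a l ∉ X.lens j := by
  intro h
  have h1 : l = j := by
    by_contra hlj; exact absurd h.1 (not_lt.2 (X.hd l j hlj))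
  have h2 := (X.hl j _ h.1 h.2).1.2
  rw [h1, div_self (X.ne j)] at h2
  simp at h2

theorem Pts.p_lens (X : Pts N) (j : Fin N) : X.p j ∈ X.lens j := ⟨(X.hp j).1, (X.hp' j).1⟩
theorem Pts.q_lens (X : Pts N) (j : Fin N) : X.q j ∈ X.lens j := ⟨(X.hq j).1, (X.hq' j).1⟩

/-- `T` is the collection of connection matrices of the Fuchsian system `A` -/
def IsMono (X : Pts N) (A T : Fin N → Matrix ι ι ℂ) : Prop :=
  ∃ (Yp Ym : ℂ → Matrix ι ι ℂ) (F : Fin N → ℂ → Matrix ι ι ℂ),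
    SolOn (fA X.a A) Yp (Metric.ball 0 1) ∧ (∀ z ∈ Metric.ball (0 : ℂ) 1, IsUnit (Yp z)) ∧
    SolOn (fA X.a A) Ym {z | 1 < ‖z‖} ∧ (∀ z ∈ {z : ℂ | 1 < ‖z‖}, IsUnit (Ym z)) ∧
    ∀ j, SolOn (fA X.a A) (F j) (X.lens j) ∧ F j (X.p j) = Yp (X.p j) ∧ F j (X.q j) = Ym (X.q j) * T j

theorem mono_exists (X : Pts N) (A : Fin N → Matrix ι ι ℂ) (hsum : ∑ j, A j = 0)
    (g : Fin N → (Matrix ι ι ℂ)ˣ) (μ : Fin N → ι → ℂ)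
    (hA : ∀ j, A j = (g j).val * diagonal (μ j) * ((g j)⁻¹).val)
    (hres : ∀ j, ∀ (m : ℕ) i k, (m : ℂ) + 1 - μ j i + μ j k ≠ 0 ∨
      (m = 0 ∧ (∑ l, (X.a l - X.a j)⁻¹ • (((g j)⁻¹).val * A l * (g j).val)) i k = 0)) :
    ∃ T, IsMono X A T ∧ (∀ j, IsUnit (T j)) ∧
      ∀ j, Sim (diagonal fun k => Complex.exp (2 * Real.pi * Complex.I * μ (j + 1) k)) (T j * (T (j + 1))⁻¹) := by
  obtain ⟨Yp, hp, hpu⟩ := plus_sol X.a X.ha A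
  obtain ⟨Ym, hm, hmu⟩ := minus_sol X.a X.ha A hsum
  choose Fr Fl T T' h1 h2 h3 h4 h5 h6 using fun j => local_mono X.a X.ha A j (g j) (μ j) (hA j) X.hR
    (fun i hi => X.hd i j hi) (hres j) hp hpu hm hmu
  have sr : ∀ j, SolOn (fA X.a A) (Fr j) (X.lens j) := fun j => (h2 j).mono fun z hz => (X.hl j z hz.1 hz.2).1
  have sl : ∀ j, SolOn (fA X.a A) (Fl (j + 1)) (X.lens j) := fun j =>
    (h3 (j + 1)).mono fun z hz => (X.hl j z hz.1 hz.2).2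
  have hTT : ∀ j, T' (j + 1) = T j := by
    intro j
    have e1 : Fr j (X.p j) = Fl (j + 1) (X.p j) := by
      rw [(h4 j _ (X.hp j)).1, (h4 (j + 1) _ (X.hp' j)).2]
    have e2 := (sr j).eqOn (sl j) (X.lens_convex j) (fA_cont X.a A (X.not_lens j)) (X.p_lens j) e1 (X.q_lens j)
    rw [(h5 j _ (X.hq j)).1, (h5 (j + 1) _ (X.hq' j)).2] at e2
    have hu := hmu _ (norm_gt_of_loReg (X.ha j) (X.hq j))
    exact (hu.mul_left_cancel e2).symm
  refine ⟨T, ⟨Yp, Ym, Fr, hp, hpu, hm, hmu, fun j => ⟨sr j, (h4 j _ (X.hp j)).1, (h5 j _ (X.hq j)).1⟩⟩, h1, fun j => ?_⟩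
  have := h6 (j + 1)
  rwa [hTT] at this

theorem tele (T : Fin N → Matrix ι ι ℂ) (hT : ∀ j, IsUnit (T j)) :
    (List.ofFn fun j : Fin N => T (j - 1) * (T j)⁻¹).prod = 1 := by
  have hsucc : ∀ k : ℕ, Fin.ofNat N (k + 1) = Fin.ofNat N k + 1 := by
    intro k; apply Fin.ext
    simp [Fin.val_add, Fin.val_one', Nat.add_mod]
  have hself : ∀ i : Fin N, Fin.ofNat N (i : ℕ) = i := fun i => Fin.ext (Nat.mod_eq_of_lt i.2)
  have h00 : Fin.ofNat N N = Fin.ofNat N 0 := Fin.ext (by simp)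
  have key : ∀ k : ℕ, (List.ofFn fun i : Fin k => T (Fin.ofNat N (i : ℕ) - 1) * (T (Fin.ofNat N (i : ℕ)))⁻¹).prod
      = T (Fin.ofNat N 0 - 1) * (T (Fin.ofNat N k - 1))⁻¹ := by
    intro k
    induction k with
    | zero => rw [Matrix.mul_nonsing_inv _ ((Matrix.isUnit_iff_isUnit_det _).1 (hT _))]; simp
    | succ k ih =>
      rw [List.ofFn_succ', List.concat_eq_append, List.prod_append]
      simp only [Fin.val_castSucc, Fin.val_last, List.prod_singleton]
      rw [ih, Matrix.mul_assoc, ← Matrix.mul_assoc (T (Fin.ofNat N k - 1))⁻¹,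
        Matrix.nonsing_inv_mul _ ((Matrix.isUnit_iff_isUnit_det _).1 (hT _)), Matrix.one_mul, hsucc, add_sub_cancel_right]
  have h := key N
  simp only [hself] at h
  rw [h, h00, Matrix.mul_nonsing_inv _ ((Matrix.isUnit_iff_isUnit_det _).1 (hT _))]

theorem functor (X : Pts N) {A T : Fin N → Matrix ι ι ℂ} {B T' : Fin N → Matrix ι' ι' ℂ}
    (hA : IsMono X A T) (hB : IsMono X B T') (hT : ∀ j, IsUnit (T j)) (hT' : ∀ j, IsUnit (T' j))
    (W : ℂ → Matrix ι ι' ℂ)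
    (hW : ∀ z, (∀ j, z ≠ X.a j) → ∀ i k, HasDerivAt (fun z => W z i k) ((fA X.a A z * W z - W z * fA X.a B z) i k) z) :
    ∃ S : Matrix ι ι' ℂ, (∀ j, T j * (T (j + 1))⁻¹ * S = S * (T' j * (T' (j + 1))⁻¹)) ∧
      (S = 0 → ∀ z, 1 < ‖z‖ → W z = 0) := by
  obtain ⟨Yp, Ym, F, hp, hpu, hm, hmu, hF⟩ := hA
  obtain ⟨Yp', Ym', F', hp', hpu', hm', hmu', hF'⟩ := hB
  have nb : ∀ l, X.a l ∉ Metric.ball (0 : ℂ) 1 := fun l => by simp [X.ha]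
  have ne : ∀ l, X.a l ∉ {z : ℂ | 1 < ‖z‖} := fun l => by simp [X.ha]
  have gau : ∀ {κ : Type _} [Fintype κ] [DecidableEq κ] {Y : ℂ → Matrix ι' κ ℂ} {U : Set ℂ},
      (∀ l, X.a l ∉ U) → SolOn (fA X.a B) Y U → SolOn (fA X.a A) (fun z => W z * Y z) U := by
    intro κ _ _ Y U hU hY
    exact hY.gauge fun z hz => hW z fun j hj => hU j (hj ▸ hz)
  obtain ⟨Sp, hSp⟩ := hp.conn (gau nb hp') (convex_ball 0 1) (fA_cont X.a A nb) (z₀ := 0) (by simp) (hpu 0 (by simp))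
  obtain ⟨S, hS⟩ : ∃ S : Matrix ι ι' ℂ, ∀ z, 1 < ‖z‖ → W z * Ym' z = Ym z * S := by
    have hre : ∀ u ∈ {u : ℂ | 0 < u.re}, Complex.exp u ∈ {z : ℂ | 1 < ‖z‖} ∧ HasDerivAt Complex.exp (Complex.exp u) u := by
      intro u hu
      refine ⟨?_, Complex.hasDerivAt_exp u⟩
      simp only [Set.mem_ofPred_eq, Complex.norm_exp] at hu ⊢
      exact Real.one_lt_exp_iff.2 hu
    have c1 := hm.comp hre
    have c2 := (gau ne hm').comp hre
    obtain ⟨S, hS⟩ := c1.conn c2 (convex_halfSpace_re_gt 0) (fun i k => by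
      simp only [Matrix.smul_apply, smul_eq_mul]
      refine Complex.continuous_exp.continuousOn.mul ?_
      exact (fA_cont X.a A ne i k).comp Complex.continuous_exp.continuousOn fun u hu => (hre u hu).1) (z₀ := 1)
      (by simp) (hmu _ (hre 1 (by simp)).1)
    refine ⟨S, fun z hz => ?_⟩
    have hz0 : z ≠ 0 := by rintro rfl; simp at hz; linarith
    have := hS (Complex.log z) (by simp only [Set.mem_ofPred_eq, Complex.log_re]; exact Real.log_pos hz)
    rwa [Complex.exp_log hz0] at this
  have hq : ∀ j, 1 < ‖X.q j‖ := fun j => norm_gt_of_loReg (X.ha j) (X.hq j)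
  have hST : ∀ j, S * T' j = T j * Sp := by
    intro j
    have s1 := gau (X.not_lens j) (hF' j).1
    have s2 := (hF j).1.mul_const Sp
    have e := s1.eqOn s2 (X.lens_convex j) (fA_cont X.a A (X.not_lens j)) (X.p_lens j)
      (by rw [(hF' j).2.1, (hF j).2.1]; exact hSp _ (by simpa using (X.hp j).2)) (X.q_lens j)
    rw [(hF' j).2.2, (hF j).2.2, ← Matrix.mul_assoc, hS _ (hq j), Matrix.mul_assoc, Matrix.mul_assoc] at e
    have hu := (Matrix.isUnit_iff_isUnit_det _).1 (hmu _ (hq j))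
    have := congrArg (fun M => (Ym (X.q j))⁻¹ * M) e
    simpa only [Matrix.nonsing_inv_mul_cancel_left _ _ hu] using this
  refine ⟨S, fun j => ?_, fun h z hz => ?_⟩
  · have d1 := (Matrix.isUnit_iff_isUnit_det _).1 (hT (j + 1))
    have d2 := (Matrix.isUnit_iff_isUnit_det _).1 (hT' (j + 1))
    have e1 : (T (j + 1))⁻¹ * S = Sp * (T' (j + 1))⁻¹ := by
      have h1 : S = T (j + 1) * Sp * (T' (j + 1))⁻¹ := by
        rw [← hST, Matrix.mul_nonsing_inv_cancel_right _ _ d2]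
      rw [h1, Matrix.mul_assoc (T (j + 1)), Matrix.nonsing_inv_mul_cancel_left _ _ d1]
    rw [Matrix.mul_assoc, e1, ← Matrix.mul_assoc, ← hST, Matrix.mul_assoc]
  · have h1 := hS z hz
    rw [h, Matrix.mul_zero] at h1
    have hu := (Matrix.isUnit_iff_isUnit_det _).1 (hmu' z hz)
    rw [← Matrix.mul_nonsing_inv_cancel_right _ (W z) hu, h1, Matrix.zero_mul]

end mono
end DSP

namespace DSP

section pad
variable {p : ℕ} {ι : Type*} [Fintype ι] [DecidableEq ι] {ι' : Type*} [Fintype ι'] [DecidableEq ι']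

/-- residues padded by a zero -/
def pad (A : Fin (p + 1) → Matrix ι ι ℂ) : Fin (p + 2) → Matrix ι ι ℂ := Fin.snoc A 0

theorem pad_cast (A : Fin (p + 1) → Matrix ι ι ℂ) (j : Fin (p + 1)) : pad A j.castSucc = A j := by
  simp [pad]
theorem pad_last (A : Fin (p + 1) → Matrix ι ι ℂ) : pad A (Fin.last (p + 1)) = 0 := by
  simp [pad]

/-- monodromy matrices from connection matrices -/
noncomputable def mon (T : Fin (p + 2) → Matrix ι ι ℂ) (j : Fin (p + 1)) : Matrix ι ι ℂ :=
  T (j.castSucc - 1) * (T j.castSucc)⁻¹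

theorem sim_one {M : Matrix ι ι ℂ} (h : Sim (1 : Matrix ι ι ℂ) M) : M = 1 := by
  obtain ⟨G, H, h1, h2, h3⟩ := h.symm
  rw [h3, Matrix.mul_one, h1]

theorem mono_pad (X : Pts (p + 2)) (A : Fin (p + 1) → Matrix ι ι ℂ) (hsum : ∑ j, A j = 0)
    (g : Fin (p + 1) → (Matrix ι ι ℂ)ˣ) (μ : Fin (p + 1) → ι → ℂ)
    (hA : ∀ j, A j = (g j).val * diagonal (μ j) * ((g j)⁻¹).val)
    (hres : ∀ j, ∀ (m : ℕ) i k, (m : ℂ) + 1 - μ j i + μ j k ≠ 0 ∨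
      (m = 0 ∧ (∑ l : Fin (p + 1), (X.a l.castSucc - X.a j.castSucc)⁻¹ • (((g j)⁻¹).val * A l * (g j).val)) i k = 0)) :
    ∃ T, IsMono X (pad A) T ∧ (∀ j, IsUnit (T j)) ∧
      (∀ j, Sim (diagonal fun k => Complex.exp (2 * Real.pi * Complex.I * μ j k)) (mon T j)) ∧
      (List.ofFn (mon T)).prod = 1 := by
  obtain ⟨T, h1, h2, h3⟩ := mono_exists X (pad A) (by rw [Fin.sum_univ_castSucc]; simp [pad_cast, pad_last, hsum])
    (Fin.snoc g 1) (Fin.snoc μ 0)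
    (fun j => by
      refine Fin.lastCases ?_ (fun j => ?_) j
      · simp [pad_last]
      · simp [pad_cast, hA])
    (fun j => by
      refine Fin.lastCases ?_ (fun j => ?_) j
      · intro m i k
        left
        have : ((m + 1 : ℕ) : ℂ) ≠ 0 := Nat.cast_ne_zero.2 (Nat.succ_ne_zero m)
        simpa using this
      · intro m i k
        rcases hres j m i k with h | h
        · left; simpa using h
        · right; rw [Fin.sum_univ_castSucc]; simpa [pad_cast, pad_last] using h)
  have h4 : ∀ j : Fin (p + 2), Sim (diagonal fun k => Complex.exp (2 * Real.pi * Complex.I *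
      (Fin.snoc (α := fun _ => ι → ℂ) μ 0 : Fin (p + 2) → ι → ℂ) j k)) (T (j - 1) * (T j)⁻¹) := by
    intro j
    have := h3 (j - 1)
    rwa [sub_add_cancel] at this
  refine ⟨T, h1, h2, fun j => ?_, ?_⟩
  · have := h4 j.castSucc
    rw [mon]
    simpa only [Fin.snoc_castSucc] using this
  · have h5 := tele T h2
    have h6 := h4 (Fin.last (p + 1))
    have h7 : T (Fin.last (p + 1) - 1) * (T (Fin.last (p + 1)))⁻¹ = 1 := by
      apply sim_one
      have e : (diagonal fun k : ι => Complex.exp (2 * Real.pi * Complex.I *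
        (Fin.snoc (α := fun _ => ι → ℂ) μ 0 : Fin (p + 2) → ι → ℂ) (Fin.last (p + 1)) k)) = 1 := by
        rw [← diagonal_one]; congr 1; funext k; simp
      rwa [e] at h6
    rw [List.ofFn_succ', List.concat_eq_append, List.prod_append, List.prod_singleton, h7, mul_one] at h5
    exact h5

theorem fA_pad (X : Pts (p + 2)) (A : Fin (p + 1) → Matrix ι ι ℂ) (z : ℂ) :
    fA X.a (pad A) z = ∑ j : Fin (p + 1), (z - X.a j.castSucc)⁻¹ • A j := by
  rw [fA, Fin.sum_univ_castSucc]; simp [pad_cast, pad_last]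

theorem kzero (X : Pts (p + 2)) {A : Fin (p + 1) → Matrix ι ι ℂ} {B : Fin (p + 1) → Matrix ι' ι' ℂ}
    {T : Fin (p + 2) → Matrix ι ι ℂ} {T' : Fin (p + 2) → Matrix ι' ι' ℂ}
    (hA : IsMono X (pad A) T) (hB : IsMono X (pad B) T') (hT : ∀ j, IsUnit (T j)) (hT' : ∀ j, IsUnit (T' j))
    (hsA : ∑ j, A j = 0) (hsB : ∑ j, B j = 0) (hS : ∀ S : Matrix ι ι' ℂ, (∀ j, mon T j * S = S * mon T' j) → S = 0)
    (h : Fin (p + 1)) (b E : Matrix ι ι' ℂ) (hE : A h * E - E * B h = -E)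
    (hb : ∀ j, j ≠ h → A j * (b + (X.a j.castSucc - X.a h.castSucc)⁻¹ • E)
      = (b + (X.a j.castSucc - X.a h.castSucc)⁻¹ • E) * B j) : b = 0 ∧ E = 0 := by
  obtain ⟨c, hc⟩ : ∃ c : Fin (p + 1) → ℂ, c = fun j => X.a j.castSucc := ⟨_, rfl⟩
  have hc' : ∀ j, X.a j.castSucc = c j := fun j => by rw [hc]
  have hcin : ∀ j, j ≠ h → c j - c h ≠ 0 := by
    intro j hj h0
    rw [hc, sub_eq_zero] at h0
    exact hj (Fin.castSucc_injective _ (X.inj h0))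
  simp only [hc'] at hb
  obtain ⟨W, hW⟩ : ∃ W : ℂ → Matrix ι ι' ℂ, W = fun z => b + (z - c h)⁻¹ • E := ⟨_, rfl⟩
  have key : ∀ z, (∀ j, z ≠ c j) → fA X.a (pad A) z * W z - W z * fA X.a (pad B) z = (-((z - c h) ^ 2)⁻¹) • E := by
    intro z hz
    rw [fA_pad, fA_pad, hW]
    simp only [hc']
    have hzh : z - c h ≠ 0 := sub_ne_zero.2 (hz h)
    rw [Matrix.sum_mul, Matrix.mul_sum, ← Finset.sum_sub_distrib]
    have hterm : ∀ j ∈ Finset.univ.erase h, ((z - c j)⁻¹ • A j * (b + (z - c h)⁻¹ • E)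
        - (b + (z - c h)⁻¹ • E) * (z - c j)⁻¹ • B j) = (z - c h)⁻¹ • (A j * b - b * B j) := by
      intro j hj
      have hjh := Finset.ne_of_mem_erase hj
      have h1 := hb j hjh
      have hzj : z - c j ≠ 0 := sub_ne_zero.2 (hz j)
      have hch := hcin j hjh
      have h2 : A j * E - E * B j = (-(c j - c h)) • (A j * b - b * B j) := by
        have h3 : (c j - c h)⁻¹ • (A j * E - E * B j) = -(A j * b - b * B j) := by
          rw [Matrix.mul_add, Matrix.add_mul, Matrix.mul_smul, Matrix.smul_mul] at h1
          rw [smul_sub, eq_comm, ← sub_eq_zero]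
          rw [← sub_eq_zero] at h1
          rw [← neg_eq_zero, ← h1]; abel
        rw [neg_smul, ← smul_neg, ← h3, smul_smul, mul_inv_cancel₀ hch, one_smul]
      have h4 : ((z - c j)⁻¹ • A j * (b + (z - c h)⁻¹ • E)
        - (b + (z - c h)⁻¹ • E) * (z - c j)⁻¹ • B j)
        = (z - c j)⁻¹ • ((A j * b - b * B j) + (z - c h)⁻¹ • (A j * E - E * B j)) := by
        simp only [Matrix.smul_mul, Matrix.mul_smul, Matrix.mul_add, Matrix.add_mul, smul_add, smul_sub]
        rw [smul_comm (z - c h)⁻¹ (z - c j)⁻¹]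
        abel
      rw [h4, h2, smul_smul, ← one_smul ℂ (A j * b - b * B j), smul_smul, smul_smul, ← add_smul, smul_smul]
      congr 1
      field_simp
      ring
    rw [← Finset.add_sum_erase _ _ (Finset.mem_univ h), Finset.sum_congr rfl hterm, ← Finset.smul_sum]
    have h5 : ∑ j ∈ Finset.univ.erase h, (A j * b - b * B j) = -(A h * b - b * B h) := by
      have h6 : ∑ j, (A j * b - b * B j) = 0 := by
        rw [Finset.sum_sub_distrib, ← Matrix.sum_mul, ← Matrix.mul_sum, hsA, hsB]; simp
      rw [← Finset.add_sum_erase _ _ (Finset.mem_univ h)] at h6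
      exact eq_neg_of_add_eq_zero_right h6
    rw [h5]
    have h7 : (z - c h)⁻¹ • A h * (b + (z - c h)⁻¹ • E) - (b + (z - c h)⁻¹ • E) * (z - c h)⁻¹ • B h
        = (z - c h)⁻¹ • (A h * b - b * B h) + ((z - c h) ^ 2)⁻¹ • (A h * E - E * B h) := by
      rw [pow_two, _root_.mul_inv_rev]
      simp only [Matrix.smul_mul, Matrix.mul_smul, Matrix.mul_add, Matrix.add_mul, smul_add, smul_sub, smul_smul]
      abel
    rw [h7, hE, smul_neg, smul_neg, neg_smul]
    abel
  obtain ⟨S, h1, h2⟩ := functor X hA hB hT hT' W (fun z hz i k => by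
    have hz' : ∀ j, z ≠ c j := fun j => by rw [← hc']; exact hz _
    have hzh : z - c h ≠ 0 := sub_ne_zero.2 (hz' h)
    rw [key z hz', hW]
    have := ((((hasDerivAt_id z).sub_const (c h)).inv hzh).mul_const (E i k)).const_add (b i k)
    simp only [Matrix.add_apply, Matrix.smul_apply, smul_eq_mul]
    have e : -((z - c h) ^ 2)⁻¹ * E i k = -1 / (id z - c h) ^ 2 * E i k := by
      rw [id, neg_div, one_div]
    rw [e]
    exact this)
  have hW0 := h2 (hS S fun j => by
    have := h1 (j.castSucc - 1)
    rw [sub_add_cancel] at this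
    exact this)
  have hch1 : ‖c h‖ = 1 := by rw [← hc']; exact X.ha _
  have hpt : ∀ t : ℝ, 1 < t → (t : ℂ) - c h ≠ 0 := by
    intro t ht h0
    rw [sub_eq_zero] at h0
    rw [← h0, Complex.norm_real, Real.norm_of_nonneg (by linarith)] at hch1
    linarith
  have w2 := hW0 ((2 : ℝ) : ℂ) (by rw [Complex.norm_real]; norm_num)
  have w3 := hW0 ((3 : ℝ) : ℂ) (by rw [Complex.norm_real]; norm_num)
  have p2 := hpt 2 (by norm_num)
  have p3 := hpt 3 (by norm_num)
  rw [hW] at w2 w3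
  simp only at w2 w3
  have hE0 : E = 0 := by
    have h8 : (((2 : ℝ) : ℂ) - c h)⁻¹ • E - (((3 : ℝ) : ℂ) - c h)⁻¹ • E = 0 := by
      have := w2.trans w3.symm
      rw [sub_eq_zero]; exact add_left_cancel this
    rw [← sub_smul, smul_eq_zero] at h8
    rcases h8 with h8 | h8
    · rw [sub_eq_zero, _root_.inv_inj, sub_left_inj] at h8
      norm_num at h8
    · exact h8
  rw [hE0, smul_zero, add_zero] at w2
  exact ⟨w2, hE0⟩

end pad
end DSP

namespace DSP

section tw
variable {Λ : Type*} [LinearOrder Λ] [Fintype Λ] {J : Type*} [Fintype J]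

/-- twisted half type -/
noncomputable def tw (β : J → Λ → ℕ) (j0 h : J) (x s y z : Λ) : J → Λ → ℕ := fun j l =>
  if j = h ∧ l = z then 1 else if j = h ∧ l = y then 0 else if j = j0 ∧ l = x then 2
    else if j = j0 ∧ l = s then 0 else β j l

/-- standing assumptions on the twist -/
structure TW (β : J → Λ → ℕ) (j0 h : J) (x s y z0 z1 : Λ) : Prop where
  xs : x ≠ s
  bx : β j0 x = 1
  bs : β j0 s = 1
  b_y : β h y = 1
  hy : h = j0 → y ≠ x ∧ y ≠ s
  bz : ∀ j, β j z0 = 0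
  bz' : ∀ j, β j z1 = 0
  zz : z0 ≠ z1

variable {β : J → Λ → ℕ} {j0 h : J} {x s y z0 z1 : Λ} {a : ℕ}

theorem TW.swap (H : TW β j0 h x s y z0 z1) : TW β j0 h s x y z1 z0 :=
  ⟨H.xs.symm, H.bs, H.bx, H.b_y, fun e => ⟨(H.hy e).2, (H.hy e).1⟩, H.bz', H.bz, H.zz.symm⟩

theorem TW.xz (H : TW β j0 h x s y z0 z1) : x ≠ z0 := fun e => by
  have := H.bx; rw [e, H.bz] at this; omega
theorem TW.xz' (H : TW β j0 h x s y z0 z1) : x ≠ z1 := fun e => by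
  have := H.bx; rw [e, H.bz'] at this; omega
theorem TW.yz (H : TW β j0 h x s y z0 z1) : y ≠ z0 := fun e => by
  have := H.b_y; rw [e, H.bz] at this; omega
theorem TW.yz' (H : TW β j0 h x s y z0 z1) : y ≠ z1 := fun e => by
  have := H.b_y; rw [e, H.bz'] at this; omega
theorem TW.sz (H : TW β j0 h x s y z0 z1) : s ≠ z0 := H.swap.xz'
theorem TW.sz' (H : TW β j0 h x s y z0 z1) : s ≠ z1 := H.swap.xz

/-- indicator of a label -/
noncomputable def dl (j' : J) (l' : Λ) (j : J) (l : Λ) : ℤ := if j = j' ∧ l = l' then 1 else 0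

theorem sum_dl (j' : J) (l' : Λ) (j : J) : ∑ l, dl j' l' j l = if j = j' then 1 else 0 := by
  simp only [dl]
  by_cases h : j = j' <;> simp [h]

theorem tw_pt (H : TW β j0 h x s y z0 z1) (j : J) (l : Λ) :
    (tw β j0 h x s y z0 j l : ℤ) = β j l + (dl j0 x j l - dl j0 s j l) + (dl h z0 j l - dl h y j l) ∧
    (tw β j0 h x s y z0 j l : ℤ) ^ 2 = (β j l : ℤ) ^ 2 + (3 * dl j0 x j l - dl j0 s j l)
      + (dl h z0 j l - dl h y j l) ∧
    (tw β j0 h x s y z0 j l : ℤ) * tw β j0 h s x y z1 j l = (β j l : ℤ) ^ 2 - dl j0 x j l - dl j0 s j l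
      - dl h y j l := by
  have h1 := H.xs; have h2 := H.bx; have h3 := H.bs; have h4 := H.b_y; have h6 := H.bz
  have h7 := H.bz'; have h8 := H.zz; have h9 := H.xz; have h10 := H.xz'; have h11 := H.yz; have h12 := H.yz'
  have h13 := H.sz; have h14 := H.sz'
  have hy := H.hy
  by_cases e0 : j = j0
  · subst e0
    by_cases eh : j = h
    · subst eh
      obtain ⟨h15, h16⟩ := hy rfl
      by_cases a1 : l = x
      · subst a1; simp [tw, dl, *, h1.symm, h15.symm, h16.symm]
      by_cases a2 : l = s
      · subst a2; simp [tw, dl, *, h1.symm, h15.symm, h16.symm]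
      by_cases a3 : l = y
      · subst a3; simp [tw, dl, *]
      by_cases a4 : l = z0
      · subst a4; simp [tw, dl, *, h11.symm, h9.symm, h13.symm]
      by_cases a5 : l = z1
      · subst a5; simp [tw, dl, *, h12.symm, h10.symm, h14.symm]
      simp [tw, dl, *]; ring
    · by_cases a1 : l = x
      · subst a1; simp [tw, dl, *, h1.symm]
      by_cases a2 : l = s
      · subst a2; simp [tw, dl, *, h1.symm]
      simp [tw, dl, *]; ring
  · by_cases eh : j = h
    · subst eh
      by_cases a3 : l = y
      · subst a3; simp [tw, dl, *]
      by_cases a4 : l = z0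
      · subst a4; simp [tw, dl, *, h11.symm]
      by_cases a5 : l = z1
      · subst a5; simp [tw, dl, *, h12.symm]
      simp [tw, dl, *]; ring
    · simp [tw, dl, *]; ring

theorem tw_sum (H : TW β j0 h x s y z0 z1) (hb : ∀ j, ∑ l, β j l = a) (j : J) :
    ∑ l, tw β j0 h x s y z0 j l = a := by
  have : ((∑ l, tw β j0 h x s y z0 j l : ℕ) : ℤ) = (a : ℤ) := by
    push_cast
    rw [Finset.sum_congr rfl fun l _ => (tw_pt H j l).1]
    simp only [Finset.sum_add_distrib, Finset.sum_sub_distrib, sum_dl]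
    rw [← hb j]; push_cast; ring
  exact_mod_cast this

theorem tw_sq (H : TW β j0 h x s y z0 z1) (j : J) :
    sq (tw β j0 h x s y z0) j = sq β j + if j = j0 then 2 else 0 := by
  rw [sq, Finset.sum_congr rfl fun l _ => (tw_pt H j l).2.1]
  simp only [Finset.sum_add_distrib, Finset.sum_sub_distrib, ← Finset.mul_sum, sum_dl, sq]
  split_ifs <;> ring

theorem tw_mul (H : TW β j0 h x s y z0 z1) (j : J) :
    ∑ l, ((tw β j0 h x s y z0 j l : ℤ) * tw β j0 h s x y z1 j l)
      = sq β j - (if j = j0 then 2 else 0) - (if j = h then 1 else 0) := by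
  rw [Finset.sum_congr rfl fun l _ => (tw_pt H j l).2.2]
  simp only [Finset.sum_add_distrib, Finset.sum_sub_distrib, ← Finset.mul_sum, sum_dl, sq]
  split_ifs <;> ring

theorem tw_z (H : TW β j0 h x s y z0 z1) : tw β j0 h x s y z0 h z0 = 1 := by simp [tw]
theorem tw_z' (H : TW β j0 h x s y z0 z1) : tw β j0 h x s y z0 h z1 = 0 := by
  simp [tw, H.zz.symm, H.xz'.symm, H.sz'.symm, H.yz'.symm, H.bz']
theorem tw_y (H : TW β j0 h x s y z0 z1) : tw β j0 h x s y z0 h y = 0 := by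
  simp [tw, H.yz]
theorem tw_x (H : TW β j0 h x s y z0 z1) : tw β j0 h x s y z0 j0 x = 2 := by
  have h1 : ¬ (j0 = h ∧ x = y) := fun e => (H.hy e.1.symm).1 e.2.symm
  simp [tw, H.xz, h1]
theorem tw_s (H : TW β j0 h x s y z0 z1) : tw β j0 h x s y z0 j0 s = 0 := by
  have h1 : ¬ (j0 = h ∧ s = y) := fun e => (H.hy e.1.symm).2 e.2.symm
  simp [tw, H.sz, h1, H.xs.symm]

theorem tw_le (H : TW β j0 h x s y z0 z1) (h1 : ∀ l, β j0 l ≤ 1) (l : Λ) :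
    tw β j0 h x s y z0 j0 l + tw β j0 h s x y z1 j0 l ≤ 2 := by
  have := h1 l
  have a1 := H.xs; have a2 := H.zz; have a3 := H.xz; have a4 := H.xz'; have a5 := H.sz; have a6 := H.sz'
  unfold tw
  split_ifs <;> first | omega | (exfalso; simp_all)

theorem tw_mx (H : TW β j0 h x s y z0 z1) (j : J) (hj : j ≠ j0) :
    mx (tw β j0 h x s y z0) j ≤ mx β j := by
  refine Finset.sup_le fun l _ => ?_
  have hl : β j l ≤ mx β j := Finset.le_sup (f := β j) (Finset.mem_univ l)
  by_cases e : j = h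
  · subst e
    have h2 : β j y ≤ mx β j := Finset.le_sup (f := β j) (Finset.mem_univ y)
    rw [H.b_y] at h2
    simp only [tw, hj, false_and, if_false, true_and]
    split_ifs <;> omega
  · simp only [tw, hj, e, false_and, if_false]; exact hl

theorem tw_good (H : TW β j0 h x s y z0 z1) (ha : 1 ≤ a) (hb : ∀ j, ∑ l, β j l = a) (h1 : ∀ l, β j0 l ≤ 1)
    (hα : 2 * (a : ℤ) ^ 2 ≤ ∑ j, ((a : ℤ) ^ 2 - sq β j))
    (hβ : (a : ℤ) ≤ ∑ j ∈ Finset.univ.erase j0, ((a : ℤ) - mx β j)) : Good (tw β j0 h x s y z0) := by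
  refine plainGood j0 a _ ha (tw_sum H hb) (fun l => ?_) ⟨h, z0, ?_⟩ (Or.inr ⟨?_, ?_⟩)
  · have := tw_le H h1 l; omega
  · rw [tw_z H]; exact odd_one
  · simp only [tw_sq H, Finset.sum_sub_distrib, Finset.sum_add_distrib] at hα ⊢
    simp at hα ⊢; linarith
  · refine hβ.trans (Finset.sum_le_sum fun j hj => ?_)
    have := tw_mx H j (Finset.ne_of_mem_erase hj)
    omega

end tw
end DSP

namespace DSP

section mu
variable {Λ : Type*} [LinearOrder Λ] [Fintype Λ] {J : Type*} [Fintype J]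
variable {β : J → Λ → ℕ} {j0 h : J} {x s y z0 z1 : Λ} {a : ℕ}

/-- complex indicator -/
noncomputable def cdl (j' : J) (l' : Λ) : J → Λ → ℂ := fun j l => (dl j' l' j l : ℂ)

theorem cdl_apply (j' : J) (l' : Λ) (j : J) (l : Λ) : cdl j' l' j l = if j = j' ∧ l = l' then 1 else 0 := by
  simp only [cdl, dl]; push_cast; rfl

theorem sum_cdl (j' : J) (l' : Λ) (j : J) : ∑ l, cdl j' l' j l = if j = j' then 1 else 0 := by
  have := sum_dl j' l' j
  simp only [cdl]
  rw [← Int.cast_sum, this]; push_cast; rfl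

theorem pr_cdl (μ : J → Λ → ℂ) (j : J) (l : Λ) : pr μ (cdl j l) = μ j l := by
  unfold pr
  rw [Finset.sum_eq_single j]
  · rw [Finset.sum_eq_single l]
    · simp [cdl_apply]
    · intro i _ hi; simp [cdl_apply, hi]
    · simp
  · intro i _ hi; simp [cdl_apply, hi]
  · simp

theorem tw_cv (H : TW β j0 h x s y z0 z1) :
    cv (tw β j0 h x s y z0) = cv β + (cdl j0 x - cdl j0 s) + (cdl h z0 - cdl h y) := by
  funext j l
  have := (tw_pt H j l).1
  simp only [cv, cdl, Pi.add_apply, Pi.sub_apply]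
  exact_mod_cast this

/-- the constraint space -/
noncomputable def CS (β : J → Λ → ℕ) (j0 h : J) (x s y z0 z1 : Λ) : Submodule ℂ (J → Λ → ℂ) :=
  Submodule.span ℂ {cv (tw β j0 h x s y z0), cdl j0 x - cdl j0 s, cdl h z1 - cdl h z0}

theorem tw_diff (H : TW β j0 h x s y z0 z1) : cv (tw β j0 h s x y z1)
    = cv (tw β j0 h x s y z0) - (2 : ℂ) • (cdl j0 x - cdl j0 s) + (cdl h z1 - cdl h z0) := by
  rw [tw_cv H, tw_cv H.swap, two_smul]; abel

theorem CS_swap_le (H : TW β j0 h x s y z0 z1) : CS β j0 h x s y z0 z1 ≤ CS β j0 h s x y z1 z0 := by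
  have m1 : cv (tw β j0 h s x y z1) ∈ CS β j0 h s x y z1 z0 := Submodule.subset_span (by simp)
  have m2 : cdl j0 s - cdl j0 x ∈ CS β j0 h s x y z1 z0 := Submodule.subset_span (by simp)
  have m3 : cdl h z0 - cdl h z1 ∈ CS β j0 h s x y z1 z0 := Submodule.subset_span (by simp)
  have m2' : cdl j0 x - cdl j0 s ∈ CS β j0 h s x y z1 z0 := by rw [← neg_sub]; exact neg_mem m2
  have m3' : cdl h z1 - cdl h z0 ∈ CS β j0 h s x y z1 z0 := by rw [← neg_sub]; exact neg_mem m3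
  rw [CS, Submodule.span_le]
  intro v hv
  simp only [Set.mem_insert_iff, Set.mem_singleton_iff] at hv
  rcases hv with rfl | rfl | rfl
  · have : cv (tw β j0 h x s y z0) = cv (tw β j0 h s x y z1) + (2 : ℂ) • (cdl j0 x - cdl j0 s)
        - (cdl h z1 - cdl h z0) := by rw [tw_diff H]; abel
    rw [this]
    exact sub_mem (add_mem m1 (Submodule.smul_mem _ _ m2')) m3'
  · exact m2'
  · exact m3'

theorem CS_mem (H : TW β j0 h x s y z0 z1) (hb : ∀ j, ∑ l, β j l = a) (w : J → Λ → ℂ)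
    (hw : w ∈ CS β j0 h x s y z0 z1) : ∃ α b c : ℂ,
      (∀ j l, w j l = α * tw β j0 h x s y z0 j l + b * (cdl j0 x j l - cdl j0 s j l)
        + c * (cdl h z1 j l - cdl h z0 j l)) ∧ ∀ j, ∑ l, w j l = α * a := by
  obtain ⟨α, b, c, e⟩ := Submodule.mem_span_triple.1 hw
  have e' : ∀ j l, w j l = α * tw β j0 h x s y z0 j l + b * (cdl j0 x j l - cdl j0 s j l)
        + c * (cdl h z1 j l - cdl h z0 j l) := by
    intro j l
    rw [← e]; simp [cv]
  refine ⟨α, b, c, e', fun j => ?_⟩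
  rw [Finset.sum_congr rfl fun l _ => e' j l]
  simp only [Finset.sum_add_distrib, ← Finset.mul_sum, Finset.sum_sub_distrib, sum_cdl]
  rw [← Nat.cast_sum, tw_sum H hb]; ring

theorem CS_sub (H : TW β j0 h x s y z0 z1) (hb : ∀ j, ∑ l, β j l = a) (v : J → Λ → ℕ)
    (hv : ∀ j l, v j l ≤ tw β j0 h x s y z0 j l) (r : ℕ) (hr : ∀ j, ∑ l, v j l = r) (h0 : 0 < r) (h1 : r < a) :
    cv v ∉ CS β j0 h x s y z0 z1 := by
  intro hmem
  obtain ⟨α, b, c, e, e2⟩ := CS_mem H hb _ hmem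
  have hα : (r : ℂ) = α * a := by
    rw [← e2 h, ← hr h]; push_cast; rfl
  have hs : v j0 s = 0 := by have := hv j0 s; rw [tw_s H] at this; omega
  have hz1 : v h z1 = 0 := by have := hv h z1; rw [tw_z' H] at this; omega
  have hz0 : v h z0 ≤ 1 := by have := hv h z0; rwa [tw_z H] at this
  have hc := e h z1
  simp [cv, hz1, tw_z' H, cdl_apply, H.xz'.symm, H.sz'.symm, H.zz.symm] at hc
  have hz := e h z0
  simp [cv, tw_z H, cdl_apply, H.xz.symm, H.sz.symm, H.zz, ← hc] at hz
  rw [← hz] at hα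
  have : r = v h z0 * a := by exact_mod_cast hα
  interval_cases v h z0 <;> omega

theorem CS_pair (H : TW β j0 h x s y z0 z1) (ha : a ≠ 0) (hb : ∀ j, ∑ l, β j l = a) (j : J) (l l' : Λ) (hl : l ≠ l')
    (hmem : cdl j l - cdl j l' ∈ CS β j0 h x s y z0 z1) :
    (j = j0 ∧ ((l = x ∧ l' = s) ∨ (l = s ∧ l' = x))) ∨ (j = h ∧ ((l = z0 ∧ l' = z1) ∨ (l = z1 ∧ l' = z0))) := by
  obtain ⟨α, b, c, e, e2⟩ := CS_mem H hb _ hmem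
  have hα : α = 0 := by
    have := e2 j
    simp only [Pi.sub_apply, Finset.sum_sub_distrib, sum_cdl] at this
    rw [sub_self, eq_comm, mul_eq_zero] at this
    rcases this with h | h
    · exact h
    · exact absurd (by exact_mod_cast h) ha
  subst hα
  have f1 := e j l
  have f2 := e j l'
  have f3 := e j0 x
  have f4 := e j0 s
  have f5 := e h z0
  have f6 := e h z1
  have a1 := H.xs; have a2 := H.zz; have a3 := H.xz; have a4 := H.xz'; have a5 := H.sz; have a6 := H.sz'
  simp only [Pi.sub_apply, cdl_apply] at f1 f2 f3 f4 f5 f6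
  clear e e2 hmem hb H
  simp only [zero_mul, zero_add, hl, hl.symm, a1, a1.symm, a2, a2.symm, a3, a4, a5, a6, a3.symm, a4.symm, a5.symm,
    a6.symm, and_false, and_true, if_true, if_false, sub_zero, zero_sub] at f1 f2 f3 f4 f5 f6
  grind

end mu
end DSP

namespace DSP

section mu
variable {Λ : Type*} [LinearOrder Λ] [Fintype Λ] {J : Type*} [Fintype J]
variable {β : J → Λ → ℕ} {j0 h : J} {x s y z0 z1 : Λ} {a : ℕ}

theorem exists_mu2 (H : TW β j0 h x s y z0 z1) (ha : 1 ≤ a) (hb : ∀ j, ∑ l, β j l = a) :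
    ∃ μ : J → Λ → ℂ, pr μ (cv (tw β j0 h x s y z0)) = 0 ∧ pr μ (cv (tw β j0 h s x y z1)) = 0 ∧
      μ h z1 = μ h z0 + 1 ∧
      (∀ (v : J → Λ → ℕ) (r : ℕ), (∀ j l, v j l ≤ tw β j0 h x s y z0 j l) → (∀ j, ∑ l, v j l = r) → 0 < r → r < a →
        ∀ k : ℤ, pr μ (cv v) ≠ k) ∧
      (∀ (v : J → Λ → ℕ) (r : ℕ), (∀ j l, v j l ≤ tw β j0 h s x y z1 j l) → (∀ j, ∑ l, v j l = r) → 0 < r → r < a →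
        ∀ k : ℤ, pr μ (cv v) ≠ k) ∧
      (∀ j l l', l ≠ l' → ∀ k : ℤ, μ j l - μ j l' = k →
        j = h ∧ ((l = z0 ∧ l' = z1) ∨ (l = z1 ∧ l' = z0))) := by
  obtain ⟨μ0, hμ0⟩ : ∃ μ0 : J → Λ → ℂ, ∀ w, pr μ0 w = -(1 / (a : ℂ)) * ∑ l, w j0 l + 1 / 2 * w j0 x + w h z1 := by
    let f : (J → Λ → ℂ) →ₗ[ℂ] ℂ :=
      { toFun := fun w => -(1 / (a : ℂ)) * ∑ l, w j0 l + 1 / 2 * w j0 x + w h z1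
        map_add' := by intro u v; simp only [Pi.add_apply, Finset.sum_add_distrib]; ring
        map_smul' := by
          intro c u
          simp only [Pi.smul_apply, smul_eq_mul, ← Finset.mul_sum, RingHom.id_apply]; ring }
    obtain ⟨μ0, h0⟩ := exists_pr_repr f
    exact ⟨μ0, fun w => (h0 w).symm⟩
  have ha0 : (a : ℂ) ≠ 0 := by norm_cast; omega
  have a1 := H.xs; have a2 := H.zz; have a3 := H.xz; have a4 := H.xz'; have a5 := H.sz; have a6 := H.sz'
  let C := CS β j0 h x s y z0 z1
  let P1 : Set (J → Λ → ℕ) := {v | v ≤ tw β j0 h x s y z0 ∧ cv v ∉ C}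
  let P2 : Set (J → Λ → ℕ) := {v | v ≤ tw β j0 h s x y z1 ∧ cv v ∉ C}
  let I3 := {p : J × Λ × Λ // cdl p.1 p.2.1 - cdl p.1 p.2.2 ∉ C}
  have hf1 : Finite P1 := ((Set.finite_Iic (tw β j0 h x s y z0)).subset (fun v hv => hv.1)).to_subtype
  have hf2 : Finite P2 := ((Set.finite_Iic (tw β j0 h s x y z1)).subset (fun v hv => hv.1)).to_subtype
  obtain ⟨μ, hμ, hμ2⟩ := avoid (I := P1 ⊕ P2 ⊕ I3) C
    (Sum.elim (fun v => cv v.1) (Sum.elim (fun v => cv v.1) (fun p => cdl p.1.1 p.1.2.1 - cdl p.1.1 p.1.2.2))) (by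
      rintro (⟨v, hv⟩ | ⟨v, hv⟩ | ⟨p, hp⟩)
      · exact hv.2
      · exact hv.2
      · exact hp) μ0 (Set.range ((↑) : ℤ → ℂ)) (Set.countable_range _)
  have mP : cv (tw β j0 h x s y z0) ∈ C := Submodule.subset_span (by simp)
  have mx' : cdl j0 x - cdl j0 s ∈ C := Submodule.subset_span (by simp)
  have mz : cdl h z1 - cdl h z0 ∈ C := Submodule.subset_span (by simp)
  have eP : pr μ (cv (tw β j0 h x s y z0)) = 0 := by
    rw [hμ _ mP, hμ0]
    simp only [cv, tw_x H, tw_z' H]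
    rw [← Nat.cast_sum, tw_sum H hb]
    field_simp; norm_num
  have ex : pr μ (cdl j0 x - cdl j0 s) = 1 / 2 := by
    rw [hμ _ mx', hμ0]
    simp only [Pi.sub_apply, Finset.sum_sub_distrib, sum_cdl]
    simp [cdl_apply, a1, a4.symm, a6.symm]
  have ez : pr μ (cdl h z1 - cdl h z0) = 1 := by
    rw [hμ _ mz, hμ0]
    simp only [Pi.sub_apply, Finset.sum_sub_distrib, sum_cdl]
    simp [cdl_apply, a2.symm, a4, a3]
  have eQ : pr μ (cv (tw β j0 h s x y z1)) = 0 := by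
    rw [tw_diff H, pr_add, pr_sub, pr_smul, eP, ex, ez]; norm_num
  rw [pr_sub, pr_cdl, pr_cdl] at ex ez
  refine ⟨μ, eP, eQ, by linear_combination ez, ?_, ?_, ?_⟩
  · intro v r hv hr h0 h1 k hk
    exact hμ2 (Sum.inl ⟨v, fun j l => hv j l, CS_sub H hb v hv r hr h0 h1⟩) ⟨k, by simpa using hk.symm⟩
  · intro v r hv hr h0 h1 k hk
    exact hμ2 (Sum.inr (Sum.inl ⟨v, fun j l => hv j l, fun hm => CS_sub H.swap hb v hv r hr h0 h1 (CS_swap_le H hm)⟩))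
      ⟨k, by simpa using hk.symm⟩
  · intro j l l' hl k hk
    by_cases hm : cdl j l - cdl j l' ∈ C
    · rcases CS_pair H (by omega) hb j l l' hl hm with ⟨rfl, hh⟩ | hh
      · exfalso
        have key : ∀ k : ℤ, (1 / 2 : ℂ) ≠ k := by
          intro k hk
          have : (1 : ℂ) = ((2 * k : ℤ) : ℂ) := by push_cast; rw [← hk]; norm_num
          have : (1 : ℤ) = 2 * k := by exact_mod_cast this
          omega
        rcases hh with ⟨rfl, rfl⟩ | ⟨rfl, rfl⟩
        · exact key k (ex.symm.trans hk)
        · exact key (-k) (by push_cast; rw [← hk, ← ex]; ring)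
      · exact hh
    · exact absurd ⟨k, by simp only [Sum.elim_inr, pr_sub, pr_cdl]; exact hk.symm⟩ (hμ2 (Sum.inr (Sum.inr ⟨(j, l, l'), hm⟩)))

end mu

section inst
variable {Λ : Type*} [LinearOrder Λ] [Fintype Λ] {J : Type*} [Fintype J]

theorem Good.inst_fin {m : J → Λ → ℕ} (h : Good m) (μ : J → Λ → ℂ) (hμ : ∀ j, Function.Injective (μ j))
    (h0 : pr μ (cv m) = 0) (a : ℕ) (ha : ∀ j, ∑ l, m j l = a) (j0 : J) :
    ∃ (κ : J → Fin a → Λ) (g : J → (Matrix (Fin a) (Fin a) ℂ)ˣ),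
    cnt κ (fun _ => Finset.univ) = m ∧ ∑ j, AA κ g μ 0 j = 0 := by
  obtain ⟨ι, _, _, κ, g, hc, hs⟩ := h.inst μ hμ h0
  have hcard : Fintype.card (Fin a) = Fintype.card ι := by rw [← sum_type hc j0, ha]; simp
  let e : Fin a ≃ ι := Fintype.equivOfCardEq hcard
  have : ∀ j, ∃ g' : (Matrix (Fin a) (Fin a) ℂ)ˣ,
      (AA κ g μ 0 j).submatrix e e = g'.val * diagonal (μ j ∘ κ j ∘ e) * (g'⁻¹).val := by
    intro j
    refine Sim.exists_unit ((sim_submatrix e _).trans ?_)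
    rw [AA_zero]
    exact (sim_of_unit _ _).trans (sim_diagonal_of_equiv e.symm fun i => by simp)
  choose g' hg' using this
  refine ⟨fun j => κ j ∘ e, g', ?_, ?_⟩
  · rw [← hc]
    funext j l
    simp only [cnt]
    refine Finset.card_bij (fun i _ => e i) (by simp) (fun i _ i' _ hh => e.injective hh) ?_
    intro i hi
    exact ⟨e.symm i, by simpa using hi, by simp⟩
  · have : ∀ j, AA (fun j => κ j ∘ e) g' μ 0 j = (AA κ g μ 0 j).submatrix e e := by
      intro j; rw [AA_zero, hg']
    rw [Finset.sum_congr rfl fun j _ => this j]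
    have h2 : (∑ j, AA κ g μ 0 j).submatrix e e = ∑ j, (AA κ g μ 0 j).submatrix e e := by
      ext i i'; simp [Matrix.sum_apply]
    rw [← h2, hs]; rfl

theorem irr_mon {p a : ℕ} {κ : Fin (p + 1) → Fin a → Λ} {m : Fin (p + 1) → Λ → ℕ}
    (hc : cnt κ (fun _ => Finset.univ) = m) (μ : Fin (p + 1) → Λ → ℂ)
    (M : Fin (p + 1) → Matrix (Fin a) (Fin a) ℂ)
    (hM : ∀ j, Sim (diagonal fun k => Complex.exp (2 * Real.pi * Complex.I * μ j (κ j k))) (M j))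
    (hp : (List.ofFn M).prod = 1)
    (hgen : ∀ (v : Fin (p + 1) → Λ → ℕ) (r : ℕ), (∀ j l, v j l ≤ m j l) → (∀ j, ∑ l, v j l = r) → 0 < r → r < a →
        ∀ k : ℤ, pr μ (cv v) ≠ k) : Irr M := by
  refine irr_of_genericMul ?_ hp
  intro r h1 h2 Φ hΦ hprod
  have : ∀ j, ∃ S : Finset (Fin a), S.val.map (fun k => Complex.exp (2 * Real.pi * Complex.I * μ j (κ j k))) = Φ j := by
    intro j
    refine exists_subset_of_le_map _ _ ?_
    rw [← charpoly_diagonal_roots, (hM j).charpoly]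
    exact (hΦ j).1
  choose S hS using this
  have hSc : ∀ j, (S j).card = r := by
    intro j
    have := (hΦ j).2
    rw [← hS j, Multiset.card_map] at this
    exact this
  have hpr : ∀ j, (Φ j).prod = Complex.exp (2 * Real.pi * Complex.I * ∑ i ∈ S j, μ j (κ j i)) := by
    intro j
    rw [← hS j, Finset.mul_sum, Complex.exp_sum]; rfl
  rw [Finset.prod_congr rfl fun j _ => hpr j, ← Complex.exp_sum, ← Finset.mul_sum, pr_cnt, Complex.exp_eq_one_iff] at hprod
  obtain ⟨k, hk⟩ := hprod
  refine hgen (cnt κ S) r (fun j l => by rw [← hc]; exact cnt_le κ S j l) (fun j => by rw [sum_cnt, hSc]) h1 (by omega) k ?_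
  have h2pi : (2 * Real.pi * Complex.I : ℂ) ≠ 0 := Complex.two_pi_I_ne_zero
  exact mul_left_cancel₀ h2pi (by rw [hk]; ring)

/-- intertwiners vanish when an eigenvalue is missing -/
theorem noiso {α γ : Type*} [Fintype α] [DecidableEq α] [Fintype γ] [DecidableEq γ]
    {A : J → Matrix α α ℂ} {B : J → Matrix γ γ ℂ} (hA : Irr A) (hB : Irr B) (j : J) (gA : (Matrix α α ℂ)ˣ) (dA : α → ℂ)
    (eA : A j = gA.val * diagonal dA * (gA⁻¹).val) (gB : (Matrix γ γ ℂ)ˣ) (dB : γ → ℂ)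
    (eB : B j = gB.val * diagonal dB * (gB⁻¹).val) (i : α) (hi : ∀ k, dB k ≠ dA i) (X : Matrix γ α ℂ)
    (hX : ∀ j, X * A j = B j * X) : X = 0 := by
  rcases hA.schur_zero hB X hX with h | h
  · exact h
  exfalso
  let E : Matrix α Unit ℂ := Matrix.of fun k _ => if k = i then 1 else 0
  have h1 : diagonal dA * E = dA i • E := by
    ext k u
    by_cases hk : k = i <;> simp [E, Matrix.diagonal_mul, hk]
  have h2 : A j * (gA.val * E) = dA i • (gA.val * E) := by
    rw [eA]
    simp only [Matrix.mul_assoc]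
    rw [← Matrix.mul_assoc ((gA⁻¹).val) gA.val, Units.inv_mul, Matrix.one_mul, h1, Matrix.mul_smul]
  have h3 : X * (gA.val * E) = 0 := by
    refine left_zero gB dB (dA i) hi _ ?_
    rw [← eB, ← Matrix.mul_assoc, ← hX, Matrix.mul_assoc, h2, Matrix.mul_smul]
  have h4 : gA.val * E = 0 := by
    ext k u
    have h5 : X.mulVec (fun k => (gA.val * E) k u) = X.mulVec 0 := by
      rw [Matrix.mulVec_zero]
      ext c
      exact congrFun (congrFun h3 c) u
    exact congrFun (h.1 h5) k
  have h6 : E = 0 := by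
    have := congrArg (fun Z => (gA⁻¹).val * Z) h4
    simp only [← Matrix.mul_assoc, Units.inv_mul, Matrix.one_mul, Matrix.mul_zero] at this
    exact this
  have := congrFun (congrFun h6 i) ()
  simp [E] at this

end inst
end DSP

namespace DSP

section step
variable {ι₁ ι₂ : Type*} [Fintype ι₁] [DecidableEq ι₁] [Fintype ι₂] [DecidableEq ι₂]
variable {Λ : Type*} [LinearOrder Λ] [Fintype Λ] {J : Type*} [Fintype J]

theorem ext_step (R : J → Matrix ι₁ ι₂ ℂ →ₗ[ℂ] Matrix ι₁ ι₂ ℂ) (E : Matrix ι₁ ι₂ ℂ) (b : J → ℂ) (h : J)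
    (hr : 2 * (Fintype.card ι₁ * Fintype.card ι₂) + 2 ≤ ∑ j, Module.finrank ℂ (R j).range) :
    ∃ Y : J → Matrix ι₁ ι₂ ℂ, ∑ j, R j (Y j) = 0 ∧
      ∀ (w : ℂ) (x : Matrix ι₁ ι₂ ℂ) (c : ℂ),
        (∀ j, j ≠ h → w • R j (Y j) + R j (x + (c * b j) • E) = 0) → w = 0 := by
  let φ : J → (Matrix ι₁ ι₂ ℂ × ℂ) →ₗ[ℂ] Matrix ι₁ ι₂ ℂ := fun j =>
    { toFun := fun q => R j (q.1 + (q.2 * b j) • E)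
      map_add' := by
        intro u v
        rw [← map_add]; congr 1
        simp only [Prod.fst_add, Prod.snd_add, add_mul, add_smul]; abel
      map_smul' := by
        intro c u
        simp only [RingHom.id_apply]
        rw [← map_smul]; congr 1
        simp only [Prod.smul_fst, Prod.smul_snd, smul_add, smul_smul, smul_eq_mul, mul_assoc] }
  let L : (Matrix ι₁ ι₂ ℂ × ℂ) →ₗ[ℂ] (J → Matrix ι₁ ι₂ ℂ) :=
    LinearMap.pi fun j => if j = h then -∑ i ∈ Finset.univ.erase h, φ i else φ j
  have hf : Module.finrank ℂ (Matrix ι₁ ι₂ ℂ) = Fintype.card ι₁ * Fintype.card ι₂ := by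
    rw [Module.finrank_matrix]; simp
  have hN : Module.finrank ℂ L.range ≤ Fintype.card ι₁ * Fintype.card ι₂ + 1 := by
    refine (LinearMap.finrank_range_le L).trans ?_
    rw [Module.finrank_prod, hf]; simp
  obtain ⟨y, hy0, hy1⟩ := ext_count R L.range 1 (by rw [hf]; omega)
  refine ⟨y 0, hy0 0, fun w x c hw => ?_⟩
  have h2 := hy1 (fun _ => w) ?_
  · exact congrFun h2 0
  · refine ⟨(-x, -c), ?_⟩
    have hj : ∀ j, j ≠ h → φ j (-x, -c) = w • R j (y 0 j) := by
      intro j hj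
      have e : φ j (-x, -c) = - R j (x + (c * b j) • E) := by
        show R j (-x + (-c * b j) • E) = _
        rw [← map_neg]; congr 1
        rw [neg_mul, neg_smul]; abel
      rw [e]
      exact (eq_neg_of_add_eq_zero_left (hw j hj)).symm
    funext j
    simp only [Fin.sum_univ_one, Finset.univ_unique, Fin.default_eq_zero, Finset.sum_singleton, Fin.isValue]
    show (if j = h then -∑ i ∈ Finset.univ.erase h, φ i else φ j) (-x, -c) = _
    split_ifs with e
    · subst e
      rw [LinearMap.neg_apply, LinearMap.sum_apply, Finset.sum_congr rfl fun i hi => hj i (Finset.ne_of_mem_erase hi),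
        ← Finset.smul_sum, ← smul_neg]
      congr 1
      have := hy0 0
      rw [← Finset.add_sum_erase _ _ (Finset.mem_univ j)] at this
      exact (eq_neg_of_add_eq_zero_left this).symm
    · exact hj j e

theorem card_pairs (κ₁ : ι₁ → Λ) (κ₂ : ι₂ → Λ) (μ : Λ → ℂ) (hμ : Function.Injective μ) :
    (((Finset.univ.filter fun q : ι₁ × ι₂ => μ (κ₁ q.1) ≠ μ (κ₂ q.2)).card : ℕ) : ℤ)
      = (Fintype.card ι₁ * Fintype.card ι₂ : ℤ) - ∑ l, ((Finset.univ.filter fun i => κ₁ i = l).card : ℤ) *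
        ((Finset.univ.filter fun i => κ₂ i = l).card : ℤ) := by
  have h1 := Finset.card_filter_add_card_filter_not (s := (Finset.univ : Finset (ι₁ × ι₂)))
    (fun q : ι₁ × ι₂ => κ₁ q.1 = κ₂ q.2)
  have h2 : (Finset.univ.filter fun q : ι₁ × ι₂ => κ₁ q.1 = κ₂ q.2).card
      = ∑ l, (Finset.univ.filter fun i => κ₁ i = l).card * (Finset.univ.filter fun i => κ₂ i = l).card := by
    rw [Finset.card_eq_sum_card_fiberwise (f := fun q : ι₁ × ι₂ => κ₁ q.1) (t := Finset.univ) (by simp)]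
    refine Finset.sum_congr rfl fun l _ => ?_
    rw [← Finset.card_product]
    congr 1
    ext ⟨i, k⟩
    simp only [Finset.mem_filter, Finset.mem_univ, true_and, Finset.mem_product]
    constructor
    · rintro ⟨e, rfl⟩; exact ⟨rfl, e.symm⟩
    · rintro ⟨rfl, e⟩; exact ⟨e.symm, rfl⟩
  have h3 : (Finset.univ.filter fun q : ι₁ × ι₂ => μ (κ₁ q.1) ≠ μ (κ₂ q.2))
      = Finset.univ.filter fun q : ι₁ × ι₂ => ¬ (κ₁ q.1 = κ₂ q.2) := by
    ext q; simp [hμ.eq_iff]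
  rw [h3]
  rw [h2, Finset.card_univ, Fintype.card_prod] at h1
  have h4 := congrArg (Nat.cast : ℕ → ℤ) h1
  push_cast at h4
  linarith

end step
end DSP

namespace DSP

section half
variable {Λ : Type*} [LinearOrder Λ] [Fintype Λ] {p : ℕ}

theorem cnt_pos {ι J : Type*} [Fintype ι] [Fintype J] {κ : J → ι → Λ} {m : J → Λ → ℕ}
    (hc : (cnt κ fun _ => Finset.univ) = m) (j : J) (i : ι) : 0 < m j (κ j i) := by
  rw [← hc]; unfold cnt
  exact Finset.card_pos.2 ⟨i, by simp⟩

theorem exists_of_cnt {ι J : Type*} [Fintype ι] [Fintype J] {κ : J → ι → Λ} {m : J → Λ → ℕ}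
    (hc : (cnt κ fun _ => Finset.univ) = m) {j : J} {l : Λ} (hp : 0 < m j l) : ∃ i, κ j i = l := by
  rw [← hc] at hp; unfold cnt at hp
  obtain ⟨i, hi⟩ := Finset.card_pos.1 hp
  exact ⟨i, (Finset.mem_filter.1 hi).2⟩

theorem half (X : Pts (p + 2)) {m : Fin (p + 1) → Λ → ℕ} {a : ℕ} (hG : Good m) (hm : ∀ j, ∑ l, m j l = a)
    (μ : Fin (p + 1) → Λ → ℂ) (hinj : ∀ j, Function.Injective (μ j)) (h0 : pr μ (cv m) = 0)
    (hnint : ∀ j l l', l ≠ l' → 0 < m j l → 0 < m j l' → ∀ k : ℤ, μ j l - μ j l' ≠ k) :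
    ∃ (κ : Fin (p + 1) → Fin a → Λ) (g : Fin (p + 1) → (Matrix (Fin a) (Fin a) ℂ)ˣ)
      (T : Fin (p + 2) → Matrix (Fin a) (Fin a) ℂ),
      (cnt κ fun _ => Finset.univ) = m ∧ ∑ j, AA κ g μ 0 j = 0 ∧
      IsMono X (pad (AA κ g μ 0)) T ∧ (∀ j, IsUnit (T j)) ∧
      (∀ j, Sim (diagonal fun k => Complex.exp (2 * Real.pi * Complex.I * μ j (κ j k))) (mon T j)) ∧
      (List.ofFn (mon T)).prod = 1 := by
  obtain ⟨κ, g, hc, hs⟩ := hG.inst_fin μ hinj h0 a hm 0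
  obtain ⟨T, h1, h2, h3, h4⟩ := mono_pad X (AA κ g μ 0) hs g (fun j => μ j ∘ κ j)
    (fun j => AA_zero κ g μ j) (by
      intro j r i k
      left
      intro e
      simp only [Function.comp] at e
      by_cases hik : κ j i = κ j k
      · rw [hik] at e
        have : ((r : ℂ) + 1) = 0 := by linear_combination e
        exact Nat.cast_add_one_ne_zero r this
      · refine hnint j _ _ hik (cnt_pos hc j i) (cnt_pos hc j k) (r + 1) ?_
        push_cast
        linear_combination -e)
  exact ⟨κ, g, T, hc, hs, h1, h2, h3, h4⟩

theorem exp_ne_of_int {u v : ℂ} (h : ∀ k : ℤ, u - v ≠ k) :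
    Complex.exp (2 * Real.pi * Complex.I * u) ≠ Complex.exp (2 * Real.pi * Complex.I * v) := by
  intro e
  rw [Complex.exp_eq_exp_iff_exists_int] at e
  obtain ⟨n, hn⟩ := e
  apply h n
  have h2 : (2 * Real.pi * Complex.I : ℂ) ≠ 0 := Complex.two_pi_I_ne_zero
  apply mul_left_cancel₀ h2
  linear_combination hn

end half

section host
variable {Λ : Type*} [LinearOrder Λ] [Fintype Λ] {p : ℕ}
variable {β : Fin (p + 1) → Λ → ℕ} {h : Fin (p + 1)} {x s y z0 z1 : Λ} {a : ℕ}

theorem cnt_elim2 {ι₁ ι₂ J : Type*} [Fintype ι₁] [Fintype ι₂] [Fintype J] (κ₁ : J → ι₁ → Λ) (κ₂ : J → ι₂ → Λ)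
    (j : J) (l : Λ) : cnt (fun j => Sum.elim (κ₁ j) (κ₂ j)) (fun _ => Finset.univ) j l
      = cnt κ₁ (fun _ => Finset.univ) j l + cnt κ₂ (fun _ => Finset.univ) j l := by
  unfold cnt
  simp only [Finset.card_filter, Fintype.sum_sum_type, Sum.elim_inl, Sum.elim_inr]
  congr

theorem trace_single_conj {ι : Type*} [Fintype ι] [DecidableEq ι] (G A G' : Matrix ι ι ℂ) (i k : ι) :
    (G * single i k 1 * G' * A).trace = (G' * A * G) k i := by
  rw [mul_assoc, mul_assoc, Matrix.trace_mul_comm, mul_assoc, Matrix.trace_single_mul, one_smul]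

theorem hostSol (hp : 2 ≤ p) (H : TW β 0 h x s y z0 z1) (ha : 1 ≤ a) (hb : ∀ j, ∑ l, β j l = a)
    (h1 : ∀ l, β 0 l ≤ 1) (hα : 2 * (a : ℤ) ^ 2 ≤ ∑ j, ((a : ℤ) ^ 2 - sq β j))
    (hβ : (a : ℤ) ≤ ∑ j ∈ Finset.univ.erase 0, ((a : ℤ) - mx β j))
    (hz0 : ∀ l, l ≠ z0 → z0 < l) (hz1 : ∀ l, l ≠ z1 → l < z1) :
    ∃ (X : Pts (p + 2)) (κ : Fin (p + 1) → (Fin a ⊕ Fin a) → Λ)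
      (g : Fin (p + 1) → (Matrix (Fin a ⊕ Fin a) (Fin a ⊕ Fin a) ℂ)ˣ) (i0 i1 : Fin a ⊕ Fin a),
      (∀ j l, cnt κ (fun _ => Finset.univ) j l = tw β 0 h x s y z0 j l + tw β 0 h s x y z1 j l) ∧
      (∀ i, κ h i = z0 ↔ i = i0) ∧ (∀ i, κ h i = z1 ↔ i = i1) ∧
      ∀ μ' : Fin (p + 1) → Λ → ℂ, ∑ j, ∑ i, μ' j (κ j i) = 0 → ∃ U, (∀ j, SU (κ j) (U j)) ∧
        ∑ j, AA κ g μ' U j = 0 ∧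
        ∑ j, (X.a j.castSucc - X.a h.castSucc)⁻¹ * (((g h)⁻¹).val * AA κ g μ' U j * (g h).val) i1 i0 = 0 := by
  obtain ⟨X⟩ := exists_pts (N := p + 2) (by omega)
  obtain ⟨μ, hP0, hQ0, hz, hPg, hQg, hnint⟩ := exists_mu2 H ha hb
  have hinj : ∀ j, Function.Injective (μ j) := by
    intro j l l' e
    by_contra hl
    obtain ⟨rfl, hh⟩ := hnint j l l' hl 0 (by rw [e]; simp)
    rcases hh with ⟨rfl, rfl⟩ | ⟨rfl, rfl⟩
    · rw [hz] at e; simp at e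
    · rw [hz] at e; simp at e
  have hGP := tw_good H ha hb h1 hα (by convert hβ)
  have hGQ := tw_good H.swap ha hb h1 hα (by convert hβ)
  obtain ⟨κ₁, g₁, T₁, hc₁, hs₁, hm₁, hu₁, hS₁, hp₁⟩ := half X hGP (tw_sum H hb) μ hinj hP0 (by
    intro j l l' hl p1 p2 k e
    obtain ⟨rfl, hh⟩ := hnint j l l' hl k e
    rcases hh with ⟨rfl, rfl⟩ | ⟨rfl, rfl⟩
    · rw [tw_z' H] at p2; exact absurd p2 (lt_irrefl 0)
    · rw [tw_z' H] at p1; exact absurd p1 (lt_irrefl 0))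
  obtain ⟨κ₂, g₂, T₂, hc₂, hs₂, hm₂, hu₂, hS₂, hp₂⟩ := half X hGQ (tw_sum H.swap hb) μ hinj hQ0 (by
    intro j l l' hl p1 p2 k e
    obtain ⟨rfl, hh⟩ := hnint j l l' hl k e
    rcases hh with ⟨rfl, rfl⟩ | ⟨rfl, rfl⟩
    · rw [tw_z' H.swap] at p1; exact absurd p1 (lt_irrefl 0)
    · rw [tw_z' H.swap] at p2; exact absurd p2 (lt_irrefl 0))
  have hA₁ : Irr (AA κ₁ g₁ μ 0) := irr_inst hc₁ hs₁ (fun v r hv hr hr0 hra => by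
    have := hPg v r hv hr hr0 (by simpa using hra) 0
    simpa using this)
  have hA₂ : Irr (AA κ₂ g₂ μ 0) := irr_inst hc₂ hs₂ (fun v r hv hr hr0 hra => by
    have := hQg v r hv hr hr0 (by simpa using hra) 0
    simpa using this)
  have hM₁ : Irr (mon T₁) := irr_mon hc₁ μ _ hS₁ hp₁ hPg
  have hM₂ : Irr (mon T₂) := irr_mon hc₂ μ _ hS₂ hp₂ hQg
  have : Nonempty (Fin a) := ⟨⟨0, ha⟩⟩
  -- no intertwiners
  have hS : ∀ S : Matrix (Fin a) (Fin a) ℂ, (∀ j, mon T₁ j * S = S * mon T₂ j) → S = 0 := by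
    intro S hS
    obtain ⟨gA, hgA⟩ := (hS₂ 0).symm.exists_unit
    obtain ⟨gB, hgB⟩ := (hS₁ 0).symm.exists_unit
    obtain ⟨i, hi⟩ := exists_of_cnt hc₂ (j := 0) (l := s) (by rw [tw_x H.swap]; norm_num)
    refine noiso hM₂ hM₁ 0 gA _ hgA gB _ hgB i ?_ S (fun j => (hS j).symm)
    intro k
    refine exp_ne_of_int (fun r e => ?_)
    rw [hi] at e
    have hk : κ₁ 0 k ≠ s := by
      intro e2
      have := cnt_pos hc₁ 0 k
      rw [e2, tw_s H] at this; exact absurd this (lt_irrefl 0)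
    obtain ⟨_, hh⟩ := hnint 0 _ _ hk r e
    rcases hh with ⟨_, e2⟩ | ⟨_, e2⟩
    · exact H.sz' e2
    · exact H.sz e2
  have H21 : ∀ Z : Matrix (Fin a) (Fin a) ℂ, (∀ j, AA κ₂ g₂ μ 0 j * Z = Z * AA κ₁ g₁ μ 0 j) → Z = 0 := by
    intro Z hZ
    obtain ⟨i, hi⟩ := exists_of_cnt hc₁ (j := 0) (l := x) (by rw [tw_x H]; norm_num)
    refine noiso hA₁ hA₂ 0 (g₁ 0) _ (AA_zero κ₁ g₁ μ 0) (g₂ 0) _ (AA_zero κ₂ g₂ μ 0) i ?_ Z (fun j => (hZ j).symm)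
    intro k e
    have e2 := hinj 0 e
    rw [hi] at e2
    have := cnt_pos hc₂ 0 k
    rw [e2, tw_s H.swap] at this; exact absurd this (lt_irrefl 0)
  -- the extra matrix
  have uniq : ∀ {κ : Fin (p + 1) → Fin a → Λ} {m : Fin (p + 1) → Λ → ℕ} {z : Λ},
      (cnt κ fun _ => Finset.univ) = m → m h z = 1 → ∃ i0, ∀ i, κ h i = z ↔ i = i0 := by
    intro κ m z hc hm
    rw [← hc] at hm
    obtain ⟨i0, hi0⟩ := Finset.card_eq_one.1 hm
    refine ⟨i0, fun i => ?_⟩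
    have := Finset.ext_iff.1 hi0 i
    simpa using this
  obtain ⟨i0, hi0⟩ := uniq hc₁ (tw_z H)
  obtain ⟨i1, hi1⟩ := uniq hc₂ (tw_z H.swap)
  have hn1 : ∀ i, κ₁ h i ≠ z1 := fun i e => by
    have := cnt_pos hc₁ h i
    rw [e, tw_z' H] at this; exact absurd this (lt_irrefl 0)
  have hn2 : ∀ i, κ₂ h i ≠ z0 := fun i e => by
    have := cnt_pos hc₂ h i
    rw [e, tw_z' H.swap] at this; exact absurd this (lt_irrefl 0)
  obtain ⟨E, hE⟩ : ∃ E : Matrix (Fin a) (Fin a) ℂ, E = (g₁ h).val * single i0 i1 1 * ((g₂ h)⁻¹).val := ⟨_, rfl⟩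
  obtain ⟨b, hbd⟩ : ∃ b : Fin (p + 1) → ℂ, b = fun j => (X.a j.castSucc - X.a h.castSucc)⁻¹ := ⟨_, rfl⟩
  have hEE : AA κ₁ g₁ μ 0 h * E - E * AA κ₂ g₂ μ 0 h = -E := by
    have e1 : AA κ₁ g₁ μ 0 h * E = μ h z0 • E := by
      rw [hE, AA_zero]
      calc _ = (g₁ h).val * diagonal (μ h ∘ κ₁ h) * (((g₁ h)⁻¹).val * (g₁ h).val) * single i0 i1 1 * ((g₂ h)⁻¹).val := by
            simp only [mul_assoc]
        _ = (g₁ h).val * (diagonal (μ h ∘ κ₁ h) * single i0 i1 1) * ((g₂ h)⁻¹).val := by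
            rw [Units.inv_mul, mul_one]; simp only [mul_assoc]
        _ = _ := by
            have : diagonal (μ h ∘ κ₁ h) * single i0 i1 (1 : ℂ) = μ h z0 • single i0 i1 1 := by
              ext i k
              rw [Matrix.diagonal_mul, Matrix.smul_apply, Matrix.single_apply]
              split_ifs with e
              · rw [← e.1, Function.comp, (hi0 i0).2 rfl, smul_eq_mul]
              · simp
            rw [this, mul_smul_comm, smul_mul_assoc]
    have e2 : E * AA κ₂ g₂ μ 0 h = μ h z1 • E := by
      rw [hE, AA_zero]
      calc _ = (g₁ h).val * single i0 i1 1 * (((g₂ h)⁻¹).val * (g₂ h).val) * diagonal (μ h ∘ κ₂ h) * ((g₂ h)⁻¹).val := by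
            simp only [mul_assoc]
        _ = (g₁ h).val * (single i0 i1 1 * diagonal (μ h ∘ κ₂ h)) * ((g₂ h)⁻¹).val := by
            rw [Units.inv_mul, mul_one]; simp only [mul_assoc]
        _ = _ := by
            have : single i0 i1 (1 : ℂ) * diagonal (μ h ∘ κ₂ h) = μ h z1 • single i0 i1 1 := by
              ext i k
              rw [Matrix.mul_diagonal, Matrix.smul_apply, Matrix.single_apply]
              split_ifs with e
              · rw [← e.2, Function.comp, (hi1 i1).2 rfl, smul_eq_mul, mul_comm]
              · simp
            rw [this, mul_smul_comm, smul_mul_assoc]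
    rw [e1, e2, hz, add_smul, one_smul]; abel
  -- the extension
  have hrk : 2 * (Fintype.card (Fin a) * Fintype.card (Fin a)) + 2 ≤
      ∑ j, Module.finrank ℂ (adR (AA κ₁ g₁ μ 0 j) (AA κ₂ g₂ μ 0 j)).range := by
    have e : ∀ j, ((Module.finrank ℂ (adR (AA κ₁ g₁ μ 0 j) (AA κ₂ g₂ μ 0 j)).range : ℕ) : ℤ)
        = ((a : ℤ) ^ 2 - sq β j) + (if j = 0 then 2 else 0) + (if j = h then 1 else 0) := by
      intro j
      rw [AA_zero, AA_zero, finrank_adR]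
      have h2 := card_pairs (κ₁ j) (κ₂ j) (μ j) (hinj j)
      have h3 := tw_mul H j
      rw [← hc₁, ← hc₂] at h3
      simp only [cnt] at h3
      rw [h3] at h2
      simp only [Function.comp]
      rw [h2]; simp only [Fintype.card_fin]; ring
    have e2 : ((∑ j, Module.finrank ℂ (adR (AA κ₁ g₁ μ 0 j) (AA κ₂ g₂ μ 0 j)).range : ℕ) : ℤ)
        = ∑ j, ((a : ℤ) ^ 2 - sq β j) + 3 := by
      push_cast
      rw [Finset.sum_congr rfl fun j _ => e j, Finset.sum_add_distrib, Finset.sum_add_distrib]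
      simp; ring
    zify
    push_cast at e2
    rw [e2]; simp only [Fintype.card_fin]; nlinarith
  obtain ⟨Y, hY0, hY1⟩ := ext_step (fun j => adR (AA κ₁ g₁ μ 0 j) (AA κ₂ g₂ μ 0 j)) E b h hrk
  have hCB := cbrick_bg κ₁ κ₂ g₁ g₂ Y μ h b E hs₁ hs₂ H21 (by
    intro θ₁ θ₂ w c hθ₁ hθ₂ hw
    obtain ⟨s1, rfl⟩ := hA₁.schur θ₁ hθ₁
    obtain ⟨s2, rfl⟩ := hA₂.schur θ₂ hθ₂
    have hs12 : s1 - s2 = 0 := hY1 (s1 - s2) w c (fun j hj => by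
      have := hw j hj
      rw [smul_mul_assoc, one_mul, mul_smul_comm, mul_one, ← sub_smul] at this
      exact this)
    have hs12' : s1 = s2 := sub_eq_zero.1 hs12
    subst hs12'
    refine ⟨s1, rfl, rfl, ?_⟩
    refine kzero X hm₁ hm₂ hu₁ hu₂ hs₁ hs₂ hS h w (c • E) ?_ ?_
    · rw [mul_smul_comm, smul_mul_assoc, ← smul_sub, hEE, smul_neg]
    · intro j hj
      have := hw j hj
      rw [smul_mul_assoc, one_mul, mul_smul_comm, mul_one, sub_self, zero_add] at this
      have e : (c * b j) • E = (X.a j.castSucc - X.a h.castSucc)⁻¹ • c • E := by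
        rw [smul_smul, hbd, mul_comm]
      rw [e] at this
      exact (sub_eq_zero.1 this).symm)
  have hSol := sol_bg κ₁ κ₂ g₁ g₂ Y μ b E hs₁ hs₂ hY0
  have hEb : fromBlocks 0 E 0 0 = (bg g₁ g₂ Y h).val * single (Sum.inl i0) (Sum.inr i1) 1 * ((bg g₁ g₂ Y h)⁻¹).val := by
    have e0 : (single (Sum.inl i0) (Sum.inr i1) 1 : Matrix (Fin a ⊕ Fin a) (Fin a ⊕ Fin a) ℂ)
        = fromBlocks 0 (single i0 i1 1) 0 0 := by
      ext (i | i) (k | k) <;> simp [Matrix.single_apply]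
    rw [e0]
    change _ = fromBlocks (g₁ h).val (Y h * (g₂ h).val) 0 (g₂ h).val * _ *
      fromBlocks ((g₁ h)⁻¹).val (-(((g₁ h)⁻¹).val * Y h)) 0 ((g₂ h)⁻¹).val
    simp [Matrix.fromBlocks_multiply, hE]
  have hEC := ecompat_single (fun j => Sum.elim (κ₁ j) (κ₂ j)) (bg g₁ g₂ Y) b h (by rw [hbd]; simp)
    (Sum.inl i0) (Sum.inr i1) (by simp) (by
      rintro (i | i) hi
      · simp only [Sum.elim_inl]
        rw [(hi0 i0).2 rfl]
        exact hz0 _ (fun e => hi (by rw [(hi0 i).1 e]))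
      · simp only [Sum.elim_inl, Sum.elim_inr]
        rw [(hi0 i0).2 rfl]
        exact hz0 _ (hn2 i)) (by
      rintro (i | i) hi
      · simp only [Sum.elim_inl, Sum.elim_inr]
        rw [(hi1 i1).2 rfl]
        exact hz1 _ (hn1 i)
      · simp only [Sum.elim_inr]
        rw [(hi1 i1).2 rfl]
        exact hz1 _ (fun e => hi (by rw [(hi1 i).1 e])))
  rw [← hEb] at hEC
  have hcnt : ∀ j l, cnt (fun j => Sum.elim (κ₁ j) (κ₂ j)) (fun _ => Finset.univ) j l
      = tw β 0 h x s y z0 j l + tw β 0 h s x y z1 j l := by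
    intro j l
    rw [cnt_elim2, hc₁, hc₂]
  obtain ⟨g', hg', hrob⟩ := robust hEC hSol hCB 0 (fun l => by rw [hcnt]; exact tw_le H h1 l)
    ⟨h, z0, by rw [hcnt, tw_z H, tw_z' H.swap]; decide⟩
  refine ⟨X, fun j => Sum.elim (κ₁ j) (κ₂ j), g', Sum.inl i0, Sum.inr i1, hcnt, ?_, ?_, ?_⟩
  · rintro (i | i)
    · simpa using hi0 i
    · simpa using hn2 i
  · rintro (i | i)
    · simpa using hn1 i
    · simpa using hi1 i
  · intro μ' hμ'
    obtain ⟨U, hU1, hU2, hU3⟩ := hrob μ' hμ'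
    refine ⟨U, hU1, hU2, ?_⟩
    rw [← hU3]
    refine Finset.sum_congr rfl fun j _ => ?_
    rw [hbd, hEb, ← hg']
    congr 1
    exact (trace_single_conj _ _ _ _ _).symm

end host
end DSP

namespace DSP

section frame
variable {ι : Type*} [Fintype ι] [DecidableEq ι] {Λ : Type*} [LinearOrder Λ]

theorem frame_supp {κ : ι → Λ} {U : Matrix ι ι ℂ} (hU : SU κ U) (μ : Λ → ℂ) (w : (Matrix ι ι ℂ)ˣ)
    (hw : diagonal (μ ∘ κ) + U = w.val * diagonal (μ ∘ κ) * (w⁻¹).val) (i0 i1 : ι)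
    (hmin : ∀ i, i ≠ i0 → κ i0 < κ i ∧ μ (κ i) ≠ μ (κ i0)) (hmax : ∀ i, i ≠ i1 → κ i < κ i1 ∧ μ (κ i) ≠ μ (κ i1))
    (Z : Matrix ι ι ℂ) (hZ : Z i1 i0 = 0) : ((w⁻¹).val * Z * w.val) i1 i0 = 0 := by
  have e1 : (diagonal (μ ∘ κ) + U) * w.val = w.val * diagonal (μ ∘ κ) := by
    rw [hw, mul_assoc, Units.inv_mul, mul_one]
  have e2 : (w⁻¹).val * (diagonal (μ ∘ κ) + U) = diagonal (μ ∘ κ) * (w⁻¹).val := by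
    rw [hw, ← mul_assoc, ← mul_assoc, Units.inv_mul, one_mul]
  have r1 : ∀ k, k ≠ i1 → w.val i1 k = 0 := by
    intro k hk
    have h1 := congrFun (congrFun e1 i1) k
    rw [add_mul, Matrix.add_apply, Matrix.diagonal_mul, Matrix.mul_diagonal, Matrix.mul_apply,
      Finset.sum_eq_zero (fun l _ => by
        rw [hU i1 l (fun hlt => ?_), zero_mul]
        by_cases hl : l = i1
        · rw [hl] at hlt; exact lt_irrefl _ hlt
        · exact lt_asymm hlt (hmax l hl).1), add_zero] at h1
    simp only [Function.comp] at h1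
    have h2 : (μ (κ k) - μ (κ i1)) * w.val i1 k = 0 := by linear_combination -h1
    exact (mul_eq_zero.1 h2).resolve_left (sub_ne_zero.2 (hmax k hk).2)
  have r2 : ∀ k, k ≠ i0 → (w⁻¹).val k i0 = 0 := by
    intro k hk
    have h1 := congrFun (congrFun e2 k) i0
    rw [mul_add, Matrix.add_apply, Matrix.diagonal_mul, Matrix.mul_diagonal, Matrix.mul_apply (N := U),
      Finset.sum_eq_zero (fun l _ => by
        rw [hU l i0 (fun hlt => ?_), mul_zero]
        by_cases hl : l = i0
        · rw [hl] at hlt; exact lt_irrefl _ hlt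
        · exact lt_asymm hlt (hmin l hl).1), add_zero] at h1
    simp only [Function.comp] at h1
    have h2 : (μ (κ k) - μ (κ i0)) * (w⁻¹).val k i0 = 0 := by linear_combination -h1
    exact (mul_eq_zero.1 h2).resolve_left (sub_ne_zero.2 (hmin k hk).2)
  have hone : w.val * (w⁻¹).val = 1 := Units.mul_inv w
  have s1 : ∀ k, w.val i1 i1 * (w⁻¹).val i1 k = (1 : Matrix ι ι ℂ) i1 k := by
    intro k
    rw [← hone, Matrix.mul_apply, Finset.sum_eq_single i1]
    · intro l _ hl; rw [r1 l hl, zero_mul]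
    · simp
  have s2 : ∀ k, w.val k i0 * (w⁻¹).val i0 i0 = (1 : Matrix ι ι ℂ) k i0 := by
    intro k
    rw [← hone, Matrix.mul_apply, Finset.sum_eq_single i0]
    · intro l _ hl; rw [r2 l hl, mul_zero]
    · simp
  have n1 : w.val i1 i1 ≠ 0 := by
    intro e; have := s1 i1; rw [e, zero_mul, Matrix.one_apply_eq] at this; exact zero_ne_one this
  have n2 : (w⁻¹).val i0 i0 ≠ 0 := by
    intro e; have := s2 i0; rw [e, mul_zero, Matrix.one_apply_eq] at this; exact zero_ne_one this
  have t1 : ∀ k, k ≠ i1 → (w⁻¹).val i1 k = 0 := by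
    intro k hk
    have := s1 k
    rw [Matrix.one_apply_ne hk.symm] at this
    exact (mul_eq_zero.1 this).resolve_left n1
  have t2 : ∀ k, k ≠ i0 → w.val k i0 = 0 := by
    intro k hk
    have := s2 k
    rw [Matrix.one_apply_ne hk] at this
    exact (mul_eq_zero.1 this).resolve_right n2
  rw [Matrix.mul_apply, Finset.sum_eq_single i0, Matrix.mul_apply, Finset.sum_eq_single i1, hZ, mul_zero, zero_mul]
  · intro k _ hk; rw [t1 k hk, zero_mul]
  · simp
  · intro k _ hk; rw [t2 k hk, mul_zero]
  · simp

end frame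

section even
variable {Λ : Type*} [LinearOrder Λ] [Fintype Λ] {p : ℕ}
variable {β : Fin (p + 1) → Λ → ℕ} {h : Fin (p + 1)} {x s y z0 z1 : Λ} {a : ℕ}

theorem tw_add (H : TW β 0 h x s y z0 z1) (j : Fin (p + 1)) (l : Λ) :
    tw β 0 h x s y z0 j l + tw β 0 h s x y z1 j l = if j = h ∧ (l = z0 ∨ l = z1) then 1 else
      if j = h ∧ l = y then 0 else 2 * β j l := by
  have a1 := H.xs; have a2 := H.zz; have a3 := H.xz; have a4 := H.xz'; have a5 := H.sz; have a6 := H.sz'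
  have b1 := H.yz; have b2 := H.yz'; have b3 := H.bz; have b4 := H.bz'; have b5 := H.bx; have b6 := H.bs
  have b7 := H.hy
  unfold tw
  by_cases c1 : l = z0
  · subst c1; by_cases c : j = h <;> simp [c, a2, a3.symm, a5.symm, b1.symm, b3]
  · by_cases c2 : l = z1
    · subst c2; by_cases c : j = h <;> simp [c, c1, a2, a4.symm, a6.symm, b2.symm, b4]
    · by_cases c3 : j = h ∧ l = y
      · simp [c1, c2, c3, b1, b2]
      · simp only [c1, c2, c3, and_false, or_self, if_false]
        by_cases c4 : j = 0 ∧ l = x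
        · obtain ⟨rfl, rfl⟩ := c4
          simp [a1, b5]
        · by_cases c5 : j = 0 ∧ l = s
          · obtain ⟨rfl, rfl⟩ := c5
            simp [a1.symm, b6]
          · simp only [c4, c5, if_false]; ring

theorem evenCase (hp : 2 ≤ p) (H : TW β 0 h x s y z0 z1) (ha : 1 ≤ a) (hb : ∀ j, ∑ l, β j l = a)
    (h1 : ∀ l, β 0 l ≤ 1) (hα : 2 * (a : ℤ) ^ 2 ≤ ∑ j, ((a : ℤ) ^ 2 - sq β j))
    (hβ : (a : ℤ) ≤ ∑ j ∈ Finset.univ.erase 0, ((a : ℤ) - mx β j))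
    (hz0 : ∀ l, l ≠ z0 → z0 < l) (hz1 : ∀ l, l ≠ z1 → l < z1)
    (ν : Fin (p + 1) → Λ → ℂ) (hν : 2 * pr ν (cv β) = -1)
    (hnint : ∀ j l l', l ≠ l' → 0 < β j l → 0 < β j l' → ∀ k : ℤ, ν j l - ν j l' ≠ k) :
    ∃ (κ : Fin (p + 1) → (Fin a ⊕ Fin a) → Λ) (M : Fin (p + 1) → Matrix (Fin a ⊕ Fin a) (Fin a ⊕ Fin a) ℂ),
      (∀ j l, cnt κ (fun _ => Finset.univ) j l = 2 * β j l) ∧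
      (∀ j, Sim (diagonal fun k => Complex.exp (2 * Real.pi * Complex.I * ν j (κ j k))) (M j)) ∧
      (List.ofFn M).prod = 1 := by
  obtain ⟨X, κ, g, i0, i1, hc, hi0, hi1, hsol⟩ := hostSol hp H ha hb h1 hα hβ hz0 hz1
  have hzz := H.zz
  obtain ⟨μ, hμ⟩ : ∃ μ : Fin (p + 1) → Λ → ℂ, μ = fun j l => if j = h ∧ l = z0 then ν h y else
    if j = h ∧ l = z1 then ν h y + 1 else ν j l := ⟨_, rfl⟩
  have m0 : μ h z0 = ν h y := by rw [hμ]; simp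
  have m1 : μ h z1 = ν h y + 1 := by rw [hμ]; simp [hzz.symm]
  have m2 : ∀ j l, l ≠ z0 → l ≠ z1 → μ j l = ν j l := by
    intro j l e0 e1; rw [hμ]; simp [e0, e1]
  have hby : 0 < β h y := by rw [H.b_y]; norm_num
  -- used labels
  have used : ∀ j i, (j = h ∧ κ j i = z0) ∨ (j = h ∧ κ j i = z1) ∨
      (0 < β j (κ j i) ∧ ¬ (j = h ∧ κ j i = y) ∧ κ j i ≠ z0 ∧ κ j i ≠ z1) := by
    intro j i
    have h2 : 0 < cnt κ (fun _ => Finset.univ) j (κ j i) := cnt_pos rfl j i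
    rw [hc, tw_add H] at h2
    split_ifs at h2 with e1 e2
    · rcases e1 with ⟨e, e1 | e1⟩
      · exact Or.inl ⟨e, e1⟩
      · exact Or.inr (Or.inl ⟨e, e1⟩)
    · exact absurd h2 (lt_irrefl 0)
    · refine Or.inr (Or.inr ⟨by omega, e2, ?_, ?_⟩)
      · intro e; rw [e, H.bz] at h2; simp at h2
      · intro e; rw [e, H.bz'] at h2; simp at h2
  have nonint : ∀ j i k, κ j i ≠ κ j k → ∀ r : ℤ, μ j (κ j i) - μ j (κ j k) = r →
      j = h ∧ ((κ j i = z0 ∧ κ j k = z1) ∨ (κ j i = z1 ∧ κ j k = z0)) := by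
    intro j i k hik r hr
    rcases used j i with ⟨e, e1⟩ | ⟨e, e1⟩ | ⟨p1, p2, p3, p4⟩ <;>
    rcases used j k with ⟨e', e1'⟩ | ⟨e', e1'⟩ | ⟨p1', p2', p3', p4'⟩
    · exact absurd (e1.trans e1'.symm) hik
    · exact ⟨e, Or.inl ⟨e1, e1'⟩⟩
    · subst e
      rw [e1, m0, m2 _ _ p3' p4'] at hr
      exact absurd hr (hnint _ _ _ (fun e => p2' ⟨rfl, e.symm⟩) hby p1' r)
    · exact ⟨e, Or.inr ⟨e1, e1'⟩⟩
    · exact absurd (e1.trans e1'.symm) hik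
    · subst e
      rw [e1, m1, m2 _ _ p3' p4'] at hr
      refine absurd ?_ (hnint _ _ _ (fun e => p2' ⟨rfl, e.symm⟩) hby p1' (r - 1))
      push_cast; linear_combination hr
    · subst e'
      rw [e1', m0, m2 _ _ p3 p4] at hr
      exact absurd hr (hnint _ _ _ (fun e => p2 ⟨rfl, e⟩) p1 hby r)
    · subst e'
      rw [e1', m1, m2 _ _ p3 p4] at hr
      refine absurd ?_ (hnint _ _ _ (fun e => p2 ⟨rfl, e⟩) p1 hby (r + 1))
      push_cast; linear_combination hr
    · rw [m2 _ _ p3 p4, m2 _ _ p3' p4'] at hr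
      exact absurd hr (hnint _ _ _ hik p1 p1' r)
  -- trace condition
  have hsum : ∑ j, ∑ i, μ j (κ j i) = 0 := by
    have e := pr_cnt κ (fun _ => Finset.univ) μ
    rw [e]
    have e2 : cv (cnt κ fun _ => Finset.univ) = (cv β + (cdl 0 x - cdl 0 s) + (cdl h z0 - cdl h y))
        + (cv β + (cdl 0 s - cdl 0 x) + (cdl h z1 - cdl h y)) := by
      rw [← tw_cv H, ← tw_cv H.swap]
      funext j l
      simp only [cv, Pi.add_apply]
      rw [hc]; push_cast; rfl
    have e3 : pr μ (cv β) = pr ν (cv β) := by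
      unfold pr
      refine Finset.sum_congr rfl fun j _ => Finset.sum_congr rfl fun l _ => ?_
      by_cases c0 : l = z0
      · simp [cv, c0, H.bz]
      · by_cases c1 : l = z1
        · simp [cv, c1, H.bz']
        · rw [m2 j l c0 c1]
    rw [e2]
    simp only [pr_add, pr_sub, pr_cdl, m0, m1, m2 h y H.yz H.yz', e3]
    linear_combination hν
  obtain ⟨U, hU1, hU2, hU3⟩ := hsol μ hsum
  have inj : ∀ j i i', μ j (κ j i) = μ j (κ j i') → κ j i = κ j i' := by
    intro j i i' e
    by_contra hne
    obtain ⟨rfl, hh⟩ := nonint j i i' hne 0 (by rw [e]; simp)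
    rcases hh with ⟨e1, e2⟩ | ⟨e1, e2⟩ <;> rw [e1, e2, m0, m1] at e <;> simp at e
  have hw : ∀ j, ∃ w : (Matrix (Fin a ⊕ Fin a) (Fin a ⊕ Fin a) ℂ)ˣ,
      diagonal (μ j ∘ κ j) + U j = w.val * diagonal (μ j ∘ κ j) * (w⁻¹).val := fun j =>
    (sim_diag_add_su (hU1 j) (μ j) (inj j)).exists_unit
  choose w hw using hw
  have hA : ∀ j, AA κ g μ U j = (g j * w j).val * diagonal (μ j ∘ κ j) * ((g j * w j)⁻¹).val := by
    intro j
    rw [AA, hw j, _root_.mul_inv_rev, Units.val_mul, Units.val_mul]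
    simp only [mul_assoc]
  obtain ⟨T, hT1, hT2, hT3, hT4⟩ := mono_pad X (AA κ g μ U) hU2 (fun j => g j * w j) (fun j => μ j ∘ κ j) hA (by
    intro j r i k
    simp only [Function.comp]
    by_cases hik : κ j i = κ j k
    · left
      rw [hik]; intro e
      have : ((r : ℂ) + 1) = 0 := by linear_combination e
      exact Nat.cast_add_one_ne_zero r this
    · by_cases hz : (r : ℂ) + 1 - μ j (κ j i) + μ j (κ j k) = 0
      · right
        obtain ⟨rfl, hh⟩ := nonint j i k hik (r + 1) (by push_cast; linear_combination -hz)
        rcases hh with ⟨e1, e2⟩ | ⟨e1, e2⟩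
        · exfalso
          rw [e1, e2, m0, m1] at hz
          have : ((r + 1 : ℕ) : ℂ) + 1 = 0 := by push_cast; linear_combination hz
          exact Nat.cast_add_one_ne_zero _ this
        · rw [e1, e2, m0, m1] at hz
          have hr : (r : ℂ) = 0 := by linear_combination hz
          refine ⟨by exact_mod_cast hr, ?_⟩
          rw [(hi1 i).1 e1, (hi0 k).1 e2]
          have hsupp := frame_supp (hU1 j) (μ j) (w j) (hw j) i0 i1 (by
              intro i hi
              have hne : κ j i ≠ z0 := fun e => hi ((hi0 i).1 e)
              rw [(hi0 i0).2 rfl]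
              refine ⟨hz0 _ hne, fun e => hne ?_⟩
              have := inj j i i0 (by rw [(hi0 i0).2 rfl]; exact e)
              rw [this, (hi0 i0).2 rfl]) (by
              intro i hi
              have hne : κ j i ≠ z1 := fun e => hi ((hi1 i).1 e)
              rw [(hi1 i1).2 rfl]
              refine ⟨hz1 _ hne, fun e => hne ?_⟩
              have := inj j i i1 (by rw [(hi1 i1).2 rfl]; exact e)
              rw [this, (hi1 i1).2 rfl])
            (∑ l, (X.a l.castSucc - X.a j.castSucc)⁻¹ • (((g j)⁻¹).val * AA κ g μ U l * (g j).val)) (by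
              rw [Matrix.sum_apply, ← hU3]
              exact Finset.sum_congr rfl fun l _ => by rw [Matrix.smul_apply, smul_eq_mul])
          rw [← hsupp]
          refine congrFun (congrFun ?_ i1) i0
          rw [Matrix.mul_sum, Matrix.sum_mul]
          refine Finset.sum_congr rfl fun l _ => ?_
          rw [mul_smul_comm, smul_mul_assoc, _root_.mul_inv_rev, Units.val_mul, Units.val_mul]
          simp only [mul_assoc]
          rfl
      · exact Or.inl hz)
  refine ⟨fun j i => if j = h ∧ (κ j i = z0 ∨ κ j i = z1) then y else κ j i, mon T, ?_, ?_, hT4⟩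
  · intro j l
    by_cases hj : j = h
    · subst hj
      have hcy : ∀ l, (Finset.univ.filter fun i => κ j i = l).card = _ := fun l => (hc j l).trans (tw_add H j l)
      unfold cnt
      simp only [true_and]
      by_cases ly : l = y
      · subst ly
        have e : (Finset.univ.filter fun i => (if κ j i = z0 ∨ κ j i = z1 then l else κ j i) = l)
            = ({i0, i1} : Finset _) := by
          ext i
          simp only [Finset.mem_filter, Finset.mem_univ, true_and, Finset.mem_insert, Finset.mem_singleton, hi0, hi1]
          split_ifs with c
          · simp [c]
          · simp only [c, iff_false]
            intro e
            have := used j i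
            simp only [hi0, hi1] at this
            rcases this with ⟨_, q⟩ | ⟨_, q⟩ | ⟨_, q, _⟩
            · exact c (Or.inl q)
            · exact c (Or.inr q)
            · exact q ⟨trivial, e⟩
        rw [e, Finset.card_pair, H.b_y]
        intro e; have := (hi0 i0).2 rfl; rw [e, (hi1 i1).2 rfl] at this; exact hzz this.symm
      · by_cases lz : l = z0 ∨ l = z1
        · have : β j l = 0 := by rcases lz with rfl | rfl; exacts [H.bz j, H.bz' j]
          rw [this, mul_zero, Finset.card_eq_zero, Finset.filter_eq_empty_iff]
          intro i _
          split_ifs with c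
          · exact fun e => ly e.symm
          · intro e; rw [e] at c; exact c lz
        · have e : (Finset.univ.filter fun i => (if κ j i = z0 ∨ κ j i = z1 then y else κ j i) = l)
              = Finset.univ.filter fun i => κ j i = l := by
            ext i
            simp only [Finset.mem_filter, Finset.mem_univ, true_and]
            split_ifs with c
            · constructor
              · exact fun e => absurd e.symm ly
              · intro e; rw [e] at c; exact absurd c lz
            · rfl
          rw [e, hcy]
          simp [lz, ly]
    · have e := (hc j l).trans (tw_add H j l)
      simp only [hj, false_and, if_false] at e
      rw [← e]
      unfold cnt
      simp only [hj, false_and, if_false]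
  · intro j
    convert hT3 j using 3 with k
    simp only [Function.comp]
    rcases used j k with ⟨rfl, e1⟩ | ⟨rfl, e1⟩ | ⟨p1, p2, p3, p4⟩
    · simp [e1, m0]
    · simp only [e1, m1, or_true, true_and, if_true]
      rw [Complex.exp_eq_exp_iff_exists_int]
      exact ⟨-1, by push_cast; ring⟩
    · simp only [p3, p4, or_self, and_false, if_false]
      rw [m2 _ _ p3 p4]

end even
end DSP

namespace DSP

section core
variable {Λ : Type*} [LinearOrder Λ] [Fintype Λ] {p : ℕ}

theorem inj_extend (f : Λ → ℂ) (S : Finset Λ) (hf : ∀ l ∈ S, ∀ l' ∈ S, f l = f l' → l = l') :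
    ∃ f' : Λ → ℂ, Function.Injective f' ∧ ∀ l ∈ S, f' l = f l := by
  obtain ⟨B, hB⟩ : ∃ B : ℝ, B = ∑ l, ‖f l‖ := ⟨_, rfl⟩
  have hle : ∀ l, ‖f l‖ ≤ B := fun l => by
    rw [hB]; exact Finset.single_le_sum (f := fun l => ‖f l‖) (fun _ _ => norm_nonneg _) (Finset.mem_univ l)
  have hB0 : 0 ≤ B := by rw [hB]; positivity
  obtain ⟨e⟩ : Nonempty (Λ ≃ Fin (Fintype.card Λ)) := ⟨Fintype.equivFin Λ⟩
  obtain ⟨q, hq⟩ : ∃ q : Λ → ℂ, q = fun l => (((B + 1 + ((e l).val : ℝ)) : ℝ) : ℂ) := ⟨_, rfl⟩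
  have hqn : ∀ l l', f l ≠ q l' := by
    intro l l' h
    have h1 := hle l
    rw [h, hq] at h1
    simp only [Complex.norm_real, Real.norm_eq_abs] at h1
    have h2 := le_abs_self (B + 1 + ((e l').val : ℝ))
    have h3 : (0 : ℝ) ≤ ((e l').val : ℝ) := Nat.cast_nonneg _
    linarith
  have hqi : Function.Injective q := by
    intro l l' h
    simp only [hq] at h
    have h2 : B + 1 + ((e l).val : ℝ) = B + 1 + ((e l').val : ℝ) := by exact_mod_cast h
    have h3 : ((e l).val : ℝ) = ((e l').val : ℝ) := by linarith
    exact e.injective (Fin.ext (by exact_mod_cast h3))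
  refine ⟨fun l => if l ∈ S then f l else q l, ?_, fun l hl => by simp [hl]⟩
  intro l l' h
  simp only at h
  split_ifs at h with h1 h2 h2
  · exact hf l h1 l' h2 h
  · exact absurd h (hqn _ _)
  · exact absurd h.symm (hqn _ _)
  · exact hqi h

theorem pr_shift {J : Type*} [Fintype J] (ν : J → Λ → ℂ) (t : J → Λ → ℂ) (w : J → Λ → ℂ) :
    pr (ν + t) w = pr ν w + pr t w := by
  rw [pr_comm, pr_add, pr_comm w ν, pr_comm w t]

theorem pr_single_left {J : Type*} [Fintype J] (j : J) (l : Λ) (c : ℂ) (w : J → Λ → ℂ) :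
    pr (fun j' l' => if j' = j ∧ l' = l then c else 0) w = c * w j l := by
  unfold pr
  rw [Finset.sum_eq_single j, Finset.sum_eq_single l]
  · simp
  · intro b _ hb; simp [hb]
  · simp
  · intro b _ hb; simp [hb]
  · simp

theorem exists_shift {J : Type*} [Fintype J] {m : J → Λ → ℕ} {n : ℕ} (hn : 1 ≤ n) (hm : ∀ j, ∑ l, m j l = n)
    (j0 : J) (h2 : ∀ l, m j0 l ≤ 2) (hodd : ∃ j l, Odd (m j l)) (D : ℤ) :
    ∃ t : J → Λ → ℤ, pr (fun j l => (t j l : ℂ)) (cv m) = D := by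
  by_cases h1 : ∃ l, m j0 l = 1
  · obtain ⟨l, hl⟩ := h1
    refine ⟨fun j' l' => if j' = j0 ∧ l' = l then D else 0, ?_⟩
    have := pr_single_left j0 l (D : ℂ) (cv m)
    simp only [cv, hl] at this
    rw [← mul_one (D : ℂ), ← Nat.cast_one, ← this]
    congr 1
    funext j' l'
    beta_reduce
    by_cases hc : j' = j0 ∧ l' = l
    · rw [if_pos hc, if_pos hc]
    · rw [if_neg hc, if_neg hc, Int.cast_zero]
  · obtain ⟨l0, hl0⟩ : ∃ l, m j0 l = 2 := by
      by_contra hc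
      push Not at h1 hc
      have : ∀ l, m j0 l = 0 := fun l => by have := h2 l; have := h1 l; have := hc l; omega
      have h3 := hm j0
      simp [this] at h3; omega
    obtain ⟨j, l, q, hq⟩ := hodd
    refine ⟨(fun j' l' => if j' = j ∧ l' = l then D else 0) + fun j' l' => if j' = j0 ∧ l' = l0 then -q * D else 0, ?_⟩
    have e1 := pr_single_left j l (D : ℂ) (cv m)
    have e2 := pr_single_left j0 l0 (-q * D : ℂ) (cv m)
    have e3 := pr_shift (fun j' l' => if j' = j ∧ l' = l then (D : ℂ) else 0)
      (fun j' l' => if j' = j0 ∧ l' = l0 then (-q * D : ℂ) else 0) (cv m)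
    rw [e1, e2] at e3
    simp only [cv, hq, hl0] at e3
    trans (D : ℂ) * ((2 * q + 1 : ℕ) : ℂ) + -q * D * ((2 : ℕ) : ℂ)
    · rw [← e3]
      congr 1
      funext j' l'
      simp only [Pi.add_apply]
      push_cast
      rfl
    · push_cast; ring

theorem exp_shift (u : ℂ) (k : ℤ) : Complex.exp (2 * Real.pi * Complex.I * (u + k)) =
    Complex.exp (2 * Real.pi * Complex.I * u) := by
  rw [Complex.exp_eq_exp_iff_exists_int]
  exact ⟨k, by ring⟩

theorem core_odd (hp : 2 ≤ p) {n : ℕ} (hn : 2 ≤ n) {m : Fin (p + 1) → Λ → ℕ} (hm : ∀ j, ∑ l, m j l = n)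
    (h2 : ∀ l, m 0 l ≤ 2) (hodd : ∃ j l, Odd (m j l))
    (hα : 2 * (n : ℤ) ^ 2 - 2 ≤ ∑ j, ((n : ℤ) ^ 2 - sq m j))
    (hβ : (n : ℤ) ≤ ∑ j ∈ Finset.univ.erase 0, ((n : ℤ) - mx m j))
    (ν : Fin (p + 1) → Λ → ℂ) (D : ℤ) (hD : pr ν (cv m) = D)
    (hnint : ∀ j l l', l ≠ l' → 0 < m j l → 0 < m j l' → ∀ k : ℤ, ν j l - ν j l' ≠ k) :
    ∃ (κ : Fin (p + 1) → Fin n → Λ) (M : Fin (p + 1) → Matrix (Fin n) (Fin n) ℂ),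
      (∀ j l, cnt κ (fun _ => Finset.univ) j l = m j l) ∧
      (∀ j, Sim (diagonal fun k => Complex.exp (2 * Real.pi * Complex.I * ν j (κ j k))) (M j)) ∧
      (List.ofFn M).prod = 1 := by
  have hG : Good m := plainGood 0 n m (by omega) hm h2 hodd (Or.inr ⟨hα, by convert hβ⟩)
  obtain ⟨X⟩ := exists_pts (N := p + 2) (by omega)
  obtain ⟨t, ht⟩ := exists_shift (by omega) hm 0 h2 hodd (-D)
  have hext : ∀ j, ∃ f' : Λ → ℂ, Function.Injective f' ∧
      ∀ l ∈ Finset.univ.filter (fun l => 0 < m j l), f' l = ν j l + t j l := fun j =>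
    inj_extend (fun l => ν j l + t j l) _ (by
      intro l hl l' hl' e
      by_contra hne
      refine hnint j l l' hne (by simpa using hl) (by simpa using hl') (t j l' - t j l) ?_
      push_cast; linear_combination e)
  choose μ hμi hμ using hext
  have hμ' : ∀ j l, 0 < m j l → μ j l = ν j l + t j l := fun j l hl => hμ j l (by simpa using hl)
  obtain ⟨κ, g, T, hc, hs, h3, h4, h5, h6⟩ := half X hG hm μ hμi (by
      have e : pr μ (cv m) = pr (ν + fun j l => (t j l : ℂ)) (cv m) := by
        unfold pr
        refine Finset.sum_congr rfl fun j _ => Finset.sum_congr rfl fun l _ => ?_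
        by_cases hl : 0 < m j l
        · rw [hμ' j l hl]; rfl
        · have : m j l = 0 := by omega
          simp [cv, this]
      rw [e, pr_shift, hD, ht]; push_cast; ring) (by
      intro j l l' hne hl hl' k e
      rw [hμ' j l hl, hμ' j l' hl'] at e
      refine hnint j l l' hne hl hl' (k + t j l' - t j l) ?_
      push_cast; linear_combination e)
  refine ⟨κ, mon T, fun j l => by rw [hc], fun j => ?_, h6⟩
  convert h5 j using 3 with k
  rw [hμ' j _ (cnt_pos hc j k), exp_shift]

theorem core_even (hp : 2 ≤ p) {a : ℕ} (ha : 1 ≤ a) {β : Fin (p + 1) → Λ → ℕ} (hb : ∀ j, ∑ l, β j l = a)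
    (h1 : ∀ l, β 0 l ≤ 1) (hα : 2 * (a : ℤ) ^ 2 ≤ ∑ j, ((a : ℤ) ^ 2 - sq β j))
    (hβ : (a : ℤ) ≤ ∑ j ∈ Finset.univ.erase 0, ((a : ℤ) - mx β j))
    {z0 z1 : Λ} (hzz : z0 ≠ z1) (hz0 : ∀ l, l ≠ z0 → z0 < l) (hz1 : ∀ l, l ≠ z1 → l < z1)
    (hbz : ∀ j, β j z0 = 0) (hbz' : ∀ j, β j z1 = 0)
    (ν : Fin (p + 1) → Λ → ℂ) (D : ℤ) (hD : 2 * pr ν (cv β) = D) (hgen : ∀ k : ℤ, pr ν (cv β) ≠ k)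
    (hnint : ∀ j l l', l ≠ l' → 0 < β j l → 0 < β j l' → ∀ k : ℤ, ν j l - ν j l' ≠ k) :
    ∃ (κ : Fin (p + 1) → (Fin a ⊕ Fin a) → Λ) (M : Fin (p + 1) → Matrix (Fin a ⊕ Fin a) (Fin a ⊕ Fin a) ℂ),
      (∀ j l, cnt κ (fun _ => Finset.univ) j l = 2 * β j l) ∧
      (∀ j, Sim (diagonal fun k => Complex.exp (2 * Real.pi * Complex.I * ν j (κ j k))) (M j)) ∧
      (List.ofFn M).prod = 1 := by
  -- a nonscalar class besides the first
  obtain ⟨j1, hj1, hj1'⟩ : ∃ j, j ≠ 0 ∧ mx β j < a := by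
    by_contra hc
    push Not at hc
    have : ∑ j ∈ Finset.univ.erase (0 : Fin (p + 1)), ((a : ℤ) - mx β j) ≤ 0 := by
      refine Finset.sum_nonpos fun j hj => ?_
      have := hc j (Finset.ne_of_mem_erase hj)
      have h4 : (a : ℤ) ≤ mx β j := by exact_mod_cast this
      linarith
    have h5 : (1 : ℤ) ≤ a := by exact_mod_cast ha
    linarith
  have hmx : ∀ j l, β j l ≤ mx β j := fun j l => Finset.le_sup (f := β j) (Finset.mem_univ l)
  have ha2 : 2 ≤ a := by
    by_contra hlt
    have h0 : a = 1 := by omega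
    have : ∀ l, β j1 l = 0 := fun l => by have := hmx j1 l; omega
    have h3 := hb j1
    simp [this] at h3; omega
  obtain ⟨S, hS⟩ : ∃ S : Finset Λ, S = Finset.univ.filter fun l => β 0 l = 1 := ⟨_, rfl⟩
  have hSc : S.card = a := by
    rw [← hb 0, hS, Finset.card_filter]
    refine Finset.sum_congr rfl fun l _ => ?_
    have := h1 l
    split_ifs <;> omega
  have hSm : ∀ l, l ∈ S → β 0 l = 1 := fun l hl => by rw [hS] at hl; simpa using hl
  obtain ⟨h, x, s, y, H⟩ : ∃ h x s y, TW β 0 h x s y z0 z1 := by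
    by_cases ha3 : 3 ≤ a
    · obtain ⟨x, s, y, hx, hs, hy, h12, h13, h23⟩ := Finset.two_lt_card_iff.1 (show 2 < S.card by omega)
      exact ⟨0, x, s, y, h12, hSm x hx, hSm s hs, hSm y hy, fun _ => ⟨h13.symm, h23.symm⟩, hbz, hbz', hzz⟩
    · obtain ⟨x, s, hx, hs, hxs⟩ := Finset.one_lt_card_iff.1 (show 1 < S.card by omega)
      obtain ⟨y, hy⟩ : ∃ y, β j1 y = 1 := by
        by_contra hc
        push Not at hc
        have : ∀ l, β j1 l = 0 := fun l => by have := hmx j1 l; have := hc l; omega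
        have h3 := hb j1
        simp [this] at h3; omega
      exact ⟨j1, x, s, y, hxs, hSm x hx, hSm s hs, hy, fun e => absurd e hj1, hbz, hbz', hzz⟩
  obtain ⟨k, hk⟩ : ∃ k, D = 2 * k + 1 := by
    rcases Int.even_or_odd D with ⟨k, hk⟩ | ⟨k, hk⟩
    · exfalso
      apply hgen k
      rw [hk] at hD
      push_cast at hD
      linear_combination hD / 2
    · exact ⟨k, hk⟩
  obtain ⟨t, ht⟩ : ∃ t : Fin (p + 1) → Λ → ℤ, t = fun j' l' => if j' = 0 ∧ l' = x then -(k + 1) else 0 := ⟨_, rfl⟩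
  have htp : pr (fun j l => (t j l : ℂ)) (cv β) = -(k + 1) := by
    have e := pr_single_left (0 : Fin (p + 1)) x (-(k + 1) : ℂ) (cv β)
    simp only [cv, H.bx] at e
    rw [Nat.cast_one, mul_one] at e
    rw [← e, ht]
    congr 1
    funext j' l'
    beta_reduce
    by_cases hc : j' = 0 ∧ l' = x
    · rw [if_pos hc, if_pos hc]; push_cast; rfl
    · rw [if_neg hc, if_neg hc, Int.cast_zero]
  obtain ⟨κ, M, e1, e2, e3⟩ := evenCase hp H ha hb h1 hα hβ hz0 hz1 (ν + fun j l => (t j l : ℂ)) (by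
      rw [pr_shift, mul_add, hD, htp, hk]; push_cast; ring) (by
      intro j l l' hne hl hl' r e
      refine hnint j l l' hne hl hl' (r + t j l' - t j l) ?_
      simp only [Pi.add_apply] at e
      push_cast; linear_combination e)
  refine ⟨κ, M, e1, fun j => ?_, e3⟩
  convert e2 j using 3 with i
  simp only [Pi.add_apply]
  rw [exp_shift]

theorem core {n : ℕ} (hn : 2 ≤ n) {m : Fin (p + 1) → Λ → ℕ} (hm : ∀ j, ∑ l, m j l = n)
    (h2 : ∀ l, m 0 l ≤ 2)
    (hα : 2 * (n : ℤ) ^ 2 - 2 ≤ ∑ j, ((n : ℤ) ^ 2 - sq m j))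
    (hβ : (n : ℤ) ≤ ∑ j ∈ Finset.univ.erase 0, ((n : ℤ) - mx m j))
    {z0 z1 : Λ} (hzz : z0 ≠ z1) (hz0 : ∀ l, l ≠ z0 → z0 < l) (hz1 : ∀ l, l ≠ z1 → l < z1)
    (hbz : ∀ j, m j z0 = 0) (hbz' : ∀ j, m j z1 = 0)
    (ν : Fin (p + 1) → Λ → ℂ) (D : ℤ) (hD : pr ν (cv m) = D)
    (hnint : ∀ j l l', l ≠ l' → 0 < m j l → 0 < m j l' → ∀ k : ℤ, ν j l - ν j l' ≠ k)
    (hgen : ∀ (β : Fin (p + 1) → Λ → ℕ) (a : ℕ), (∀ j, ∑ l, β j l = a) → 0 < a → a < n → (∀ j l, β j l ≤ m j l) →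
      ∀ k : ℤ, pr ν (cv β) ≠ k) :
    ∃ (ι : Type) (_ : Fintype ι) (_ : DecidableEq ι) (κ : Fin (p + 1) → ι → Λ) (M : Fin (p + 1) → Matrix ι ι ℂ),
      (∀ j l, cnt κ (fun _ => Finset.univ) j l = m j l) ∧
      (∀ j, Sim (diagonal fun k => Complex.exp (2 * Real.pi * Complex.I * ν j (κ j k))) (M j)) ∧
      (List.ofFn M).prod = 1 := by
  have hmx : ∀ j l, m j l ≤ mx m j := fun j l => Finset.le_sup (f := m j) (Finset.mem_univ l)
  have hmx1 : ∀ j, 1 ≤ mx m j := by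
    intro j
    by_contra hc
    have : ∀ l, m j l = 0 := fun l => by have := hmx j l; omega
    have h3 := hm j
    simp [this] at h3; omega
  have hp : 2 ≤ p := by
    by_contra hlt
    have h3 : ∑ j ∈ Finset.univ.erase (0 : Fin (p + 1)), ((n : ℤ) - mx m j) ≤
        ∑ j ∈ Finset.univ.erase (0 : Fin (p + 1)), ((n : ℤ) - 1) := by
      refine Finset.sum_le_sum fun j _ => ?_
      have : (1 : ℤ) ≤ mx m j := by exact_mod_cast hmx1 j
      linarith
    rw [Finset.sum_const, Finset.card_erase_of_mem (Finset.mem_univ _), Finset.card_univ, Fintype.card_fin,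
      nsmul_eq_mul, Nat.add_sub_cancel] at h3
    have h4 : (p : ℤ) ≤ 1 := by exact_mod_cast (by omega : p ≤ 1)
    have h5 : (2 : ℤ) ≤ n := by exact_mod_cast hn
    nlinarith
  by_cases hodd : ∃ j l, Odd (m j l)
  · obtain ⟨κ, M, h⟩ := core_odd hp hn hm h2 hodd hα hβ ν D hD hnint
    exact ⟨Fin n, inferInstance, inferInstance, κ, M, h⟩
  · push Not at hodd
    have hev : ∀ j l, ∃ b, m j l = 2 * b := fun j l => by
      obtain ⟨b, hb⟩ := Nat.not_odd_iff_even.1 (hodd j l)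
      exact ⟨b, by omega⟩
    choose β hβm using hev
    obtain ⟨a, hna⟩ : ∃ a, n = 2 * a := ⟨∑ l, β 0 l, by rw [← hm 0, Finset.mul_sum]; simp [hβm]⟩
    have hb : ∀ j, ∑ l, β j l = a := by
      intro j
      have := hm j
      simp only [hβm, ← Finset.mul_sum] at this
      omega
    have hna' : (n : ℤ) = 2 * a := by exact_mod_cast hna
    have hsq : ∀ j, sq m j = 4 * sq β j := by
      intro j
      unfold sq
      rw [Finset.mul_sum]
      refine Finset.sum_congr rfl fun l _ => ?_
      rw [hβm]; push_cast; ring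
    have hprm : pr ν (cv m) = 2 * pr ν (cv β) := by
      rw [← pr_smul]
      congr 1
      funext j l
      simp only [cv, Pi.smul_apply, smul_eq_mul]
      rw [hβm]; push_cast; ring
    obtain ⟨κ, M, e1, e2, e3⟩ := core_even (β := β) (a := a) hp (by omega) hb
      (fun l => by have := h2 l; rw [hβm] at this; omega)
      (by
        have e : ∑ j, ((n : ℤ) ^ 2 - sq m j) = 4 * ∑ j, ((a : ℤ) ^ 2 - sq β j) := by
          rw [Finset.mul_sum]
          refine Finset.sum_congr rfl fun j _ => ?_
          rw [hsq, hna']; ring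
        rw [e, hna'] at hα
        have : 8 * (a : ℤ) ^ 2 - 2 ≤ 4 * ∑ j, ((a : ℤ) ^ 2 - sq β j) := by linarith
        omega)
      (by
        have e : (2 : ℤ) * a ≤ 2 * ∑ j ∈ Finset.univ.erase 0, ((a : ℤ) - mx β j) := by
          rw [← hna', Finset.mul_sum]
          refine hβ.trans (Finset.sum_le_sum fun j _ => ?_)
          have h3 : mx β j ≤ mx m j / 2 := Finset.sup_le fun l _ => by
            have := hmx j l; rw [hβm] at this; omega
          have h4 : 2 * mx β j ≤ mx m j := by omega
          have h5 : 2 * (mx β j : ℤ) ≤ mx m j := by exact_mod_cast h4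
          linarith
        linarith)
      hzz hz0 hz1 (fun j => by have := hbz j; rw [hβm] at this; omega)
      (fun j => by have := hbz' j; rw [hβm] at this; omega) ν D (by rw [← hprm, hD])
      (hgen β a hb (by omega) (by omega) (fun j l => by rw [hβm]; omega))
      (fun j l l' hne hl hl' => hnint j l l' hne (by rw [hβm]; omega) (by rw [hβm]; omega))
    exact ⟨Fin a ⊕ Fin a, inferInstance, inferInstance, κ, M, fun j l => by rw [e1, hβm], e2, e3⟩

end core
end DSP

namespace DSP

theorem classDim_diag {n q : ℕ} (d : Fin n → ℂ) (κ : Fin n → Fin q) (h : ∀ i k, κ i = κ k ↔ d i = d k) :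
    (classDim (diagonal d) : ℤ) = (n : ℤ) ^ 2 - ∑ l, ((Finset.univ.filter fun i => κ i = l).card : ℤ) ^ 2 := by
  obtain ⟨g, hg, hg'⟩ : ∃ g : (Matrix (Fin n) (Fin n) ℂ)ˣ, g.val = 1 ∧ (g⁻¹).val = 1 :=
    ⟨⟨1, 1, Matrix.one_mul 1, Matrix.one_mul 1⟩, rfl, rfl⟩
  have e1 := finrank_adR g g d d
  rw [hg, hg', Matrix.one_mul, Matrix.mul_one] at e1
  have e2 := card_pairs κ κ (fun l : Fin q => ((l.val : ℕ) : ℂ)) (by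
    intro a b hab; simp only at hab; exact Fin.ext (by exact_mod_cast hab))
  have e3 : (LinearMap.mulLeft ℂ (diagonal d) - LinearMap.mulRight ℂ (diagonal d)) = - adR (diagonal d) (diagonal d) := by
    ext1 X
    simp [adR]
  rw [classDim_eq, e3, LinearMap.range_neg, e1]
  have e4 : (Finset.univ.filter fun p : Fin n × Fin n => d p.1 ≠ d p.2)
      = Finset.univ.filter fun q : Fin n × Fin n => ((κ q.1).val : ℂ) ≠ ((κ q.2).val : ℂ) := by
    ext ⟨a, b⟩
    simp only [Finset.mem_filter, Finset.mem_univ, true_and, ne_eq, Nat.cast_inj, ← Fin.ext_iff, h]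
  rw [e4]
  convert e2 using 1
  simp [pow_two]

theorem minRank_diag {n q : ℕ} (d : Fin n → ℂ) (κ : Fin n → Fin q) (h : ∀ i k, κ i = κ k ↔ d i = d k) (l : Fin q) :
    (minRank (diagonal d) : ℤ) ≤ (n : ℤ) - ((Finset.univ.filter fun i => κ i = l).card : ℤ) := by
  have key : ∀ c : ℂ, minRank (diagonal d) + (Finset.univ.filter fun i => d i = c).card ≤ n := by
    intro c
    have h1 : minRank (diagonal d) ≤ (diagonal d - c • (1 : Matrix (Fin n) (Fin n) ℂ)).rank := Nat.sInf_le ⟨c, rfl⟩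
    have h2 : diagonal d - c • (1 : Matrix (Fin n) (Fin n) ℂ) = diagonal fun i => d i - c := by
      rw [← Matrix.diagonal_one, ← Matrix.diagonal_smul, Matrix.diagonal_sub]; simp
    rw [h2, Matrix.rank_diagonal, Fintype.card_subtype] at h1
    have h3 := Finset.card_filter_add_card_filter_not (s := (Finset.univ : Finset (Fin n))) (fun i => d i = c)
    simp only [ne_eq, sub_eq_zero] at h1
    simp only [Finset.card_univ, Fintype.card_fin] at h3
    omega
  by_cases hl : ∃ i, κ i = l
  · obtain ⟨i, hi⟩ := hl
    have := key (d i)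
    have e : (Finset.univ.filter fun k => κ k = l) = Finset.univ.filter fun k => d k = d i := by
      ext k; simp only [Finset.mem_filter, Finset.mem_univ, true_and]; rw [← hi, h]
    rw [e]; omega
  · push Not at hl
    have e : (Finset.univ.filter fun k => κ k = l) = ∅ := by
      ext k; simp [hl]
    have := key 0
    rw [e]; simp; omega

theorem exists_labels {n : ℕ} (hn : 2 ≤ n) (d : Fin n → ℂ) (hd : ∀ i, d i ≠ 0) :
    ∃ (κ : Fin n → Fin (n + 2)) (ν : Fin (n + 2) → ℂ),
      (∀ i k, κ i = κ k ↔ d i = d k) ∧ (∀ i, κ i ≠ 0) ∧ (∀ i, κ i ≠ Fin.last (n + 1)) ∧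
      ∀ i, Complex.exp (2 * Real.pi * Complex.I * ν (κ i)) = d i := by
  have hr : ∀ c : ℂ, ∃ i : Fin n, (∃ k, d k = c) → d i = c := by
    intro c
    by_cases h : ∃ k, d k = c
    · obtain ⟨k, hk⟩ := h; exact ⟨k, fun _ => hk⟩
    · exact ⟨⟨0, by omega⟩, fun h' => absurd h' h⟩
  choose rep hrep using hr
  have hrep' : ∀ i, d (rep (d i)) = d i := fun i => hrep _ ⟨i, rfl⟩
  refine ⟨fun i => ⟨(rep (d i)).val + 1, by have := (rep (d i)).isLt; omega⟩,
    fun l => if hl : l.val - 1 < n then Complex.log (d ⟨l.val - 1, hl⟩) / (2 * Real.pi * Complex.I) else 0, ?_, ?_, ?_, ?_⟩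
  · intro i k
    constructor
    · intro h
      have h1 : rep (d i) = rep (d k) := by
        have := congrArg Fin.val h
        simp only at this
        exact Fin.ext (by omega)
      rw [← hrep' i, h1, hrep']
    · intro h; simp only [h]
  · intro i h
    have := congrArg Fin.val h
    simp at this
  · intro i h
    have := congrArg Fin.val h
    simp only [Fin.val_last] at this
    have := (rep (d i)).isLt
    omega
  · intro i
    have e : (rep (d i)).val + 1 - 1 < n := by have := (rep (d i)).isLt; omega
    simp only [e, dite_true]
    simp only [Nat.add_sub_cancel, Fin.eta]
    rw [mul_div_cancel₀, hrep', Complex.exp_log (hd i)]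
    simp [Real.pi_ne_zero, Complex.I_ne_zero]

theorem exp_eq_one_int {u : ℂ} (h : Complex.exp (2 * Real.pi * Complex.I * u) = 1) : ∃ k : ℤ, u = k := by
  obtain ⟨k, hk⟩ := Complex.exp_eq_one_iff.1 h
  refine ⟨k, ?_⟩
  have h0 : (2 * Real.pi * Complex.I : ℂ) ≠ 0 := by simp [Real.pi_ne_zero, Complex.I_ne_zero]
  exact mul_left_cancel₀ h0 (by rw [hk]; ring)

theorem exp_int_one (k : ℤ) : Complex.exp (2 * Real.pi * Complex.I * (k : ℂ)) = 1 :=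
  Complex.exp_eq_one_iff.2 ⟨k, by ring⟩

theorem prod_exp_cnt {p n q : ℕ} (κ : Fin (p + 1) → Fin n → Fin q) (S : Fin (p + 1) → Finset (Fin n))
    (ν : Fin (p + 1) → Fin q → ℂ) :
    ∏ j, ∏ i ∈ S j, Complex.exp (2 * Real.pi * Complex.I * ν j (κ j i))
      = Complex.exp (2 * Real.pi * Complex.I * pr ν (cv (cnt κ S))) := by
  rw [← pr_cnt, Finset.mul_sum, Complex.exp_sum]
  refine Finset.prod_congr rfl fun j _ => ?_
  rw [Finset.mul_sum, Complex.exp_sum]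

theorem exists_subset_cnt {n q : ℕ} (κ : Fin n → Fin q) (β : Fin q → ℕ)
    (hβ : ∀ l, β l ≤ (Finset.univ.filter fun i => κ i = l).card) :
    ∃ S : Finset (Fin n), ∀ l, (S.filter fun i => κ i = l).card = β l := by
  have : ∀ l, ∃ T ⊆ (Finset.univ.filter fun i => κ i = l), T.card = β l := fun l =>
    Finset.exists_subset_card_eq (hβ l)
  choose T hT hc using this
  refine ⟨Finset.univ.filter fun i => i ∈ T (κ i), fun l => ?_⟩
  rw [← hc l]
  congr 1
  ext i
  simp only [Finset.mem_filter, Finset.mem_univ, true_and]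
  constructor
  · rintro ⟨h1, rfl⟩; exact h1
  · intro h
    have := (Finset.mem_filter.1 (hT l h)).2
    exact ⟨by rw [this]; exact h, this⟩

theorem sufficiency (n p : ℕ) (hn : 2 ≤ n)
    (Y : Fin (p + 1) → Matrix (Fin n) (Fin n) ℂ)
    (hunit : ∀ j, IsUnit (Y j))
    (hdiag : ∀ j, ∃ dv : Fin n → ℂ, MatConj (Matrix.diagonal dv) (Y j))
    (hdet : (∏ j, (Y j).det) = 1)
    (hgen : GenericMulRoots Y)
    (hmult : ∀ σ : ℂ, ((Y 0).charpoly.roots).count σ ≤ 2)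
    (hA : 2 * n ^ 2 - 2 ≤ ∑ j, classDim (Y j))
    (hB : ∀ j, n ≤ ∑ i ∈ Finset.univ.erase j, minRank (Y i)) :
    ∃ M : Fin (p + 1) → Matrix (Fin n) (Fin n) ℂ,
        (∀ j, MatConj (Y j) (M j)) ∧ IrreducibleTuple M ∧ (List.ofFn M).prod = 1 := by
  choose dv hdv using hdiag
  have hS : ∀ j, Sim (Y j) (diagonal (dv j)) := by
    intro j
    obtain ⟨S, hS⟩ := hdv j
    rw [hS]; exact sim_of_unit S _
  have hroots : ∀ j, (Y j).charpoly.roots = Finset.univ.val.map (dv j) := by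
    intro j; rw [(hS j).charpoly, charpoly_diagonal_roots]
  have hdetj : ∀ j, (Y j).det = ∏ i, dv j i := by
    intro j
    obtain ⟨S, hS⟩ := hdv j
    rw [hS, Matrix.det_units_conj, Matrix.det_diagonal]
  have hd0 : ∀ j i, dv j i ≠ 0 := by
    intro j i h
    have h1 := (Matrix.isUnit_iff_isUnit_det _).1 (hunit j)
    rw [hdetj, Finset.prod_eq_zero (Finset.mem_univ i) h] at h1
    exact not_isUnit_zero h1
  have hlab := fun j => exists_labels hn (dv j) (hd0 j)
  choose κ ν hκ hκ0 hκ1 hν using hlab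
  obtain ⟨m, hm⟩ : ∃ m, m = cnt κ (fun _ => Finset.univ) := ⟨_, rfl⟩
  have hmd : ∀ j l, m j l = (Finset.univ.filter fun i => κ j i = l).card := fun j l => by rw [hm]; rfl
  have hpos : ∀ j l, 0 < m j l → ∃ i, κ j i = l := by
    intro j l h
    rw [hmd] at h
    obtain ⟨i, hi⟩ := Finset.card_pos.1 h
    exact ⟨i, (Finset.mem_filter.1 hi).2⟩
  have hsum : ∀ j, ∑ l, m j l = n := by
    intro j; rw [hm, sum_cnt]; simp
  have h2 : ∀ l, m 0 l ≤ 2 := by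
    intro l
    rcases Nat.eq_zero_or_pos (m 0 l) with h | h
    · omega
    obtain ⟨i, hi⟩ := hpos 0 l h
    have := hmult (dv 0 i)
    rw [hroots, Multiset.count_map] at this
    refine le_trans (le_of_eq ?_) this
    rw [hmd, Finset.card_def, Finset.filter_val]
    congr 1
    refine Multiset.filter_congr fun k _ => ?_
    rw [← hi, hκ, eq_comm]
  have hα : 2 * (n : ℤ) ^ 2 - 2 ≤ ∑ j, ((n : ℤ) ^ 2 - sq m j) := by
    have e : ∀ j, ((n : ℤ) ^ 2 - sq m j) = (classDim (Y j) : ℤ) := by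
      intro j
      rw [classDim_conj (hdv j), classDim_diag (dv j) (κ j) (hκ j)]
      simp only [sq, hmd]
    rw [Finset.sum_congr rfl fun j _ => e j]
    have hA' : (2 * n ^ 2 : ℕ) ≤ (∑ j, classDim (Y j)) + 2 := by omega
    have : ((2 * n ^ 2 : ℕ) : ℤ) ≤ (((∑ j, classDim (Y j)) + 2 : ℕ) : ℤ) := by exact_mod_cast hA'
    push_cast at this
    linarith
  have hβ : (n : ℤ) ≤ ∑ j ∈ Finset.univ.erase 0, ((n : ℤ) - mx m j) := by
    have e : ∀ j, (minRank (Y j) : ℤ) ≤ (n : ℤ) - mx m j := by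
      intro j
      obtain ⟨l, _, hl⟩ := Finset.exists_mem_eq_sup (Finset.univ : Finset (Fin (n + 2))) ⟨0, by simp⟩ (m j)
      have := minRank_diag (dv j) (κ j) (hκ j) l
      rw [minRank_conj (hdv j)]
      unfold mx
      rw [hl, hmd]
      exact this
    have h1 : (n : ℤ) ≤ ((∑ i ∈ Finset.univ.erase (0 : Fin (p + 1)), minRank (Y i) : ℕ) : ℤ) := by
      exact_mod_cast hB 0
    push_cast at h1
    exact h1.trans (Finset.sum_le_sum fun j _ => e j)
  obtain ⟨D, hD⟩ : ∃ D : ℤ, pr ν (cv m) = D := by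
    apply exp_eq_one_int
    rw [hm, ← prod_exp_cnt, ← hdet]
    refine Finset.prod_congr rfl fun j _ => ?_
    rw [hdetj]
    exact Finset.prod_congr rfl fun i _ => hν j i
  obtain ⟨ι, i1, i2, κ', M, hc, hMS, hMp⟩ := core hn hsum h2 hα hβ (z0 := (0 : Fin (n + 2)))
    (z1 := Fin.last (n + 1)) (by intro h; have := congrArg Fin.val h; simp at this)
    (fun l hl => Fin.pos_iff_ne_zero.2 hl) (fun l hl => Fin.lt_last_iff_ne_last.2 hl)
    (fun j => by
      by_contra h
      obtain ⟨i, hi⟩ := hpos j 0 (by omega)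
      exact hκ0 j i hi)
    (fun j => by
      by_contra h
      obtain ⟨i, hi⟩ := hpos j (Fin.last (n + 1)) (by omega)
      exact hκ1 j i hi) ν D hD
    (by
      intro j l l' hne hl hl' k e
      obtain ⟨i, rfl⟩ := hpos j l hl
      obtain ⟨i', rfl⟩ := hpos j l' hl'
      apply hne
      rw [hκ, ← hν, ← hν, sub_eq_iff_eq_add.1 e, mul_add, Complex.exp_add, exp_int_one, one_mul])
    (by
      intro β a hβa ha0 han hle k e
      have hex := fun j => exists_subset_cnt (κ j) (β j) (fun l => by rw [← hmd]; exact hle j l)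
      choose S hS' using hex
      have hcS : cnt κ S = β := by
        funext j l; exact hS' j l
      refine hgen a ha0 (by omega) (fun j => (S j).val.map (dv j)) (fun j => ⟨?_, ?_⟩) ?_
      · rw [hroots]
        exact Multiset.map_le_map (Finset.val_le_iff.2 (Finset.subset_univ _))
      · rw [Multiset.card_map, ← hβa j, ← hcS, sum_cnt]; rfl
      · have h1 := prod_exp_cnt κ S ν
        rw [hcS, e, exp_int_one] at h1
        rw [← h1]
        refine Finset.prod_congr rfl fun j _ => ?_
        exact (Finset.prod_congr rfl fun i _ => (hν j i).symm))
  have hcard : Fintype.card ι = n := by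
    rw [← hsum 0, ← Finset.sum_congr rfl fun l _ => hc 0 l]
    have := sum_cnt κ' (fun _ => Finset.univ) 0
    rw [← Finset.card_univ, ← this]
  obtain ⟨e⟩ : Nonempty (Fin n ≃ ι) := ⟨(Fintype.equivFinOfCardEq hcard).symm⟩
  obtain ⟨M', hM'⟩ : ∃ M' : Fin (p + 1) → Matrix (Fin n) (Fin n) ℂ, M' = fun j => (M j).submatrix e e := ⟨_, rfl⟩
  have hconj : ∀ j, MatConj (Y j) (M' j) := by
    intro j
    have s1 : Sim (M' j) (M j) := by rw [hM']; exact sim_submatrix e (M j)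
    obtain ⟨ej, hej⟩ := exists_equiv_of_card_fiber (κ j) (κ' j) (fun l => by
      have := hc j l
      rw [hmd] at this
      rw [← this]; simp only [cnt])
    have s2 : Sim (diagonal (dv j)) (diagonal fun k => Complex.exp (2 * Real.pi * Complex.I * ν j (κ' j k))) :=
      sim_diagonal_of_equiv ej (fun i => by rw [← hej, hν])
    have s3 := (s1.trans (hMS j).symm).trans (s2.symm.trans (hS j).symm)
    obtain ⟨g, hg⟩ := s3.exists_unit
    exact ⟨g, hg⟩
  have hprod : (List.ofFn M').prod = 1 := by
    have h1 := congrArg (Matrix.reindexAlgEquiv ℂ ℂ e.symm) hMp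
    rw [map_list_prod, map_one, List.map_ofFn] at h1
    rw [← h1, hM']
    rfl
  refine ⟨M', hconj, ?_, hprod⟩
  exact DSP.IrreducibleTuple.irr.2 (irr_of_genericMul (genericMulRoots_conj hconj hgen) hprod)

theorem necessity (n p : ℕ) (hn : 2 ≤ n)
    (Y M : Fin (p + 1) → Matrix (Fin n) (Fin n) ℂ)
    (hunit : ∀ j, IsUnit (Y j)) (hc : ∀ j, MatConj (Y j) (M j)) (hI : IrreducibleTuple M)
    (hp : (List.ofFn M).prod = 1) :
    2 * n ^ 2 - 2 ≤ ∑ j, classDim (Y j) ∧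
        ∀ j, n ≤ ∑ i ∈ Finset.univ.erase j, minRank (Y i) := by
  have hu : ∀ j, IsUnit (M j) := by
    intro j
    obtain ⟨S, hS⟩ := hc j
    rw [hS]
    exact (S.isUnit.mul (hunit j)).mul (S⁻¹).isUnit
  have hI' := DSP.IrreducibleTuple.irr.1 hI
  constructor
  · have := alpha_necessary hn M hu hI' hp
    rwa [Finset.sum_congr rfl fun j _ => classDim_conj (hc j)] at this
  · intro j
    have := beta_necessary hn M hu hI' hp j
    rw [Finset.sum_congr rfl fun j _ => minRank_conj (hc j)] at this
    convert this

end DSP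

/-- Theorem for `u ≤ 2`, multiplicative version. For conjugacy classes of
diagonalizable matrices with generic eigenvalues in which every eigenvalue of the first class
has multiplicity at most `2`, conditions `(α_n)` and `(β_n)` are necessary and sufficient for
the existence of an irreducible tuple `M j ∈ C_j` with `M 1 ⋯ M (p+1) = I`. -/
theorem stmt14 (n p : ℕ) (hn : 2 ≤ n)
    (Y : Fin (p + 1) → Matrix (Fin n) (Fin n) ℂ)
    (hunit : ∀ j, IsUnit (Y j))
    (hdiag : ∀ j, ∃ dv : Fin n → ℂ, MatConj (Matrix.diagonal dv) (Y j))
    (hdet : (∏ j, (Y j).det) = 1)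
    (hgen : GenericMulRoots Y)
    (hmult : ∀ σ : ℂ, ((Y 0).charpoly.roots).count σ ≤ 2) :
    (∃ M : Fin (p + 1) → Matrix (Fin n) (Fin n) ℂ,
        (∀ j, MatConj (Y j) (M j)) ∧ IrreducibleTuple M ∧ (List.ofFn M).prod = 1) ↔
      (2 * n ^ 2 - 2 ≤ ∑ j, classDim (Y j) ∧
        ∀ j, n ≤ ∑ i ∈ Finset.univ.erase j, minRank (Y i)) := by
  constructor
  · rintro ⟨M, hc, hI, hp⟩
    exact DSP.necessity n p hn Y M hunit hc hI hp
  · rintro ⟨hA, hB⟩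
    exact DSP.sufficiency n p hn Y hunit hdiag hdet hgen hmult hA hB
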